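/- For any constants a, b > 0 with a + b < 1/2 and any constant C₀ > 0, there exist ε > 0, C > 0 and N such that the following holds for all n ≥ N. Let d = (d_1,…,d_n) be a graphical degree sequence satisfying δ ≤ C₀ n^{1/2+ε} and min{d̄, n − d̄ − 1} ≥ n/(3a log n), and let H be a graph on vertex set {1,…,n} with m ≤ C₀ n^{1+2ε} edges and degree sequence h = (h_1,…,h_n) with max_j h_j ≤ C₀ n^{1/2+ε}, δ³ μ₃ / (λ³ n²) ≤ C₀ n^{−b}, and additionally μ₃ ≤ C₀ λ² n^{1−b}. Then the expected number of copies of H in G ∼ 𝒢_d equals (n!/|Aut(H)|) λ^m exp( (1−λ)/(4λ) (μ₁² + 2μ₁ − 2μ₂) − (R/(2λ²n)) (μ₁² + μ₁ − μ₂) + E ) for some real E with |E| ≤ C n^{−b}. -/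

import Mathlib

open scoped BigOperators Classical

namespace Stmt10

/-- The degree of vertex `j` in the graph `G`. -/
noncomputable def deg {n : ℕ} (G : SimpleGraph (Fin n)) (j : Fin n) : ℕ :=
  (Finset.univ.filter (fun k => G.Adj j k)).card

/-- The set of simple graphs on `{1,…,n}` with degree sequence `d`. -/
noncomputable def degFinset (n : ℕ) (d : Fin n → ℕ) : Finset (SimpleGraph (Fin n)) :=
  Finset.univ.filter (fun G => ∀ j, deg G j = d j)

/-- The average degree `d̄`. -/
noncomputable def dbar (n : ℕ) (d : Fin n → ℕ) : ℝ := (∑ j, (d j : ℝ)) / n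

/-- The edge density `λ = d̄ / (n-1)`. -/
noncomputable def lam (n : ℕ) (d : Fin n → ℕ) : ℝ := dbar n d / ((n : ℝ) - 1)

/-- `R = (1/n) Σ_j (d_j - d̄)²`. -/
noncomputable def Rpar (n : ℕ) (d : Fin n → ℕ) : ℝ :=
  (∑ j, ((d j : ℝ) - dbar n d) ^ 2) / n

/-- `δ = max_j |d_j - d̄|`. -/
noncomputable def deltaPar (n : ℕ) (d : Fin n → ℕ) : ℝ :=
  ⨆ j : Fin n, |(d j : ℝ) - dbar n d|

/-- The number of automorphisms of `H`: permutations of the vertices preserving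
the edge set. -/
noncomputable def autCard {k : ℕ} (H : SimpleGraph (Fin k)) : ℕ :=
  (Finset.univ.filter
    (fun π : Equiv.Perm (Fin k) => ∀ i j, H.Adj (π i) (π j) ↔ H.Adj i j)).card

/-- The number of copies of `H` in `G`: spanning subgraphs of `G` isomorphic to `H`. -/
noncomputable def copyCount {n : ℕ} (H G : SimpleGraph (Fin n)) : ℕ :=
  (Finset.univ.filter
    (fun K : SimpleGraph (Fin n) => K ≤ G ∧ Nonempty (K ≃g H))).card

/-- The expected number of copies of `H` in a uniformly random graph with degree
sequence `d`. -/
noncomputable def expCopies (n : ℕ) (d : Fin n → ℕ) (H : SimpleGraph (Fin n)) : ℝ :=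
  (∑ G ∈ degFinset n d, (copyCount H G : ℝ)) / ((degFinset n d).card : ℝ)

/-- `μ_t = (1/n) Σ_j h_j^t` for the degree sequence `h` of `H`. -/
noncomputable def mu (n : ℕ) (H : SimpleGraph (Fin n)) (t : ℕ) : ℝ :=
  (∑ j, (deg H j : ℝ) ^ t) / n

section LinAlg
variable {ι : Type*} [Fintype ι] [DecidableEq ι]
open Matrix

lemma exists_diag (A : Matrix ι ι ℝ) (hA : A.IsSymm) :
    ∃ (U : Matrix ι ι ℝ) (α : ι → ℝ), Uᵀ * U = 1 ∧ U * Uᵀ = 1 ∧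
      ∀ i : ℕ, A ^ i = U * diagonal (fun p => α p ^ i) * Uᵀ := by
  have hH : A.IsHermitian := by
    rw [Matrix.IsHermitian, Matrix.conjTranspose_eq_transpose_of_trivial]; exact hA
  have h := hH.spectral_theorem
  rw [Unitary.conjStarAlgAut_apply] at h
  have hU := hH.eigenvectorUnitary.2
  rw [Matrix.mem_unitaryGroup_iff] at hU
  set U : Matrix ι ι ℝ := (hH.eigenvectorUnitary : Matrix ι ι ℝ) with hUdef
  have hs : star U = Uᵀ := by
    rw [Matrix.star_eq_conjTranspose, Matrix.conjTranspose_eq_transpose_of_trivial]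
  rw [hs] at hU h
  have hU' : Uᵀ * U = 1 := mul_eq_one_comm.mp hU
  refine ⟨U, hH.eigenvalues, hU', hU, ?_⟩
  have h1 : A = U * diagonal (fun p => hH.eigenvalues p) * Uᵀ := h
  intro i
  induction i with
  | zero => simp [hU]
  | succ i ih =>
    rw [pow_succ, ih]
    generalize hH.eigenvalues = ev at h1
    rw [h1]
    have : U * (diagonal fun p => ev p ^ i) * Uᵀ *
        (U * (diagonal fun p => ev p) * Uᵀ) =
        U * ((diagonal fun p => ev p ^ i) * ((Uᵀ * U) *
          (diagonal fun p => ev p))) * Uᵀ := by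
      simp only [Matrix.mul_assoc]
    rw [this, hU', Matrix.one_mul, diagonal_mul_diagonal]
    simp only [pow_succ]

lemma trace_two_diag (A B X : Matrix ι ι ℝ) (hA : A.IsSymm) (hB : B.IsSymm) (hX : X.IsSymm) :
    ∃ (α β : ι → ℝ) (w : ι → ι → ℝ), (∀ p q, 0 ≤ w p q) ∧
      ∀ i j : ℕ, (A ^ i * X * B ^ j * X).trace = ∑ p, ∑ q, α p ^ i * β q ^ j * w p q := by
  obtain ⟨U, α, hU1, hU2, hUA⟩ := exists_diag A hA
  obtain ⟨W, β, hW1, hW2, hWB⟩ := exists_diag B hB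
  refine ⟨α, β, fun p q => ((Uᵀ * X * W) p q) ^ 2, fun p q => sq_nonneg _, fun i j => ?_⟩
  rw [hUA, hWB]
  have h1 : (U * (diagonal fun p => α p ^ i) * Uᵀ * X * (W * (diagonal fun p => β p ^ j) * Wᵀ)
      * X).trace = ((diagonal fun p => α p ^ i) * (Uᵀ * X * W) * (diagonal fun p => β p ^ j) *
        (Uᵀ * X * W)ᵀ).trace := by
    rw [show U * (diagonal fun p => α p ^ i) * Uᵀ * X * (W * (diagonal fun p => β p ^ j) * Wᵀ)
      * X = U * ((diagonal fun p => α p ^ i) * Uᵀ * X * (W * (diagonal fun p => β p ^ j) * Wᵀ)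
      * X) by simp only [Matrix.mul_assoc], Matrix.trace_mul_comm]
    congr 1
    simp only [Matrix.transpose_mul, Matrix.transpose_transpose, hX.eq, Matrix.mul_assoc]
  rw [h1]
  simp only [Matrix.trace, Matrix.diag_apply, Matrix.mul_apply (M := _ * diagonal _),
    Matrix.mul_diagonal, Matrix.diagonal_mul, Matrix.transpose_apply]
  refine Finset.sum_congr rfl fun p _ => Finset.sum_congr rfl fun q _ => ?_
  ring

lemma abs_pow_mul_pow_le (x y : ℝ) {i j l : ℕ} (h : i + j = 2 * l) :
    x ^ i * y ^ j ≤ x ^ (2 * l) + y ^ (2 * l) := by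
  have h1 : x ^ i * y ^ j ≤ |x| ^ i * |y| ^ j := by
    rw [← abs_pow, ← abs_pow, ← abs_mul]; exact le_abs_self _
  have h2 : |x| ^ i * |y| ^ j ≤ (max |x| |y|) ^ (2 * l) := by
    rw [← h, pow_add]
    gcongr
    · exact le_max_left _ _
    · exact le_max_right _ _
  have h3 : (max |x| |y|) ^ (2 * l) ≤ x ^ (2 * l) + y ^ (2 * l) := by
    have hx : |x| ^ (2*l) = x ^ (2*l) := by rw [pow_mul, pow_mul, sq_abs]
    have hy : |y| ^ (2*l) = y ^ (2*l) := by rw [pow_mul, pow_mul, sq_abs]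
    have hx0 : 0 ≤ x ^ (2*l) := by rw [pow_mul]; positivity
    have hy0 : 0 ≤ y ^ (2*l) := by rw [pow_mul]; positivity
    rcases max_choice |x| |y| with h | h <;> rw [h]
    · rw [hx]; linarith
    · rw [hy]; linarith
  linarith

lemma trace_pow_mul_pow_le (A B X : Matrix ι ι ℝ) (hA : A.IsSymm) (hB : B.IsSymm)
    (hX : X.IsSymm) {i j l : ℕ} (h : i + j = 2 * l) :
    (A ^ i * X * B ^ j * X).trace ≤
      (A ^ (2 * l) * X * X).trace + (B ^ (2 * l) * X * X).trace := by
  obtain ⟨α, β, w, hw, hf⟩ := trace_two_diag A B X hA hB hX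
  have hA' := hf (2 * l) 0
  have hB' := hf 0 (2 * l)
  simp only [pow_zero, mul_one, one_mul] at hA' hB'
  have hB'' : (B ^ (2 * l) * X * X).trace = (X * B ^ (2 * l) * X).trace := by
    rw [Matrix.trace_mul_cycle, Matrix.mul_assoc, ← Matrix.mul_assoc X, Matrix.mul_assoc]
  rw [hB'', hA', hB', hf, ← Finset.sum_add_distrib]
  refine Finset.sum_le_sum fun p _ => ?_
  rw [← Finset.sum_add_distrib]
  refine Finset.sum_le_sum fun q _ => ?_
  rw [← add_mul]
  exact mul_le_mul_of_nonneg_right (abs_pow_mul_pow_le _ _ h) (hw p q)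

lemma trace_even_nonneg (A : Matrix ι ι ℝ) (hA : A.IsSymm) (l : ℕ) :
    0 ≤ (A ^ (2 * l)).trace := by
  have h : (A ^ l)ᵀ = A ^ l := by rw [Matrix.transpose_pow, hA.eq]
  rw [two_mul, pow_add]
  nth_rewrite 2 [← h]
  simp only [Matrix.trace, Matrix.diag_apply, Matrix.mul_apply, Matrix.transpose_apply]
  exact Finset.sum_nonneg fun p _ => Finset.sum_nonneg fun q _ => mul_self_nonneg _

lemma sum_sq_conj_diag_le (U B : Matrix ι ι ℝ) (hU2 : U * Uᵀ = 1) :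
    ∑ p, ((Uᵀ * B * U) p p) ^ 2 ≤ ∑ p, ∑ q, (B p q) ^ 2 := by
  have key : ∀ M : Matrix ι ι ℝ, ∑ p, ∑ q, (M p q) ^ 2 = (M * Mᵀ).trace := by
    intro M
    simp only [Matrix.trace, Matrix.diag_apply, Matrix.mul_apply, Matrix.transpose_apply, sq]
  have h1 : ∑ p, ((Uᵀ * B * U) p p) ^ 2 ≤ ∑ p, ∑ q, ((Uᵀ * B * U) p q) ^ 2 :=
    Finset.sum_le_sum fun p _ => Finset.single_le_sum (f := fun q => ((Uᵀ * B * U) p q) ^ 2)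
      (fun q _ => sq_nonneg _) (Finset.mem_univ p)
  refine h1.trans (le_of_eq ?_)
  rw [key, key]
  simp only [Matrix.transpose_mul, Matrix.transpose_transpose]
  rw [show Uᵀ * B * U * (Uᵀ * (Bᵀ * U)) = Uᵀ * (B * (U * Uᵀ) * (Bᵀ * U)) by
    simp only [Matrix.mul_assoc], hU2, Matrix.mul_one, Matrix.trace_mul_comm]
  rw [show B * (Bᵀ * U) * Uᵀ = B * Bᵀ * (U * Uᵀ) by simp only [Matrix.mul_assoc], hU2,
    Matrix.mul_one]

lemma young_odd (x y c : ℝ) (hc : 0 < c) (j : ℕ) :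
    |x ^ (2 * j + 1) * y| ≤ c * x ^ (2 * (j + 1)) + (y ^ 2) ^ (j + 1) / c ^ (2 * j + 1) := by
  have hx : x ^ (2 * (j + 1)) = |x| ^ (2 * j + 1) * |x| := by
    rw [← pow_succ, pow_mul, ← sq_abs, ← pow_mul]; ring_nf
  have hy : (y ^ 2) ^ (j + 1) = |y| ^ (2 * j + 1) * |y| := by
    rw [← pow_succ, ← sq_abs, ← pow_mul]; ring_nf
  rw [abs_mul, abs_pow, hx, hy]
  rcases le_total |y| (c * |x|) with h | h
  · have : |x| ^ (2 * j + 1) * |y| ≤ |x| ^ (2 * j + 1) * (c * |x|) := by gcongr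
    have h2 : 0 ≤ |y| ^ (2 * j + 1) * |y| / c ^ (2 * j + 1) := by positivity
    nlinarith
  · have h3 : (c * |x|) ^ (2 * j + 1) ≤ |y| ^ (2 * j + 1) := by gcongr
    have h4 : |x| ^ (2 * j + 1) * |y| ≤ |y| ^ (2 * j + 1) * |y| / c ^ (2 * j + 1) := by
      rw [le_div_iff₀ (by positivity)]
      rw [mul_pow] at h3
      nlinarith [mul_le_mul_of_nonneg_right h3 (abs_nonneg y)]
    have : 0 ≤ c * (|x| ^ (2 * j + 1) * |x|) := by positivity
    linarith

lemma sum_pow_le_pow_sum' (f : ι → ℝ) (hf : ∀ i, 0 ≤ f i) (j : ℕ) :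
    ∑ i, f i ^ (j + 1) ≤ (∑ i, f i) ^ (j + 1) := by
  induction j with
  | zero => simp
  | succ j ih =>
    calc ∑ i, f i ^ (j + 1 + 1) ≤ ∑ i, f i ^ (j+1) * ∑ k, f k := by
          refine Finset.sum_le_sum fun i _ => ?_
          rw [pow_succ]
          exact mul_le_mul_of_nonneg_left
            (Finset.single_le_sum (fun k _ => hf k) (Finset.mem_univ i)) (pow_nonneg (hf i) _)
      _ = (∑ i, f i ^ (j+1)) * ∑ k, f k := by rw [Finset.sum_mul]
      _ ≤ (∑ i, f i) ^ (j + 1) * ∑ k, f k :=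
          mul_le_mul_of_nonneg_right ih (Finset.sum_nonneg fun k _ => hf k)
      _ = _ := by rw [← pow_succ]

lemma trace_odd_mul_le (A B : Matrix ι ι ℝ) (hA : A.IsSymm) (c : ℝ) (hc : 0 < c) (j : ℕ) :
    |(A ^ (2 * j + 1) * B).trace| ≤ c * (A ^ (2 * (j + 1))).trace +
      (∑ p, ∑ q, (B p q) ^ 2) ^ (j + 1) / c ^ (2 * j + 1) := by
  obtain ⟨U, α, hU1, hU2, hUA⟩ := exists_diag A hA
  have h1 : (A ^ (2 * j + 1) * B).trace =
      ∑ p, α p ^ (2 * j + 1) * (Uᵀ * B * U) p p := by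
    rw [hUA, show U * (diagonal fun p => α p ^ (2 * j + 1)) * Uᵀ * B =
      U * ((diagonal fun p => α p ^ (2 * j + 1)) * (Uᵀ * B)) by simp only [Matrix.mul_assoc],
      Matrix.trace_mul_comm, Matrix.mul_assoc]
    simp only [Matrix.trace, Matrix.diag_apply, Matrix.diagonal_mul]
  have h2 : (A ^ (2 * (j + 1))).trace = ∑ p, α p ^ (2 * (j + 1)) := by
    rw [hUA, Matrix.mul_assoc, Matrix.trace_mul_comm, Matrix.mul_assoc, hU1, Matrix.mul_one,
      Matrix.trace_diagonal]
  rw [h1, h2]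
  calc |∑ p, α p ^ (2 * j + 1) * (Uᵀ * B * U) p p|
      ≤ ∑ p, |α p ^ (2 * j + 1) * (Uᵀ * B * U) p p| := Finset.abs_sum_le_sum_abs _ _
    _ ≤ ∑ p, (c * α p ^ (2 * (j + 1)) +
          (((Uᵀ * B * U) p p) ^ 2) ^ (j + 1) / c ^ (2 * j + 1)) :=
        Finset.sum_le_sum fun p _ => young_odd _ _ c hc j
    _ = c * ∑ p, α p ^ (2 * (j + 1)) +
          (∑ p, (((Uᵀ * B * U) p p) ^ 2) ^ (j + 1)) / c ^ (2 * j + 1) := by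
        rw [Finset.sum_add_distrib, Finset.mul_sum, Finset.sum_div]
    _ ≤ _ := by
        refine add_le_add le_rfl (div_le_div_of_nonneg_right ?_ (by positivity))
        refine (sum_pow_le_pow_sum' _ (fun p => sq_nonneg _) j).trans ?_
        exact pow_le_pow_left₀ (Finset.sum_nonneg fun p _ => sq_nonneg _)
          (sum_sq_conj_diag_le U B hU2) _

lemma sum_sq_mulVec_le (A : Matrix ι ι ℝ) (hA : A.IsSymm) (t : ℝ) (ht : 0 ≤ t) (j : ℕ)
    (h : (A ^ (2 * (j + 1))).trace ≤ t ^ (2 * (j + 1))) (w : ι → ℝ) :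
    ∑ p, (∑ q, A p q * w q) ^ 2 ≤ t ^ 2 * ∑ q, w q ^ 2 := by
  obtain ⟨U, α, hU1, hU2, hUA⟩ := exists_diag A hA
  have h2 : (A ^ (2 * (j + 1))).trace = ∑ p, α p ^ (2 * (j + 1)) := by
    rw [hUA, Matrix.mul_assoc, Matrix.trace_mul_comm, Matrix.mul_assoc, hU1, Matrix.mul_one,
      Matrix.trace_diagonal]
  have hα : ∀ p, α p ^ 2 ≤ t ^ 2 := by
    intro p
    have : α p ^ (2 * (j + 1)) ≤ t ^ (2 * (j + 1)) := by
      refine le_trans ?_ (h2 ▸ h)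
      exact Finset.single_le_sum (f := fun p => α p ^ (2 * (j + 1)))
        (fun q _ => by rw [pow_mul]; positivity) (Finset.mem_univ p)
    rw [pow_mul, pow_mul] at this
    exact le_of_pow_le_pow_left₀ (by omega) (sq_nonneg t) this
  have e1 : ∀ v : ι → ℝ, ∑ p, (v p) ^ 2 = v ⬝ᵥ v := by
    intro v; simp [dotProduct, sq]
  have e2 : ∑ p, (∑ q, A p q * w q) ^ 2 = w ⬝ᵥ ((A ^ 2) *ᵥ w) := by
    have : (fun p => ∑ q, A p q * w q) = A *ᵥ w := by ext p; simp [mulVec, dotProduct]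
    have h5 := e1 (A *ᵥ w)
    rw [← this] at h5
    rw [h5, this, pow_two, ← mulVec_mulVec, dotProduct_mulVec, ← mulVec_transpose, hA.eq,]
    rw [dotProduct_mulVec w, ← mulVec_transpose, hA.eq]
    rw [dotProduct_mulVec, ← mulVec_transpose, hA.eq]
  have e3 : w ⬝ᵥ ((A ^ 2) *ᵥ w) = ∑ p, α p ^ 2 * ((Uᵀ *ᵥ w) p) ^ 2 := by
    rw [hUA, ← mulVec_mulVec, ← mulVec_mulVec, dotProduct_mulVec, ← mulVec_transpose]
    simp only [dotProduct, mulVec_diagonal]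
    refine Finset.sum_congr rfl fun p _ => ?_
    ring
  have e4 : ∑ q, w q ^ 2 = ∑ p, ((Uᵀ *ᵥ w) p) ^ 2 := by
    rw [e1, e1 (Uᵀ *ᵥ w), dotProduct_mulVec, ← mulVec_transpose, transpose_transpose,
      mulVec_mulVec, hU2, one_mulVec]
  rw [e2, e3, e4, Finset.mul_sum]
  exact Finset.sum_le_sum fun p _ => mul_le_mul_of_nonneg_right (hα p) (sq_nonneg _)

lemma pow_even_apply (A : Matrix ι ι ℝ) (hA : A.IsSymm) (l : ℕ) (a b : ι) :
    (A ^ (2 * l)) a b = ∑ k, (A ^ l) a k * (A ^ l) b k := by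
  have h : (A ^ l)ᵀ = A ^ l := by rw [Matrix.transpose_pow, hA.eq]
  rw [two_mul, pow_add]
  nth_rewrite 2 [← h]
  simp only [Matrix.mul_apply, Matrix.transpose_apply]

lemma pow_even_diag_nonneg (A : Matrix ι ι ℝ) (hA : A.IsSymm) (l : ℕ) (a : ι) :
    0 ≤ (A ^ (2 * l)) a a := by
  rw [pow_even_apply A hA]; exact Finset.sum_nonneg fun k _ => mul_self_nonneg _

lemma abs_pow_even_le (A : Matrix ι ι ℝ) (hA : A.IsSymm) (l : ℕ) (a b : ι) :
    2 * |(A ^ (2 * l)) a b| ≤ (A ^ (2 * l)) a a + (A ^ (2 * l)) b b := by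
  rw [pow_even_apply A hA, pow_even_apply A hA, pow_even_apply A hA]
  rw [← Finset.sum_add_distrib]
  calc _ ≤ 2 * ∑ k, |(A ^ l) a k * (A ^ l) b k| := by
        gcongr; exact Finset.abs_sum_le_sum_abs _ _
    _ ≤ _ := by
        rw [Finset.mul_sum]
        refine Finset.sum_le_sum fun k _ => ?_
        have : |(A ^ l) a k * (A ^ l) b k| = |(A ^ l) a k| * |(A ^ l) b k| := abs_mul _ _
        rw [this]
        nlinarith [sq_nonneg (|(A ^ l) a k| - |(A ^ l) b k|), sq_abs ((A ^ l) a k),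
          sq_abs ((A ^ l) b k)]

end LinAlg

/-- Data for the uniform model of symmetric zero-one matrices with prescribed row sums that
vanish where `D` is one. -/
structure Setup (n : ℕ) where
  L : ℝ
  k : ℕ
  l : ℝ
  D : Matrix (Fin n) (Fin n) ℝ
  d : Fin n → ℝ
  Ω : Finset (Matrix (Fin n) (Fin n) ℝ)
  hL : 1000 ≤ L
  hk : 6 ≤ k
  hkL : 16 * (k : ℝ) ≤ L
  hn : 1 ≤ n
  hnL : (n : ℝ) ≤ L ^ k
  hl0 : 0 < l
  hl1 : l < 1
  hv : 1 / L ≤ l * (1 - l)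
  hD : ∀ a b, D a b = 0 ∨ D a b = 1
  hDs : ∀ a b, D a b = D b a
  hD1 : ∀ a, D a a = 1
  hDg : ∀ a, ∑ b, D a b ≤ L * Real.sqrt n
  htot : ∑ a, ∑ b, D a b ≤ L * n
  hη : ∀ a, |d a - l * (n - ∑ b, D a b)| ≤ L * Real.sqrt n
  hηs : |∑ a, (d a - l * (n - ∑ b, D a b))| ≤ L * n
  hΩ : ∀ X, X ∈ Ω ↔ (∀ a b, X a b = 0 ∨ X a b = 1) ∧ (∀ a b, X a b = X b a) ∧
    (∀ a b, D a b = 1 → X a b = 0) ∧ (∀ a, ∑ b, X a b = d a)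
  hne : Ω.Nonempty

namespace Setup
variable {n : ℕ} (S : Setup n)

/-- one minus the density -/
noncomputable def u : ℝ := 1 - S.l
/-- the variance of a Bernoulli variable with the given density -/
noncomputable def v : ℝ := S.l * S.u
/-- square root of the dimension -/
noncomputable def s (_ : Setup n) : ℝ := Real.sqrt n
/-- row sums of `D` -/
noncomputable def Dg (a : Fin n) : ℝ := ∑ b, S.D a b
/-- row sums of the centred matrix -/
noncomputable def η (a : Fin n) : ℝ := S.d a - S.l * (n - S.Dg a)
/-- allowed positions -/
noncomputable def K : Matrix (Fin n) (Fin n) ℝ := Matrix.of fun a b => 1 - S.D a b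
/-- centred matrix -/
noncomputable def x (X : Matrix (Fin n) (Fin n) ℝ) : Matrix (Fin n) (Fin n) ℝ := X - S.l • S.K
/-- complementary matrix -/
noncomputable def Y (X : Matrix (Fin n) (Fin n) ℝ) : Matrix (Fin n) (Fin n) ℝ := S.K - X
/-- indicator of an admissible switching -/
noncomputable def wt (X : Matrix (Fin n) (Fin n) ℝ) (a b c d : Fin n) : ℝ :=
  X a b * X c d * S.Y X a c * S.Y X b d
/-- weighted sum over switchings -/
noncomputable def W (X : Matrix (Fin n) (Fin n) ℝ) (g : Fin n → Fin n → Fin n → Fin n → ℝ) : ℝ :=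
  ∑ a, ∑ b, ∑ c, ∑ d, S.wt X a b c d * g a b c d
/-- uniform average -/
noncomputable def E (φ : Matrix (Fin n) (Fin n) ℝ → ℝ) : ℝ :=
  (∑ X ∈ S.Ω, φ X) / S.Ω.card

end Setup

/-- indicator -/
noncomputable def ind {n : ℕ} (a p : Fin n) : ℝ := if a = p then 1 else 0

/-- the change of the matrix under a switching -/
noncomputable def swD {n : ℕ} (a b c d : Fin n) : Matrix (Fin n) (Fin n) ℝ :=
  Matrix.of fun p q => (ind a p - ind d p) * (ind c q - ind b q) +
    (ind c p - ind b p) * (ind a q - ind d q)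

/-- number of positions of a switching equal to `p` -/
noncomputable def hit {n : ℕ} (a b c d p : Fin n) : ℝ := ind a p + ind b p + ind c p + ind d p

section swD
variable {n : ℕ}

lemma ind_nonneg (a p : Fin n) : 0 ≤ ind a p := by unfold ind; split_ifs <;> norm_num
lemma ind_le_one (a p : Fin n) : ind a p ≤ 1 := by unfold ind; split_ifs <;> norm_num
lemma hit_nonneg (a b c d p : Fin n) : 0 ≤ hit a b c d p := by
  unfold hit; linarith [ind_nonneg a p, ind_nonneg b p, ind_nonneg c p, ind_nonneg d p]
lemma hit_le (a b c d p : Fin n) : hit a b c d p ≤ 4 := by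
  unfold hit; linarith [ind_le_one a p, ind_le_one b p, ind_le_one c p, ind_le_one d p]
lemma sum_ind (a : Fin n) : ∑ p, ind a p = 1 := by simp [ind]
lemma sum_ind_mul (a : Fin n) (f : Fin n → ℝ) : ∑ p, ind a p * f p = f a := by simp [ind]
lemma sum_ind' (p : Fin n) : ∑ a, ind a p = 1 := by simp [ind]
lemma sum_ind_mul' (p : Fin n) (f : Fin n → ℝ) : ∑ a, ind a p * f a = f p := by simp [ind]
lemma ind_mul_ind (a p q : Fin n) (h : p ≠ q) : ind a p * ind a q = 0 := by
  unfold ind; split_ifs with h1 h2 <;> simp_all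

lemma swD_apply (a b c d p q : Fin n) : swD a b c d p q =
    (ind a p - ind d p) * (ind c q - ind b q) + (ind c p - ind b p) * (ind a q - ind d q) := rfl

lemma swD_symm (a b c d : Fin n) : (swD a b c d).IsSymm := by
  ext p q; simp only [Matrix.transpose_apply, swD_apply]; ring

lemma swD_neg (a b c d : Fin n) : swD a c b d = - swD a b c d := by
  ext p q; simp only [Matrix.neg_apply, swD_apply]; ring

lemma swD_row (a b c d p : Fin n) : ∑ q, swD a b c d p q = 0 := by
  simp only [swD_apply, Finset.sum_add_distrib, ← Finset.mul_sum, Finset.sum_sub_distrib, sum_ind]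
  ring

lemma abs_swD_le (a b c d p q : Fin n) : |swD a b c d p q| ≤ hit a b c d p * hit a b c d q := by
  rw [swD_apply]
  unfold hit
  have h1 := ind_nonneg a p; have h2 := ind_nonneg b p
  have h3 := ind_nonneg c p; have h4 := ind_nonneg d p
  have g1 := ind_nonneg a q; have g2 := ind_nonneg b q
  have g3 := ind_nonneg c q; have g4 := ind_nonneg d q
  generalize ind a p = a1 at *
  generalize ind b p = b1 at *
  generalize ind c p = c1 at *
  generalize ind d p = d1 at *
  generalize ind a q = a2 at *
  generalize ind b q = b2 at *
  generalize ind c q = c2 at *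
  generalize ind d q = d2 at *
  have e1 : |a1 - d1| ≤ a1 + d1 := by rw [abs_le]; constructor <;> linarith
  have e2 : |c2 - b2| ≤ c2 + b2 := by rw [abs_le]; constructor <;> linarith
  have e3 : |c1 - b1| ≤ c1 + b1 := by rw [abs_le]; constructor <;> linarith
  have e4 : |a2 - d2| ≤ a2 + d2 := by rw [abs_le]; constructor <;> linarith
  calc _ ≤ |a1 - d1| * |c2 - b2| + |c1 - b1| * |a2 - d2| := by
        rw [← abs_mul, ← abs_mul]; exact abs_add_le _ _
    _ ≤ (a1 + d1) * (c2 + b2) + (c1 + b1) * (a2 + d2) := by gcongr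
    _ ≤ _ := by
      have : 0 ≤ (a1 + d1) * (a2 + d2) + (c1 + b1) * (c2 + b2) := by positivity
      nlinarith

lemma sum_hit (a b c d : Fin n) : ∑ p, hit a b c d p = 4 := by
  simp only [hit, Finset.sum_add_distrib, sum_ind]; norm_num

lemma sum_abs_swD_le (a b c d p : Fin n) : ∑ q, |swD a b c d p q| ≤ 4 * hit a b c d p := by
  calc _ ≤ ∑ q, hit a b c d p * hit a b c d q := Finset.sum_le_sum fun q _ => abs_swD_le ..
    _ = _ := by rw [← Finset.mul_sum, sum_hit]; ring

lemma count_hit (p : Fin n) : ∑ a, ∑ b, ∑ c, ∑ d, hit a b c d p = 4 * (n : ℝ) ^ 3 := by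
  simp only [hit, Finset.sum_add_distrib, sum_ind', Finset.sum_const, Finset.card_univ,
    Fintype.card_fin, nsmul_eq_mul, ← Finset.mul_sum]
  ring

lemma count_hit2 (p q : Fin n) (h : p ≠ q) :
    ∑ a, ∑ b, ∑ c, ∑ d, hit a b c d p * hit a b c d q = 12 * (n : ℝ) ^ 2 := by
  have e : ∀ a b c d : Fin n, hit a b c d p * hit a b c d q =
      (ind a p * ind b q + ind b p * ind a q) + (ind a p * ind c q + ind c p * ind a q)
      + (ind a p * ind d q + ind d p * ind a q) + (ind b p * ind c q + ind c p * ind b q)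
      + (ind b p * ind d q + ind d p * ind b q) + (ind c p * ind d q + ind d p * ind c q) := by
    intro a b c d
    have := ind_mul_ind a p q h; have := ind_mul_ind b p q h
    have := ind_mul_ind c p q h; have := ind_mul_ind d p q h
    unfold hit; linarith
  simp only [e, Finset.sum_add_distrib, sum_ind', Finset.sum_const, Finset.card_univ,
    Fintype.card_fin, nsmul_eq_mul, ← Finset.mul_sum, ← Finset.sum_mul]
  ring

lemma count_hit3 (p q r : Fin n) (h : p ≠ q) (h' : p ≠ r) (h'' : q ≠ r) :
    ∑ a, ∑ b, ∑ c, ∑ d, hit a b c d p * hit a b c d q * hit a b c d r ≤ 24 * (n : ℝ) := by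
  have e : ∀ a b c d : Fin n, hit a b c d p * hit a b c d q * hit a b c d r =
      (ind a p * ind b q * ind c r + ind a p * ind b q * ind d r)
      + (ind b p * ind a q * ind c r + ind b p * ind a q * ind d r)
      + (ind a p * ind c q * ind b r + ind a p * ind c q * ind d r)
      + (ind c p * ind a q * ind b r + ind c p * ind a q * ind d r)
      + (ind a p * ind d q * ind b r + ind a p * ind d q * ind c r)
      + (ind d p * ind a q * ind b r + ind d p * ind a q * ind c r)
      + (ind b p * ind c q * ind a r + ind b p * ind c q * ind d r)
      + (ind c p * ind b q * ind a r + ind c p * ind b q * ind d r)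
      + (ind b p * ind d q * ind a r + ind b p * ind d q * ind c r)
      + (ind d p * ind b q * ind a r + ind d p * ind b q * ind c r)
      + (ind c p * ind d q * ind a r + ind c p * ind d q * ind b r)
      + (ind d p * ind c q * ind a r + ind d p * ind c q * ind b r) := by
    intro a b c d
    have a1 := ind_mul_ind a p q h; have b1 := ind_mul_ind b p q h
    have c1 := ind_mul_ind c p q h; have d1 := ind_mul_ind d p q h
    have a2 := ind_mul_ind a p r h'; have b2 := ind_mul_ind b p r h'
    have c2 := ind_mul_ind c p r h'; have d2 := ind_mul_ind d p r h'
    have a3 := ind_mul_ind a q r h''; have b3 := ind_mul_ind b q r h''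
    have c3 := ind_mul_ind c q r h''; have d3 := ind_mul_ind d q r h''
    unfold hit
    linear_combination (ind a r + ind b r + ind c r + ind d r) * (a1 + b1 + c1 + d1)
      + (ind b q + ind c q + ind d q) * a2 + (ind a q + ind c q + ind d q) * b2
      + (ind a q + ind b q + ind d q) * c2 + (ind a q + ind b q + ind c q) * d2
      + (ind b p + ind c p + ind d p) * a3 + (ind a p + ind c p + ind d p) * b3
      + (ind a p + ind b p + ind d p) * c3 + (ind a p + ind b p + ind c p) * d3
  simp only [e, Finset.sum_add_distrib, sum_ind', Finset.sum_const, Finset.card_univ,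
    Fintype.card_fin, nsmul_eq_mul, ← Finset.mul_sum, ← Finset.sum_mul]
  apply le_of_eq; ring

end swD

namespace Setup
variable {n : ℕ} (S : Setup n)

lemma K_apply (a b : Fin n) : S.K a b = 1 - S.D a b := rfl
lemma K_symm (a b : Fin n) : S.K a b = S.K b a := by simp [K_apply, S.hDs a b]
lemma K_01 (a b : Fin n) : S.K a b = 0 ∨ S.K a b = 1 := by
  rcases S.hD a b with h | h <;> simp [K_apply, h]
lemma K_diag (a : Fin n) : S.K a a = 0 := by simp [K_apply, S.hD1]
lemma x_apply (X : Matrix (Fin n) (Fin n) ℝ) (a b : Fin n) :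
    S.x X a b = X a b - S.l * S.K a b := by simp [x]
lemma Y_apply (X : Matrix (Fin n) (Fin n) ℝ) (a b : Fin n) :
    S.Y X a b = S.K a b - X a b := by simp [Y]

section mem
variable {S} {X : Matrix (Fin n) (Fin n) ℝ} (hX : X ∈ S.Ω)
include hX
lemma X_01 (a b : Fin n) : X a b = 0 ∨ X a b = 1 := ((S.hΩ X).1 hX).1 a b
lemma X_symm (a b : Fin n) : X a b = X b a := ((S.hΩ X).1 hX).2.1 a b
lemma X_D (a b : Fin n) (h : S.D a b = 1) : X a b = 0 := ((S.hΩ X).1 hX).2.2.1 a b h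
lemma X_row (a : Fin n) : ∑ b, X a b = S.d a := ((S.hΩ X).1 hX).2.2.2 a
lemma X_diag (a : Fin n) : X a a = 0 := X_D hX a a (S.hD1 a)
lemma XK_cases (a b : Fin n) : (X a b = 0 ∧ S.K a b = 0 ∧ S.D a b = 1) ∨
    (X a b = 0 ∧ S.K a b = 1 ∧ S.D a b = 0) ∨ (X a b = 1 ∧ S.K a b = 1 ∧ S.D a b = 0) := by
  rcases S.hD a b with h | h
  · rcases X_01 hX a b with h' | h' <;> simp [K_apply, h, h']
  · simp [K_apply, h, X_D hX a b h]
lemma Y_01 (a b : Fin n) : S.Y X a b = 0 ∨ S.Y X a b = 1 := by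
  rw [Y_apply]
  rcases XK_cases hX a b with ⟨h, h', _⟩ | ⟨h, h', _⟩ | ⟨h, h', _⟩ <;> simp [h, h']
lemma Y_symm (a b : Fin n) : S.Y X a b = S.Y X b a := by
  rw [Y_apply, Y_apply, S.K_symm, X_symm hX]
lemma Y_diag (a : Fin n) : S.Y X a a = 0 := by simp [Y_apply, K_diag, X_diag hX]
lemma x_symm (a b : Fin n) : S.x X a b = S.x X b a := by
  rw [x_apply, x_apply, S.K_symm, X_symm hX]
lemma x_isSymm : (S.x X).IsSymm := by ext a b; exact x_symm hX b a
lemma x_abs_le (a b : Fin n) : |S.x X a b| ≤ 1 := by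
  have := S.hl0; have := S.hl1
  rw [x_apply, abs_le]
  rcases XK_cases hX a b with ⟨h, h', _⟩ | ⟨h, h', _⟩ | ⟨h, h', _⟩ <;> rw [h, h'] <;>
    constructor <;> linarith
lemma x_diag (a : Fin n) : S.x X a a = 0 := by simp [x_apply, X_diag hX, K_diag]
lemma x_D (a b : Fin n) (h : S.D a b = 1) : S.x X a b = 0 := by
  simp [x_apply, X_D hX a b h, K_apply, h]
lemma x_mul_D (a b : Fin n) : S.x X a b * S.D a b = 0 := by
  rcases S.hD a b with h | h
  · simp [h]
  · simp [x_D hX a b h]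
lemma x_row (a : Fin n) : ∑ b, S.x X a b = S.η a := by
  simp only [x_apply, Finset.sum_sub_distrib, X_row hX, K_apply, ← Finset.mul_sum, η, Dg]
  simp
lemma x_col (a : Fin n) : ∑ b, S.x X b a = S.η a := by
  rw [← x_row hX]; exact Finset.sum_congr rfl fun b _ => x_symm hX b a

lemma wt_nonneg (a b c d : Fin n) : 0 ≤ S.wt X a b c d := by
  unfold wt
  rcases X_01 hX a b with h1 | h1 <;> rcases X_01 hX c d with h2 | h2 <;>
  rcases Y_01 hX a c with h3 | h3 <;> rcases Y_01 hX b d with h4 | h4 <;> simp [h1, h2, h3, h4]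
lemma wt_le_one (a b c d : Fin n) : S.wt X a b c d ≤ 1 := by
  unfold wt
  rcases X_01 hX a b with h1 | h1 <;> rcases X_01 hX c d with h2 | h2 <;>
  rcases Y_01 hX a c with h3 | h3 <;> rcases Y_01 hX b d with h4 | h4 <;> simp [h1, h2, h3, h4]
lemma wt_ne {a b c d : Fin n} (h : S.wt X a b c d ≠ 0) :
    X a b = 1 ∧ X c d = 1 ∧ S.Y X a c = 1 ∧ S.Y X b d = 1 := by
  unfold wt at h
  rcases X_01 hX a b with h1 | h1 <;> rcases X_01 hX c d with h2 | h2 <;>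
  rcases Y_01 hX a c with h3 | h3 <;> rcases Y_01 hX b d with h4 | h4 <;> simp_all
lemma Y_one {a b : Fin n} (h : S.Y X a b = 1) : X a b = 0 ∧ S.D a b = 0 := by
  rw [Y_apply] at h
  rcases XK_cases hX a b with ⟨h1, h2, h3⟩ | ⟨h1, h2, h3⟩ | ⟨h1, h2, h3⟩ <;> simp_all
lemma wt_distinct {a b c d : Fin n} (h : S.wt X a b c d ≠ 0) :
    a ≠ b ∧ a ≠ c ∧ a ≠ d ∧ b ≠ c ∧ b ≠ d ∧ c ≠ d := by
  obtain ⟨h1, h2, h3, h4⟩ := wt_ne hX h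
  have h3' := Y_one hX h3
  have h4' := Y_one hX h4
  refine ⟨?_, ?_, ?_, ?_, ?_, ?_⟩ <;> rintro rfl
  · simp [X_diag hX] at h1
  · simp [Y_diag hX] at h3
  · rw [X_symm hX] at h1; simp [h1] at h4'
  · simp [h1] at h3'
  · simp [Y_diag hX] at h4
  · simp [X_diag hX] at h2

lemma switch_mem {a b c d : Fin n} (h : S.wt X a b c d ≠ 0) :
    X + swD a b c d ∈ S.Ω ∧ S.wt (X + swD a b c d) a c b d = 1 := by
  obtain ⟨h1, h2, h3, h4⟩ := wt_ne hX h
  obtain ⟨h3, g3⟩ := Y_one hX h3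
  obtain ⟨h4, g4⟩ := Y_one hX h4
  obtain ⟨n1, n2, n3, n4, n5, n6⟩ := wt_distinct hX h
  have g1 : S.D a b = 0 := by
    rcases S.hD a b with h | h
    · exact h
    · simp [X_D hX a b h] at h1
  have g2 : S.D c d = 0 := by
    rcases S.hD c d with h | h
    · exact h
    · simp [X_D hX c d h] at h2
  have s1 := X_symm hX b a ▸ h1
  have s2 := X_symm hX d c ▸ h2
  have s3 := X_symm hX c a ▸ h3
  have s4 := X_symm hX d b ▸ h4
  have t1 := S.hDs b a ▸ g1
  have t2 := S.hDs d c ▸ g2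
  have t3 := S.hDs c a ▸ g3
  have t4 := S.hDs d b ▸ g4
  have key : ∀ p q, ((X + swD a b c d) p q = 0 ∨ (X + swD a b c d) p q = 1) ∧
      (S.D p q = 1 → (X + swD a b c d) p q = 0) := by
    intro p q
    have o1 := X_01 hX p q
    have o2 := X_D hX p q
    rw [Matrix.add_apply, swD_apply]
    unfold ind
    by_cases pa : a = p
    · subst pa
      by_cases qb : b = q
      · subst qb; simp [*, n1.symm, n2.symm, n3.symm, n4.symm, n5.symm, n6.symm]
      by_cases qc : c = q
      · subst qc; simp [*, n1.symm, n2.symm, n3.symm, n4.symm, n5.symm, n6.symm]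
      simp [*, n1.symm, n2.symm, n3.symm, n4.symm, n5.symm, n6.symm]
      exact o2
    by_cases pb : b = p
    · subst pb
      by_cases qb : a = q
      · subst qb; simp [*, n1.symm, n2.symm, n3.symm, n4.symm, n5.symm, n6.symm]
      by_cases qc : d = q
      · subst qc; simp [*, n1.symm, n2.symm, n3.symm, n4.symm, n5.symm, n6.symm]
      simp [*, n1.symm, n2.symm, n3.symm, n4.symm, n5.symm, n6.symm]
      exact o2
    by_cases pc : c = p
    · subst pc
      by_cases qb : a = q
      · subst qb; simp [*, n1.symm, n2.symm, n3.symm, n4.symm, n5.symm, n6.symm]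
      by_cases qc : d = q
      · subst qc; simp [*, n1.symm, n2.symm, n3.symm, n4.symm, n5.symm, n6.symm]
      simp [*, n1.symm, n2.symm, n3.symm, n4.symm, n5.symm, n6.symm]
      exact o2
    by_cases pd : d = p
    · subst pd
      by_cases qb : b = q
      · subst qb; simp [*, n1.symm, n2.symm, n3.symm, n4.symm, n5.symm, n6.symm]
      by_cases qc : c = q
      · subst qc; simp [*, n1.symm, n2.symm, n3.symm, n4.symm, n5.symm, n6.symm]
      simp [*, n1.symm, n2.symm, n3.symm, n4.symm, n5.symm, n6.symm]
      exact o2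
    simp [pa, pb, pc, pd]
    exact ⟨o1, o2⟩
  constructor
  · rw [S.hΩ]
    refine ⟨fun p q => (key p q).1, fun p q => ?_, fun p q => (key p q).2, fun p => ?_⟩
    · rw [Matrix.add_apply, Matrix.add_apply, X_symm hX p q, ← (swD_symm a b c d).apply q p]
    · simp only [Matrix.add_apply, Finset.sum_add_distrib, X_row hX, swD_row, add_zero]
  · unfold wt
    simp only [Y_apply, Matrix.add_apply, swD_apply, ind, K_apply, g1, g2, h1, h2, h3, h4]
    simp [*, n1.symm, n2.symm, n3.symm, n4.symm, n5.symm, n6.symm]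

end mem

lemma switch_sum (F : Matrix (Fin n) (Fin n) ℝ → ℝ) (a b c d : Fin n) :
    ∑ X ∈ S.Ω, S.wt X a b c d * F (X + swD a b c d) = ∑ X ∈ S.Ω, S.wt X a c b d * F X := by
  have w1 : ∀ {X a b c d}, X ∈ S.Ω → S.wt X a b c d ≠ 0 → S.wt X a b c d = 1 := by
    intro X a b c d hX h
    obtain ⟨h1, h2, h3, h4⟩ := wt_ne hX h
    simp [wt, h1, h2, h3, h4]
  refine Finset.sum_bij_ne_zero (fun X _ _ => X + swD a b c d) ?_ ?_ ?_ ?_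
  · intro X hX h
    exact (switch_mem hX (left_ne_zero_of_mul h)).1
  · intro X hX h Z hZ h' e
    exact add_right_cancel e
  · intro Z hZ h
    have hw := left_ne_zero_of_mul h
    obtain ⟨m1, m2⟩ := switch_mem hZ hw
    have e : Z + swD a c b d + swD a b c d = Z := by rw [swD_neg]; abel
    refine ⟨Z + swD a c b d, m1, ?_, e⟩
    rw [m2, e]
    rw [w1 hZ hw] at h
    exact h
  · intro X hX h
    have hw := left_ne_zero_of_mul h
    obtain ⟨m1, m2⟩ := switch_mem hX hw
    rw [m2, w1 hX hw]

lemma reversal (ψ : Matrix (Fin n) (Fin n) ℝ → Fin n → Fin n → Fin n → Fin n → ℝ) :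
    ∑ X ∈ S.Ω, S.W X (fun a b c d => ψ (X + swD a b c d) a b c d) =
      ∑ X ∈ S.Ω, S.W X (fun a b c d => ψ X a c b d) := by
  have key : ∀ ψ : Matrix (Fin n) (Fin n) ℝ → Fin n → Fin n → Fin n → Fin n → ℝ,
      ∑ X ∈ S.Ω, S.W X (ψ X) =
      ∑ a, ∑ b, ∑ c, ∑ d, ∑ X ∈ S.Ω, S.wt X a b c d * ψ X a b c d := by
    intro ψ
    unfold W
    rw [Finset.sum_comm]; refine Finset.sum_congr rfl fun a _ => ?_
    rw [Finset.sum_comm]; refine Finset.sum_congr rfl fun b _ => ?_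
    rw [Finset.sum_comm]; refine Finset.sum_congr rfl fun c _ => ?_
    rw [Finset.sum_comm]
  rw [key (fun X a b c d => ψ (X + swD a b c d) a b c d), key (fun X a b c d => ψ X a c b d)]
  refine Finset.sum_congr rfl fun a _ => ?_
  rw [Finset.sum_comm]
  refine Finset.sum_congr rfl fun c _ => Finset.sum_congr rfl fun b _ =>
    Finset.sum_congr rfl fun d _ => ?_
  exact S.switch_sum (fun X => ψ X a b c d) a b c d

end Setup

namespace Setup
variable {n : ℕ} (S : Setup n)

section Wlin
variable (X : Matrix (Fin n) (Fin n) ℝ)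
lemma W_add (f g : Fin n → Fin n → Fin n → Fin n → ℝ) :
    S.W X (fun a b c d => f a b c d + g a b c d) = S.W X f + S.W X g := by
  simp only [W, mul_add, Finset.sum_add_distrib]
lemma W_sub (f g : Fin n → Fin n → Fin n → Fin n → ℝ) :
    S.W X (fun a b c d => f a b c d - g a b c d) = S.W X f - S.W X g := by
  simp only [W, mul_sub, Finset.sum_sub_distrib]
lemma W_mul_left (r : ℝ) (f : Fin n → Fin n → Fin n → Fin n → ℝ) :
    S.W X (fun a b c d => r * f a b c d) = r * S.W X f := by
  simp only [W, Finset.mul_sum]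
  refine Finset.sum_congr rfl fun a _ => Finset.sum_congr rfl fun b _ =>
    Finset.sum_congr rfl fun c _ => Finset.sum_congr rfl fun d _ => ?_
  ring
lemma W_mul_right (r : ℝ) (f : Fin n → Fin n → Fin n → Fin n → ℝ) :
    S.W X (fun a b c d => f a b c d * r) = S.W X f * r := by
  rw [mul_comm, ← W_mul_left]; simp only [mul_comm]
lemma W_sum {ι : Type*} (t : Finset ι) (f : ι → Fin n → Fin n → Fin n → Fin n → ℝ) :
    S.W X (fun a b c d => ∑ i ∈ t, f i a b c d) = ∑ i ∈ t, S.W X (f i) := by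
  induction t using Finset.induction_on with
  | empty => simp [W]
  | insert i t hi ih =>
    simp only [Finset.sum_insert hi, W_add, ih]
end Wlin

section Wmem
variable {S} {X : Matrix (Fin n) (Fin n) ℝ} (hX : X ∈ S.Ω)
include hX

lemma W_congr {f g : Fin n → Fin n → Fin n → Fin n → ℝ}
    (h : ∀ a b c d, a ≠ b → a ≠ c → a ≠ d → b ≠ c → b ≠ d → c ≠ d → f a b c d = g a b c d) :
    S.W X f = S.W X g := by
  unfold W
  refine Finset.sum_congr rfl fun a _ => Finset.sum_congr rfl fun b _ =>
    Finset.sum_congr rfl fun c _ => Finset.sum_congr rfl fun d _ => ?_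
  by_cases hw : S.wt X a b c d = 0
  · simp [hw]
  · obtain ⟨h1, h2, h3, h4, h5, h6⟩ := wt_distinct hX hw
    rw [h a b c d h1 h2 h3 h4 h5 h6]

lemma W_mono {f g : Fin n → Fin n → Fin n → Fin n → ℝ}
    (h : ∀ a b c d, f a b c d ≤ g a b c d) : S.W X f ≤ S.W X g := by
  unfold W
  refine Finset.sum_le_sum fun a _ => Finset.sum_le_sum fun b _ =>
    Finset.sum_le_sum fun c _ => Finset.sum_le_sum fun d _ => ?_
  exact mul_le_mul_of_nonneg_left (h a b c d) (wt_nonneg hX a b c d)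

lemma W_le_sum {g : Fin n → Fin n → Fin n → Fin n → ℝ} (h : ∀ a b c d, 0 ≤ g a b c d) :
    S.W X g ≤ ∑ a, ∑ b, ∑ c, ∑ d, g a b c d := by
  unfold W
  refine Finset.sum_le_sum fun a _ => Finset.sum_le_sum fun b _ =>
    Finset.sum_le_sum fun c _ => Finset.sum_le_sum fun d _ => ?_
  exact mul_le_of_le_one_left (h a b c d) (wt_le_one hX a b c d)

lemma abs_W_le {f g : Fin n → Fin n → Fin n → Fin n → ℝ}
    (h : ∀ a b c d, |f a b c d| ≤ g a b c d) :
    |S.W X f| ≤ ∑ a, ∑ b, ∑ c, ∑ d, g a b c d := by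
  have hg : ∀ a b c d, 0 ≤ g a b c d := fun a b c d => (abs_nonneg _).trans (h a b c d)
  rw [abs_le]
  constructor
  · have := W_mono hX (f := fun a b c d => (-1) * g a b c d) (g := f)
      (fun a b c d => by linarith [neg_abs_le (f a b c d), h a b c d])
    rw [W_mul_left] at this
    linarith [W_le_sum hX hg]
  · exact (W_mono hX (fun a b c d => (le_abs_self _).trans (h a b c d))).trans (W_le_sum hX hg)

lemma abs_W_hit_le {f : Fin n → Fin n → Fin n → Fin n → ℝ} {C : ℝ} {p : Fin n}
    (h : ∀ a b c d, |f a b c d| ≤ C * hit a b c d p) : |S.W X f| ≤ C * (4 * (n : ℝ) ^ 3) := by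
  refine (abs_W_le hX h).trans (le_of_eq ?_)
  simp only [← Finset.mul_sum]; rw [count_hit]

lemma abs_W_hit2_le {f : Fin n → Fin n → Fin n → Fin n → ℝ} {C : ℝ} {p q : Fin n} (hpq : p ≠ q)
    (h : ∀ a b c d, |f a b c d| ≤ C * (hit a b c d p * hit a b c d q)) :
    |S.W X f| ≤ C * (12 * (n : ℝ) ^ 2) := by
  refine (abs_W_le hX h).trans (le_of_eq ?_)
  simp only [← Finset.mul_sum]; rw [count_hit2 p q hpq]

lemma abs_W_hit3_le {f : Fin n → Fin n → Fin n → Fin n → ℝ} {C : ℝ} (hC : 0 ≤ C) {p q r : Fin n}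
    (hpq : p ≠ q) (hpr : p ≠ r) (hqr : q ≠ r)
    (h : ∀ a b c d, |f a b c d| ≤ C * (hit a b c d p * hit a b c d q * hit a b c d r)) :
    |S.W X f| ≤ C * (24 * (n : ℝ)) := by
  refine (abs_W_le hX h).trans ?_
  simp only [← Finset.mul_sum]
  exact mul_le_mul_of_nonneg_left (count_hit3 p q r hpq hpr hqr) hC

lemma wt_swap (a b c d : Fin n) : S.wt X d c b a = S.wt X a b c d := by
  unfold wt
  rw [X_symm hX d c, X_symm hX b a, Y_symm hX d b, Y_symm hX c a]; ring

lemma W_swap (f : Fin n → Fin n → Fin n → Fin n → ℝ) :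
    S.W X (fun a b c d => f d c b a) = S.W X f := by
  have e : ∀ g : Fin n → Fin n → Fin n → Fin n → ℝ,
      (∑ a, ∑ b, ∑ c, ∑ d, g a b c d) = ∑ t : Fin n × Fin n × Fin n × Fin n,
        g t.1 t.2.1 t.2.2.1 t.2.2.2 := by
    intro g; simp only [Fintype.sum_prod_type]
  unfold W
  rw [e, e]
  refine Fintype.sum_equiv ⟨fun t => (t.2.2.2, t.2.2.1, t.2.1, t.1),
    fun t => (t.2.2.2, t.2.2.1, t.2.1, t.1), fun t => rfl, fun t => rfl⟩ _ _ ?_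
  rintro ⟨a, b, c, d⟩
  simp only [Equiv.coe_fn_mk]
  rw [wt_swap hX]

lemma W_ac (p q : Fin n) : S.W X (fun a b c d => ind a p * ind c q) =
    S.Y X p q * (X * S.Y X * X) p q := by
  have : ∀ a b c d, S.wt X a b c d * (ind a p * ind c q) =
      ind a p * (ind c q * (S.Y X a c * (X a b * S.Y X b d * X d c))) := by
    intro a b c d; unfold wt; rw [X_symm hX c d]; ring
  simp only [W, this, ← Finset.mul_sum, sum_ind_mul']
  simp only [Matrix.mul_apply, Finset.sum_mul]
  rw [Finset.sum_comm]

lemma W_ab (p q : Fin n) : S.W X (fun a b c d => ind a p * ind b q) =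
    X p q * (S.Y X * X * S.Y X) p q := by
  have : ∀ a b c d, S.wt X a b c d * (ind a p * ind b q) =
      ind a p * (ind b q * (X a b * (S.Y X a c * X c d * S.Y X d b))) := by
    intro a b c d; unfold wt; rw [Y_symm hX b d]; ring
  simp only [W, this, ← Finset.mul_sum, sum_ind_mul']
  simp only [Matrix.mul_apply, Finset.sum_mul]
  rw [Finset.sum_comm (f := fun i j => _)]

/-- the product entering the second order term -/
lemma W_ad (p q : Fin n) : S.W X (fun a b c d => ind a p * ind d q) =
    (X * S.Y X) p q * (S.Y X * X) p q := by
  have : ∀ a b c d, S.wt X a b c d * (ind a p * ind d q) =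
      ind a p * (ind d q * ((X a b * S.Y X b d) * (S.Y X a c * X c d))) := by
    intro a b c d; unfold wt; ring
  simp only [W, this, ← Finset.mul_sum, sum_ind_mul']
  simp only [Matrix.mul_apply, Finset.sum_mul, Finset.mul_sum]
  rw [Finset.sum_comm]

lemma W_cb (p q : Fin n) : S.W X (fun a b c d => ind c p * ind b q) =
    (X * S.Y X) p q * (S.Y X * X) p q := by
  have : ∀ a b c d, S.wt X a b c d * (ind c p * ind b q) =
      ind c p * (ind b q * ((X c d * S.Y X d b) * (S.Y X c a * X a b))) := by
    intro a b c d; unfold wt; rw [Y_symm hX b d, Y_symm hX a c]; ring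
  simp only [W, this]
  calc _ = ∑ a, ∑ b, ∑ c, ind c p * (ind b q * ((S.Y X c a * X a b) * ∑ d, X c d * S.Y X d b)) := by
        refine Finset.sum_congr rfl fun a _ => Finset.sum_congr rfl fun b _ =>
          Finset.sum_congr rfl fun c _ => ?_
        simp only [Finset.mul_sum]
        refine Finset.sum_congr rfl fun d _ => ?_
        ring
    _ = ∑ a, ((S.Y X p a * X a q) * ∑ d, X p d * S.Y X d q) := by
        simp only [sum_ind_mul']
    _ = _ := by
        rw [← Finset.sum_mul, Matrix.mul_apply, Matrix.mul_apply, mul_comm]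

lemma X_isSymm : X.IsSymm := by ext a b; exact X_symm hX b a
lemma Y_isSymm : (S.Y X).IsSymm := by ext a b; exact Y_symm hX b a

end Wmem

/-- the normalised drift of a matrix entry -/
noncomputable def G (X : Matrix (Fin n) (Fin n) ℝ) : Matrix (Fin n) (Fin n) ℝ :=
  Matrix.of fun p q => X p q * (S.Y X * X * S.Y X) p q - S.Y X p q * (X * S.Y X * X) p q

/-- codegree product -/
noncomputable def M (X : Matrix (Fin n) (Fin n) ℝ) (p q : Fin n) : ℝ :=
  (X * S.Y X) p q * (S.Y X * X) p q

section Wmem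
variable {S} {X : Matrix (Fin n) (Fin n) ℝ} (hX : X ∈ S.Ω)
include hX

lemma XYX_symm (p q : Fin n) : (X * S.Y X * X) p q = (X * S.Y X * X) q p := by
  have : (X * S.Y X * X).IsSymm := by
    unfold Matrix.IsSymm
    rw [Matrix.transpose_mul, Matrix.transpose_mul, (X_isSymm hX).eq, (Y_isSymm hX).eq,
      Matrix.mul_assoc]
  exact this.apply q p

lemma YXY_symm (p q : Fin n) : (S.Y X * X * S.Y X) p q = (S.Y X * X * S.Y X) q p := by
  have : (S.Y X * X * S.Y X).IsSymm := by
    unfold Matrix.IsSymm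
    rw [Matrix.transpose_mul, Matrix.transpose_mul, (X_isSymm hX).eq, (Y_isSymm hX).eq,
      Matrix.mul_assoc]
  exact this.apply q p

lemma XY_transpose (p q : Fin n) : (X * S.Y X) p q = (S.Y X * X) q p := by
  have : Matrix.transpose (S.Y X * X) = X * S.Y X := by
    rw [Matrix.transpose_mul, (X_isSymm hX).eq, (Y_isSymm hX).eq]
  rw [← this]; rfl

lemma M_symm (p q : Fin n) : S.M X p q = S.M X q p := by
  unfold M; rw [XY_transpose hX p q, ← XY_transpose hX q p]; ring

lemma W_swD (p q : Fin n) : S.W X (fun a b c d => swD a b c d p q) = -4 * S.G X p q := by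
  have e : ∀ a b c d : Fin n, swD a b c d p q =
      (ind a p * ind c q + ind d p * ind b q + ind a q * ind c p + ind d q * ind b p)
      - (ind a p * ind b q + ind d p * ind c q + ind a q * ind b p + ind d q * ind c p) := by
    intro a b c d; rw [swD_apply]; ring
  simp only [e]
  have h1 := W_swap hX (fun a b c d => ind a p * ind c q)
  have h2 := W_swap hX (fun a b c d => ind a q * ind c p)
  have h3 := W_swap hX (fun a b c d => ind a p * ind b q)
  have h4 := W_swap hX (fun a b c d => ind a q * ind b p)
  rw [W_sub, W_add, W_add, W_add, W_add, W_add, W_add, h1, h2, h3, h4, W_ac hX, W_ac hX, W_ab hX,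
    W_ab hX, XYX_symm hX q p, YXY_symm hX q p, Y_symm hX q p, X_symm hX q p]
  simp only [G, Matrix.of_apply]; ring

lemma swD_sq {a b c d : Fin n} (h1 : a ≠ b) (h2 : a ≠ c) (h3 : a ≠ d) (h4 : b ≠ c) (h5 : b ≠ d)
    (h6 : c ≠ d) (p q : Fin n) : (swD a b c d * swD a b c d) p q =
      2 * ((ind a p - ind d p) * (ind a q - ind d q) + (ind c p - ind b p) * (ind c q - ind b q)) := by
  have o : ∀ a b : Fin n, a ≠ b → ∑ r, ind a r * ind b r = 0 := by
    intro a b h; rw [sum_ind_mul]; simp [ind, h.symm]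
  have i : ∀ a : Fin n, ∑ r, ind a r * ind a r = 1 := by
    intro a; rw [sum_ind_mul]; simp [ind]
  have uu : ∑ r, (ind a r - ind d r) * (ind a r - ind d r) = 2 := by
    have := i a; have := i d; have := o a d h3; have := o d a h3.symm
    simp only [mul_sub, sub_mul, Finset.sum_sub_distrib]; linarith
  have zz : ∑ r, (ind c r - ind b r) * (ind c r - ind b r) = 2 := by
    have := i c; have := i b; have := o c b h4.symm; have := o b c h4
    simp only [mul_sub, sub_mul, Finset.sum_sub_distrib]; linarith
  have uz : ∑ r, (ind a r - ind d r) * (ind c r - ind b r) = 0 := by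
    have := o a c h2; have := o a b h1; have := o d c h6.symm; have := o d b h5.symm
    simp only [mul_sub, sub_mul, Finset.sum_sub_distrib]; linarith
  rw [Matrix.mul_apply]
  have : ∀ r, swD a b c d p r * swD a b c d r q =
      ((ind a p - ind d p) * (ind a q - ind d q)) * ((ind c r - ind b r) * (ind c r - ind b r))
      + ((ind c p - ind b p) * (ind c q - ind b q)) * ((ind a r - ind d r) * (ind a r - ind d r))
      + ((ind a p - ind d p) * (ind c q - ind b q) + (ind c p - ind b p) * (ind a q - ind d q)) *
        ((ind a r - ind d r) * (ind c r - ind b r)) := by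
    intro r; rw [swD_apply, swD_apply]; ring
  simp only [this, Finset.sum_add_distrib, ← Finset.mul_sum, uu, zz, uz]
  ring

lemma W_swD_sq_of_ne (p q : Fin n) (hpq : p ≠ q) :
    S.W X (fun a b c d => (swD a b c d * swD a b c d) p q) = -8 * S.M X p q := by
  rw [W_congr hX (g := fun a b c d => -2 * (ind a p * ind d q + ind a q * ind d p
    + (ind c p * ind b q + ind c q * ind b p)))]
  · rw [W_mul_left, W_add, W_add, W_add, W_ad hX, W_ad hX, W_cb hX, W_cb hX]
    have := M_symm hX p q
    unfold M at *
    linarith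
  · intro a b c d h1 h2 h3 h4 h5 h6
    rw [swD_sq hX h1 h2 h3 h4 h5 h6]
    have := ind_mul_ind a p q hpq; have := ind_mul_ind b p q hpq
    have := ind_mul_ind c p q hpq; have := ind_mul_ind d p q hpq
    linarith

lemma sum_W_swD_sq_mul (p : Fin n) (f : Fin n → ℝ) :
    ∑ q, S.W X (fun a b c d => (swD a b c d * swD a b c d) p q) * f q =
      8 * ∑ q, S.M X p q * (f p - f q) := by
  have h0 : ∑ q, S.W X (fun a b c d => (swD a b c d * swD a b c d) p q) = 0 := by
    rw [← W_sum]
    have : ∀ a b c d : Fin n, ∑ q, (swD a b c d * swD a b c d) p q = 0 := by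
      intro a b c d
      simp only [Matrix.mul_apply]
      rw [Finset.sum_comm]
      simp only [← Finset.mul_sum, swD_row, mul_zero, Finset.sum_const_zero]
    simp [this, W]
  have h1 : ∑ q, S.W X (fun a b c d => (swD a b c d * swD a b c d) p q) * f q =
      ∑ q, S.W X (fun a b c d => (swD a b c d * swD a b c d) p q) * (f q - f p) := by
    simp only [mul_sub, Finset.sum_sub_distrib, ← Finset.sum_mul, h0]; ring
  rw [h1, Finset.mul_sum]
  refine Finset.sum_congr rfl fun q _ => ?_
  by_cases h : p = q
  · subst h; simp
  · rw [W_swD_sq_of_ne hX p q h]; ring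

lemma trace_mul_swD_sq_le (P : Matrix (Fin n) (Fin n) ℝ) (hP : ∀ a b, 2 * |P a b| ≤ P a a + P b b)
    {a b c d : Fin n} (h1 : a ≠ b) (h2 : a ≠ c) (h3 : a ≠ d) (h4 : b ≠ c) (h5 : b ≠ d)
    (h6 : c ≠ d) : (P * (swD a b c d * swD a b c d)).trace ≤
      4 * (P a a + P b b + P c c + P d d) := by
  have e : (P * (swD a b c d * swD a b c d)).trace = 2 * ((P a a - P a d - P d a + P d d)
      + (P c c - P c b - P b c + P b b)) := by
    simp only [Matrix.trace, Matrix.diag_apply, Matrix.mul_apply (M := P), swD_sq hX h1 h2 h3 h4 h5 h6]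
    have : ∀ p q, P p q * (2 * ((ind a q - ind d q) * (ind a p - ind d p) +
        (ind c q - ind b q) * (ind c p - ind b p))) =
        2 * ((ind a p * (ind a q * P p q) - ind a p * (ind d q * P p q)
          - ind d p * (ind a q * P p q) + ind d p * (ind d q * P p q))
        + (ind c p * (ind c q * P p q) - ind c p * (ind b q * P p q)
          - ind b p * (ind c q * P p q) + ind b p * (ind b q * P p q))) := by
      intro p q; ring
    simp only [this, ← Finset.mul_sum, Finset.sum_add_distrib, Finset.sum_sub_distrib, sum_ind_mul]
  rw [e]
  have g1 := hP a d; have g2 := hP d a; have g3 := hP c b; have g4 := hP b c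
  have i1 := neg_abs_le (P a d); have i2 := neg_abs_le (P d a)
  have i3 := neg_abs_le (P c b); have i4 := neg_abs_le (P b c)
  linarith

end Wmem

end Setup

namespace Setup
variable {n : ℕ} (S : Setup n)

/-- `D` applied to the row sums -/
noncomputable def Dη (a : Fin n) : ℝ := ∑ b, S.D a b * S.η b
/-- `D` applied to its row sums -/
noncomputable def DD (a : Fin n) : ℝ := ∑ b, S.D a b * S.Dg b
/-- total of the row sums -/
noncomputable def ηs : ℝ := ∑ a, S.η a
/-- total of `D` -/
noncomputable def tot : ℝ := ∑ a, S.Dg a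
/-- centred matrix applied to the row sums -/
noncomputable def p (X : Matrix (Fin n) (Fin n) ℝ) (a : Fin n) : ℝ := ∑ b, S.x X a b * S.η b
/-- centred matrix applied to the row sums of `D` -/
noncomputable def q (X : Matrix (Fin n) (Fin n) ℝ) (a : Fin n) : ℝ := ∑ b, S.x X a b * S.Dg b
/-- first correction of the drift -/
noncomputable def z (X : Matrix (Fin n) (Fin n) ℝ) (a b : Fin n) : ℝ :=
  (S.Dg a + S.Dg b) * S.x X a b + (S.η a + S.η b) * S.K a b
/-- deterministic coefficient -/
noncomputable def κ (a b : Fin n) : ℝ :=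
  S.v * (-S.tot + S.Dg a * S.Dg b + S.DD a + S.DD b - (S.D * S.D * S.D) a b)
    + (S.u - S.l) * (S.ηs - S.Dη a - S.Dη b) + S.η a * S.η b
/-- deterministic term -/
noncomputable def θ (a b : Fin n) : ℝ :=
  S.v * (S.ηs - S.Dη a - S.Dη b + S.η a * S.Dg b + S.η b * S.Dg a)
    + (S.l - S.u) * (S.η a * S.η b)
/-- random coefficient -/
noncomputable def ρU (X : Matrix (Fin n) (Fin n) ℝ) (a b : Fin n) : ℝ :=
  (S.u - S.l) * (S.D * S.x X * S.D) a b - S.p X a - S.p X b + (S.x X * S.x X * S.D) a b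
    + (S.D * (S.x X * S.x X)) a b - (S.x X * S.D * S.x X) a b
/-- random term without the cube -/
noncomputable def ρV (X : Matrix (Fin n) (Fin n) ℝ) (a b : Fin n) : ℝ :=
  S.v * ((S.D * S.x X * S.D) a b + S.q X a + S.q X b - (S.x X * (S.D * S.D)) a b
    - ((S.D * S.D) * S.x X) a b) - (S.l - S.u) * (S.x X * S.D * S.x X) a b
/-- remainder of the drift -/
noncomputable def r (X : Matrix (Fin n) (Fin n) ℝ) (a b : Fin n) : ℝ :=
  S.κ a b * S.x X a b + S.K a b * S.θ a b + S.x X a b * S.ρU X a b +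
    S.K a b * (S.ρV X a b + (S.x X * S.x X * S.x X) a b)
/-- drift minus its main part -/
noncomputable def B (X : Matrix (Fin n) (Fin n) ℝ) : Matrix (Fin n) (Fin n) ℝ :=
  S.G X - (S.v * (n : ℝ) ^ 2) • S.x X

lemma u_add_l : S.u + S.l = 1 := by unfold u; ring

/-- all-ones matrix -/
noncomputable def J (n : ℕ) : Matrix (Fin n) (Fin n) ℝ := Matrix.of fun _ _ => 1
lemma J_mul (M : Matrix (Fin n) (Fin n) ℝ) (a b : Fin n) : (J n * M) a b = ∑ c, M c b := by
  simp [J, Matrix.mul_apply]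
lemma mul_J (M : Matrix (Fin n) (Fin n) ℝ) (a b : Fin n) : (M * J n) a b = ∑ c, M a c := by
  simp [J, Matrix.mul_apply]
lemma K_eq : S.K = J n - S.D := by ext a b; simp [J, K]
lemma D_col (a : Fin n) : ∑ b, S.D b a = S.Dg a :=
  Finset.sum_congr rfl fun b _ => S.hDs b a

lemma sum_mul_apply (M N : Matrix (Fin n) (Fin n) ℝ) (a : Fin n) :
    ∑ b, (M * N) a b = ∑ c, M a c * ∑ b, N c b := by
  simp only [Matrix.mul_apply, Finset.mul_sum]; rw [Finset.sum_comm]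
lemma sum_mul_apply' (M N : Matrix (Fin n) (Fin n) ℝ) (b : Fin n) :
    ∑ a, (M * N) a b = ∑ c, (∑ a, M a c) * N c b := by
  simp only [Matrix.mul_apply, Finset.sum_mul]; rw [Finset.sum_comm]

lemma K2_apply (a b : Fin n) : (S.K * S.K) a b = n - S.Dg a - S.Dg b + (S.D * S.D) a b := by
  rw [K_eq, sub_mul, mul_sub, mul_sub]
  simp only [Matrix.sub_apply, J_mul, mul_J, D_col]
  simp [J, Dg]
  ring

lemma K3_apply (a b : Fin n) : (S.K * (S.K * S.K)) a b = (n : ℝ) ^ 2 - n * (S.Dg a + S.Dg b)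
    - S.tot + S.Dg a * S.Dg b + S.DD a + S.DD b - (S.D * S.D * S.D) a b := by
  rw [Matrix.mul_apply]
  simp only [K2_apply, K_apply]
  have : ∀ c, (1 - S.D a c) * (n - S.Dg c - S.Dg b + (S.D * S.D) c b) =
      n - S.Dg c - S.Dg b + (S.D * S.D) c b - n * S.D a c + S.D a c * S.Dg c + S.D a c * S.Dg b
        - S.D a c * (S.D * S.D) c b := by
    intro c; ring
  simp only [this, Finset.sum_add_distrib, Finset.sum_sub_distrib, ← Finset.mul_sum,
    ← Finset.sum_mul, sum_mul_apply', D_col]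
  rw [Matrix.mul_assoc, Matrix.mul_apply (M := S.D) (N := S.D * S.D)]
  have e1 : ∑ c, S.D a c = S.Dg a := rfl
  have e2 : ∑ c, S.D a c * S.Dg c = S.DD a := rfl
  have e3 : ∑ c, S.Dg c * S.D c b = S.DD b := by
    unfold DD; refine Finset.sum_congr rfl fun c _ => ?_
    rw [S.hDs c b]; ring
  have e4 : ∑ c, S.Dg c = S.tot := rfl
  rw [e1, e2, e3, e4]
  simp
  ring

section mem
variable {S} {X : Matrix (Fin n) (Fin n) ℝ} (hX : X ∈ S.Ω)
include hX

lemma KxK_apply (a b : Fin n) : (S.K * S.x X * S.K) a b =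
    S.ηs - S.Dη a - S.Dη b + (S.D * S.x X * S.D) a b := by
  simp only [K_eq, Matrix.sub_mul, Matrix.mul_sub, Matrix.sub_apply, mul_J, sum_mul_apply, Matrix.mul_assoc (J n), J_mul, x_row hX,
    sum_mul_apply', x_col hX]
  have e1 : ∑ c, S.D a c * S.η c = S.Dη a := rfl
  have e3 : ∑ c, S.η c * S.D c b = S.Dη b := by
    unfold Dη; refine Finset.sum_congr rfl fun c _ => ?_
    rw [S.hDs c b]; ring
  rw [e1, e3]
  unfold ηs; ring

lemma xK_apply (a b : Fin n) : (S.x X * S.K) a b = S.η a - (S.x X * S.D) a b := by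
  rw [K_eq, mul_sub, Matrix.sub_apply, mul_J, x_row hX]

lemma Kx_apply (a b : Fin n) : (S.K * S.x X) a b = S.η b - (S.D * S.x X) a b := by
  rw [K_eq, sub_mul, Matrix.sub_apply, J_mul, x_col hX]

lemma xxK_apply (a b : Fin n) : (S.x X * S.x X * S.K) a b =
    S.p X a - (S.x X * S.x X * S.D) a b := by
  rw [K_eq, mul_sub, Matrix.sub_apply, mul_J, sum_mul_apply]
  simp only [x_row hX]; rfl

lemma Kxx_apply (a b : Fin n) : (S.K * (S.x X * S.x X)) a b =
    S.p X b - (S.D * (S.x X * S.x X)) a b := by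
  rw [K_eq, sub_mul, Matrix.sub_apply, J_mul, sum_mul_apply']
  simp only [x_col hX, p]
  congr 1
  refine Finset.sum_congr rfl fun c _ => ?_
  rw [x_symm hX c b]; ring

lemma xKx_apply (a b : Fin n) : (S.x X * S.K * S.x X) a b =
    S.η a * S.η b - (S.x X * S.D * S.x X) a b := by
  rw [K_eq, mul_sub, sub_mul, Matrix.sub_apply, Matrix.mul_apply]
  simp only [mul_J, x_row hX, ← Finset.mul_sum, x_col hX]

lemma xKK_apply (a b : Fin n) : (S.x X * (S.K * S.K)) a b =
    n * S.η a - S.η a * S.Dg b - S.q X a + (S.x X * (S.D * S.D)) a b := by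
  rw [Matrix.mul_apply, Matrix.mul_apply]
  simp only [K2_apply]
  have : ∀ c, S.x X a c * (n - S.Dg c - S.Dg b + (S.D * S.D) c b) =
      S.x X a c * n - S.x X a c * S.Dg c - S.x X a c * S.Dg b + S.x X a c * (S.D * S.D) c b := by
    intro c; ring
  simp only [this, Finset.sum_add_distrib, Finset.sum_sub_distrib, ← Finset.sum_mul, x_row hX]
  unfold q; ring

lemma KKx_apply (a b : Fin n) : ((S.K * S.K) * S.x X) a b =
    n * S.η b - S.η b * S.Dg a - S.q X b + ((S.D * S.D) * S.x X) a b := by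
  rw [Matrix.mul_apply, Matrix.mul_apply]
  simp only [K2_apply]
  have : ∀ c, (n - S.Dg a - S.Dg c + (S.D * S.D) a c) * S.x X c b =
      n * S.x X c b - S.x X b c * S.Dg c - S.Dg a * S.x X c b + (S.D * S.D) a c * S.x X c b := by
    intro c; rw [x_symm hX b c]; ring
  simp only [this, Finset.sum_add_distrib, Finset.sum_sub_distrib, ← Finset.mul_sum, x_col hX]
  unfold q; ring

lemma G_eq (a b : Fin n) : S.G X a b =
    S.v * (n : ℝ) ^ 2 * S.x X a b - S.v * n * S.z X a b + S.r X a b := by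
  have hXx : X = S.x X + S.l • S.K := by unfold x; abel
  have hYx : S.Y X = S.u • S.K - S.x X := by
    unfold Y x u
    ext a b; simp only [Matrix.sub_apply, Matrix.smul_apply, smul_eq_mul]; ring
  have hul := S.u_add_l
  have hu : S.u = 1 - S.l := rfl
  have e1 : S.G X a b = S.x X a b * ((S.Y X * X * S.Y X) a b + (X * S.Y X * X) a b) +
      S.K a b * (S.l * (S.Y X * X * S.Y X) a b - S.u * (X * S.Y X * X) a b) := by
    have hX1 : X a b = S.x X a b + S.l * S.K a b := by rw [x_apply]; ring
    have hY1 : S.Y X a b = S.u * S.K a b - S.x X a b := by rw [x_apply, Y_apply, hu]; ring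
    simp only [G, Matrix.of_apply]
    rw [hX1, hY1]; ring
  have e2 : S.Y X * X * S.Y X = (S.u * S.u * S.l) • (S.K * (S.K * S.K))
      + (S.u * S.u) • (S.K * S.x X * S.K) - (S.u * S.l) • (S.x X * (S.K * S.K))
      - (S.u * S.l) • ((S.K * S.K) * S.x X) - S.u • (S.x X * S.x X * S.K)
      - S.u • (S.K * (S.x X * S.x X)) + S.l • (S.x X * S.K * S.x X) + S.x X * S.x X * S.x X := by
    rw [hYx]
    nth_rewrite 2 [hXx]
    simp only [mul_add, add_mul, mul_sub, sub_mul, Matrix.smul_mul, Matrix.mul_smul, smul_smul,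
      smul_add, smul_sub, Matrix.mul_assoc]
    module
  have e3 : X * S.Y X * X = (S.l * S.l * S.u) • (S.K * (S.K * S.K))
      - (S.l * S.l) • (S.K * S.x X * S.K) + (S.u * S.l) • (S.x X * (S.K * S.K))
      + (S.u * S.l) • ((S.K * S.K) * S.x X) - S.l • (S.x X * S.x X * S.K)
      - S.l • (S.K * (S.x X * S.x X)) + S.u • (S.x X * S.K * S.x X) - S.x X * S.x X * S.x X := by
    rw [hYx]
    nth_rewrite 1 [hXx]
    nth_rewrite 3 [hXx]
    simp only [mul_add, add_mul, mul_sub, sub_mul, Matrix.smul_mul, Matrix.mul_smul, smul_smul,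
      smul_add, smul_sub, Matrix.mul_assoc]
    module
  rw [e1, e2, e3]
  simp only [Matrix.add_apply, Matrix.sub_apply, Matrix.smul_apply, smul_eq_mul, K3_apply,
    KxK_apply hX, xKK_apply hX, KKx_apply hX, xxK_apply hX, Kxx_apply hX, xKx_apply hX]
  unfold z r κ θ ρU ρV v
  rw [hu]
  ring

lemma B_apply (a b : Fin n) : S.B X a b = - (S.v * n * S.z X a b) + S.r X a b := by
  simp only [B, Matrix.sub_apply, Matrix.smul_apply, smul_eq_mul, G_eq hX]; ring

lemma G_eq_B : S.G X = (S.v * (n : ℝ) ^ 2) • S.x X + S.B X := by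
  unfold B; abel

lemma G_symm (a b : Fin n) : S.G X a b = S.G X b a := by
  simp only [G, Matrix.of_apply]
  rw [XYX_symm hX, YXY_symm hX, Y_symm hX, X_symm hX]

lemma B_symm (a b : Fin n) : S.B X a b = S.B X b a := by
  simp only [B, Matrix.sub_apply, Matrix.smul_apply, G_symm hX a b, x_symm hX a b]

end mem

end Setup

namespace Setup
variable {n : ℕ} (S : Setup n)

lemma L_pos : 0 < S.L := by linarith [S.hL]
lemma one_le_L : 1 ≤ S.L := by linarith [S.hL]
include S in
lemma n_ge_one : (1 : ℝ) ≤ n := by exact_mod_cast S.hn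
lemma one_le_s : 1 ≤ S.s := by
  unfold s; rw [Real.one_le_sqrt]; exact S.n_ge_one
lemma s_pos : 0 < S.s := lt_of_lt_of_le one_pos S.one_le_s
lemma s_sq : S.s ^ 2 = n := by unfold s; exact Real.sq_sqrt (Nat.cast_nonneg n)
lemma s_zpow_two : S.s ^ (2 : ℤ) = n := by
  have := S.s_sq; exact_mod_cast this
lemma u_pos : 0 < S.u := by unfold u; linarith [S.hl1]
lemma u_le : S.u ≤ 1 := by unfold u; linarith [S.hl0]
lemma v_pos : 0 < S.v := mul_pos S.hl0 S.u_pos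
lemma v_ge : 1 / S.L ≤ S.v := S.hv
lemma v_le : S.v ≤ 1 := by
  unfold v; nlinarith [S.hl0, S.hl1, S.u_pos, S.u_le]
lemma inv_v_le : 1 / S.v ≤ S.L := by
  rw [div_le_iff₀ S.v_pos]
  have := S.v_ge
  rw [div_le_iff₀ S.L_pos] at this; linarith

/-- bound by powers of the two scales -/
def Bd (a : ℕ) (j : ℤ) (y : ℝ) : Prop := |y| ≤ S.L ^ a * S.s ^ j

section Bd
variable {S} {a b : ℕ} {i j : ℤ} {y w : ℝ}

lemma scale_pos (S : Setup n) (a : ℕ) (j : ℤ) : 0 < S.L ^ a * S.s ^ j :=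
  mul_pos (pow_pos S.L_pos _) (zpow_pos S.s_pos _)

lemma scale_mono (S : Setup n) (hab : a ≤ b) (hij : i ≤ j) :
    S.L ^ a * S.s ^ i ≤ S.L ^ b * S.s ^ j :=
  mul_le_mul (pow_le_pow_right₀ S.one_le_L hab) (zpow_le_zpow_right₀ S.one_le_s hij)
    (zpow_nonneg S.s_pos.le _) (pow_nonneg S.L_pos.le _)

lemma Bd.mono (h : S.Bd a i y) (hab : a ≤ b) (hij : i ≤ j) : S.Bd b j y :=
  le_trans (show |y| ≤ _ from h) (scale_mono S hab hij)
lemma Bd.mono_j (h : S.Bd a i y) (hij : i ≤ j) : S.Bd a j y := h.mono le_rfl hij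
lemma Bd.of_abs_le (h : S.Bd a i y) (hw : |w| ≤ |y|) : S.Bd a i w := le_trans hw h
lemma Bd.abs (h : S.Bd a i y) : S.Bd a i |y| := by unfold Bd at *; rwa [abs_abs]
lemma Bd.neg (h : S.Bd a i y) : S.Bd a i (-y) := by unfold Bd at *; rwa [abs_neg]

lemma two_scale_le (S : Setup n) (a b : ℕ) (j : ℤ) :
    S.L ^ a * S.s ^ j + S.L ^ b * S.s ^ j ≤ S.L ^ (max a b + 1) * S.s ^ j := by
  have h1 := scale_mono S (le_max_left a b) (le_refl j)
  have h2 := scale_mono S (le_max_right a b) (le_refl j)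
  have h3 := scale_pos S (max a b) j
  have : S.L ^ (max a b + 1) * S.s ^ j = S.L * (S.L ^ (max a b) * S.s ^ j) := by
    rw [pow_succ]; ring
  rw [this]
  nlinarith [S.hL]

lemma Bd.add (h : S.Bd a j y) (g : S.Bd b j w) : S.Bd (max a b + 1) j (y + w) :=
  (abs_add_le y w).trans ((add_le_add h g).trans (two_scale_le S a b j))
lemma Bd.sub (h : S.Bd a j y) (g : S.Bd b j w) : S.Bd (max a b + 1) j (y - w) := by
  rw [sub_eq_add_neg]; exact h.add g.neg
lemma scale_mul (S : Setup n) (a b : ℕ) (i j : ℤ) :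
    (S.L ^ a * S.s ^ i) * (S.L ^ b * S.s ^ j) = S.L ^ (a + b) * S.s ^ (i + j) := by
  rw [pow_add, zpow_add₀ S.s_pos.ne']; ring
lemma Bd.mul (h : S.Bd a i y) (g : S.Bd b j w) : S.Bd (a + b) (i + j) (y * w) := by
  unfold Bd
  rw [abs_mul, ← scale_mul]
  exact mul_le_mul h g (abs_nonneg _) (scale_pos S a i).le
lemma bd_one {y : ℝ} (h : |y| ≤ 1) : S.Bd 0 0 y := by unfold Bd; simpa using h
lemma bd_L {y : ℝ} (h : |y| ≤ S.L) : S.Bd 1 0 y := by unfold Bd; simpa using h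
lemma bd_thousand {y : ℝ} (h : |y| ≤ 1000) : S.Bd 1 0 y := bd_L (h.trans S.hL)
lemma bd_zero (a : ℕ) (j : ℤ) : S.Bd a j 0 := by
  unfold Bd; rw [abs_zero]; exact (scale_pos S a j).le
lemma bd_n : S.Bd 0 2 (n : ℝ) := by
  unfold Bd; rw [s_zpow_two]; simp
lemma Bd.sum {f : Fin n → ℝ} (h : ∀ i, S.Bd a j (f i)) : S.Bd a (j + 2) (∑ i, f i) := by
  unfold Bd
  refine (Finset.abs_sum_le_sum_abs _ _).trans ((Finset.sum_le_sum fun i _ => h i).trans ?_)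
  rw [Finset.sum_const, Finset.card_univ, Fintype.card_fin, nsmul_eq_mul, zpow_add₀ S.s_pos.ne',
    s_zpow_two]
  apply le_of_eq; ring
lemma D_nonneg (a b : Fin n) : 0 ≤ S.D a b := by rcases S.hD a b with h | h <;> simp [h]
lemma D_le (a b : Fin n) : S.D a b ≤ 1 := by rcases S.hD a b with h | h <;> simp [h]
lemma bd_D (a b : Fin n) : S.Bd 0 0 (S.D a b) := bd_one (by
  rw [abs_of_nonneg (D_nonneg a b)]; exact D_le a b)
lemma bd_K (a b : Fin n) : S.Bd 0 0 (S.K a b) := bd_one (by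
  rcases S.K_01 a b with h | h <;> simp [h])
lemma K_nonneg (a b : Fin n) : 0 ≤ S.K a b := by rcases S.K_01 a b with h | h <;> simp [h]
lemma K_le (a b : Fin n) : S.K a b ≤ 1 := by rcases S.K_01 a b with h | h <;> simp [h]
lemma Dg_nonneg (a : Fin n) : 0 ≤ S.Dg a := Finset.sum_nonneg fun b _ => D_nonneg a b
lemma Dg_le (a : Fin n) : S.Dg a ≤ S.L * S.s := S.hDg a
lemma bd_Dg (a : Fin n) : S.Bd 1 1 (S.Dg a) := by
  unfold Bd; rw [abs_of_nonneg (Dg_nonneg a)]; simpa using Dg_le a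
lemma bd_η (a : Fin n) : S.Bd 1 1 (S.η a) := by
  have := S.hη a
  unfold Bd; rw [pow_one, zpow_one]; exact this
lemma bd_ηs : S.Bd 1 2 S.ηs := by
  unfold Bd; rw [s_zpow_two, pow_one]; exact S.hηs
lemma tot_nonneg : 0 ≤ S.tot := Finset.sum_nonneg fun a _ => Dg_nonneg a
lemma bd_tot : S.Bd 1 2 S.tot := by
  unfold Bd; rw [abs_of_nonneg tot_nonneg, s_zpow_two, pow_one]; exact S.htot
lemma bd_l : S.Bd 0 0 S.l := bd_one (by rw [abs_of_pos S.hl0]; exact S.hl1.le)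
lemma bd_u : S.Bd 0 0 S.u := bd_one (by rw [abs_of_pos S.u_pos]; exact S.u_le)
lemma bd_v : S.Bd 0 0 S.v := bd_one (by rw [abs_of_pos S.v_pos]; exact S.v_le)
lemma bd_u_sub_l : S.Bd 0 0 (S.u - S.l) := bd_one (by
  rw [abs_le]; constructor <;> linarith [S.u_pos, S.u_le, S.hl0, S.hl1])
lemma bd_l_sub_u : S.Bd 0 0 (S.l - S.u) := bd_one (by
  rw [abs_le]; constructor <;> linarith [S.u_pos, S.u_le, S.hl0, S.hl1])
lemma Bd.D_sum {f : Fin n → ℝ} (h : ∀ i, S.Bd a j (f i)) (c : Fin n) :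
    S.Bd (a + 1) (j + 1) (∑ i, S.D c i * f i) := by
  unfold Bd
  calc |∑ i, S.D c i * f i| ≤ ∑ i, |S.D c i * f i| := Finset.abs_sum_le_sum_abs _ _
    _ ≤ ∑ i, S.D c i * (S.L ^ a * S.s ^ j) := by
        refine Finset.sum_le_sum fun i _ => ?_
        rw [abs_mul, abs_of_nonneg (D_nonneg c i)]
        exact mul_le_mul_of_nonneg_left (h i) (D_nonneg c i)
    _ = S.Dg c * (S.L ^ a * S.s ^ j) := by rw [← Finset.sum_mul]; rfl
    _ ≤ (S.L * S.s) * (S.L ^ a * S.s ^ j) :=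
        mul_le_mul_of_nonneg_right (Dg_le c) (scale_pos S a j).le
    _ = _ := by rw [pow_succ, zpow_add_one₀ S.s_pos.ne']; ring
lemma bd_Dη (a : Fin n) : S.Bd 2 2 (S.Dη a) := Bd.D_sum bd_η a
lemma bd_DD (a : Fin n) : S.Bd 2 2 (S.DD a) := Bd.D_sum bd_Dg a

lemma Bd.mat_mul {M N : Matrix (Fin n) (Fin n) ℝ} (hM : ∀ c d, S.Bd a i (M c d))
    (hN : ∀ c d, S.Bd b j (N c d)) (c d : Fin n) : S.Bd (a + b) (i + j + 2) ((M * N) c d) := by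
  rw [Matrix.mul_apply]; exact Bd.sum fun e => (hM c e).mul (hN e d)
lemma Bd.D_mul {M : Matrix (Fin n) (Fin n) ℝ} (hM : ∀ c d, S.Bd a j (M c d))
    (c d : Fin n) : S.Bd (a + 1) (j + 1) ((S.D * M) c d) := by
  rw [Matrix.mul_apply]; exact Bd.D_sum (fun e => hM e d) c
lemma Bd.mul_D {M : Matrix (Fin n) (Fin n) ℝ} (hM : ∀ c d, S.Bd a j (M c d))
    (c d : Fin n) : S.Bd (a + 1) (j + 1) ((M * S.D) c d) := by
  rw [Matrix.mul_apply]
  have := Bd.D_sum (fun e => hM c e) d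
  have e1 : ∑ e, M c e * S.D e d = ∑ e, S.D d e * M c e :=
    Finset.sum_congr rfl fun e _ => by rw [S.hDs d e, mul_comm]
  rwa [e1]
lemma bd_D3 (a b : Fin n) : S.Bd 2 2 ((S.D * S.D * S.D) a b) := by
  have h := Bd.mul_D (Bd.mul_D (S := S) (M := 1) (a := 0) (j := 0) (fun c d => bd_one (by
    rw [Matrix.one_apply]; split_ifs <;> simp)))
  have h2 := Bd.mul_D (Bd.mul_D (S := S) bd_D)
  exact h2 a b
lemma bd_κ (a b : Fin n) : S.Bd 8 2 (S.κ a b) := by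
  have h1 := (((((bd_tot (S := S)).neg.add ((bd_Dg a).mul (bd_Dg b))).add (bd_DD a)).add
    (bd_DD b)).sub (bd_D3 a b))
  have h2 := ((bd_ηs (S := S)).sub (bd_Dη a)).sub (bd_Dη b)
  have h3 := ((bd_v.mul h1).add (bd_u_sub_l.mul h2)).add ((bd_η a).mul (bd_η b))
  exact h3.mono (by decide) (by decide)
lemma bd_θ (a b : Fin n) : S.Bd 7 2 (S.θ a b) := by
  have h1 := ((((bd_ηs (S := S)).sub (bd_Dη a)).sub (bd_Dη b)).add
    ((bd_η a).mul (bd_Dg b))).add ((bd_η b).mul (bd_Dg a))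
  have h3 := (bd_v.mul h1).add (bd_l_sub_u.mul ((bd_η a).mul (bd_η b)))
  exact h3.mono (by decide) (by decide)

section mem
variable {X : Matrix (Fin n) (Fin n) ℝ} (hX : X ∈ S.Ω)
include hX
lemma bd_x (a b : Fin n) : S.Bd 0 0 (S.x X a b) := bd_one (x_abs_le hX a b)
lemma bd_p (a : Fin n) : S.Bd 1 3 (S.p X a) :=
  Bd.sum fun b => (bd_x hX a b).mul (bd_η b)
lemma bd_q (a : Fin n) : S.Bd 1 2 (S.q X a) := by
  have h : |S.q X a| ≤ ∑ b, S.Dg b := by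
    refine (Finset.abs_sum_le_sum_abs _ _).trans (Finset.sum_le_sum fun b _ => ?_)
    rw [abs_mul, abs_of_nonneg (Dg_nonneg b)]
    exact mul_le_of_le_one_left (Dg_nonneg b) (x_abs_le hX a b)
  exact (bd_tot (S := S)).of_abs_le (h.trans (le_abs_self _))
lemma bd_DxD (a b : Fin n) : S.Bd 2 2 ((S.D * S.x X * S.D) a b) :=
  Bd.mul_D (Bd.D_mul (bd_x hX)) a b
lemma bd_xx (a b : Fin n) : S.Bd 0 2 ((S.x X * S.x X) a b) :=
  Bd.mat_mul (bd_x hX) (bd_x hX) a b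
lemma bd_xxD (a b : Fin n) : S.Bd 1 3 ((S.x X * S.x X * S.D) a b) :=
  Bd.mul_D (bd_xx hX) a b
lemma bd_Dxx (a b : Fin n) : S.Bd 1 3 ((S.D * (S.x X * S.x X)) a b) :=
  Bd.D_mul (bd_xx hX) a b
lemma bd_xDx (a b : Fin n) : S.Bd 1 2 ((S.x X * S.D * S.x X) a b) := by
  have h : |(S.x X * S.D * S.x X) a b| ≤ S.tot := by
    have e : (S.x X * S.D * S.x X) a b = ∑ d, ∑ c, S.x X a c * S.D c d * S.x X d b := by
      simp only [Matrix.mul_apply, Finset.sum_mul]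
    rw [e]
    unfold tot Dg
    refine (Finset.abs_sum_le_sum_abs _ _).trans (Finset.sum_le_sum fun d _ => ?_)
    refine (Finset.abs_sum_le_sum_abs _ _).trans (Finset.sum_le_sum fun c _ => ?_)
    rw [abs_mul, abs_mul, abs_of_nonneg (D_nonneg c d), S.hDs c d]
    have h1 := x_abs_le hX a c; have h2 := x_abs_le hX d b
    have h3 := abs_nonneg (S.x X a c); have h4 := abs_nonneg (S.x X d b)
    have h5 := D_nonneg (S := S) d c
    calc |S.x X a c| * S.D d c * |S.x X d b| ≤ 1 * S.D d c * 1 := by gcongr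
      _ = _ := by ring
  exact (bd_tot (S := S)).of_abs_le (h.trans (le_abs_self _))
lemma bd_xDD (a b : Fin n) : S.Bd 2 2 ((S.x X * (S.D * S.D)) a b) := by
  rw [← Matrix.mul_assoc]; exact Bd.mul_D (Bd.mul_D (bd_x hX)) a b
lemma bd_DDx (a b : Fin n) : S.Bd 2 2 (((S.D * S.D) * S.x X) a b) := by
  rw [Matrix.mul_assoc]; exact Bd.D_mul (Bd.D_mul (bd_x hX)) a b
lemma bd_xxx (a b : Fin n) : S.Bd 0 4 ((S.x X * S.x X * S.x X) a b) :=
  Bd.mat_mul (bd_xx hX) (bd_x hX) a b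
lemma bd_z (a b : Fin n) : S.Bd 3 1 (S.z X a b) :=
  ((((bd_Dg a).add (bd_Dg b)).mul (bd_x hX a b)).add
    (((bd_η a).add (bd_η b)).mul (bd_K a b))).mono (by decide) (by decide)
lemma bd_ρU (a b : Fin n) : S.Bd 7 3 (S.ρU X a b) := by
  have h1 := (bd_u_sub_l.mul (bd_DxD hX a b)).mono_j (j := 3) (by decide)
  have h2 := ((((h1.sub (bd_p hX a)).sub (bd_p hX b)).add (bd_xxD hX a b)).add
    (bd_Dxx hX a b)).sub ((bd_xDx hX a b).mono_j (by decide))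
  exact h2.mono (by decide) le_rfl
lemma bd_ρV (a b : Fin n) : S.Bd 7 2 (S.ρV X a b) := by
  have h1 := ((((bd_DxD hX a b).add (bd_q hX a)).add (bd_q hX b)).sub (bd_xDD hX a b)).sub
    (bd_DDx hX a b)
  have h2 := (bd_v.mul h1).sub (bd_l_sub_u.mul (bd_xDx hX a b))
  exact h2.mono (by decide) (by decide)
end mem

end Bd

section Elin
variable (f g : Matrix (Fin n) (Fin n) ℝ → ℝ)
lemma card_pos : (0 : ℝ) < S.Ω.card := by exact_mod_cast S.hne.card_pos
lemma E_add : S.E (fun X => f X + g X) = S.E f + S.E g := by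
  simp only [E, Finset.sum_add_distrib, add_div]
lemma E_sub : S.E (fun X => f X - g X) = S.E f - S.E g := by
  simp only [E, Finset.sum_sub_distrib, sub_div]
lemma E_neg : S.E (fun X => - f X) = - S.E f := by
  simp only [E, Finset.sum_neg_distrib, neg_div]
lemma E_mul_left (c : ℝ) : S.E (fun X => c * f X) = c * S.E f := by
  simp only [E, ← Finset.mul_sum, mul_div_assoc]
lemma E_mul_right (c : ℝ) : S.E (fun X => f X * c) = S.E f * c := by
  rw [mul_comm, ← E_mul_left]; simp only [mul_comm]
lemma E_const (c : ℝ) : S.E (fun _ => c) = c := by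
  simp only [E, Finset.sum_const, nsmul_eq_mul]
  rw [mul_div_assoc, mul_comm, div_mul_cancel₀ _ S.card_pos.ne']
lemma E_sum {ι : Type*} (t : Finset ι) (F : ι → Matrix (Fin n) (Fin n) ℝ → ℝ) :
    S.E (fun X => ∑ i ∈ t, F i X) = ∑ i ∈ t, S.E (F i) := by
  simp only [E]; rw [Finset.sum_comm, Finset.sum_div]
variable {S f g}
lemma E_congr (h : ∀ X ∈ S.Ω, f X = g X) : S.E f = S.E g := by
  unfold E; rw [Finset.sum_congr rfl h]
lemma E_mono (h : ∀ X ∈ S.Ω, f X ≤ g X) : S.E f ≤ S.E g :=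
  div_le_div_of_nonneg_right (Finset.sum_le_sum h) S.card_pos.le
lemma E_nonneg (h : ∀ X ∈ S.Ω, 0 ≤ f X) : 0 ≤ S.E f :=
  div_nonneg (Finset.sum_nonneg h) S.card_pos.le
lemma abs_E_le : |S.E f| ≤ S.E (fun X => |f X|) := by
  unfold E; rw [abs_div, abs_of_pos S.card_pos]
  exact div_le_div_of_nonneg_right (Finset.abs_sum_le_sum_abs _ _) S.card_pos.le
lemma E_mul_sq_le : (S.E (fun X => f X * g X)) ^ 2 ≤ S.E (fun X => f X ^ 2) * S.E (fun X => g X ^ 2) := by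
  unfold E
  rw [div_pow, div_mul_div_comm, ← sq]
  exact div_le_div_of_nonneg_right (Finset.sum_mul_sq_le_sq_mul_sq _ _ _) (sq_nonneg _)
end Elin

lemma E_reversal (ψ : Matrix (Fin n) (Fin n) ℝ → Fin n → Fin n → Fin n → Fin n → ℝ) :
    S.E (fun X => S.W X (fun a b c d => ψ (X + swD a b c d) a b c d)) =
      S.E (fun X => S.W X (fun a b c d => ψ X a c b d)) := by
  unfold E; rw [S.reversal]

lemma E_stationary (φ : Matrix (Fin n) (Fin n) ℝ → ℝ) :
    S.E (fun X => S.W X (fun a b c d => φ (X + swD a b c d) - φ X)) = 0 := by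
  simp only [W_sub]
  rw [E_sub, S.E_reversal (fun X _ _ _ _ => φ X)]
  ring

lemma x_add (X Z : Matrix (Fin n) (Fin n) ℝ) : S.x (X + Z) = S.x X + Z := by
  unfold x; abel

end Setup

namespace Setup
variable {n : ℕ} (S : Setup n)

lemma pow_sub_pow_eq_sum {ι : Type*} [Fintype ι] [DecidableEq ι] (A C : Matrix ι ι ℝ) (m : ℕ) :
    A ^ m - C ^ m = ∑ i ∈ Finset.range m, A ^ i * (A - C) * C ^ (m - 1 - i) := by
  induction m with
  | zero => simp
  | succ m ih =>
    have e : A ^ (m + 1) - C ^ (m + 1) = (A ^ m - C ^ m) * C + A ^ m * (A - C) := by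
      rw [pow_succ, pow_succ]; noncomm_ring
    rw [e, ih, Finset.sum_range_succ, Finset.sum_mul]
    congr 1
    · refine Finset.sum_congr rfl fun i hi => ?_
      have hi' := Finset.mem_range.1 hi
      rw [show m + 1 - 1 - i = (m - 1 - i) + 1 by omega, pow_succ, Matrix.mul_assoc (A ^ i * (A - C))]
    · simp

/-- trace of an even power of the centred matrix -/
noncomputable def T (j : ℕ) (X : Matrix (Fin n) (Fin n) ℝ) : ℝ := (S.x X ^ (2 * j)).trace

section mem
variable {S} {X : Matrix (Fin n) (Fin n) ℝ} (hX : X ∈ S.Ω)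
include hX

lemma T_nonneg (j : ℕ) : 0 ≤ S.T j X := trace_even_nonneg _ (x_isSymm hX) j

lemma W_mono_ne {f g : Fin n → Fin n → Fin n → Fin n → ℝ}
    (h : ∀ a b c d, a ≠ b → a ≠ c → a ≠ d → b ≠ c → b ≠ d → c ≠ d → f a b c d ≤ g a b c d) :
    S.W X f ≤ S.W X g := by
  unfold W
  refine Finset.sum_le_sum fun a _ => Finset.sum_le_sum fun b _ =>
    Finset.sum_le_sum fun c _ => Finset.sum_le_sum fun d _ => ?_
  by_cases hw : S.wt X a b c d = 0
  · simp [hw]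
  · obtain ⟨h1, h2, h3, h4, h5, h6⟩ := wt_distinct hX hw
    exact mul_le_mul_of_nonneg_left (h a b c d h1 h2 h3 h4 h5 h6) (wt_nonneg hX a b c d)

lemma W_trace_sq_le (j : ℕ) :
    S.W X (fun a b c d => (S.x X ^ (2 * j) * (swD a b c d * swD a b c d)).trace) ≤
      16 * (n : ℝ) ^ 3 * S.T j X := by
  set P := S.x X ^ (2 * j) with hP
  have h := W_mono_ne hX (fun a b c d h1 h2 h3 h4 h5 h6 =>
    trace_mul_swD_sq_le hX P (fun a b => abs_pow_even_le _ (x_isSymm hX) j a b) h1 h2 h3 h4 h5 h6)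
  refine h.trans ((W_le_sum hX ?_).trans (le_of_eq ?_))
  · intro a b c d
    have := fun a => pow_even_diag_nonneg _ (x_isSymm hX) j a
    rw [← hP] at this
    have h1 := this a; have h2 := this b; have h3 := this c; have h4 := this d
    positivity
  · have hT : S.T j X = ∑ a, P a a := rfl
    rw [hT]
    simp only [← Finset.mul_sum, Finset.sum_add_distrib, Finset.sum_const, Finset.card_univ,
      Fintype.card_fin, nsmul_eq_mul]
    ring

lemma W_trace_swD (j : ℕ) :
    S.W X (fun a b c d => (S.x X ^ j * swD a b c d).trace) = -4 * (S.x X ^ j * S.G X).trace := by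
  simp only [Matrix.trace, Matrix.diag_apply, Matrix.mul_apply, W_sum, W_mul_left, W_swD hX,
    Finset.mul_sum]
  refine Finset.sum_congr rfl fun a _ => Finset.sum_congr rfl fun b _ => by ring

lemma trace_telescope_le {a b c d : Fin n} (hX' : X + swD a b c d ∈ S.Ω) (j : ℕ) :
    ((S.x (X + swD a b c d) ^ (2 * j + 1) - S.x X ^ (2 * j + 1)) * swD a b c d).trace ≤
      (2 * j + 1 : ℝ) * ((S.x (X + swD a b c d) ^ (2 * j) * (swD a b c d * swD a b c d)).trace +
        (S.x X ^ (2 * j) * (swD a b c d * swD a b c d)).trace) := by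
  have hd : S.x (X + swD a b c d) - S.x X = swD a b c d := by rw [x_add]; abel
  rw [pow_sub_pow_eq_sum, Finset.sum_mul, Matrix.trace_sum, hd]
  have : ∀ i ∈ Finset.range (2 * j + 1), (S.x (X + swD a b c d) ^ i * swD a b c d *
      S.x X ^ (2 * j + 1 - 1 - i) * swD a b c d).trace ≤
      (S.x (X + swD a b c d) ^ (2 * j) * (swD a b c d * swD a b c d)).trace +
        (S.x X ^ (2 * j) * (swD a b c d * swD a b c d)).trace := by
    intro i hi
    have hi' := Finset.mem_range.1 hi
    rw [← Matrix.mul_assoc, ← Matrix.mul_assoc]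
    exact trace_pow_mul_pow_le _ _ _ (x_isSymm hX') (x_isSymm hX) (swD_symm a b c d) (by omega)
  refine (Finset.sum_le_sum this).trans (le_of_eq ?_)
  rw [Finset.sum_const, Finset.card_range, nsmul_eq_mul]; push_cast; ring
end mem

lemma E_trace_G_le (j : ℕ) :
    S.E (fun X => (S.x X ^ (2 * j + 1) * S.G X).trace) ≤
      8 * (j + 1) * (n : ℝ) ^ 3 * S.E (S.T j) := by
  have hrev : S.E (fun X => S.W X (fun a b c d =>
      (S.x (X + swD a b c d) ^ (2 * j + 1) * swD a b c d).trace)) =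
      4 * S.E (fun X => (S.x X ^ (2 * j + 1) * S.G X).trace) := by
    rw [S.E_reversal (fun X a b c d => (S.x X ^ (2 * j + 1) * swD a b c d).trace), ← E_mul_left]
    refine E_congr fun X hX => ?_
    have : S.W X (fun a b c d => (S.x X ^ (2 * j + 1) * swD a c b d).trace) =
        -1 * S.W X (fun a b c d => (S.x X ^ (2 * j + 1) * swD a b c d).trace) := by
      rw [← W_mul_left]; congr 1; ext a b c d
      rw [swD_neg, Matrix.mul_neg, Matrix.trace_neg]; ring
    rw [this, W_trace_swD hX]; ring
  have hrev2 : S.E (fun X => S.W X (fun a b c d =>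
      (S.x (X + swD a b c d) ^ (2 * j) * (swD a b c d * swD a b c d)).trace)) =
      S.E (fun X => S.W X (fun a b c d =>
        (S.x X ^ (2 * j) * (swD a b c d * swD a b c d)).trace)) := by
    refine (S.E_reversal (fun X a b c d =>
      (S.x X ^ (2 * j) * (swD a b c d * swD a b c d)).trace)).trans ?_
    refine E_congr fun X _ => ?_
    refine congrArg (S.W X) ?_
    funext a b c d
    show (S.x X ^ (2 * j) * (swD a c b d * swD a c b d)).trace = _
    rw [swD_neg, neg_mul_neg]
  have h1 : S.E (fun X => S.W X (fun a b c d =>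
      ((S.x (X + swD a b c d) ^ (2 * j + 1) - S.x X ^ (2 * j + 1)) * swD a b c d).trace)) =
      8 * S.E (fun X => (S.x X ^ (2 * j + 1) * S.G X).trace) := by
    simp only [Matrix.sub_mul, Matrix.trace_sub, W_sub]
    rw [E_sub, hrev]
    have : S.E (fun X => S.W X (fun a b c d => (S.x X ^ (2 * j + 1) * swD a b c d).trace)) =
        -4 * S.E (fun X => (S.x X ^ (2 * j + 1) * S.G X).trace) := by
      rw [← E_mul_left]; exact E_congr fun X hX => W_trace_swD hX _
    rw [this]; ring
  have h2 : S.E (fun X => S.W X (fun a b c d =>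
      ((S.x (X + swD a b c d) ^ (2 * j + 1) - S.x X ^ (2 * j + 1)) * swD a b c d).trace)) ≤
      S.E (fun X => S.W X (fun a b c d => (2 * j + 1 : ℝ) *
        ((S.x (X + swD a b c d) ^ (2 * j) * (swD a b c d * swD a b c d)).trace +
        (S.x X ^ (2 * j) * (swD a b c d * swD a b c d)).trace))) := by
    refine E_mono fun X hX => ?_
    unfold W
    refine Finset.sum_le_sum fun a _ => Finset.sum_le_sum fun b _ =>
      Finset.sum_le_sum fun c _ => Finset.sum_le_sum fun d _ => ?_
    by_cases hw : S.wt X a b c d = 0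
    · simp [hw]
    · exact mul_le_mul_of_nonneg_left (trace_telescope_le hX (switch_mem hX hw).1 j)
        (wt_nonneg hX a b c d)
  simp only [W_mul_left, W_add] at h2
  rw [E_mul_left, E_add, hrev2, h1] at h2
  have h3 : S.E (fun X => S.W X (fun a b c d =>
      (S.x X ^ (2 * j) * (swD a b c d * swD a b c d)).trace)) ≤
      16 * (n : ℝ) ^ 3 * S.E (S.T j) := by
    rw [← E_mul_left]; exact E_mono fun X hX => W_trace_sq_le hX j
  have h4 : 0 ≤ (n : ℝ) ^ 3 * S.E (S.T j) := mul_nonneg (by positivity) (E_nonneg fun X hX => T_nonneg hX j)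
  have hj : (0:ℝ) ≤ j := Nat.cast_nonneg j
  nlinarith

section mem
variable {S} {X : Matrix (Fin n) (Fin n) ℝ} (hX : X ∈ S.Ω)
include hX

lemma sum_sq_B_sub_le : ∑ a, ∑ b, ((S.B X - S.x X * S.x X * S.x X) a b) ^ 2 ≤
    S.L ^ 30 * S.s ^ 10 := by
  set g : Fin n → Fin n → ℝ := fun a b => -(S.v * n * S.z X a b) + S.κ a b * S.x X a b +
    S.K a b * S.θ a b + S.x X a b * S.ρU X a b + S.K a b * S.ρV X a b with hg
  have hb : ∀ a b, S.Bd 14 3 (g a b) := by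
    intro a b
    have h1 := ((((bd_v.mul bd_n).mul (bd_z hX a b)).neg.add
      (((bd_κ a b).mul (bd_x hX a b)).mono_j (j := 3) (by decide))).add
      (((bd_K a b).mul (bd_θ a b)).mono_j (j := 3) (by decide))).add
      (((bd_x hX a b).mul (bd_ρU hX a b)).mono_j (j := 3) (by decide))
    have h2 := h1.add (((bd_K a b).mul (bd_ρV hX a b)).mono_j (j := 3) (by decide))
    exact h2.mono (by decide) (by decide)
  have e : ∀ a b, (S.B X - S.x X * S.x X * S.x X) a b =
      g a b - S.D a b * (S.x X * S.x X * S.x X) a b := by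
    intro a b
    rw [Matrix.sub_apply, B_apply hX, hg]
    simp only [r, K_apply]; ring
  have h3 : ∀ a b, ((S.B X - S.x X * S.x X * S.x X) a b) ^ 2 ≤
      2 * (S.L ^ 28 * S.s ^ 6) + 2 * (S.D a b * S.s ^ 8) := by
    intro a b
    have i1 : (g a b) ^ 2 ≤ S.L ^ 28 * S.s ^ 6 := by
      have := hb a b
      unfold Bd at this
      calc (g a b) ^ 2 = |g a b| ^ 2 := (sq_abs _).symm
        _ ≤ (S.L ^ 14 * S.s ^ (3:ℤ)) ^ 2 := pow_le_pow_left₀ (abs_nonneg _) this 2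
        _ = _ := by norm_cast; ring
    have i2 : (S.D a b * (S.x X * S.x X * S.x X) a b) ^ 2 ≤ S.D a b * S.s ^ 8 := by
      have := bd_xxx hX a b
      unfold Bd at this
      have i3 : ((S.x X * S.x X * S.x X) a b) ^ 2 ≤ S.s ^ 8 := by
        calc ((S.x X * S.x X * S.x X) a b) ^ 2 = |(S.x X * S.x X * S.x X) a b| ^ 2 := (sq_abs _).symm
        _ ≤ (S.L ^ 0 * S.s ^ (4:ℤ)) ^ 2 := pow_le_pow_left₀ (abs_nonneg _) this 2
        _ = _ := by norm_cast; ring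
      rw [mul_pow]
      rcases S.hD a b with h | h <;> rw [h] <;> simp
      exact i3
    rw [e]
    nlinarith [sq_nonneg (g a b + S.D a b * (S.x X * S.x X * S.x X) a b)]
  refine (Finset.sum_le_sum fun a _ => Finset.sum_le_sum fun b _ => h3 a b).trans ?_
  have e2 : ∑ a, ∑ b, (2 * (S.L ^ 28 * S.s ^ 6) + 2 * (S.D a b * S.s ^ 8)) =
      2 * (S.L ^ 28 * S.s ^ 10) + 2 * (S.tot * S.s ^ 8) := by
    simp only [Finset.sum_add_distrib, ← Finset.mul_sum, ← Finset.sum_mul, Finset.sum_const,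
      Finset.card_univ, Fintype.card_fin, nsmul_eq_mul, tot, Dg, ← S.s_sq]
    ring
  rw [e2]
  have h5 : S.tot ≤ S.L * S.s ^ 2 := by rw [s_sq]; exact S.htot
  have h6 : S.tot * S.s ^ 8 ≤ S.L * S.s ^ 10 := by
    calc _ ≤ (S.L * S.s ^ 2) * S.s ^ 8 := mul_le_mul_of_nonneg_right h5 (pow_nonneg S.s_pos.le _)
      _ = _ := by ring
  have h7 : S.L ≤ S.L ^ 28 := le_self_pow₀ S.one_le_L (by norm_num)
  have h8 : 0 < S.s ^ 10 := pow_pos S.s_pos _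
  have h9 : 4 * S.L ^ 28 ≤ S.L ^ 30 := by
    have : S.L ^ 30 = S.L ^ 28 * (S.L * S.L) := by ring
    rw [this]
    have := S.hL
    have h10 : 0 < S.L ^ 28 := pow_pos S.L_pos _
    have h11 : 4 ≤ S.L * S.L := by nlinarith
    nlinarith
  nlinarith

lemma T_succ_le (j : ℕ) : S.v * S.s ^ 4 / 2 * S.T (j + 1) X ≤
    (S.x X ^ (2 * j + 1) * S.G X).trace +
      (S.L ^ 30 * S.s ^ 10) ^ (j + 1) / (S.v * S.s ^ 4 / 2) ^ (2 * j + 1) := by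
  have hc : 0 < S.v * S.s ^ 4 / 2 := by
    have := S.v_pos; have := S.s_pos; positivity
  set B1 := S.B X - S.x X * S.x X * S.x X with hB1
  have h1 := trace_odd_mul_le (S.x X) B1 (x_isSymm hX) _ hc j
  have e : S.G X = (S.v * S.s ^ 4) • S.x X + B1 + S.x X * S.x X * S.x X := by
    rw [hB1, G_eq_B hX, ← S.s_sq]
    rw [show (S.s ^ 2) ^ 2 = S.s ^ 4 by ring]; abel
  have e2 : (S.x X ^ (2 * j + 1) * S.G X).trace = S.v * S.s ^ 4 * S.T (j + 1) X +
      (S.x X ^ (2 * j + 1) * B1).trace + S.T (j + 2) X := by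
    rw [e, Matrix.mul_add, Matrix.mul_add, Matrix.trace_add, Matrix.trace_add, Matrix.mul_smul,
      Matrix.trace_smul, smul_eq_mul, ← pow_succ]
    unfold T
    rw [show S.x X * S.x X * S.x X = S.x X ^ 3 by rw [pow_succ, pow_two], ← pow_add]
    rw [show 2 * j + 1 + 1 = 2 * (j + 1) by ring, show 2 * j + 1 + 3 = 2 * (j + 2) by ring]
  have h2 := T_nonneg hX (j + 2)
  have h3 := neg_abs_le (S.x X ^ (2 * j + 1) * B1).trace
  have h4 : (∑ p, ∑ q, (B1 p q) ^ 2) ^ (j + 1) / (S.v * S.s ^ 4 / 2) ^ (2 * j + 1) ≤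
      (S.L ^ 30 * S.s ^ 10) ^ (j + 1) / (S.v * S.s ^ 4 / 2) ^ (2 * j + 1) :=
    div_le_div_of_nonneg_right (pow_le_pow_left₀ (Finset.sum_nonneg fun a _ =>
      Finset.sum_nonneg fun b _ => sq_nonneg _) (sum_sq_B_sub_le hX) _) (pow_pos hc _).le
  have h5 : S.T (j + 1) X = (S.x X ^ (2 * (j + 1))).trace := rfl
  rw [e2]
  rw [← h5] at h1
  linarith
end mem

lemma E_T_le (j : ℕ) (hj : j ≤ S.k) : S.E (S.T j) ≤ (S.L ^ 36 * S.s ^ 2) ^ j * S.s ^ 2 := by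
  induction j with
  | zero =>
    have : S.E (S.T 0) = n := by
      have : S.T 0 = fun _ => (n : ℝ) := by ext X; simp [T, Matrix.trace_one]
      rw [this, E_const]
    rw [this, S.s_sq]; simp
  | succ j ih =>
    have ih' := ih (by omega)
    have hs := S.s_pos
    have hv := S.v_pos
    have hL := S.hL
    have hL0 := S.L_pos
    have h1 : S.v * S.s ^ 4 / 2 * S.E (S.T (j + 1)) ≤ 8 * (j + 1) * (n : ℝ) ^ 3 * S.E (S.T j) +
        (S.L ^ 30 * S.s ^ 10) ^ (j + 1) / (S.v * S.s ^ 4 / 2) ^ (2 * j + 1) := by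
      rw [← E_mul_left]
      refine (E_mono fun X hX => T_succ_le hX j).trans ?_
      rw [E_add, E_const]
      linarith [S.E_trace_G_le j]
    have hT0 : 0 ≤ S.E (S.T j) := E_nonneg fun X hX => T_nonneg hX j
    have hj1 : 16 * ((j : ℝ) + 1) ≤ S.L := by
      have : ((j : ℝ) + 1) ≤ S.k := by exact_mod_cast hj
      linarith [S.hkL]
    set c := S.v * S.s ^ 4 / 2 with hc
    have hc0 : 0 < c := by positivity
    have hcinv : S.s ^ 4 ≤ 2 * S.L * c := by
      have := S.v_ge
      rw [div_le_iff₀ hL0] at this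
      rw [hc]
      have : 0 < S.s ^ 4 := by positivity
      nlinarith
    have h2 : 8 * ((j : ℝ) + 1) * (n : ℝ) ^ 3 * S.E (S.T j) ≤
        c * (S.L ^ 2 * S.s ^ 2 * S.E (S.T j)) := by
      rw [← S.s_sq]
      have : (S.s ^ 2) ^ 3 = S.s ^ 4 * S.s ^ 2 := by ring
      rw [this]
      calc 8 * ((j : ℝ) + 1) * (S.s ^ 4 * S.s ^ 2) * S.E (S.T j) ≤
          S.L / 2 * ((2 * S.L * c) * S.s ^ 2) * S.E (S.T j) := by
            gcongr; linarith
        _ = _ := by ring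
    have h3 : (S.L ^ 30 * S.s ^ 10) ^ (j + 1) / c ^ (2 * j + 1) ≤
        c * (S.L ^ 33 * S.s ^ 2) ^ (j + 1) := by
      rw [div_le_iff₀ (by positivity)]
      have : c * (S.L ^ 33 * S.s ^ 2) ^ (j + 1) * c ^ (2 * j + 1) =
          (S.L ^ 33 * S.s ^ 2 * c ^ 2) ^ (j + 1) := by
        rw [mul_pow _ (c ^ 2), ← pow_mul]; ring
      rw [this]
      refine pow_le_pow_left₀ (by positivity) ?_ _
      have i1 : S.s ^ 8 ≤ 4 * S.L ^ 2 * c ^ 2 := by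
        have := pow_le_pow_left₀ (by positivity) hcinv 2
        nlinarith
      calc S.L ^ 30 * S.s ^ 10 = S.L ^ 30 * S.s ^ 2 * S.s ^ 8 := by ring
        _ ≤ S.L ^ 30 * S.s ^ 2 * (4 * S.L ^ 2 * c ^ 2) := by gcongr
        _ ≤ S.L ^ 30 * S.s ^ 2 * (S.L * S.L ^ 2 * c ^ 2) := by gcongr; linarith
        _ = _ := by ring
    have h4 : S.E (S.T (j + 1)) ≤ S.L ^ 2 * S.s ^ 2 * S.E (S.T j) + (S.L ^ 33 * S.s ^ 2) ^ (j + 1) := by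
      have : c * S.E (S.T (j + 1)) ≤
          c * (S.L ^ 2 * S.s ^ 2 * S.E (S.T j) + (S.L ^ 33 * S.s ^ 2) ^ (j + 1)) := by linarith
      exact le_of_mul_le_mul_left this hc0
    have hs2 : 1 ≤ S.s ^ 2 := one_le_pow₀ S.one_le_s
    set Q := S.L ^ 36 * S.s ^ 2 with hQ
    have hQ0 : 0 < Q := by positivity
    have i1 : 2 * (S.L ^ 2 * S.s ^ 2) ≤ Q := by
      rw [hQ]
      have : 2 * S.L ^ 2 ≤ S.L ^ 36 := by
        calc 2 * S.L ^ 2 ≤ S.L * S.L ^ 2 := by gcongr; linarith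
          _ = S.L ^ 3 := by ring
          _ ≤ _ := pow_le_pow_right₀ S.one_le_L (by norm_num)
      nlinarith
    have i2 : 2 * (S.L ^ 33 * S.s ^ 2) ^ (j + 1) ≤ Q ^ (j + 1) := by
      have : 2 * (S.L ^ 33 * S.s ^ 2) ≤ Q := by
        rw [hQ]
        have : 2 * S.L ^ 33 ≤ S.L ^ 36 := by
          calc 2 * S.L ^ 33 ≤ S.L * S.L ^ 33 := by gcongr; linarith
          _ = S.L ^ 34 := by ring
          _ ≤ _ := pow_le_pow_right₀ S.one_le_L (by norm_num)
        nlinarith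
      calc 2 * (S.L ^ 33 * S.s ^ 2) ^ (j + 1) ≤ 2 ^ (j + 1) * (S.L ^ 33 * S.s ^ 2) ^ (j + 1) := by
            gcongr; exact le_self_pow₀ (by norm_num) (by omega)
        _ = (2 * (S.L ^ 33 * S.s ^ 2)) ^ (j + 1) := (mul_pow _ _ _).symm
        _ ≤ _ := pow_le_pow_left₀ (by positivity) this _
    have i3 : 2 * (S.L ^ 2 * S.s ^ 2) * S.E (S.T j) ≤ Q * (Q ^ j * S.s ^ 2) :=
      mul_le_mul i1 ih' hT0 hQ0.le
    have i4 : Q ^ (j + 1) ≤ Q ^ (j + 1) * S.s ^ 2 := le_mul_of_one_le_right (by positivity) hs2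
    have i5 : Q * (Q ^ j * S.s ^ 2) = Q ^ (j + 1) * S.s ^ 2 := by ring
    linarith

/-- normalised bound for the spectral radius -/
noncomputable def τ (X : Matrix (Fin n) (Fin n) ℝ) : ℝ :=
  max 1 ((S.T S.k X) ^ (1 / (2 * S.k : ℝ)) / S.s)

lemma one_le_τ (X : Matrix (Fin n) (Fin n) ℝ) : 1 ≤ S.τ X := le_max_left _ _
lemma τ_pos (X : Matrix (Fin n) (Fin n) ℝ) : 0 < S.τ X := lt_of_lt_of_le one_pos (S.one_le_τ X)

section mem
variable {S} {X : Matrix (Fin n) (Fin n) ℝ} (hX : X ∈ S.Ω)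
include hX

lemma T_rpow_pow : ((S.T S.k X) ^ (1 / (2 * S.k : ℝ))) ^ (2 * S.k) = S.T S.k X := by
  have hk : (S.k : ℝ) ≠ 0 := by have := S.hk; positivity
  rw [← Real.rpow_natCast, ← Real.rpow_mul (T_nonneg hX _)]
  push_cast
  rw [one_div_mul_cancel (by positivity), Real.rpow_one]

lemma T_le_τ : S.T S.k X ≤ (S.s * S.τ X) ^ (2 * S.k) := by
  have h1 := T_rpow_pow hX
  have h2 : (S.T S.k X) ^ (1 / (2 * S.k : ℝ)) ≤ S.s * S.τ X := by
    have := le_max_right 1 ((S.T S.k X) ^ (1 / (2 * S.k : ℝ)) / S.s)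
    rw [div_le_iff₀ S.s_pos] at this
    unfold τ; linarith
  calc _ = _ := h1.symm
    _ ≤ _ := pow_le_pow_left₀ (Real.rpow_nonneg (T_nonneg hX _) _) h2 _

lemma τ_pow_le : S.τ X ^ (2 * S.k) ≤ 1 + S.T S.k X / S.s ^ (2 * S.k) := by
  have h1 := T_rpow_pow hX
  have h0 : 0 ≤ S.T S.k X / S.s ^ (2 * S.k) := div_nonneg (T_nonneg hX _) (pow_nonneg S.s_pos.le _)
  unfold τ
  rcases max_choice 1 ((S.T S.k X) ^ (1 / (2 * S.k : ℝ)) / S.s) with h | h <;> rw [h]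
  · rw [one_pow]; linarith
  · rw [div_pow, h1]; linarith

lemma sum_sq_x_mul_le (w : Fin n → ℝ) :
    ∑ a, (∑ b, S.x X a b * w b) ^ 2 ≤ (S.s * S.τ X) ^ 2 * ∑ b, w b ^ 2 := by
  have hk := S.hk
  obtain ⟨j, hj⟩ : ∃ j, S.k = j + 1 := ⟨S.k - 1, by omega⟩
  refine sum_sq_mulVec_le _ (x_isSymm hX) _ (mul_nonneg S.s_pos.le (S.τ_pos X).le) j ?_ w
  rw [← hj]; exact T_le_τ hX
end mem

lemma E_τ_le : S.E (fun X => S.τ X ^ 12) ≤ S.L ^ 460 := by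
  have hs := S.s_pos
  have hL := S.hL
  have hL0 := S.L_pos
  have hL1 := S.one_le_L
  have hk := S.hk
  set M := S.L ^ 38 with hM
  have hM0 : 0 < M := by positivity
  have h1 : ∀ X ∈ S.Ω, S.τ X ^ 12 ≤ M ^ 12 + M ^ 12 / M ^ (2 * S.k) *
      (1 + S.T S.k X / S.s ^ (2 * S.k)) := by
    intro X hX
    have hT : 0 ≤ S.T S.k X / S.s ^ (2 * S.k) := div_nonneg (T_nonneg hX _) (pow_nonneg hs.le _)
    rcases le_total (S.τ X) M with h | h
    · have := pow_le_pow_left₀ (S.τ_pos X).le h 12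
      have : 0 ≤ M ^ 12 / M ^ (2 * S.k) * (1 + S.T S.k X / S.s ^ (2 * S.k)) := by positivity
      linarith
    · have i1 := τ_pow_le hX
      have i2 : S.τ X ^ 12 ≤ M ^ 12 / M ^ (2 * S.k) * S.τ X ^ (2 * S.k) := by
        obtain ⟨m, hm⟩ : ∃ m, 2 * S.k = 12 + m := ⟨2 * S.k - 12, by omega⟩
        rw [hm, pow_add, pow_add]
        have j1 : M ^ m ≤ S.τ X ^ m := pow_le_pow_left₀ hM0.le h m
        have j2 := S.τ_pos X
        rw [show M ^ 12 / (M ^ 12 * M ^ m) * (S.τ X ^ 12 * S.τ X ^ m) =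
          S.τ X ^ 12 * (S.τ X ^ m / M ^ m) by field_simp]
        refine le_mul_of_one_le_right (by positivity) ?_
        rw [one_le_div (by positivity)]; exact j1
      have i3 : M ^ 12 / M ^ (2 * S.k) * S.τ X ^ (2 * S.k) ≤
          M ^ 12 / M ^ (2 * S.k) * (1 + S.T S.k X / S.s ^ (2 * S.k)) :=
        mul_le_mul_of_nonneg_left i1 (by positivity)
      have : 0 ≤ M ^ 12 := by positivity
      linarith
  refine (E_mono h1).trans ?_
  simp only [mul_add, E_add, E_const, E_mul_left, div_eq_mul_inv (S.T S.k _), E_mul_right]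
  have h2 := S.E_T_le S.k le_rfl
  have h3 : S.E (fun X => S.T S.k X) * (S.s ^ (2 * S.k))⁻¹ ≤ S.L ^ (37 * S.k) := by
    rw [← div_eq_mul_inv, div_le_iff₀ (by positivity)]
    refine h2.trans ?_
    have : S.s ^ 2 ≤ S.L ^ S.k := by rw [S.s_sq]; exact S.hnL
    calc (S.L ^ 36 * S.s ^ 2) ^ S.k * S.s ^ 2 ≤ (S.L ^ 36 * S.s ^ 2) ^ S.k * S.L ^ S.k := by gcongr
      _ = _ := by rw [mul_pow, ← pow_mul, ← pow_mul, mul_comm 2, pow_mul S.L 37]; ring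
  have h4 : S.L ^ (37 * S.k) ≤ M ^ (2 * S.k) := by
    rw [hM, ← pow_mul]; exact pow_le_pow_right₀ hL1 (by nlinarith)
  have h5 : M ^ 12 / M ^ (2 * S.k) * (S.E (fun X => S.T S.k X) * (S.s ^ (2 * S.k))⁻¹) ≤ M ^ 12 := by
    rw [div_mul_eq_mul_div, div_le_iff₀ (by positivity)]
    gcongr; exact h3.trans h4
  have h6 : M ^ 12 / M ^ (2 * S.k) ≤ M ^ 12 :=
    div_le_self (by positivity) (one_le_pow₀ (one_le_pow₀ hL1))
  have h7 : M ^ 12 = S.L ^ 456 := by rw [hM, ← pow_mul]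
  have h8 : 3 * S.L ^ 456 ≤ S.L ^ 460 := by
    calc 3 * S.L ^ 456 ≤ S.L * S.L ^ 456 := by gcongr; linarith
      _ = S.L ^ 457 := by ring
      _ ≤ _ := pow_le_pow_right₀ hL1 (by norm_num)
  rw [← h7] at h8
  rw [mul_one]
  linarith

end Setup

namespace Setup
variable {n : ℕ} (S : Setup n)

/-- pointwise bound -/
def P0 (a : ℕ) (j : ℤ) (φ : Matrix (Fin n) (Fin n) ℝ → ℝ) : Prop := ∀ X ∈ S.Ω, S.Bd a j (φ X)
/-- mean bound -/
def N1 (a : ℕ) (j : ℤ) (φ : Matrix (Fin n) (Fin n) ℝ → ℝ) : Prop :=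
  S.E (fun X => |φ X|) ≤ S.L ^ a * S.s ^ j
/-- mean square bound -/
def N2 (a : ℕ) (j : ℤ) (φ : Matrix (Fin n) (Fin n) ℝ → ℝ) : Prop :=
  S.E (fun X => φ X ^ 2) ≤ (S.L ^ a * S.s ^ j) ^ 2

section N
variable {S} {a b : ℕ} {i j : ℤ} {φ ψ : Matrix (Fin n) (Fin n) ℝ → ℝ}

lemma N1.mono (h : S.N1 a i φ) (hab : a ≤ b) (hij : i ≤ j) : S.N1 b j φ :=
  le_trans (show _ ≤ _ from h) (scale_mono S hab hij)
lemma N2.mono (h : S.N2 a i φ) (hab : a ≤ b) (hij : i ≤ j) : S.N2 b j φ :=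
  le_trans (show _ ≤ _ from h) (pow_le_pow_left₀ (scale_pos S a i).le (scale_mono S hab hij) 2)
lemma N1.bd (h : S.N1 a j φ) : S.Bd a j (S.E φ) := abs_E_le.trans h
lemma P0.n1 (h : S.P0 a j φ) : S.N1 a j φ := by
  unfold N1
  refine (E_mono fun X hX => h X hX).trans (le_of_eq (E_const _ _))
lemma P0.n2 (h : S.P0 a j φ) : S.N2 a j φ := by
  unfold N2
  refine (E_mono (g := fun _ => (S.L ^ a * S.s ^ j) ^ 2) fun X hX => ?_).trans
    (le_of_eq (E_const _ _))
  rw [← sq_abs]; exact pow_le_pow_left₀ (abs_nonneg _) (h X hX) 2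
lemma N2.mul (h : S.N2 a i φ) (g : S.N2 b j ψ) : S.N1 (a + b) (i + j) (fun X => φ X * ψ X) := by
  unfold N1
  have h1 : (S.E (fun X => |φ X * ψ X|)) ^ 2 ≤ (S.L ^ (a + b) * S.s ^ (i + j)) ^ 2 := by
    rw [← scale_mul, mul_pow]
    simp only [abs_mul]
    refine E_mul_sq_le.trans ?_
    simp only [sq_abs]
    exact mul_le_mul h g (E_nonneg fun X _ => sq_nonneg _) (sq_nonneg _)
  exact le_of_sq_le_sq h1 (scale_pos S _ _).le
lemma N2.n1 (h : S.N2 a i φ) : S.N1 a i φ := by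
  have := h.mul (P0.n2 (S := S) (a := 0) (j := 0) (φ := fun _ => 1) fun X _ => bd_one (by simp))
  simpa using this
lemma N1.of_le (h : S.N1 a i ψ) (hle : ∀ X ∈ S.Ω, |φ X| ≤ |ψ X|) : S.N1 a i φ :=
  (E_mono hle).trans h
lemma N2.of_le (h : S.N2 a i ψ) (hle : ∀ X ∈ S.Ω, |φ X| ≤ |ψ X|) : S.N2 a i φ :=
  (E_mono fun X hX => by rw [← sq_abs, ← sq_abs (ψ X)]; exact pow_le_pow_left₀ (abs_nonneg _) (hle X hX) 2).trans h
lemma N1.mul_P0 (h : S.N1 a i φ) (g : S.P0 b j ψ) : S.N1 (a + b) (i + j) (fun X => φ X * ψ X) := by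
  unfold N1
  rw [← scale_mul]
  calc _ ≤ S.E (fun X => |φ X| * (S.L ^ b * S.s ^ j)) := E_mono fun X hX => by
        rw [abs_mul]; exact mul_le_mul_of_nonneg_left (g X hX) (abs_nonneg _)
    _ = _ := E_mul_right _ _ _
    _ ≤ _ := mul_le_mul_of_nonneg_right h (scale_pos S _ _).le
lemma N2.mul_P0 (h : S.N2 a i φ) (g : S.P0 b j ψ) : S.N2 (a + b) (i + j) (fun X => φ X * ψ X) := by
  unfold N2
  rw [← scale_mul, mul_pow]
  calc _ ≤ S.E (fun X => φ X ^ 2 * (S.L ^ b * S.s ^ j) ^ 2) := E_mono fun X hX => by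
        rw [mul_pow]; refine mul_le_mul_of_nonneg_left ?_ (sq_nonneg _)
        rw [← sq_abs]; exact pow_le_pow_left₀ (abs_nonneg _) (g X hX) 2
    _ = _ := E_mul_right _ _ _
    _ ≤ _ := mul_le_mul_of_nonneg_right h (sq_nonneg _)
lemma N1.add (h : S.N1 a j φ) (g : S.N1 b j ψ) : S.N1 (max a b + 1) j (fun X => φ X + ψ X) := by
  unfold N1
  refine (E_mono fun X _ => abs_add_le _ _).trans ?_
  rw [E_add]
  exact (add_le_add h g).trans (two_scale_le S a b j)
lemma N2.neg (h : S.N2 a j φ) : S.N2 a j (fun X => - φ X) := by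
  unfold N2 at *; simpa using h
lemma N2.add (h : S.N2 a j φ) (g : S.N2 b j ψ) : S.N2 (max a b + 1) j (fun X => φ X + ψ X) := by
  unfold N2
  have h1 : S.E (fun X => (φ X + ψ X) ^ 2) ≤
      2 * S.E (fun X => φ X ^ 2) + 2 * S.E (fun X => ψ X ^ 2) := by
    rw [← E_mul_left, ← E_mul_left, ← E_add]
    exact E_mono fun X _ => by nlinarith [sq_nonneg (φ X - ψ X)]
  have i1 := pow_le_pow_left₀ (scale_pos S _ _).le (scale_mono S (le_max_left a b) (le_refl j)) 2
  have i2 := pow_le_pow_left₀ (scale_pos S _ _).le (scale_mono S (le_max_right a b) (le_refl j)) 2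
  have e : (S.L ^ (max a b + 1) * S.s ^ j) ^ 2 = S.L ^ 2 * (S.L ^ (max a b) * S.s ^ j) ^ 2 := by
    rw [pow_succ]; ring
  have h4 : (4 : ℝ) ≤ S.L ^ 2 := by nlinarith [S.hL]
  have h5 := mul_le_mul_of_nonneg_right h4 (sq_nonneg (S.L ^ (max a b) * S.s ^ j))
  have h' := show S.E (fun X => φ X ^ 2) ≤ _ from h
  have g' := show S.E (fun X => ψ X ^ 2) ≤ _ from g
  rw [e]; linarith
lemma N2.sub (h : S.N2 a j φ) (g : S.N2 b j ψ) : S.N2 (max a b + 1) j (fun X => φ X - ψ X) := by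
  simpa only [sub_eq_add_neg] using h.add g.neg
lemma N1.sum {f : Fin n → Matrix (Fin n) (Fin n) ℝ → ℝ} (h : ∀ i, S.N1 a j (f i)) :
    S.N1 a (j + 2) (fun X => ∑ i, f i X) := by
  unfold N1
  refine (E_mono fun X _ => Finset.abs_sum_le_sum_abs _ _).trans ?_
  rw [E_sum]
  have h2 : ∀ i, S.Bd a j (S.E fun X => |f i X|) := fun i =>
    (by unfold Bd; rw [abs_of_nonneg (E_nonneg fun X _ => abs_nonneg _)]; exact h i)
  exact (le_abs_self _).trans (Bd.sum h2)
lemma N1.const_mul {c : ℝ} (h : S.N1 a i φ) (hc : S.Bd b j c) :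
    S.N1 (a + b) (i + j) (fun X => c * φ X) := by
  simpa only [mul_comm] using h.mul_P0 (ψ := fun _ => c) fun X _ => hc
lemma N2.const_mul {c : ℝ} (h : S.N2 a i φ) (hc : S.Bd b j c) :
    S.N2 (a + b) (i + j) (fun X => c * φ X) := by
  simpa only [mul_comm] using h.mul_P0 (ψ := fun _ => c) fun X _ => hc
lemma N2.of_τ (h : ∀ X ∈ S.Ω, |φ X| ≤ S.L ^ a * S.s ^ j * S.τ X ^ 6) : S.N2 (a + 230) j φ := by
  unfold N2
  calc _ ≤ S.E (fun X => (S.L ^ a * S.s ^ j) ^ 2 * S.τ X ^ 12) := E_mono fun X hX => by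
        rw [← sq_abs]
        calc |φ X| ^ 2 ≤ (S.L ^ a * S.s ^ j * S.τ X ^ 6) ^ 2 :=
              pow_le_pow_left₀ (abs_nonneg _) (h X hX) 2
          _ = _ := by ring
    _ = (S.L ^ a * S.s ^ j) ^ 2 * S.E (fun X => S.τ X ^ 12) := E_mul_left _ _ _
    _ ≤ (S.L ^ a * S.s ^ j) ^ 2 * S.L ^ 460 := mul_le_mul_of_nonneg_left S.E_τ_le (sq_nonneg _)
    _ = _ := by rw [pow_add]; ring
lemma N2.of_τ' {m : ℕ} (hm : m ≤ 6)
    (h : ∀ X ∈ S.Ω, |φ X| ≤ S.L ^ a * S.s ^ j * S.τ X ^ m) : S.N2 (a + 230) j φ :=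
  N2.of_τ fun X hX => (h X hX).trans (mul_le_mul_of_nonneg_left
    (pow_le_pow_right₀ (S.one_le_τ X) hm) (scale_pos S _ _).le)

lemma Bd.sum_except {f : Fin n → ℝ} (c : Fin n) (h : ∀ e, e ≠ c → S.Bd a j (f e))
    (hc : S.Bd b (j + 2) (f c)) : S.Bd (max a b + 1) (j + 2) (∑ e, f e) := by
  have h1 : S.Bd a (j + 2) (∑ e, if e = c then 0 else f e) := by
    refine Bd.sum fun e => ?_
    split_ifs with he
    · exact bd_zero a j
    · exact h e he
  have e1 : ∑ e, f e = (∑ e, if e = c then 0 else f e) + f c := by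
    have : f c = ∑ e, if e = c then f e else 0 := by simp
    rw [this, ← Finset.sum_add_distrib]
    exact Finset.sum_congr rfl fun e _ => by split_ifs <;> simp
  rw [e1]; exact h1.add hc
lemma Bd.sum_except2 {f : Fin n → ℝ} (c d : Fin n) (h : ∀ e, e ≠ c → e ≠ d → S.Bd a j (f e))
    (hc : S.Bd b (j + 2) (f c)) (hd : S.Bd b (j + 2) (f d)) :
    S.Bd (max a b + 2) (j + 2) (∑ e, f e) := by
  have h1 : S.Bd (max a b + 1) (j + 2) (∑ e, if e = d then 0 else f e) := by
    refine Bd.sum_except c (fun e he => ?_) ?_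
    · split_ifs with hed
      · exact bd_zero a j
      · exact h e he hed
    · split_ifs
      · exact bd_zero _ _
      · exact hc
  have e1 : ∑ e, f e = (∑ e, if e = d then 0 else f e) + f d := by
    have : f d = ∑ e, if e = d then f e else 0 := by simp
    rw [this, ← Finset.sum_add_distrib]
    exact Finset.sum_congr rfl fun e _ => by split_ifs <;> simp
  rw [e1]; exact (h1.add (hd.mono (le_max_right a b) le_rfl)).mono (by omega) le_rfl
lemma Bd.D_sum2 {f : Fin n → Fin n → ℝ} (p q : Fin n)
    (h : ∀ c e, ¬ (c = p ∧ e = q) → S.Bd a j (f c e)) (hc : S.Bd b (j + 2) (f p q)) :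
    S.Bd (max (a + 1) b + 1) (j + 2) (∑ c, ∑ e, S.D c e * f c e) := by
  have h0 : ∀ c e, S.Bd a j (if c = p ∧ e = q then 0 else f c e) := by
    intro c e; split_ifs with he
    · exact bd_zero a j
    · exact h c e he
  have h1 : S.Bd (a + 1) (j + 2) (∑ c, ∑ e, S.D c e * (if c = p ∧ e = q then 0 else f c e)) := by
    unfold Bd
    calc _ ≤ ∑ c, ∑ e, S.D c e * (S.L ^ a * S.s ^ j) := by
          refine (Finset.abs_sum_le_sum_abs _ _).trans (Finset.sum_le_sum fun c _ => ?_)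
          refine (Finset.abs_sum_le_sum_abs _ _).trans (Finset.sum_le_sum fun e _ => ?_)
          rw [abs_mul, abs_of_nonneg (D_nonneg c e)]
          exact mul_le_mul_of_nonneg_left (h0 c e) (D_nonneg c e)
      _ = S.tot * (S.L ^ a * S.s ^ j) := by simp only [← Finset.sum_mul]; rfl
      _ ≤ (S.L * S.s ^ (2:ℤ)) * (S.L ^ a * S.s ^ j) := by
          rw [s_zpow_two]; exact mul_le_mul_of_nonneg_right S.htot (scale_pos S _ _).le
      _ = _ := by rw [pow_succ, zpow_add₀ S.s_pos.ne']; ring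
  have e1 : ∑ c, ∑ e, S.D c e * f c e =
      (∑ c, ∑ e, S.D c e * (if c = p ∧ e = q then 0 else f c e)) + S.D p q * f p q := by
    have : S.D p q * f p q = ∑ c, ∑ e, if c = p ∧ e = q then S.D c e * f c e else 0 := by
      simp [ite_and]
    rw [this, ← Finset.sum_add_distrib]
    refine Finset.sum_congr rfl fun c _ => ?_
    rw [← Finset.sum_add_distrib]
    exact Finset.sum_congr rfl fun e _ => by split_ifs <;> simp
  rw [e1]
  exact h1.add (by simpa using (bd_D p q).mul hc)

lemma Bd.gain {R : Matrix (Fin n) (Fin n) ℝ → ℝ} (c : ℝ) (hc : 1 ≤ c)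
    (h : ∀ X ∈ S.Ω, S.W X (fun a b c d => φ (X + swD a b c d) - φ X) =
      -4 * c * (S.v * (n : ℝ) ^ 2) * φ X + R X) (hR : S.Bd a (j + 4) (S.E R)) :
    S.Bd (a + 1) j (S.E φ) := by
  have h0 := S.E_stationary φ
  rw [E_congr h, E_add, E_mul_left] at h0
  have hn : (n : ℝ) ^ 2 = S.s ^ (4:ℤ) := by
    rw [← s_sq]; norm_cast; ring
  have hs := zpow_pos S.s_pos 4
  have hL := S.L_pos
  have h1 : S.v * S.s ^ (4:ℤ) * |S.E φ| ≤ |S.E R| := by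
    have e : S.E R = 4 * c * (S.v * S.s ^ (4:ℤ)) * S.E φ := by rw [hn] at h0; linarith
    rw [e, abs_mul, abs_of_nonneg (by have := S.v_pos; positivity : (0:ℝ) ≤ 4 * c * (S.v * S.s ^ (4:ℤ)))]
    refine mul_le_mul_of_nonneg_right ?_ (abs_nonneg _)
    have : 0 < S.v * S.s ^ (4:ℤ) := mul_pos S.v_pos hs
    nlinarith
  have h2 : S.s ^ (4:ℤ) * |S.E φ| ≤ S.L * (S.v * S.s ^ (4:ℤ) * |S.E φ|) := by
    have := S.v_ge
    rw [div_le_iff₀ hL] at this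
    have h3 : 0 ≤ S.s ^ (4:ℤ) * |S.E φ| := mul_nonneg hs.le (abs_nonneg _)
    nlinarith
  unfold Bd at *
  have h4 : S.s ^ (4:ℤ) * |S.E φ| ≤ S.L * (S.L ^ a * S.s ^ (j + 4)) :=
    h2.trans (mul_le_mul_of_nonneg_left (h1.trans hR) hL.le)
  have e : S.L * (S.L ^ a * S.s ^ (j + 4)) = S.s ^ (4:ℤ) * (S.L ^ (a + 1) * S.s ^ j) := by
    rw [zpow_add₀ S.s_pos.ne', pow_succ]; ring
  rw [e] at h4
  exact le_of_mul_le_mul_left h4 hs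

lemma N2.gain {R : Matrix (Fin n) (Fin n) ℝ → ℝ} (c : ℝ) (hc : 1 ≤ c)
    (h : ∀ X ∈ S.Ω, S.W X (fun a b c d => φ (X + swD a b c d) - φ X) =
      -4 * c * (S.v * (n : ℝ) ^ 2) * φ X + R X) (hR : S.N2 a (j + 4) R)
    (hQ : ∀ X ∈ S.Ω, S.W X (fun a b c d => (φ (X + swD a b c d) - φ X) ^ 2) ≤
      (S.L ^ a * S.s ^ (j + 2)) ^ 2) :
    S.N2 (a + 2) j φ := by
  have h0 := S.E_stationary (fun X => φ X ^ 2)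
  have hn : (n : ℝ) ^ 2 = S.s ^ (4:ℤ) := by
    rw [← s_sq]; norm_cast; ring
  have hs := zpow_pos S.s_pos 4
  have hL := S.L_pos
  have hv := S.v_pos
  set m := S.v * S.s ^ (4:ℤ) with hm
  have hm0 : 0 < m := mul_pos hv hs
  have h1 : 0 ≤ S.E (fun X => -4 * m * φ X ^ 2 + (R X ^ 2 / m + (S.L ^ a * S.s ^ (j + 2)) ^ 2)) := by
    rw [← h0]
    refine E_mono fun X hX => ?_
    have e : S.W X (fun a b c d => φ (X + swD a b c d) ^ 2 - φ X ^ 2) =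
        2 * φ X * S.W X (fun a b c d => φ (X + swD a b c d) - φ X) +
        S.W X (fun a b c d => (φ (X + swD a b c d) - φ X) ^ 2) := by
      rw [← W_mul_left, ← W_add]; congr 1; ext a b c d; ring
    rw [e, h X hX, hn, ← hm]
    have i2 := hQ X hX
    have i3 : 2 * φ X * R X ≤ 4 * c * m * φ X ^ 2 + R X ^ 2 / m := by
      have : 2 * φ X * R X ≤ m * φ X ^ 2 + R X ^ 2 / m := by
        have e2 : m * φ X ^ 2 + R X ^ 2 / m - 2 * φ X * R X = (m * φ X - R X) ^ 2 / m := by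
          field_simp; ring
        have : 0 ≤ (m * φ X - R X) ^ 2 / m := by positivity
        linarith
      have i5 : 0 ≤ m * φ X ^ 2 := by positivity
      nlinarith
    have i5 : 0 ≤ m * φ X ^ 2 := by positivity
    nlinarith
  rw [E_add, E_add, E_mul_left, E_const] at h1
  simp only [div_eq_mul_inv] at h1
  rw [E_mul_right, ← div_eq_mul_inv] at h1
  have h2 : m * S.E (fun X => φ X ^ 2) ≤ S.E (fun X => R X ^ 2) / m + (S.L ^ a * S.s ^ (j + 2)) ^ 2 := by
    have : 0 ≤ m * S.E (fun X => φ X ^ 2) :=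
      mul_nonneg hm0.le (E_nonneg fun X _ => sq_nonneg _)
    linarith
  have hinv : S.s ^ (4:ℤ) ≤ S.L * m := by
    have := S.v_ge
    rw [div_le_iff₀ hL] at this
    rw [hm]; nlinarith
  set q := S.L ^ a * S.s ^ j with hq
  have hq0 : 0 < q := scale_pos S a j
  have e3 : (S.L ^ a * S.s ^ (j + 4)) ^ 2 = q ^ 2 * (S.s ^ (4:ℤ)) ^ 2 := by
    rw [zpow_add₀ S.s_pos.ne', hq]; ring
  have e4 : (S.L ^ a * S.s ^ (j + 2)) ^ 2 = q ^ 2 * S.s ^ (4:ℤ) := by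
    rw [zpow_add₀ S.s_pos.ne', hq, show (4:ℤ) = 2 + 2 by norm_num, zpow_add₀ S.s_pos.ne']; ring
  have h3 : S.E (fun X => R X ^ 2) ≤ q ^ 2 * (S.s ^ (4:ℤ)) ^ 2 := by rw [← e3]; exact hR
  rw [e4] at h2
  have h4 : S.E (fun X => R X ^ 2) / m ≤ q ^ 2 * (S.L ^ 2 * m) := by
    rw [div_le_iff₀ hm0]
    refine h3.trans ?_
    have : (S.s ^ (4:ℤ)) ^ 2 ≤ (S.L * m) ^ 2 := pow_le_pow_left₀ hs.le hinv 2
    calc q ^ 2 * (S.s ^ (4:ℤ)) ^ 2 ≤ q ^ 2 * (S.L * m) ^ 2 := by gcongr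
      _ = _ := by ring
  have h5 : q ^ 2 * S.s ^ (4:ℤ) ≤ q ^ 2 * (S.L * m) := by gcongr
  have h6 : m * S.E (fun X => φ X ^ 2) ≤ m * (q ^ 2 * (S.L ^ 2 + S.L)) := by linarith
  have h7 := le_of_mul_le_mul_left h6 hm0
  unfold N2
  refine h7.trans ?_
  have e5 : (S.L ^ (a + 2) * S.s ^ j) ^ 2 = q ^ 2 * S.L ^ 4 := by rw [hq, pow_add]; ring
  rw [e5]
  have hL1 := S.one_le_L
  gcongr
  have i1 : S.L ≤ S.L ^ 2 := le_self_pow₀ hL1 (by norm_num)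
  have i2 : 2 * S.L ^ 2 ≤ S.L ^ 4 := by
    have : S.L ^ 4 = S.L ^ 2 * S.L ^ 2 := by ring
    rw [this]
    have : 2 ≤ S.L ^ 2 := by nlinarith [S.hL]
    gcongr
  linarith
end N

/-- Euclidean norm -/
noncomputable def nv (w : Fin n → ℝ) : ℝ := Real.sqrt (∑ i, w i ^ 2)

section nv
variable {u w : Fin n → ℝ}
lemma nv_nonneg (w : Fin n → ℝ) : 0 ≤ nv w := Real.sqrt_nonneg _
lemma nv_sq (w : Fin n → ℝ) : nv w ^ 2 = ∑ i, w i ^ 2 :=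
  Real.sq_sqrt (Finset.sum_nonneg fun _ _ => sq_nonneg _)
lemma nv_le {c : ℝ} (hc : 0 ≤ c) (h : ∑ i, w i ^ 2 ≤ c ^ 2) : nv w ≤ c :=
  (Real.sqrt_le_left hc).2 h
lemma abs_sum_mul_le_nv (u w : Fin n → ℝ) : |∑ i, u i * w i| ≤ nv u * nv w := by
  refine abs_le_of_sq_le_sq ?_ (mul_nonneg (nv_nonneg _) (nv_nonneg _))
  rw [mul_pow, nv_sq, nv_sq]; exact Finset.sum_mul_sq_le_sq_mul_sq _ _ _
lemma nv_add_le (u w : Fin n → ℝ) : nv (fun i => u i + w i) ≤ nv u + nv w := by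
  refine nv_le (add_nonneg (nv_nonneg _) (nv_nonneg _)) ?_
  have h := (le_abs_self _).trans (abs_sum_mul_le_nv u w)
  have h1 := nv_sq u
  have h2 := nv_sq w
  have e : ∑ i, (u i + w i) ^ 2 = ∑ i, u i ^ 2 + 2 * ∑ i, u i * w i + ∑ i, w i ^ 2 := by
    rw [Finset.mul_sum, ← Finset.sum_add_distrib, ← Finset.sum_add_distrib]
    exact Finset.sum_congr rfl fun i _ => by ring
  rw [e]; nlinarith
lemma nv_mono (h : ∀ i, |u i| ≤ |w i|) : nv u ≤ nv w :=
  Real.sqrt_le_sqrt (Finset.sum_le_sum fun i _ => sq_le_sq.2 (h i))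
lemma nv_const_le {C : ℝ} (hC : 0 ≤ C) (h : ∀ i, |w i| ≤ C) : nv w ≤ C * S.s := by
  refine nv_le (mul_nonneg hC S.s_pos.le) ?_
  rw [mul_pow, S.s_sq]
  calc ∑ i, w i ^ 2 ≤ ∑ _i : Fin n, C ^ 2 := Finset.sum_le_sum fun i _ => by
        rw [← sq_abs]; exact pow_le_pow_left₀ (abs_nonneg _) (h i) 2
    _ = _ := by simp; ring
lemma nv_bd {S : Setup n} {a : ℕ} {j : ℤ} (h : ∀ i, S.Bd a j (w i)) : nv w ≤ S.L ^ a * S.s ^ (j + 1) := by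
  refine (S.nv_const_le (scale_pos S a j).le h).trans (le_of_eq ?_)
  rw [zpow_add_one₀ S.s_pos.ne']; ring
lemma abs_sum_abs_le_nv (w : Fin n → ℝ) : ∑ i, |w i| ≤ S.s * nv w := by
  have h := (le_abs_self _).trans (abs_sum_mul_le_nv (fun _ => (1:ℝ)) (fun i => |w i|))
  have h1 : nv (fun i => |w i|) = nv w := by unfold nv; simp
  have h2 : nv (fun _ : Fin n => (1:ℝ)) = S.s := by unfold nv s; simp
  rw [h1, h2] at h; simpa using h

lemma nv_row_mul_D (M : Matrix (Fin n) (Fin n) ℝ) (a : Fin n) :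
    nv (fun b => (M * S.D) a b) ≤ S.L * S.s * nv (fun b => M a b) := by
  have hLs : 0 ≤ S.L * S.s := mul_nonneg S.L_pos.le S.s_pos.le
  refine nv_le (mul_nonneg hLs (nv_nonneg _)) ?_
  rw [mul_pow, nv_sq]
  have h1 : ∀ b, ((M * S.D) a b) ^ 2 ≤ S.Dg b * ∑ c, S.D c b * M a c ^ 2 := by
    intro b
    rw [Matrix.mul_apply]
    have h2 := Finset.sum_mul_sq_le_sq_mul_sq Finset.univ (fun c => S.D c b) (fun c => S.D c b * M a c)
    have e1 : ∀ c, S.D c b * (S.D c b * M a c) = M a c * S.D c b := by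
      intro c; rcases S.hD c b with h | h <;> simp [h]
    have e2 : ∀ c, S.D c b ^ 2 = S.D c b := by
      intro c; rcases S.hD c b with h | h <;> simp [h]
    simp only [e1, mul_pow, e2] at h2
    rwa [D_col] at h2
  calc _ ≤ ∑ b, S.L * S.s * ∑ c, S.D c b * M a c ^ 2 := Finset.sum_le_sum fun b _ =>
        (h1 b).trans (mul_le_mul_of_nonneg_right (Dg_le b) (Finset.sum_nonneg fun c _ =>
          mul_nonneg (D_nonneg c b) (sq_nonneg _)))
    _ = S.L * S.s * ∑ c, S.Dg c * M a c ^ 2 := by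
        rw [← Finset.mul_sum, Finset.sum_comm]; simp only [← Finset.sum_mul]; rfl
    _ ≤ S.L * S.s * ∑ c, S.L * S.s * M a c ^ 2 := by
        refine mul_le_mul_of_nonneg_left (Finset.sum_le_sum fun c _ => ?_) hLs
        exact mul_le_mul_of_nonneg_right (Dg_le c) (sq_nonneg _)
    _ = _ := by rw [← Finset.mul_sum]; ring

lemma nv_η_le : nv S.η ≤ S.L * S.s ^ 2 := by
  refine (nv_bd (S := S) bd_η).trans (le_of_eq ?_)
  norm_cast; ring
lemma nv_D_le_s (a : Fin n) : nv (fun b => S.D a b) ≤ S.s := by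
  have := S.nv_const_le (w := fun b => S.D a b) zero_le_one (fun b => by
    rw [abs_of_nonneg (D_nonneg a b)]; exact D_le a b)
  simpa using this

section mem
variable {S} {X : Matrix (Fin n) (Fin n) ℝ} (hX : X ∈ S.Ω)
include hX
lemma nv_x_mul (w : Fin n → ℝ) : nv (fun a => ∑ b, S.x X a b * w b) ≤ S.s * S.τ X * nv w := by
  have h0 : 0 ≤ S.s * S.τ X := mul_nonneg S.s_pos.le (S.τ_pos X).le
  refine nv_le (mul_nonneg h0 (nv_nonneg _)) ?_
  rw [mul_pow, nv_sq]; exact sum_sq_x_mul_le hX w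
lemma nv_row_mul_x (M : Matrix (Fin n) (Fin n) ℝ) (a : Fin n) :
    nv (fun b => (M * S.x X) a b) ≤ S.s * S.τ X * nv (fun b => M a b) := by
  have := nv_x_mul hX (fun c => M a c)
  convert this using 3 with b
  rw [Matrix.mul_apply]
  exact Finset.sum_congr rfl fun c _ => by rw [x_symm hX, mul_comm]
lemma nv_row_x (a : Fin n) : nv (fun b => S.x X a b) ≤ S.s := by
  have := S.nv_const_le (w := fun b => S.x X a b) zero_le_one (fun b => x_abs_le hX a b)
  simpa using this
lemma nv_row_xx (a : Fin n) : nv (fun b => (S.x X * S.x X) a b) ≤ S.s ^ 2 * S.τ X := by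
  refine (nv_row_mul_x hX _ a).trans ?_
  have := mul_le_mul_of_nonneg_left (nv_row_x hX a) (mul_nonneg S.s_pos.le (S.τ_pos X).le)
  nlinarith
lemma nv_row_xxx (a : Fin n) : nv (fun b => (S.x X * S.x X * S.x X) a b) ≤ S.s ^ 3 * S.τ X ^ 2 := by
  refine (nv_row_mul_x hX _ a).trans ?_
  have := mul_le_mul_of_nonneg_left (nv_row_xx hX a) (mul_nonneg S.s_pos.le (S.τ_pos X).le)
  nlinarith
lemma nv_p : nv (S.p X) ≤ S.L * S.s ^ 3 * S.τ X := by
  refine (nv_x_mul hX S.η).trans ?_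
  have := mul_le_mul_of_nonneg_left S.nv_η_le (mul_nonneg S.s_pos.le (S.τ_pos X).le)
  nlinarith
end mem
end nv

end Setup

namespace Setup
variable {n : ℕ} (S : Setup n)

section row
variable {S} {X : Matrix (Fin n) (Fin n) ℝ} (hX : X ∈ S.Ω)
include hX

lemma abs_r_le (a b : Fin n) : |S.r X a b| ≤
    (|S.κ a b| + |S.θ a b| + |(S.D * S.x X * S.D) a b| + |(S.x X * S.D * S.x X) a b| + |S.ρV X a b|)
    + (|S.p X a| + |S.p X b| + |(S.x X * S.x X * S.D) a b| + |(S.D * S.x X * S.x X) a b|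
      + |(S.x X * S.x X * S.x X) a b|) := by
  have hx := x_abs_le hX a b
  have hK : |S.K a b| ≤ 1 := by rw [abs_of_nonneg (K_nonneg a b)]; exact K_le a b
  have hul : |S.u - S.l| ≤ 1 := by simpa [Bd] using (bd_u_sub_l (S := S))
  have g : ∀ {c y : ℝ}, |c| ≤ 1 → |c * y| ≤ |y| := fun {c y} h => by
    rw [abs_mul]; exact mul_le_of_le_one_left (abs_nonneg _) h
  have hU : |S.ρU X a b| ≤ |(S.D * S.x X * S.D) a b| + |S.p X a| + |S.p X b|
      + |(S.x X * S.x X * S.D) a b| + |(S.D * S.x X * S.x X) a b| + |(S.x X * S.D * S.x X) a b| := by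
    unfold ρU
    rw [Matrix.mul_assoc S.D (S.x X) (S.x X)]
    refine (abs_sub _ _).trans (add_le_add ?_ le_rfl)
    refine (abs_add_le _ _).trans (add_le_add ?_ le_rfl)
    refine (abs_add_le _ _).trans (add_le_add ?_ le_rfl)
    refine (abs_sub _ _).trans (add_le_add ?_ le_rfl)
    refine (abs_sub _ _).trans (add_le_add (g hul) le_rfl)
  have h1 : |S.κ a b * S.x X a b| ≤ |S.κ a b| := by rw [mul_comm]; exact g hx
  have h2 := g (y := S.θ a b) hK
  have h3 := g (y := S.ρU X a b) hx
  have h4 := g (y := S.ρV X a b + (S.x X * S.x X * S.x X) a b) hK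
  have h5 := abs_add_le (S.ρV X a b) ((S.x X * S.x X * S.x X) a b)
  unfold r
  have i1 := abs_add_le (S.κ a b * S.x X a b + S.K a b * S.θ a b + S.x X a b * S.ρU X a b)
    (S.K a b * (S.ρV X a b + (S.x X * S.x X * S.x X) a b))
  have i2 := abs_add_le (S.κ a b * S.x X a b + S.K a b * S.θ a b) (S.x X a b * S.ρU X a b)
  have i3 := abs_add_le (S.κ a b * S.x X a b) (S.K a b * S.θ a b)
  linarith

lemma nv_row_Dxx (a : Fin n) : nv (fun b => (S.D * S.x X * S.x X) a b) ≤ S.s ^ 3 * S.τ X ^ 2 := by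
  have hs := S.s_pos; have ht := S.τ_pos X
  refine (nv_row_mul_x hX _ a).trans ?_
  have h1 := (nv_row_mul_x hX S.D a).trans
    (mul_le_mul_of_nonneg_left (S.nv_D_le_s a) (mul_pos hs ht).le)
  have := mul_le_mul_of_nonneg_left h1 (mul_pos hs ht).le
  nlinarith

lemma nv_row_xxD (a : Fin n) : nv (fun b => (S.x X * S.x X * S.D) a b) ≤ S.L * S.s ^ 3 * S.τ X := by
  refine (S.nv_row_mul_D _ a).trans ?_
  have := mul_le_mul_of_nonneg_left (nv_row_xx hX a) (mul_nonneg S.L_pos.le S.s_pos.le)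
  nlinarith

lemma nv_abs (w : Fin n → ℝ) : nv (fun i => |w i|) = nv w := by unfold nv; simp

lemma nv_r_le (a : Fin n) : nv (fun b => S.r X a b) ≤ S.L ^ 15 * S.s ^ 3 * S.τ X ^ 2 + S.s * |S.p X a| := by
  have hs := S.s_pos; have ht := S.one_le_τ X; have hL := S.hL
  set w1 : Fin n → ℝ := fun b => |S.κ a b| + |S.θ a b| + |(S.D * S.x X * S.D) a b|
    + |(S.x X * S.D * S.x X) a b| + |S.ρV X a b| with hw1
  have b1 : ∀ b, S.Bd 12 2 (w1 b) := fun b => by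
    have := (((((bd_κ (S := S) a b).abs.add (bd_θ a b).abs).add (bd_DxD hX a b).abs).add
      ((bd_xDx hX a b).abs)).add (bd_ρV hX a b).abs)
    exact this.mono (by decide) (by norm_num)
  have n1 : nv w1 ≤ S.L ^ 12 * S.s ^ 3 := by
    have := nv_bd (S := S) b1
    norm_num at this
    exact_mod_cast this
  have n2 : nv (fun _ : Fin n => |S.p X a|) ≤ |S.p X a| * S.s :=
    S.nv_const_le (abs_nonneg _) fun _ => by rw [abs_abs]
  have n3 : nv (fun b => |S.p X b|) ≤ S.L * S.s ^ 3 * S.τ X := (nv_abs hX _).trans_le (nv_p hX)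
  have n4 := (nv_abs hX _).trans_le (nv_row_xxD hX a)
  have n5 := (nv_abs hX _).trans_le (nv_row_Dxx hX a)
  have n6 := (nv_abs hX _).trans_le (nv_row_xxx hX a)
  set w2 : Fin n → ℝ := fun b => |S.p X a| + |S.p X b| with hw2
  set w3 : Fin n → ℝ := fun b => w2 b + |(S.x X * S.x X * S.D) a b| with hw3
  set w4 : Fin n → ℝ := fun b => w3 b + |(S.D * S.x X * S.x X) a b| with hw4
  set w5 : Fin n → ℝ := fun b => w4 b + |(S.x X * S.x X * S.x X) a b| with hw5
  have m2 : nv w2 ≤ _ := nv_add_le (fun _ => |S.p X a|) (fun b => |S.p X b|)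
  have m3 : nv w3 ≤ _ := nv_add_le w2 (fun b => |(S.x X * S.x X * S.D) a b|)
  have m4 : nv w4 ≤ _ := nv_add_le w3 (fun b => |(S.D * S.x X * S.x X) a b|)
  have m5 : nv w5 ≤ _ := nv_add_le w4 (fun b => |(S.x X * S.x X * S.x X) a b|)
  have m6 := nv_add_le w1 w5
  have m7 : nv (fun b => S.r X a b) ≤ nv (fun b => w1 b + w5 b) := nv_mono fun b => by
    have h := abs_r_le hX a b
    exact h.trans (le_abs_self _)
  have hs3 : 0 < S.s ^ 3 := pow_pos hs 3
  have t1 : S.s ^ 3 ≤ S.s ^ 3 * S.τ X ^ 2 := le_mul_of_one_le_right hs3.le (one_le_pow₀ ht)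
  have t2 : S.s ^ 3 * S.τ X ≤ S.s ^ 3 * S.τ X ^ 2 :=
    mul_le_mul_of_nonneg_left (le_self_pow₀ ht (by norm_num)) hs3.le
  set Q := S.s ^ 3 * S.τ X ^ 2 with hQ
  have hQ0 : 0 < Q := by positivity
  have hL12 : S.L ≤ S.L ^ 12 := le_self_pow₀ S.one_le_L (by norm_num)
  have k1 : S.L ^ 12 * S.s ^ 3 ≤ S.L ^ 12 * Q := mul_le_mul_of_nonneg_left t1 (by positivity)
  have k2 : S.L * S.s ^ 3 * S.τ X ≤ S.L ^ 12 * Q := by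
    rw [mul_assoc]; exact mul_le_mul hL12 t2 (by positivity) (by positivity)
  have k3 : Q ≤ S.L ^ 12 * Q := le_mul_of_one_le_left hQ0.le (one_le_pow₀ S.one_le_L)
  have k4 : 5 * (S.L ^ 12 * Q) ≤ S.L ^ 15 * Q := by
    have e : S.L ^ 15 * Q = S.L ^ 3 * (S.L ^ 12 * Q) := by ring
    rw [e]
    refine mul_le_mul_of_nonneg_right ?_ (by positivity)
    have : S.L ≤ S.L ^ 3 := le_self_pow₀ S.one_le_L (by norm_num)
    linarith
  have e : S.L ^ 15 * S.s ^ 3 * S.τ X ^ 2 = S.L ^ 15 * Q := by rw [hQ]; ring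
  rw [e]
  linarith

lemma abs_le_nv (w : Fin n → ℝ) (i : Fin n) : |w i| ≤ nv w := by
  refine abs_le_of_sq_le_sq ?_ (nv_nonneg _)
  rw [nv_sq]
  exact Finset.single_le_sum (f := fun i => w i ^ 2) (fun i _ => sq_nonneg _) (Finset.mem_univ i)

lemma nv_r_le_trivial (a : Fin n) : nv (fun b => S.r X a b) ≤ S.L ^ 16 * S.s ^ 4 * S.τ X ^ 2 := by
  refine (nv_r_le hX a).trans ?_
  have hs := S.one_le_s; have ht := S.one_le_τ X; have hL := S.hL
  have hp : |S.p X a| ≤ S.L * S.s ^ 3 := by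
    have := bd_p hX a; unfold Bd at this; norm_num at this; exact_mod_cast this
  have hs3 : 0 < S.s ^ 3 := by positivity
  have hL15 : 0 < S.L ^ 15 := by positivity
  have h1 : S.L ^ 15 * S.s ^ 3 * S.τ X ^ 2 ≤ S.L ^ 15 * S.s ^ 4 * S.τ X ^ 2 := by
    gcongr; norm_num
  have h2 : S.s * |S.p X a| ≤ S.L ^ 15 * S.s ^ 4 * S.τ X ^ 2 := by
    calc S.s * |S.p X a| ≤ S.s * (S.L * S.s ^ 3) := by gcongr
      _ = S.L * S.s ^ 4 * 1 := by ring
      _ ≤ S.L ^ 15 * S.s ^ 4 * S.τ X ^ 2 := by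
        gcongr
        · exact le_self_pow₀ S.one_le_L (by norm_num)
        · exact one_le_pow₀ ht
  have h3 : 0 < S.L ^ 15 * S.s ^ 4 * S.τ X ^ 2 := by positivity
  have e : S.L ^ 16 * S.s ^ 4 * S.τ X ^ 2 = S.L * (S.L ^ 15 * S.s ^ 4 * S.τ X ^ 2) := by ring
  rw [e]; nlinarith

lemma W_delta_mul_const (p q : Fin n) (y : ℝ) :
    S.W X (fun a b c d => swD a b c d p q * y) = -4 * (S.v * (n:ℝ)^2 * S.x X p q + S.B X p q) * y := by
  rw [W_mul_right, W_swD hX, G_eq_B hX]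
  simp only [Matrix.add_apply, Matrix.smul_apply, smul_eq_mul]

end row

lemma n2_p (a : Fin n) : S.N2 250 2 (fun X => S.p X a) := by
  refine N2.gain (a := 248) (R := fun X => 4 * (S.v * n * ∑ b, S.z X a b * S.η b) - 4 * ∑ b, S.r X a b * S.η b)
    1 le_rfl ?_ ?_ ?_
  · intro X hX
    have e : (fun e f g h => S.p (X + swD e f g h) a - S.p X a) =
        fun e f g h => ∑ b, swD e f g h a b * S.η b := by
      ext e f g h
      simp only [p, x_add, Matrix.add_apply, add_mul, Finset.sum_add_distrib]; ring
    rw [e, W_sum]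
    simp only [W_delta_mul_const hX, B_apply hX]
    simp only [p, Finset.mul_sum]
    rw [← Finset.sum_sub_distrib, ← Finset.sum_add_distrib]
    exact Finset.sum_congr rfl fun b _ => by ring
  · refine (N2.of_τ' (a := 18) (m := 2) (by norm_num) fun X hX => ?_)
    have h1 : S.Bd 5 6 (4 * (S.v * n * ∑ b, S.z X a b * S.η b)) := by
      have := ((bd_thousand (S := S) (y := 4) (by norm_num)).mul (((bd_v (S := S)).mul bd_n).mul
        (Bd.sum fun b => (bd_z hX a b).mul (bd_η b))))
      exact this.mono (by decide) (by norm_num)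
    have h2 : |∑ b, S.r X a b * S.η b| ≤ S.L ^ 17 * S.s ^ 6 * S.τ X ^ 2 := by
      refine (abs_sum_mul_le_nv _ _).trans ?_
      refine (mul_le_mul (nv_r_le_trivial hX a) S.nv_η_le (nv_nonneg _) ?_).trans (le_of_eq (by ring))
      have := S.s_pos; have := S.L_pos; have := S.τ_pos X; positivity
    have ht := S.one_le_τ X
    have h3 : |4 * (S.v * n * ∑ b, S.z X a b * S.η b)| ≤ S.L ^ 17 * S.s ^ 6 * S.τ X ^ 2 := by
      have h := (h1.mono (show 5 ≤ 17 by decide) le_rfl)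
      unfold Bd at h
      refine h.trans ?_
      have e : S.s ^ (6:ℤ) = S.s ^ 6 := by norm_cast
      rw [e]
      exact le_mul_of_one_le_right (by have := S.s_pos; have := S.L_pos; positivity) (one_le_pow₀ ht)
    refine (abs_sub _ _).trans ?_
    rw [abs_mul (4:ℝ) (∑ b, S.r X a b * S.η b)]
    have h4 : 0 ≤ S.L ^ 17 * S.s ^ 6 * S.τ X ^ 2 := (abs_nonneg _).trans h3
    have e : S.L ^ 18 * S.s ^ ((2:ℤ) + 4) * S.τ X ^ 2 = S.L * (S.L ^ 17 * S.s ^ 6 * S.τ X ^ 2) := by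
      norm_num
      ring
    rw [e, abs_of_pos (by norm_num : (0:ℝ) < 4)]
    nlinarith [S.hL]
  · intro X hX
    refine (le_abs_self _).trans ((abs_W_hit_le hX (C := 64 * (S.L * S.s) ^ 2) (p := a) ?_).trans ?_)
    · intro e f g h
      have e1 : S.p (X + swD e f g h) a - S.p X a = ∑ b, swD e f g h a b * S.η b := by
        simp only [p, x_add, Matrix.add_apply, add_mul, Finset.sum_add_distrib]; ring
      have h1 : |S.p (X + swD e f g h) a - S.p X a| ≤ 4 * hit e f g h a * (S.L * S.s) := by
        rw [e1]
        refine (Finset.abs_sum_le_sum_abs _ _).trans ?_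
        refine le_trans ?_ (mul_le_mul_of_nonneg_right
          (sum_abs_swD_le e f g h a) (mul_nonneg S.L_pos.le S.s_pos.le))
        rw [Finset.sum_mul]
        refine Finset.sum_le_sum fun b _ => ?_
        rw [abs_mul]
        refine mul_le_mul_of_nonneg_left ?_ (abs_nonneg _)
        have := bd_η (S := S) b; unfold Bd at this; simpa using this
      rw [abs_pow]
      have hh := hit_nonneg e f g h a
      have hh4 := hit_le e f g h a
      calc _ ≤ (4 * hit e f g h a * (S.L * S.s)) ^ 2 := pow_le_pow_left₀ (abs_nonneg _) h1 2
        _ = 16 * (S.L * S.s) ^ 2 * (hit e f g h a * hit e f g h a) := by ring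
        _ ≤ 16 * (S.L * S.s) ^ 2 * (4 * hit e f g h a) := by gcongr
        _ = _ := by ring
    · have e : (S.L ^ 248 * S.s ^ ((2:ℤ) + 2)) ^ 2 = S.L ^ 494 * ((S.L * S.s) ^ 2 * (n:ℝ) ^ 3) := by
        rw [← S.s_sq]
        norm_num
        ring
      rw [e]
      have h2 : (1000:ℝ) ≤ S.L ^ 494 := S.hL.trans (le_self_pow₀ S.one_le_L (by norm_num))
      have h3 : 0 ≤ (S.L * S.s) ^ 2 * (n:ℝ) ^ 3 := by positivity
      nlinarith

lemma n2_nv_r (a : Fin n) : S.N2 253 3 (fun X => nv (fun b => S.r X a b)) := by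
  have h1 : S.N2 245 3 (fun X => S.L ^ 15 * S.s ^ 3 * S.τ X ^ 2) :=
    N2.of_τ' (a := 15) (m := 2) (by norm_num) fun X hX => by
      rw [abs_of_nonneg (by have := S.s_pos; have := S.L_pos; positivity)]
      norm_cast
  have h2 : S.N2 250 3 (fun X => S.s * S.p X a) :=
    ((S.n2_p a).const_mul (b := 0) (j := 1) (by unfold Bd; simp [abs_of_pos S.s_pos])).mono (by norm_num) (by norm_num)
  have h3 : S.N2 250 3 (fun X => S.s * |S.p X a|) := h2.of_le fun X _ => by rw [abs_mul, abs_mul, abs_abs]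
  refine ((h1.add h3).of_le fun X hX => ?_).mono (by norm_num) le_rfl
  rw [abs_of_nonneg (nv_nonneg _)]
  exact (nv_r_le hX a).trans (le_abs_self _)

lemma n2_r (a b : Fin n) : S.N2 253 3 (fun X => S.r X a b) :=
  (S.n2_nv_r a).of_le fun X hX => (abs_le_nv hX (fun b => S.r X a b) b).trans (le_abs_self _)

/-- distinct unordered pairs -/
def dist2 (a b c d : Fin n) : Prop := ¬ (a = c ∧ b = d) ∧ ¬ (a = d ∧ b = c)

section dd
variable {S} {X : Matrix (Fin n) (Fin n) ℝ} (hX : X ∈ S.Ω)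
include hX
lemma abs_W_two_le {p q p' q' : Fin n} (h1 : p ≠ q) (h2 : p' ≠ q') (h : dist2 p q p' q')
    {f : Fin n → Fin n → Fin n → Fin n → ℝ} {C : ℝ} (hC : 0 ≤ C)
    (hf : ∀ a b c d, |f a b c d| ≤ C * (|swD a b c d p q| * |swD a b c d p' q'|)) :
    |S.W X f| ≤ C * (96 * (n:ℝ)) := by
  have key : ∀ a b c d, |f a b c d| ≤ C * (hit a b c d p * hit a b c d q * (hit a b c d p' * hit a b c d q')) := by
    intro a b c d
    refine (hf a b c d).trans (mul_le_mul_of_nonneg_left ?_ hC)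
    exact mul_le_mul (abs_swD_le ..) (abs_swD_le ..) (abs_nonneg _)
      (mul_nonneg (hit_nonneg ..) (hit_nonneg ..))
  obtain ⟨g1, g2⟩ := h
  by_cases hp' : p' = p ∨ p' = q
  · have h3 : q' ≠ p ∧ q' ≠ q := by
      constructor <;> rintro rfl <;> rcases hp' with rfl | rfl <;> simp_all
    refine (abs_W_hit3_le hX (C := C * 4) (by positivity) h1 h3.1.symm h3.2.symm fun a b c d => ?_).trans
      (le_of_eq (by ring))
    refine (key a b c d).trans ?_
    have i1 := hit_nonneg a b c d p; have i2 := hit_nonneg a b c d q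
    have i3 := hit_nonneg a b c d q'; have i4 := hit_le a b c d p'
    calc _ = C * (hit a b c d p * hit a b c d q * hit a b c d q') * hit a b c d p' := by ring
      _ ≤ C * (hit a b c d p * hit a b c d q * hit a b c d q') * 4 := by gcongr
      _ = _ := by ring
  · push Not at hp'
    refine (abs_W_hit3_le hX (C := C * 4) (by positivity) h1 hp'.1.symm hp'.2.symm fun a b c d => ?_).trans
      (le_of_eq (by ring))
    refine (key a b c d).trans ?_
    have i1 := hit_nonneg a b c d p; have i2 := hit_nonneg a b c d q
    have i3 := hit_nonneg a b c d p'; have i4 := hit_le a b c d q'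
    calc _ = C * (hit a b c d p * hit a b c d q * hit a b c d p') * hit a b c d q' := by ring
      _ ≤ C * (hit a b c d p * hit a b c d q * hit a b c d p') * 4 := by gcongr
      _ = _ := by ring
lemma abs_swD_le_16 (a b c d p q : Fin n) : |swD a b c d p q| ≤ 16 := by
  have := mul_le_mul (hit_le a b c d p) (hit_le a b c d q) (hit_nonneg ..) (by norm_num)
  linarith [abs_swD_le a b c d p q]
end dd

lemma n1_B (a b : Fin n) : S.N1 255 3 (fun X => S.B X a b) := by
  have h1 : S.N1 3 3 (fun X => - (S.v * n * S.z X a b)) :=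
    (P0.n1 (fun X hX => ((((bd_v (S := S)).mul bd_n).mul (bd_z hX a b)).neg).mono (by decide) (by norm_num)))
  have := h1.add (S.n2_r a b).n1
  refine (this.mono (b := 255) (j := 3) (by norm_num) le_rfl).of_le fun X hX => ?_
  rw [B_apply hX]

lemma bd_W_two {p q p' q' : Fin n} (h1 : p ≠ q) (h2 : p' ≠ q') (h : dist2 p q p' q')
    {f : Matrix (Fin n) (Fin n) ℝ → Fin n → Fin n → Fin n → Fin n → ℝ} {C : ℝ} (hC : 0 ≤ C) (hC' : C ≤ 10)
    (hf : ∀ X ∈ S.Ω, ∀ a b c d, |f X a b c d| ≤ C * (|swD a b c d p q| * |swD a b c d p' q'|)) :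
    S.N1 1 2 (fun X => S.W X (f X)) := by
  refine P0.n1 fun X hX => ?_
  unfold Bd
  refine (abs_W_two_le hX h1 h2 h hC (hf X hX)).trans ?_
  rw [s_zpow_two, pow_one]
  have := S.n_ge_one; have := S.hL
  nlinarith

lemma W_x (p q : Fin n) {X : Matrix (Fin n) (Fin n) ℝ} (hX : X ∈ S.Ω) (y : ℝ) :
    S.W X (fun a b c d => swD a b c d p q * y) = -4 * (S.v * (n:ℝ)^2) * (S.x X p q * y) + -4 * (S.B X p q * y) := by
  rw [W_delta_mul_const hX]; ring

lemma bd_E_x (a b : Fin n) : S.Bd 257 (-1) (S.E fun X => S.x X a b) := by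
  refine Bd.gain (a := 256) (R := fun X => -4 * (S.B X a b * 1)) 1 le_rfl ?_ ?_
  · intro X hX
    have := S.W_x a b hX 1
    simp only [mul_one, x_add, Matrix.add_apply, add_sub_cancel_left] at this ⊢
    exact this
  · have := (S.n1_B a b).const_mul (bd_thousand (S := S) (y := -4) (by norm_num))
    simpa using (this.mono (b := 256) (j := 3) (by norm_num) (by norm_num)).bd

lemma n1_Bx (a b c d : Fin n) : S.N1 255 3 (fun X => S.B X a b * S.x X c d) :=
  (S.n1_B a b).mul_P0 (b := 0) (j := 0) fun X hX => bd_x hX c d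

lemma bd_E_xx {a b c d : Fin n} (h : dist2 a b c d) :
    S.Bd 259 (-1) (S.E fun X => S.x X a b * S.x X c d) := by
  by_cases hab : a = b
  · rw [E_congr (g := fun _ => 0) fun X hX => by rw [hab, x_diag hX]; ring, E_const]; exact bd_zero _ _
  by_cases hcd : c = d
  · rw [E_congr (g := fun _ => 0) fun X hX => by rw [hcd, x_diag hX]; ring, E_const]; exact bd_zero _ _
  have hw := S.bd_W_two hab hcd h (f := fun X e f g h => swD e f g h a b * swD e f g h c d) (C := 1)
    (by norm_num) (by norm_num) (fun X hX e f g h => by rw [abs_mul, one_mul])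
  refine (Bd.gain (a := 258) (R := fun X => -4 * (S.B X a b * S.x X c d + S.B X c d * S.x X a b) +
    S.W X (fun e f g h => swD e f g h a b * swD e f g h c d)) 2 (by norm_num) ?_ ?_).mono (by norm_num) le_rfl
  · intro X hX
    have e : (fun e f g h => S.x (X + swD e f g h) a b * S.x (X + swD e f g h) c d - S.x X a b * S.x X c d)
      = fun e f g h => swD e f g h a b * S.x X c d + swD e f g h c d * S.x X a b
        + swD e f g h a b * swD e f g h c d := by
      ext e f g h; simp only [x_add, Matrix.add_apply]; ring
    rw [e, W_add, W_add, W_x S _ _ hX, W_x S _ _ hX]; ring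
  · have h1 := ((S.n1_Bx a b c d).add (S.n1_Bx c d a b)).const_mul (bd_thousand (S := S) (y := -4) (by norm_num))
    exact ((h1.add (hw.mono le_rfl (show (2:ℤ) ≤ _ by norm_num))).mono (by norm_num) (by norm_num)).bd

lemma bd_E_xxx {a b c d p q : Fin n} (h1 : dist2 a b c d) (h2 : dist2 a b p q) (h3 : dist2 c d p q) :
    S.Bd 263 (-1) (S.E fun X => S.x X a b * S.x X c d * S.x X p q) := by
  by_cases hab : a = b
  · rw [E_congr (g := fun _ => 0) fun X hX => by rw [hab, x_diag hX]; ring, E_const]; exact bd_zero _ _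
  by_cases hcd : c = d
  · rw [E_congr (g := fun _ => 0) fun X hX => by rw [hcd, x_diag hX]; ring, E_const]; exact bd_zero _ _
  by_cases hpq : p = q
  · rw [E_congr (g := fun _ => 0) fun X hX => by rw [hpq, x_diag hX]; ring, E_const]; exact bd_zero _ _
  have hg : ∀ (y : ℝ) {A B : ℝ}, |y| ≤ 1 → |A * B * y| ≤ 1 * (|A| * |B|) := by
    intro y A B hy
    rw [abs_mul, abs_mul, one_mul]; exact mul_le_of_le_one_right (by positivity) hy
  have w1 := S.bd_W_two hab hcd h1 (f := fun X e f g h => swD e f g h a b * swD e f g h c d * S.x X p q) (C := 1)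
    (by norm_num) (by norm_num) (fun X hX e f g h => hg _ (x_abs_le hX _ _))
  have w2 := S.bd_W_two hab hpq h2 (f := fun X e f g h => swD e f g h a b * swD e f g h p q * S.x X c d) (C := 1)
    (by norm_num) (by norm_num) (fun X hX e f g h => hg _ (x_abs_le hX _ _))
  have w3 := S.bd_W_two hcd hpq h3 (f := fun X e f g h => swD e f g h c d * swD e f g h p q *
    (S.x (X + swD e f g h) a b / 17)) (C := 1)
    (by norm_num) (by norm_num) (fun X hX e f g h => hg _ (by
      rw [x_add, Matrix.add_apply, abs_div, abs_of_pos (by norm_num : (0:ℝ) < 17)]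
      have := abs_add_le (S.x X a b) (swD e f g h a b)
      have := x_abs_le hX a b
      have := abs_swD_le_16 hX e f g h a b
      rw [div_le_one (by norm_num)]; linarith))
  refine (Bd.gain (a := 262) (R := fun X => -4 * (S.B X a b * S.x X c d * S.x X p q + S.B X c d * S.x X a b * S.x X p q
      + S.B X p q * S.x X a b * S.x X c d) +
    (S.W X (fun e f g h => swD e f g h a b * swD e f g h c d * S.x X p q)
      + S.W X (fun e f g h => swD e f g h a b * swD e f g h p q * S.x X c d)
      + 17 * S.W X (fun e f g h => swD e f g h c d * swD e f g h p q *
    (S.x (X + swD e f g h) a b / 17)))) 3 (by norm_num) ?_ ?_).mono (by norm_num) le_rfl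
  · intro X hX
    have e : (fun e f g h => S.x (X + swD e f g h) a b * S.x (X + swD e f g h) c d * S.x (X + swD e f g h) p q
        - S.x X a b * S.x X c d * S.x X p q)
      = fun e f g h => swD e f g h a b * (S.x X c d * S.x X p q) + swD e f g h c d * (S.x X a b * S.x X p q)
        + swD e f g h p q * (S.x X a b * S.x X c d)
        + swD e f g h a b * swD e f g h c d * S.x X p q
        + swD e f g h a b * swD e f g h p q * S.x X c d
        + 17 * (swD e f g h c d * swD e f g h p q * (S.x (X + swD e f g h) a b / 17)) := by
      ext e f g h; simp only [x_add, Matrix.add_apply]; ring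
    rw [e]
    simp only [W_add, W_x S _ _ hX, W_mul_left]; ring
  · have t : ∀ (a b c d p q : Fin n), S.N1 255 3 (fun X => S.B X a b * S.x X c d * S.x X p q) := fun a b c d p q =>
      (S.n1_Bx a b c d).mul_P0 (b := 0) (j := 0) fun X hX => bd_x hX p q
    have h1 := (((t a b c d p q).add (t c d a b p q)).add (t p q a b c d)).const_mul
      (bd_thousand (S := S) (y := -4) (by norm_num))
    have h2 := (w1.add w2).add (w3.const_mul (bd_thousand (S := S) (y := 17) (by norm_num)))
    exact ((h1.add (h2.mono le_rfl (show (2:ℤ) + 0 ≤ _ by norm_num))).mono (by norm_num) (by norm_num)).bd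

end Setup

namespace Setup
variable {n : ℕ} (S : Setup n)

section mem
variable {S} {X : Matrix (Fin n) (Fin n) ℝ} (hX : X ∈ S.Ω)
include hX

lemma W_swD_mul (M : Matrix (Fin n) (Fin n) ℝ) (p q : Fin n) :
    S.W X (fun a b c d => (swD a b c d * M) p q) =
      -4 * (S.v * (n:ℝ)^2 * (S.x X * M) p q + (S.B X * M) p q) := by
  simp only [Matrix.mul_apply, W_sum, W_delta_mul_const hX]
  rw [Finset.mul_sum, ← Finset.sum_add_distrib, Finset.mul_sum]
  exact Finset.sum_congr rfl fun i _ => by ring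

lemma W_mul_swD (M : Matrix (Fin n) (Fin n) ℝ) (p q : Fin n) :
    S.W X (fun a b c d => (M * swD a b c d) p q) =
      -4 * (S.v * (n:ℝ)^2 * (M * S.x X) p q + (M * S.B X) p q) := by
  simp only [Matrix.mul_apply]
  have : (fun a b c d : Fin n => ∑ j, M p j * swD a b c d j q) =
    fun a b c d : Fin n => ∑ j, swD a b c d j q * M p j := by
    ext a b c d; exact Finset.sum_congr rfl fun i _ => by ring
  rw [this]
  simp only [W_sum, W_delta_mul_const hX]
  rw [Finset.mul_sum, ← Finset.sum_add_distrib, Finset.mul_sum]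
  exact Finset.sum_congr rfl fun i _ => by ring

lemma xB_apply (b c : Fin n) : (S.x X * S.B X) b c = (S.B X * S.x X) c b := by
  simp only [Matrix.mul_apply]
  exact Finset.sum_congr rfl fun i _ => by rw [x_symm hX b i, B_symm hX i c]; ring

lemma BM_apply (M : Matrix (Fin n) (Fin n) ℝ) (b c : Fin n) : (S.B X * M) b c =
    -(S.v * n * ∑ e, S.z X b e * M e c) + ∑ e, S.r X b e * M e c := by
  simp only [Matrix.mul_apply, B_apply hX]
  rw [Finset.mul_sum, ← Finset.sum_neg_distrib, ← Finset.sum_add_distrib]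
  exact Finset.sum_congr rfl fun i _ => by ring

lemma xx_symm (b c : Fin n) : (S.x X * S.x X) b c = (S.x X * S.x X) c b := by
  simp only [Matrix.mul_apply]
  exact Finset.sum_congr rfl fun i _ => by rw [x_symm hX b i, x_symm hX i c]; ring

omit hX in
lemma xx_add (Z : Matrix (Fin n) (Fin n) ℝ) (b c : Fin n) :
    (S.x (X + Z) * S.x (X + Z)) b c - (S.x X * S.x X) b c =
      (Z * S.x X) b c + (S.x X * Z) b c + (Z * Z) b c := by
  rw [x_add, mul_add, add_mul, add_mul]; simp only [Matrix.add_apply]; ring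

lemma W_xx (b c : Fin n) (hbc : b ≠ c) :
    S.W X (fun e f g h => (S.x (X + swD e f g h) * S.x (X + swD e f g h)) b c - (S.x X * S.x X) b c) =
      -8 * (S.v * (n:ℝ)^2) * (S.x X * S.x X) b c +
        (-4 * ((S.B X * S.x X) b c + (S.B X * S.x X) c b) - 8 * S.M X b c) := by
  simp only [xx_add, W_add, W_swD_mul hX, W_mul_swD hX, W_swD_sq_of_ne hX b c hbc, xB_apply hX]
  ring

lemma abs_swD_mul_le {M : Matrix (Fin n) (Fin n) ℝ} {C : ℝ} (hM : ∀ i j, |M i j| ≤ C) (a b c d p q : Fin n) :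
    |(swD a b c d * M) p q| ≤ 4 * C * hit a b c d p := by
  rw [Matrix.mul_apply]
  refine (Finset.abs_sum_le_sum_abs _ _).trans ?_
  calc ∑ j, |swD a b c d p j * M j q| ≤ ∑ j, |swD a b c d p j| * C := Finset.sum_le_sum fun j _ => by
        rw [abs_mul]; exact mul_le_mul_of_nonneg_left (hM _ _) (abs_nonneg _)
    _ ≤ _ := by
      rw [← Finset.sum_mul]
      have hC : 0 ≤ C := (abs_nonneg _).trans (hM p p)
      have := mul_le_mul_of_nonneg_right (sum_abs_swD_le a b c d p) hC
      linarith
lemma abs_mul_swD_le {M : Matrix (Fin n) (Fin n) ℝ} {C : ℝ} (hM : ∀ i j, |M i j| ≤ C) (a b c d p q : Fin n) :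
    |(M * swD a b c d) p q| ≤ 4 * C * hit a b c d q := by
  have h := abs_swD_mul_le hX (M := M.transpose) (C := C) (fun i j => hM j i) a b c d q p
  have e : (swD a b c d * M.transpose) q p = (M * swD a b c d) p q := by
    rw [← Matrix.transpose_apply (M * _), Matrix.transpose_mul, (swD_symm a b c d).eq]
  rwa [e] at h

lemma abs_dxx_le (a b c d p q : Fin n) :
    |(S.x (X + swD a b c d) * S.x (X + swD a b c d)) p q - (S.x X * S.x X) p q| ≤
      68 * hit a b c d p + 4 * hit a b c d q := by
  rw [xx_add]
  have h1 := abs_swD_mul_le hX (fun i j => x_abs_le hX i j) a b c d p q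
  have h2 := abs_mul_swD_le hX (fun i j => x_abs_le hX i j) a b c d p q
  have h3 := abs_swD_mul_le hX (fun i j => abs_swD_le_16 hX a b c d i j) a b c d p q
  have := abs_add_le ((swD a b c d * S.x X) p q + (S.x X * swD a b c d) p q) ((swD a b c d * swD a b c d) p q)
  have := abs_add_le ((swD a b c d * S.x X) p q) ((S.x X * swD a b c d) p q)
  linarith

lemma bd_XY (a b : Fin n) : S.Bd 0 2 ((X * S.Y X) a b) := by
  have h0 : ∀ c d, |X c d| ≤ 1 := fun c d => by rcases X_01 hX c d with h | h <;> simp [h]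
  have h1 : ∀ c d, |S.Y X c d| ≤ 1 := fun c d => by rcases Y_01 hX c d with h | h <;> simp [h]
  exact (Bd.mat_mul (a := 0) (b := 0) (i := 0) (j := 0) (fun c d => bd_one (h0 c d)) (fun c d => bd_one (h1 c d)) a b).mono (by norm_num) (by norm_num)
lemma bd_M (a b : Fin n) : S.Bd 0 4 (S.M X a b) := by
  unfold M
  rw [← XY_transpose hX]
  exact ((bd_XY hX a b).mul (bd_XY hX b a)).mono (by norm_num) (by norm_num)

lemma abs_rM_le (M : Matrix (Fin n) (Fin n) ℝ) (b c : Fin n) :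
    |∑ e, S.r X b e * M e c| ≤ nv (fun e => S.r X b e) * nv (fun e => M e c) := abs_sum_mul_le_nv _ _

lemma nv_col_x (a : Fin n) : nv (fun b => S.x X b a) ≤ S.s := by
  have := S.nv_const_le (w := fun b => S.x X b a) zero_le_one (fun b => x_abs_le hX b a)
  simpa using this
end mem

lemma n2_rx (b c : Fin n) : S.N2 253 4 (fun X => ∑ e, S.r X b e * S.x X e c) := by
  refine (((S.n2_nv_r b).const_mul (c := S.s) (b := 0) (j := 1) (by unfold Bd; simp [abs_of_pos S.s_pos])).mono
    (b := 253) (by norm_num) (by norm_num)).of_le fun X hX => ?_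
  rw [abs_mul, abs_of_pos S.s_pos, abs_of_nonneg (nv_nonneg _), mul_comm]
  exact (abs_rM_le hX _ b c).trans (mul_le_mul_of_nonneg_left (nv_col_x hX c) (nv_nonneg _))

lemma p0_zx (b c : Fin n) : S.P0 3 3 (fun X => ∑ e, S.z X b e * S.x X e c) := fun X hX =>
  (Bd.sum fun e => (bd_z hX b e).mul (bd_x hX e c)).mono (by norm_num) (by norm_num)

lemma bd_vn (S : Setup n) : S.Bd 0 2 (S.v * n) := (bd_v.mul bd_n).mono (by norm_num) (by norm_num)

lemma n2_Bx (b c : Fin n) : S.N2 254 5 (fun X => (S.B X * S.x X) b c) := by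
  have h1 : S.N2 3 5 (fun X => -(S.v * n * ∑ e, S.z X b e * S.x X e c)) :=
    (((S.p0_zx b c).n2.const_mul S.bd_vn).neg).mono (by norm_num) (by norm_num)
  refine ((h1.add ((S.n2_rx b c).mono le_rfl (show (4:ℤ) ≤ 5 by norm_num))).mono (by norm_num) le_rfl).of_le fun X hX => ?_
  rw [BM_apply hX]

lemma n2_xx {b c : Fin n} (hbc : b ≠ c) : S.N2 260 1 (fun X => (S.x X * S.x X) b c) := by
  refine N2.gain (a := 258) (R := fun X => -4 * ((S.B X * S.x X) b c + (S.B X * S.x X) c b) - 8 * S.M X b c)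
    2 (by norm_num) ?_ ?_ ?_
  · intro X hX
    rw [W_xx hX b c hbc]; ring
  · have h1 := ((S.n2_Bx b c).add (S.n2_Bx c b)).const_mul (bd_thousand (S := S) (y := -4) (by norm_num))
    have h2 : S.N2 1 5 (fun X => 8 * S.M X b c) := (P0.n2 fun X hX =>
      ((bd_thousand (y := 8) (by norm_num)).mul (bd_M hX b c)).mono (by norm_num) (by norm_num))
    exact (h1.sub (h2.mono le_rfl (by norm_num))).mono (by norm_num) (by norm_num)
  · intro X hX
    have h1 : ∀ e f g h, ((S.x (X + swD e f g h) * S.x (X + swD e f g h)) b c - (S.x X * S.x X) b c) ^ 2 ≤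
        20000 * hit e f g h b + 20000 * hit e f g h c := by
      intro e f g h
      rw [← sq_abs]
      have := abs_dxx_le hX e f g h b c
      have := hit_nonneg e f g h b; have := hit_nonneg e f g h c
      have := hit_le e f g h b; have := hit_le e f g h c
      have := abs_nonneg ((S.x (X + swD e f g h) * S.x (X + swD e f g h)) b c - (S.x X * S.x X) b c)
      nlinarith
    refine (W_mono hX h1).trans ?_
    rw [W_add]
    have i1 := (le_abs_self _).trans (abs_W_hit_le hX (C := 20000) (p := b) (f := fun e f g h => 20000 * hit e f g h b)
      fun e f g h => by rw [abs_of_nonneg (mul_nonneg (by norm_num) (hit_nonneg _ _ _ _ _))])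
    have i2 := (le_abs_self _).trans (abs_W_hit_le hX (C := 20000) (p := c) (f := fun e f g h => 20000 * hit e f g h c)
      fun e f g h => by rw [abs_of_nonneg (mul_nonneg (by norm_num) (hit_nonneg _ _ _ _ _))])
    have e : (S.L ^ 258 * S.s ^ ((1:ℤ) + 2)) ^ 2 = S.L ^ 514 * S.L ^ 2 * (n:ℝ) ^ 3 := by
      rw [← S.s_sq]
      norm_num
      ring
    rw [e]
    have h2 : 1 ≤ S.L ^ 514 := one_le_pow₀ S.one_le_L
    have h3 : (160000:ℝ) ≤ S.L ^ 514 * S.L ^ 2 := by nlinarith [S.hL]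
    have h4 : (0:ℝ) ≤ (n:ℝ) ^ 3 := by positivity
    nlinarith

/-- weighted products with the linear part of the drift -/
lemma bd_E_zx {y : Matrix (Fin n) (Fin n) ℝ → ℝ} (hy : S.P0 0 0 y) (p q c1 c2 : Fin n)
    (h1 : ∀ e, e ≠ c1 → e ≠ c2 → S.Bd 263 (-1) (S.E fun X => y X * S.x X p e * S.x X e q))
    (h2 : ∀ e, e ≠ c1 → e ≠ c2 → S.Bd 263 (-1) (S.E fun X => y X * S.x X e q)) :
    S.Bd 272 2 (S.E fun X => y X * ∑ e, S.z X p e * S.x X e q) := by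
  have e1 : (S.E fun X => y X * ∑ e, S.z X p e * S.x X e q) =
      ∑ e, ((S.Dg p + S.Dg e) * (S.E fun X => y X * S.x X p e * S.x X e q)
        + ((S.η p + S.η e) * S.K p e) * (S.E fun X => y X * S.x X e q)) := by
    simp only [← E_mul_left, ← E_add, ← E_sum]
    congr 1; ext X
    rw [Finset.mul_sum]
    exact Finset.sum_congr rfl fun e _ => by unfold z; ring
  rw [e1]
  have b1 : ∀ e, S.Bd 2 1 (S.Dg p + S.Dg e) := fun e => ((bd_Dg p).add (bd_Dg e)).mono (by norm_num) le_rfl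
  have b2 : ∀ e, S.Bd 2 1 ((S.η p + S.η e) * S.K p e) := fun e =>
    (((bd_η p).add (bd_η e)).mul (bd_K p e)).mono (by norm_num) (by norm_num)
  have t1 : ∀ e, S.Bd 0 0 (S.E fun X => y X * S.x X p e * S.x X e q) := fun e =>
    (P0.n1 fun X hX => (((hy X hX).mul (bd_x hX p e)).mul (bd_x hX e q)).mono (by norm_num) (by norm_num)).bd
  have t2 : ∀ e, S.Bd 0 0 (S.E fun X => y X * S.x X e q) := fun e =>
    (P0.n1 fun X hX => ((hy X hX).mul (bd_x hX e q)).mono (by norm_num) (by norm_num)).bd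
  have ex : ∀ e, S.Bd 5 (0 + 2) ((S.Dg p + S.Dg e) * (S.E fun X => y X * S.x X p e * S.x X e q)
        + ((S.η p + S.η e) * S.K p e) * (S.E fun X => y X * S.x X e q)) := fun e =>
    (((b1 e).mul (t1 e)).add ((b2 e).mul (t2 e))).mono (by norm_num) (by norm_num)
  refine (Bd.sum_except2 (a := 268) (b := 5) (j := 0) c1 c2 ?_ (ex c1) (ex c2)).mono (by norm_num) (by norm_num)
  intro e he1 he2
  exact (((b1 e).mul (h1 e he1 he2)).add ((b2 e).mul (h2 e he1 he2))).mono (by norm_num) (by norm_num)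

lemma bd_E_mul_Bx {y : Matrix (Fin n) (Fin n) ℝ → ℝ} (hy : S.P0 0 0 y) (p q c1 c2 : Fin n)
    (h1 : ∀ e, e ≠ c1 → e ≠ c2 → S.Bd 263 (-1) (S.E fun X => y X * S.x X p e * S.x X e q))
    (h2 : ∀ e, e ≠ c1 → e ≠ c2 → S.Bd 263 (-1) (S.E fun X => y X * S.x X e q)) :
    S.Bd 273 4 (S.E fun X => y X * (S.B X * S.x X) p q) := by
  have e : (S.E fun X => y X * (S.B X * S.x X) p q) =
      -(S.v * n * S.E fun X => y X * ∑ e, S.z X p e * S.x X e q) + S.E fun X => y X * ∑ e, S.r X p e * S.x X e q := by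
    rw [← E_mul_left, ← E_neg, ← E_add]
    refine E_congr fun X hX => ?_
    rw [BM_apply hX]; ring
  rw [e]
  have h3 := (S.bd_vn.mul (S.bd_E_zx hy p q c1 c2 h1 h2)).neg
  have h4 : S.Bd 253 4 (S.E fun X => y X * ∑ e, S.r X p e * S.x X e q) := by
    have := ((S.n2_rx p q).n1.mul_P0 hy).bd
    simp only [mul_comm (y _)]
    exact this.mono (by norm_num) (by norm_num)
  exact (h3.add (h4.mono_j (by norm_num))).mono (by norm_num) (by norm_num)

lemma bd_E_sq {a c : Fin n} (h : a ≠ c) : S.Bd 280 0 (S.E fun X => (S.x X * S.x X) a c) := by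
  have key : ∀ a c : Fin n, a ≠ c → S.Bd 273 4 (S.E fun X => (S.B X * S.x X) a c) := by
    intro a c h
    have := S.bd_E_mul_Bx (y := fun _ => 1) (fun X _ => bd_one (by simp)) a c a a
      (fun e _ _ => by
        simp only [one_mul]
        exact (S.bd_E_xx ⟨fun h' => h (h'.1.trans h'.2), fun h' => h h'.1⟩).mono (by norm_num) le_rfl)
      (fun e _ _ => by simp only [one_mul]; exact (S.bd_E_x e c).mono (by norm_num) le_rfl)
    simpa only [one_mul] using this
  refine (Bd.gain (a := 277) (R := fun X => -4 * ((S.B X * S.x X) a c + (S.B X * S.x X) c a) - 8 * S.M X a c)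
    2 (by norm_num) ?_ ?_).mono (by norm_num) le_rfl
  · intro X hX
    rw [W_xx hX a c h]; ring
  · rw [E_sub, E_mul_left, E_add, E_mul_left]
    have h2 : S.Bd 0 4 (S.E fun X => S.M X a c) := (P0.n1 fun X hX => bd_M hX a c).bd
    exact (((bd_thousand (y := -4) (by norm_num)).mul ((key a c h).add (key c a h.symm))).sub
      (((bd_thousand (y := 8) (by norm_num)).mul h2).mono_j (show (0:ℤ) + 4 ≤ 0 + 4 by norm_num))).mono (by norm_num) (by norm_num)

lemma n2_B (a b : Fin n) : S.N2 255 3 (fun X => S.B X a b) := by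
  have h1 : S.N2 3 3 (fun X => - (S.v * n * S.z X a b)) :=
    (P0.n2 (fun X hX => ((S.bd_vn.mul (bd_z hX a b)).neg).mono (by decide) (by norm_num)))
  refine ((h1.add (S.n2_r a b)).mono (b := 255) (j := 3) (by norm_num) le_rfl).of_le fun X hX => ?_
  rw [B_apply hX]

lemma bd_W_hit2 {p q : Fin n} (hpq : p ≠ q) {c : ℕ} {j : ℤ}
    {f : Matrix (Fin n) (Fin n) ℝ → Fin n → Fin n → Fin n → Fin n → ℝ}
    (hf : ∀ X ∈ S.Ω, ∀ a b c' d, |f X a b c' d| ≤ (S.L ^ c * S.s ^ j) * (hit a b c' d p * hit a b c' d q)) :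
    S.N1 (c + 1) (j + 4) (fun X => S.W X (f X)) := by
  refine P0.n1 fun X hX => ?_
  unfold Bd
  refine (abs_W_hit2_le hX hpq (hf X hX)).trans ?_
  have e : S.L ^ (c + 1) * S.s ^ (j + 4) = S.L ^ c * S.s ^ j * (S.L * (n:ℝ) ^ 2) := by
    rw [zpow_add₀ S.s_pos.ne', ← S.s_sq]
    norm_num
    ring
  rw [e]
  refine mul_le_mul_of_nonneg_left ?_ (scale_pos S c j).le
  have := S.hL
  nlinarith [sq_nonneg (n:ℝ)]

lemma bd_E_x_sq (a : Fin n) {b c : Fin n} (hbc : b ≠ c) :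
    S.Bd 526 0 (S.E fun X => S.x X a b * (S.x X * S.x X) b c) := by
  by_cases hab : a = b
  · rw [E_congr (g := fun _ => 0) fun X hX => by rw [hab, x_diag hX]; ring, E_const]; exact bd_zero _ _
  have k1 : S.Bd 273 4 (S.E fun X => S.x X a b * (S.B X * S.x X) b c) := by
    refine S.bd_E_mul_Bx (fun X hX => bd_x hX a b) b c a b (fun e h1 h2 => ?_) (fun e h1 h2 => ?_)
    · refine S.bd_E_xxx ?_ ?_ ?_ <;> unfold dist2 <;> grind
    · refine (S.bd_E_xx ?_).mono (by norm_num) le_rfl; unfold dist2; grind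
  have k2 : S.Bd 273 4 (S.E fun X => S.x X a b * (S.B X * S.x X) c b) := by
    refine S.bd_E_mul_Bx (fun X hX => bd_x hX a b) c b a b (fun e h1 h2 => ?_) (fun e h1 h2 => ?_)
    · refine S.bd_E_xxx ?_ ?_ ?_ <;> unfold dist2 <;> grind
    · refine (S.bd_E_xx ?_).mono (by norm_num) le_rfl; unfold dist2; grind
  have k3 : S.N1 515 4 (fun X => S.B X a b * (S.x X * S.x X) b c) :=
    ((S.n2_B a b).mul (S.n2_xx hbc)).mono (by norm_num) (by norm_num)
  have k4 : S.N1 0 4 (fun X => S.x X a b * S.M X b c) := P0.n1 fun X hX =>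
    ((bd_x hX a b).mul (bd_M hX b c)).mono (by norm_num) (by norm_num)
  have k5 := S.bd_W_hit2 hab (c := 2) (j := 0) (f := fun X e f g h => swD e f g h a b *
      ((S.x (X + swD e f g h) * S.x (X + swD e f g h)) b c - (S.x X * S.x X) b c)) (fun X hX e f g h => by
    rw [abs_mul, mul_comm]
    have h1 := abs_dxx_le hX e f g h b c
    have h2 := hit_le e f g h b; have h3 := hit_le e f g h c
    refine mul_le_mul ?_ (abs_swD_le e f g h a b) (abs_nonneg _) (by have := S.L_pos; positivity)
    rw [zpow_zero]
    nlinarith [S.hL])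
  refine (Bd.gain (a := 525) (R := fun X => -4 * (S.B X a b * (S.x X * S.x X) b c)
      + (-4 * (S.x X a b * (S.B X * S.x X) b c + S.x X a b * (S.B X * S.x X) c b) - 8 * (S.x X a b * S.M X b c))
      + S.W X (fun e f g h => swD e f g h a b *
      ((S.x (X + swD e f g h) * S.x (X + swD e f g h)) b c - (S.x X * S.x X) b c))) 3 (by norm_num) ?_ ?_)
  · intro X hX
    have e : (fun e f g h => S.x (X + swD e f g h) a b * (S.x (X + swD e f g h) * S.x (X + swD e f g h)) b c
        - S.x X a b * (S.x X * S.x X) b c) = fun e f g h => swD e f g h a b * (S.x X * S.x X) b c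
        + S.x X a b * ((S.x (X + swD e f g h) * S.x (X + swD e f g h)) b c - (S.x X * S.x X) b c)
        + swD e f g h a b *
      ((S.x (X + swD e f g h) * S.x (X + swD e f g h)) b c - (S.x X * S.x X) b c) := by
      ext e f g h
      have : S.x (X + swD e f g h) a b = S.x X a b + swD e f g h a b := by rw [x_add]; rfl
      rw [this]; ring
    rw [e, W_add, W_add, W_mul_left, W_xx hX b c hbc, W_x S _ _ hX]; ring
  · rw [E_add, E_add, E_mul_left, E_sub, E_mul_left, E_add, E_mul_left]
    have t : S.Bd 1 0 (-4 : ℝ) := bd_thousand (by norm_num)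
    have t' : S.Bd 1 0 (8 : ℝ) := bd_thousand (by norm_num)
    exact (((t.mul k3.bd).add ((t.mul (k1.add k2)).sub (t'.mul k4.bd))).add
      (k5.bd.mono_j (show (0:ℤ) + 4 ≤ 0 + 4 by norm_num))).mono (by norm_num) (by norm_num)

lemma abs_dp_le (a : Fin n) (X : Matrix (Fin n) (Fin n) ℝ) (e f g h : Fin n) :
    |S.p (X + swD e f g h) a - S.p X a| ≤ 16 * (S.L * S.s) := by
  have e1 : S.p (X + swD e f g h) a - S.p X a = ∑ b, swD e f g h a b * S.η b := by
    simp only [p, x_add, Matrix.add_apply, add_mul, Finset.sum_add_distrib]; ring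
  rw [e1]
  refine (Finset.abs_sum_le_sum_abs _ _).trans ?_
  have h0 : 0 ≤ S.L * S.s := mul_nonneg S.L_pos.le S.s_pos.le
  have h1 := mul_le_mul_of_nonneg_right
    ((sum_abs_swD_le e f g h a).trans (mul_le_mul_of_nonneg_left (hit_le e f g h a) (by norm_num))) h0
  refine le_trans ?_ (h1.trans (by linarith))
  rw [Finset.sum_mul]
  refine Finset.sum_le_sum fun b _ => ?_
  rw [abs_mul]
  refine mul_le_mul_of_nonneg_left ?_ (abs_nonneg _)
  have := bd_η (S := S) b; unfold Bd at this; simpa using this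

lemma W_p (a : Fin n) {X : Matrix (Fin n) (Fin n) ℝ} (hX : X ∈ S.Ω) :
    S.W X (fun e f g h => S.p (X + swD e f g h) a - S.p X a) =
      -4 * (S.v * (n:ℝ)^2) * S.p X a + (4 * (S.v * n * ∑ b, S.z X a b * S.η b) - 4 * ∑ b, S.r X a b * S.η b) := by
  have e : (fun e f g h => S.p (X + swD e f g h) a - S.p X a) =
      fun e f g h => ∑ b, swD e f g h a b * S.η b := by
    ext e f g h
    simp only [p, x_add, Matrix.add_apply, add_mul, Finset.sum_add_distrib]; ring
  rw [e, W_sum]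
  simp only [W_delta_mul_const hX, B_apply hX]
  simp only [p, Finset.mul_sum]
  rw [← Finset.sum_sub_distrib, ← Finset.sum_add_distrib]
  exact Finset.sum_congr rfl fun b _ => by ring

lemma bd_E_x_p {a b : Fin n} (hab : a ≠ b) :
    S.Bd 520 1 (S.E fun X => S.x X a b * S.p X a) := by
  have k1 : S.Bd 268 5 (S.E fun X => S.x X a b * (S.v * n * ∑ e, S.z X a e * S.η e)) := by
    have e1 : (S.E fun X => S.x X a b * (S.v * n * ∑ e, S.z X a e * S.η e)) =
        (S.v * n) * ∑ e, (((S.Dg a + S.Dg e) * S.η e) * (S.E fun X => S.x X a b * S.x X a e)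
        + ((S.η a + S.η e) * S.K a e * S.η e) * (S.E fun X => S.x X a b)) := by
      simp only [← E_mul_left, ← E_add, ← E_sum]
      congr 1; ext X
      rw [Finset.mul_sum, Finset.mul_sum, Finset.mul_sum]
      exact Finset.sum_congr rfl fun e _ => by unfold z; ring
    rw [e1]
    have b1 : ∀ e, S.Bd 3 2 ((S.Dg a + S.Dg e) * S.η e) := fun e =>
      (((bd_Dg a).add (bd_Dg e)).mul (bd_η e)).mono (by norm_num) (by norm_num)
    have b2 : ∀ e, S.Bd 3 2 ((S.η a + S.η e) * S.K a e * S.η e) := fun e =>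
      ((((bd_η a).add (bd_η e)).mul (bd_K a e)).mul (bd_η e)).mono (by norm_num) (by norm_num)
    have t : S.Bd 265 (1 + 2) (∑ e, (((S.Dg a + S.Dg e) * S.η e) * (S.E fun X => S.x X a b * S.x X a e)
        + ((S.η a + S.η e) * S.K a e * S.η e) * (S.E fun X => S.x X a b))) := by
      refine (Bd.sum_except (a := 263) (b := 262) (j := 1) b ?_ ?_).mono (by norm_num) (by norm_num)
      · intro e he
        have : S.Bd 259 (-1) (S.E fun X => S.x X a b * S.x X a e) := S.bd_E_xx (by unfold dist2; grind)
        exact (((b1 e).mul this).add ((b2 e).mul (S.bd_E_x a b))).mono (by norm_num) (by norm_num)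
      · have : S.Bd 0 0 (S.E fun X => S.x X a b * S.x X a b) :=
          (P0.n1 fun X hX => ((bd_x hX a b).mul (bd_x hX a b)).mono (by norm_num) (by norm_num)).bd
        have t1 := (((b1 b).mul this).mono_j (show (2:ℤ) + 0 ≤ 3 by norm_num))
        have t2 := (((b2 b).mul (S.bd_E_x a b)).mono_j (show (2:ℤ) + -1 ≤ 3 by norm_num))
        exact (t1.add t2).mono (by norm_num) (by norm_num)
    exact (S.bd_vn.mul t).mono (by norm_num) (by norm_num)
  have k2 : S.N1 255 5 (fun X => S.x X a b * ∑ e, S.r X a e * S.η e) := by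
    have h1 := ((S.n2_nv_r a).n1.const_mul (c := nv S.η) (b := 1) (j := 2) (by
      unfold Bd; rw [abs_of_nonneg (nv_nonneg _)]; refine S.nv_η_le.trans (le_of_eq ?_); norm_cast; ring))
    refine (h1.mono (b := 255) (j := 5) (by norm_num) (by norm_num)).of_le fun X hX => ?_
    rw [abs_mul, abs_mul, abs_of_nonneg (nv_nonneg _), abs_of_nonneg (nv_nonneg _)]
    refine (mul_le_of_le_one_left (abs_nonneg _) (x_abs_le hX a b)).trans ?_
    rw [mul_comm (nv S.η)]
    exact abs_sum_mul_le_nv _ _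
  have k3 : S.N1 505 5 (fun X => S.B X a b * S.p X a) :=
    ((S.n2_B a b).mul (S.n2_p a)).mono (by norm_num) (by norm_num)
  have k5 := S.bd_W_hit2 hab (c := 2) (j := 1) (f := fun X e f g h => swD e f g h a b *
      (S.p (X + swD e f g h) a - S.p X a)) (fun X hX e f g h => by
    rw [abs_mul, mul_comm]
    refine mul_le_mul ((S.abs_dp_le a X e f g h).trans ?_) (abs_swD_le e f g h a b) (abs_nonneg _)
      (by have := S.L_pos; have := S.s_pos; positivity)
    rw [zpow_one]
    have := S.L_pos; have := S.s_pos
    have h5 : 0 < S.L * S.s := by positivity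
    nlinarith [S.hL])
  refine (Bd.gain (a := 517) (R := fun X => -4 * (S.B X a b * S.p X a)
      + (4 * (S.x X a b * (S.v * n * ∑ b, S.z X a b * S.η b)) - 4 * (S.x X a b * ∑ b, S.r X a b * S.η b))
      + S.W X (fun e f g h => swD e f g h a b *
      (S.p (X + swD e f g h) a - S.p X a))) 2 (by norm_num) ?_ ?_).mono (by norm_num) le_rfl
  · intro X hX
    have e : (fun e f g h => S.x (X + swD e f g h) a b * S.p (X + swD e f g h) a
        - S.x X a b * S.p X a) = fun e f g h => swD e f g h a b * S.p X a
        + S.x X a b * (S.p (X + swD e f g h) a - S.p X a)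
        + swD e f g h a b * (S.p (X + swD e f g h) a - S.p X a) := by
      ext e f g h
      have : S.x (X + swD e f g h) a b = S.x X a b + swD e f g h a b := by rw [x_add]; rfl
      rw [this]; ring
    rw [e, W_add, W_add, W_mul_left, W_p S a hX, W_x S _ _ hX]; ring
  · rw [E_add, E_add, E_mul_left, E_sub, E_mul_left, E_mul_left]
    have t : S.Bd 1 0 (-4 : ℝ) := bd_thousand (by norm_num)
    have t' : S.Bd 1 0 (4 : ℝ) := bd_thousand (by norm_num)
    exact (((t.mul k3.bd).add (((t'.mul k1).mono_j (show (0:ℤ) + 5 ≤ 0 + 5 by norm_num)).sub (t'.mul k2.bd))).add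
      (k5.bd.mono_j (show (1:ℤ) + 4 ≤ 0 + 5 by norm_num))).mono (by norm_num) (by norm_num)

end Setup

/-- entrywise absolute sum -/
noncomputable def l1 {n : ℕ} (M : Matrix (Fin n) (Fin n) ℝ) : ℝ := ∑ c, ∑ e, |M c e|

lemma l1_transpose {n : ℕ} (M : Matrix (Fin n) (Fin n) ℝ) : l1 M.transpose = l1 M := by
  unfold l1; rw [Finset.sum_comm]; rfl

lemma abs_sum_mul_le_l1 {n : ℕ} {A : Fin n → Fin n → ℝ} {M : Matrix (Fin n) (Fin n) ℝ}
    (hA : ∀ c e, |A c e| ≤ 1) : |∑ c, ∑ e, A c e * M c e| ≤ l1 M := by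
  refine (Finset.abs_sum_le_sum_abs _ _).trans (Finset.sum_le_sum fun c _ => ?_)
  refine (Finset.abs_sum_le_sum_abs _ _).trans (Finset.sum_le_sum fun e _ => ?_)
  rw [abs_mul]
  exact mul_le_of_le_one_left (abs_nonneg _) (hA c e)

namespace Setup
variable {n : ℕ} (S : Setup n)

lemma l1_mul_D {M : Matrix (Fin n) (Fin n) ℝ} {C : ℝ} (h : ∀ f, ∑ c, |M c f| ≤ C) :
    l1 (M * S.D) ≤ C * S.tot := by
  calc l1 (M * S.D) ≤ ∑ c, ∑ e, ∑ f, |M c f| * S.D f e := by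
        refine Finset.sum_le_sum fun c _ => Finset.sum_le_sum fun e _ => ?_
        rw [Matrix.mul_apply]
        refine (Finset.abs_sum_le_sum_abs _ _).trans (le_of_eq ?_)
        exact Finset.sum_congr rfl fun f _ => by rw [abs_mul, abs_of_nonneg (D_nonneg f e)]
    _ = ∑ f, (∑ c, |M c f|) * S.Dg f := by
        rw [Finset.sum_comm]
        have : ∀ e, ∑ c, ∑ f, |M c f| * S.D f e = ∑ f, (∑ c, |M c f|) * S.D f e := by
          intro e; rw [Finset.sum_comm]; simp only [Finset.sum_mul]
        simp only [this]
        rw [Finset.sum_comm]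
        simp only [Dg, Finset.mul_sum]
    _ ≤ ∑ f, C * S.Dg f := Finset.sum_le_sum fun f _ => mul_le_mul_of_nonneg_right (h f) (Dg_nonneg f)
    _ = _ := by rw [← Finset.mul_sum]; rfl

section mem
variable {S} {X : Matrix (Fin n) (Fin n) ℝ} (hX : X ∈ S.Ω)
include hX

lemma x_transpose : (S.x X).transpose = S.x X := (x_isSymm hX).eq

omit hX in
lemma D_transpose : S.D.transpose = S.D := by ext a b; exact S.hDs b a

omit hX in
lemma tot_le : S.tot ≤ S.L * S.s ^ 2 := by rw [S.s_sq]; exact S.htot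

lemma l1_xxD_le : l1 (S.x X * S.x X * S.D) ≤ S.L * S.s ^ 5 * S.τ X := by
  have hs := S.s_pos; have ht := S.τ_pos X
  refine (S.l1_mul_D (C := S.s ^ 3 * S.τ X) fun f => ?_).trans ?_
  · have h1 := S.abs_sum_abs_le_nv (fun c => (S.x X * S.x X) c f)
    have h2 := nv_row_xx hX f
    have e : (fun c => (S.x X * S.x X) c f) = fun c => (S.x X * S.x X) f c := by
      ext c; exact xx_symm hX c f
    rw [e] at h1
    have := mul_le_mul_of_nonneg_left h2 hs.le
    refine h1.trans (this.trans (le_of_eq ?_)); ring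
  · have := mul_le_mul_of_nonneg_left (tot_le (S := S)) (show 0 ≤ S.s ^ 3 * S.τ X by positivity)
    nlinarith

lemma l1_Dxx_le : l1 (S.D * (S.x X * S.x X)) ≤ S.L * S.s ^ 5 * S.τ X := by
  rw [← l1_transpose, Matrix.transpose_mul, Matrix.transpose_mul, x_transpose hX, D_transpose]
  exact l1_xxD_le hX

lemma l1_DxD_le : l1 (S.D * S.x X * S.D) ≤ S.L ^ 2 * S.s ^ 5 := by
  have hs := S.s_pos; have hL := S.L_pos
  refine (S.l1_mul_D (C := S.tot) fun f => ?_).trans ?_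
  · refine Finset.sum_le_sum fun c _ => ?_
    rw [Matrix.mul_apply]
    refine (Finset.abs_sum_le_sum_abs _ _).trans (Finset.sum_le_sum fun g _ => ?_)
    rw [abs_mul, abs_of_nonneg (D_nonneg c g)]
    exact mul_le_of_le_one_right (D_nonneg c g) (x_abs_le hX g f)
  · have h1 : S.tot * S.tot ≤ (S.L * S.s ^ 2) * (S.L * S.s ^ 2) :=
      mul_le_mul tot_le tot_le tot_nonneg (by positivity)
    have h2 : S.s ^ 4 ≤ S.s ^ 5 := pow_le_pow_right₀ S.one_le_s (by norm_num)
    nlinarith [pow_pos hL 2]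

lemma l1_xDD_le : l1 (S.x X * (S.D * S.D)) ≤ S.L ^ 2 * S.s ^ 5 := by
  have hs := S.s_pos; have hL := S.L_pos
  rw [← mul_assoc]
  refine (S.l1_mul_D (C := S.L * S.s ^ 3) fun f => ?_).trans ?_
  · have : ∀ c, |(S.x X * S.D) c f| ≤ S.L * S.s := fun c => by
      rw [Matrix.mul_apply]
      refine (Finset.abs_sum_le_sum_abs _ _).trans (le_trans (Finset.sum_le_sum fun g _ => ?_) (Dg_le f))
      rw [abs_mul, abs_of_nonneg (D_nonneg g f), S.hDs f g]
      exact mul_le_of_le_one_left (D_nonneg _ _) (x_abs_le hX c g)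
    refine (Finset.sum_le_sum fun c _ => this c).trans (le_of_eq ?_)
    rw [Finset.sum_const, Finset.card_univ, Fintype.card_fin, nsmul_eq_mul, ← S.s_sq]; ring
  · have := mul_le_mul_of_nonneg_left (tot_le (S := S)) (show 0 ≤ S.L * S.s ^ 3 by positivity)
    nlinarith

lemma l1_DDx_le : l1 (S.D * S.D * S.x X) ≤ S.L ^ 2 * S.s ^ 5 := by
  rw [← l1_transpose, Matrix.transpose_mul, Matrix.transpose_mul, x_transpose hX, D_transpose]
  exact l1_xDD_le hX

lemma l1_xDx_le : l1 (S.x X * S.D * S.x X) ≤ S.L * S.s ^ 5 * S.τ X ^ 2 := by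
  have hs := S.s_pos; have hL := S.L_pos; have ht := S.τ_pos X
  have h1 : ∀ c, ∑ e, |(S.x X * S.D * S.x X) c e| ≤ S.s ^ 2 * S.τ X * nv (fun e => (S.x X * S.D) c e) := by
    intro c
    have h1 := S.abs_sum_abs_le_nv (fun e => (S.x X * S.D * S.x X) c e)
    have h2 := nv_row_mul_x hX (S.x X * S.D) c
    nlinarith
  have h2 : ∑ c, nv (fun e => (S.x X * S.D) c e) ^ 2 ≤ S.s ^ 2 * S.τ X ^ 2 * S.tot := by
    simp only [nv_sq]
    rw [Finset.sum_comm]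
    unfold tot
    rw [Finset.mul_sum]
    refine Finset.sum_le_sum fun e _ => ?_
    have h3 := nv_x_mul hX (fun b => S.D b e)
    have h4 : nv (fun b => S.D b e) ^ 2 ≤ S.Dg e := by
      rw [nv_sq]
      refine (Finset.sum_le_sum fun b _ => ?_).trans (le_of_eq (S.D_col e))
      rcases S.hD b e with h | h <;> simp [h]
    have h5 := nv_nonneg (fun b => S.D b e)
    have h6 : (fun a => ∑ b, S.x X a b * S.D b e) = fun a => (S.x X * S.D) a e := by
      ext a; rw [Matrix.mul_apply]
    rw [h6] at h3
    rw [← nv_sq]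
    have := pow_le_pow_left₀ (nv_nonneg _) h3 2
    have := mul_le_mul_of_nonneg_left h4 (show 0 ≤ S.s ^ 2 * S.τ X ^ 2 by positivity)
    nlinarith
  have h3 : ∑ c, nv (fun e => (S.x X * S.D) c e) ≤ S.L * S.s ^ 3 * S.τ X := by
    have h4 := S.abs_sum_abs_le_nv (fun c => nv (fun e => (S.x X * S.D) c e))
    simp only [abs_of_nonneg (nv_nonneg _)] at h4
    have h5 : nv (fun c => nv (fun e => (S.x X * S.D) c e)) ≤ S.L * S.s ^ 2 * S.τ X := by
      refine nv_le (by positivity) (h2.trans ?_)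
      have := mul_le_mul_of_nonneg_left (tot_le (S := S)) (show 0 ≤ S.s ^ 2 * S.τ X ^ 2 by positivity)
      have h6 := S.one_le_L
      have h7 : 0 ≤ S.s ^ 2 * S.τ X ^ 2 * S.s ^ 2 := by positivity
      have h8 : S.L ≤ S.L ^ 2 := by nlinarith
      have h9 := mul_le_mul_of_nonneg_right h8 h7
      nlinarith
    nlinarith
  calc l1 (S.x X * S.D * S.x X) ≤ ∑ c, S.s ^ 2 * S.τ X * nv (fun e => (S.x X * S.D) c e) :=
        Finset.sum_le_sum fun c _ => h1 c
    _ ≤ _ := by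
        rw [← Finset.mul_sum]
        have := mul_le_mul_of_nonneg_left h3 (show 0 ≤ S.s ^ 2 * S.τ X by positivity)
        nlinarith

lemma nv_q_le : ∀ c, |S.q X c| ≤ S.L * S.s ^ 2 := fun c => by
  refine (Finset.abs_sum_le_sum_abs _ _).trans (le_trans (Finset.sum_le_sum fun b _ => ?_) (tot_le (S := S)))
  rw [abs_mul, abs_of_nonneg (Dg_nonneg b)]
  exact mul_le_of_le_one_left (Dg_nonneg b) (x_abs_le hX c b)

lemma abs_Kx_le (c b : Fin n) : |(S.K * S.x X) c b| ≤ 2 * (S.L * S.s) := by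
  rw [Kx_apply hX]
  have h1 : |S.η b| ≤ S.L * S.s := by simpa [Bd] using bd_η (S := S) b
  have h2 : |(S.D * S.x X) c b| ≤ S.L * S.s := by
    rw [Matrix.mul_apply]
    refine (Finset.abs_sum_le_sum_abs _ _).trans (le_trans (Finset.sum_le_sum fun g _ => ?_) (Dg_le c))
    rw [abs_mul, abs_of_nonneg (D_nonneg c g)]
    exact mul_le_of_le_one_right (D_nonneg c g) (x_abs_le hX g b)
  have := abs_sub (S.η b) ((S.D * S.x X) c b)
  linarith

lemma abs_xpxx_le (a b : Fin n) : |∑ c, S.x X a c * S.p X c * (S.x X * S.x X) c b| ≤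
    S.L * S.s ^ 5 * S.τ X ^ 3 := by
  have hs := S.s_pos; have hL := S.L_pos; have ht := S.one_le_τ X
  have h1 := abs_sum_mul_le_nv (fun c => S.x X a c * S.p X c) (fun c => (S.x X * S.x X) c b)
  have h2 : nv (fun c => S.x X a c * S.p X c) ≤ nv (S.p X) := nv_mono fun c => by
    rw [abs_mul]; exact mul_le_of_le_one_left (abs_nonneg _) (x_abs_le hX a c)
  have h3 : nv (fun c => (S.x X * S.x X) c b) ≤ S.s ^ 2 * S.τ X := by
    have e : (fun c => (S.x X * S.x X) c b) = fun c => (S.x X * S.x X) b c := by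
      ext c; exact xx_symm hX c b
    rw [e]; exact nv_row_xx hX b
  have h4 := h2.trans (nv_p hX)
  refine h1.trans ((mul_le_mul h4 h3 (nv_nonneg _) (by positivity)).trans ?_)
  have : S.τ X ^ 2 ≤ S.τ X ^ 3 := pow_le_pow_right₀ ht (by norm_num)
  have := mul_le_mul_of_nonneg_left this (show 0 ≤ S.L * S.s ^ 5 by positivity)
  nlinarith

lemma abs_xqKx_le (a b : Fin n) : |∑ c, S.x X a c * S.q X c * (S.K * S.x X) c b| ≤
    2 * S.L ^ 2 * S.s ^ 5 := by
  have hs := S.s_pos; have hL := S.L_pos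
  refine (Finset.abs_sum_le_sum_abs _ _).trans ?_
  have : ∀ c, |S.x X a c * S.q X c * (S.K * S.x X) c b| ≤ (S.L * S.s ^ 2) * (2 * (S.L * S.s)) := fun c => by
    rw [abs_mul, abs_mul]
    refine mul_le_mul ?_ (abs_Kx_le hX c b) (abs_nonneg _) (by positivity)
    exact (mul_le_of_le_one_left (abs_nonneg _) (x_abs_le hX a c)).trans (nv_q_le hX c)
  refine (Finset.sum_le_sum fun c _ => this c).trans (le_of_eq ?_)
  rw [Finset.sum_const, Finset.card_univ, Fintype.card_fin, nsmul_eq_mul, ← S.s_sq]; ring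

lemma abs_xxx_le (c e : Fin n) : |(S.x X * S.x X * S.x X) c e| ≤ S.s ^ 3 * S.τ X := by
  rw [Matrix.mul_apply]
  refine (abs_sum_mul_le_nv _ _).trans ?_
  refine (mul_le_mul (nv_row_xx hX c) (nv_col_x hX e) (nv_nonneg _)
    (by have := S.s_pos; have := S.τ_pos X; positivity)).trans (le_of_eq (by ring))

lemma abs_x5_le (a b : Fin n) : |∑ c, ∑ e, S.x X a c * (S.x X * S.x X * S.x X) c e * S.x X e b| ≤
    S.s ^ 5 * S.τ X ^ 3 := by
  have hs := S.s_pos; have ht := S.τ_pos X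
  have e : ∑ c, ∑ e, S.x X a c * (S.x X * S.x X * S.x X) c e * S.x X e b =
      ∑ c, (S.x X * S.x X) a c * (S.x X * S.x X * S.x X) b c := by
    have h1 : ∑ c, ∑ e, S.x X a c * (S.x X * S.x X * S.x X) c e * S.x X e b =
      (S.x X * (S.x X * S.x X * S.x X) * S.x X) a b := by
      rw [Matrix.mul_apply, Finset.sum_comm]
      simp only [Matrix.mul_apply (M := S.x X) (N := S.x X * S.x X * S.x X), Finset.sum_mul]
    have h2 : S.x X * (S.x X * S.x X * S.x X) * S.x X = (S.x X * S.x X) * (S.x X * S.x X * S.x X) := by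
      simp only [mul_assoc]
    rw [h1, h2, Matrix.mul_apply]
    refine Finset.sum_congr rfl fun c _ => ?_
    congr 1
    rw [← Matrix.transpose_apply (S.x X * S.x X * S.x X), Matrix.transpose_mul, Matrix.transpose_mul,
      x_transpose hX, mul_assoc]
  rw [e]
  exact (abs_sum_mul_le_nv _ _).trans ((mul_le_mul (nv_row_xx hX a) (nv_row_xxx hX b) (nv_nonneg _)
    (by positivity)).trans (le_of_eq (by ring)))

lemma abs_xDxxxx_le (a b : Fin n) :
    |∑ c, ∑ e, S.x X a c * (S.D c e * (S.x X * S.x X * S.x X) c e) * S.x X e b| ≤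
    S.L * S.s ^ 5 * S.τ X := by
  have hs := S.s_pos; have ht := S.τ_pos X
  calc _ ≤ ∑ c, ∑ e, S.D c e * (S.s ^ 3 * S.τ X) := by
        refine (Finset.abs_sum_le_sum_abs _ _).trans (Finset.sum_le_sum fun c _ => ?_)
        refine (Finset.abs_sum_le_sum_abs _ _).trans (Finset.sum_le_sum fun e _ => ?_)
        rw [abs_mul, abs_mul, abs_mul, abs_of_nonneg (D_nonneg c e)]
        have h1 := mul_le_mul_of_nonneg_left (abs_xxx_le hX c e) (D_nonneg (S := S) c e)
        have h0 : 0 ≤ S.D c e * |(S.x X * S.x X * S.x X) c e| := mul_nonneg (D_nonneg c e) (abs_nonneg _)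
        have h2 := mul_le_of_le_one_left h0 (x_abs_le hX a c)
        exact (mul_le_of_le_one_right (mul_nonneg (abs_nonneg _) h0) (x_abs_le hX e b)).trans (h2.trans h1)
    _ = S.tot * (S.s ^ 3 * S.τ X) := by simp only [← Finset.sum_mul]; rfl
    _ ≤ _ := by
        have := mul_le_mul_of_nonneg_right (tot_le (S := S)) (show 0 ≤ S.s ^ 3 * S.τ X by positivity)
        nlinarith

lemma abs_xrx_le (a b : Fin n) :
    |∑ c, ∑ e, S.x X a c * (S.x X c e * S.ρU X c e + S.K c e * (S.ρV X c e + (S.x X * S.x X * S.x X) c e))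
      * S.x X e b| ≤ S.L ^ 3 * S.s ^ 5 * S.τ X ^ 3 := by
  have hs := S.s_pos; have ht := S.one_le_τ X; have hL := S.L_pos
  have ha := fun i j => x_abs_le hX i j
  have hK : ∀ i j, |S.K i j| ≤ 1 := fun i j => by simpa [Bd] using bd_K (S := S) i j
  have hv : |S.v| ≤ 1 := by simpa [Bd] using bd_v (S := S)
  have hul : |S.u - S.l| ≤ 1 := by simpa [Bd] using bd_u_sub_l (S := S)
  have hlu : |S.l - S.u| ≤ 1 := by simpa [Bd] using bd_l_sub_u (S := S)
  have m2 : ∀ {y z : ℝ}, |y| ≤ 1 → |z| ≤ 1 → |y * z| ≤ 1 := fun h1 h2 => by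
    rw [abs_mul]; exact mul_le_one₀ h1 (abs_nonneg _) h2
  set A1 : Fin n → Fin n → ℝ := fun c e => S.x X a c * S.x X c e * S.x X e b with hA1
  set A2 : Fin n → Fin n → ℝ := fun c e => S.x X a c * S.K c e * S.x X e b with hA2
  have a1 : ∀ c e, |A1 c e| ≤ 1 := fun c e => m2 (m2 (ha a c) (ha c e)) (ha e b)
  have a2 : ∀ c e, |A2 c e| ≤ 1 := fun c e => m2 (m2 (ha a c) (hK c e)) (ha e b)
  have b1 := abs_sum_mul_le_l1 (M := S.D * S.x X * S.D) (A := fun c e => (S.u - S.l) * A1 c e) fun c e => m2 hul (a1 c e)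
  have b2 := abs_sum_mul_le_l1 (M := S.D * S.x X * S.D) (A := fun c e => S.v * A2 c e) fun c e => m2 hv (a2 c e)
  have b3 := abs_sum_mul_le_l1 (M := S.x X * S.x X * S.D) (A := A1) a1
  have b4 := abs_sum_mul_le_l1 (M := S.D * (S.x X * S.x X)) (A := A1) a1
  have b5 := abs_sum_mul_le_l1 (M := S.x X * S.D * S.x X) (A := A1) a1
  have b6 := abs_sum_mul_le_l1 (M := S.x X * S.D * S.x X) (A := fun c e => (S.l - S.u) * A2 c e) fun c e => m2 hlu (a2 c e)
  have b7 := abs_sum_mul_le_l1 (M := S.x X * (S.D * S.D)) (A := fun c e => S.v * A2 c e) fun c e => m2 hv (a2 c e)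
  have b8 := abs_sum_mul_le_l1 (M := S.D * S.D * S.x X) (A := fun c e => S.v * A2 c e) fun c e => m2 hv (a2 c e)
  have b9 := abs_xpxx_le hX a b
  have b10 := abs_xpxx_le hX b a
  have b11 := abs_xqKx_le hX a b
  have b12 := abs_xqKx_le hX b a
  have b13 := abs_x5_le hX a b
  have b14 := abs_xDxxxx_le hX a b
  have e9 : ∑ c, ∑ e, A1 c e * S.p X c = ∑ c, S.x X a c * S.p X c * (S.x X * S.x X) c b := by
    refine Finset.sum_congr rfl fun c _ => ?_
    rw [Matrix.mul_apply, Finset.mul_sum]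
    exact Finset.sum_congr rfl fun e _ => by rw [hA1]; ring
  have e10 : ∑ c, ∑ e, A1 c e * S.p X e = ∑ c, S.x X b c * S.p X c * (S.x X * S.x X) c a := by
    rw [Finset.sum_comm]
    refine Finset.sum_congr rfl fun c _ => ?_
    rw [Matrix.mul_apply, Finset.mul_sum]
    exact Finset.sum_congr rfl fun e _ => by simp only [hA1]; rw [x_symm hX b c, x_symm hX c e, x_symm hX e a]; ring
  have e11 : ∑ c, ∑ e, A2 c e * S.q X c = ∑ c, S.x X a c * S.q X c * (S.K * S.x X) c b := by
    refine Finset.sum_congr rfl fun c _ => ?_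
    rw [Matrix.mul_apply, Finset.mul_sum]
    exact Finset.sum_congr rfl fun e _ => by rw [hA2]; ring
  have e12 : ∑ c, ∑ e, A2 c e * S.q X e = ∑ c, S.x X b c * S.q X c * (S.K * S.x X) c a := by
    rw [Finset.sum_comm]
    refine Finset.sum_congr rfl fun c _ => ?_
    rw [Matrix.mul_apply, Finset.mul_sum]
    exact Finset.sum_congr rfl fun e _ => by simp only [hA2]; rw [x_symm hX b c, S.K_symm c e, x_symm hX e a]; ring
  rw [← e9] at b9; rw [← e10] at b10; rw [← e11] at b11; rw [← e12] at b12
  have key : ∑ c, ∑ e, S.x X a c * (S.x X c e * S.ρU X c e + S.K c e * (S.ρV X c e + (S.x X * S.x X * S.x X) c e))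
      * S.x X e b =
      (∑ c, ∑ e, (S.u - S.l) * A1 c e * (S.D * S.x X * S.D) c e)
      + (∑ c, ∑ e, S.v * A2 c e * (S.D * S.x X * S.D) c e)
      + (∑ c, ∑ e, A1 c e * (S.x X * S.x X * S.D) c e)
      + (∑ c, ∑ e, A1 c e * (S.D * (S.x X * S.x X)) c e)
      - (∑ c, ∑ e, A1 c e * (S.x X * S.D * S.x X) c e)
      - (∑ c, ∑ e, (S.l - S.u) * A2 c e * (S.x X * S.D * S.x X) c e)
      - (∑ c, ∑ e, S.v * A2 c e * (S.x X * (S.D * S.D)) c e)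
      - (∑ c, ∑ e, S.v * A2 c e * (S.D * S.D * S.x X) c e)
      - (∑ c, ∑ e, A1 c e * S.p X c) - (∑ c, ∑ e, A1 c e * S.p X e)
      + S.v * (∑ c, ∑ e, A2 c e * S.q X c) + S.v * (∑ c, ∑ e, A2 c e * S.q X e)
      + (∑ c, ∑ e, S.x X a c * (S.x X * S.x X * S.x X) c e * S.x X e b)
      - (∑ c, ∑ e, S.x X a c * (S.D c e * (S.x X * S.x X * S.x X) c e) * S.x X e b) := by
    simp only [Finset.mul_sum, ← Finset.sum_add_distrib, ← Finset.sum_sub_distrib]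
    refine Finset.sum_congr rfl fun c _ => Finset.sum_congr rfl fun e _ => ?_
    simp only [hA1, hA2, ρU, ρV, K_apply]
    ring
  have c1 := l1_DxD_le hX; have c3 := l1_xxD_le hX; have c4 := l1_Dxx_le hX
  have c5 := l1_xDx_le hX; have c7 := l1_xDD_le hX; have c8 := l1_DDx_le hX
  have t3 : S.τ X ≤ S.τ X ^ 3 := by simpa using pow_le_pow_right₀ ht (show 1 ≤ 3 by norm_num)
  have t2 : S.τ X ^ 2 ≤ S.τ X ^ 3 := pow_le_pow_right₀ ht (by norm_num)
  have t1 : 1 ≤ S.τ X ^ 3 := one_le_pow₀ ht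
  set Q := S.L ^ 2 * S.s ^ 5 * S.τ X ^ 3 with hQ
  have hL1 := S.one_le_L
  have hLL : S.L ≤ S.L ^ 2 := by nlinarith
  have hL0 : 1 ≤ S.L ^ 2 := one_le_pow₀ hL1
  have hp5 : 0 < S.s ^ 5 := by positivity
  have q1 : S.L ^ 2 * S.s ^ 5 ≤ Q := le_mul_of_one_le_right (by positivity) t1
  have q2 : S.L * S.s ^ 5 * S.τ X ≤ Q := by rw [hQ]; gcongr
  have q3 : S.L * S.s ^ 5 * S.τ X ^ 2 ≤ Q := by rw [hQ]; gcongr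
  have q4 : S.L * S.s ^ 5 * S.τ X ^ 3 ≤ Q := by rw [hQ]; gcongr
  have q5 : S.s ^ 5 * S.τ X ^ 3 ≤ Q := by
    rw [hQ, mul_assoc]; exact le_mul_of_one_le_left (by positivity) hL0
  have hv0 := S.v_pos
  have hv1 : S.v ≤ 1 := S.v_le
  have d11 : |S.v * (∑ c, ∑ e, A2 c e * S.q X c)| ≤ 2 * Q := by
    rw [abs_mul, abs_of_pos hv0]; exact (mul_le_of_le_one_left (abs_nonneg _) hv1).trans (b11.trans (by linarith))
  have d12 : |S.v * (∑ c, ∑ e, A2 c e * S.q X e)| ≤ 2 * Q := by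
    rw [abs_mul, abs_of_pos hv0]; exact (mul_le_of_le_one_left (abs_nonneg _) hv1).trans (b12.trans (by linarith))
  have fin : |∑ c, ∑ e, S.x X a c * (S.x X c e * S.ρU X c e + S.K c e * (S.ρV X c e + (S.x X * S.x X * S.x X) c e))
      * S.x X e b| ≤ 16 * Q := by
    rw [key]
    have r1 := b1.trans (c1.trans q1)
    have r2 := b2.trans (c1.trans q1)
    have r3 := b3.trans (c3.trans q2)
    have r4 := b4.trans (c4.trans q2)
    have r5 := b5.trans (c5.trans q3)
    have r6 := b6.trans (c5.trans q3)
    have r7 := b7.trans (c7.trans q1)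
    have r8 := b8.trans (c8.trans q1)
    have r9 := b9.trans q4
    have r10 := b10.trans q4
    have r13 := b13.trans q5
    have r14 := b14.trans q2
    rw [abs_le] at *
    constructor <;> linarith [r1.1, r2.1, r3.1, r4.1, r5.1, r6.1, r7.1, r8.1, r9.1, r10.1, d11.1, d12.1, r13.1, r14.1,
      r1.2, r2.2, r3.2, r4.2, r5.2, r6.2, r7.2, r8.2, r9.2, r10.2, d11.2, d12.2, r13.2, r14.2]
  have hQ0 : 0 ≤ Q := by positivity
  refine fin.trans ?_
  have := S.hL
  calc 16 * Q ≤ S.L * Q := mul_le_mul_of_nonneg_right (by linarith) hQ0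
    _ = _ := by rw [hQ]; ring
end mem

lemma n1_xrx (a b : Fin n) : S.N1 233 5 (fun X =>
    ∑ c, ∑ e, S.x X a c * (S.x X c e * S.ρU X c e + S.K c e * (S.ρV X c e + (S.x X * S.x X * S.x X) c e))
      * S.x X e b) :=
  (N2.of_τ' (a := 3) (m := 3) (by norm_num) fun X hX => by
    have := abs_xrx_le hX a b
    norm_num
    exact this).n1
end Setup

namespace Setup
variable {n : ℕ} (S : Setup n)

lemma bd_E_Bxx {a b : Fin n} (hab : a ≠ b) : S.Bd 535 5 (S.E fun X => (S.B X * (S.x X * S.x X)) a b) := by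
  have e : (S.E fun X => (S.B X * (S.x X * S.x X)) a b) =
      -(S.v * n * ∑ e, ((S.Dg a + S.Dg e) * (S.E fun X => S.x X a e * (S.x X * S.x X) e b)
        + ((S.η a + S.η e) * S.K a e) * (S.E fun X => (S.x X * S.x X) e b)))
      + S.E fun X => ∑ e, S.r X a e * (S.x X * S.x X) e b := by
    simp only [← E_mul_left, ← E_add, ← E_sum, ← E_neg]
    refine E_congr fun X hX => ?_
    rw [BM_apply hX]
    congr 4
    ext e; unfold z; ring
  have b1 : ∀ e, S.Bd 2 1 (S.Dg a + S.Dg e) := fun e => ((bd_Dg a).add (bd_Dg e)).mono (by norm_num) le_rfl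
  have b2 : ∀ e, S.Bd 2 1 ((S.η a + S.η e) * S.K a e) := fun e =>
    (((bd_η a).add (bd_η e)).mul (bd_K a e)).mono (by norm_num) (by norm_num)
  have k1 : S.Bd 532 (1 + 2) (∑ e, ((S.Dg a + S.Dg e) * (S.E fun X => S.x X a e * (S.x X * S.x X) e b)
        + ((S.η a + S.η e) * S.K a e) * (S.E fun X => (S.x X * S.x X) e b))) := by
    refine (Bd.sum_except (a := 529) (b := 5) b (fun e he => ?_) ?_).mono (by norm_num) le_rfl
    · have t1 := ((b1 e).mul (S.bd_E_x_sq a he))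
      have t2 := ((b2 e).mul (S.bd_E_sq he))
      exact (t1.add t2).mono (by norm_num) (by norm_num)
    · have i1 : S.Bd 0 2 (S.E fun X => S.x X a b * (S.x X * S.x X) b b) := (P0.n1 fun X hX =>
        ((bd_x hX a b).mul (bd_xx hX b b)).mono (by norm_num) (by norm_num)).bd
      have i2 : S.Bd 0 2 (S.E fun X => (S.x X * S.x X) b b) := (P0.n1 fun X hX => bd_xx hX b b).bd
      exact (((b1 b).mul i1).add ((b2 b).mul i2)).mono (by norm_num) (by norm_num)
  have k2 : S.N1 483 5 (fun X => ∑ e, S.r X a e * (S.x X * S.x X) e b) := by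
    have h2 : S.N2 230 2 (fun X => nv (fun e => (S.x X * S.x X) e b)) :=
      N2.of_τ' (a := 0) (m := 1) (by norm_num) fun X hX => by
        have e : (fun e => (S.x X * S.x X) e b) = fun e => (S.x X * S.x X) b e := by
          ext e; exact xx_symm hX e b
        rw [abs_of_nonneg (nv_nonneg _), e]
        have := nv_row_xx hX b
        norm_num
        exact this
    refine (((S.n2_nv_r a).mul h2).mono (b := 483) (j := 5) (by norm_num) (by norm_num)).of_le fun X hX => ?_
    rw [abs_mul, abs_of_nonneg (nv_nonneg _), abs_of_nonneg (nv_nonneg _)]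
    exact abs_sum_mul_le_nv _ _
  rw [e]
  have t := (S.bd_vn.mul k1).neg
  exact ((t.mono_j (show (2:ℤ) + (1 + 2) ≤ 5 by norm_num)).add k2.bd).mono (by norm_num) (by norm_num)

/-- one half of the linear part of the drift of the cube -/
noncomputable def yc (X : Matrix (Fin n) (Fin n) ℝ) (a b : Fin n) : ℝ :=
  ∑ c, (S.Dg c * (S.x X a c * (S.x X * S.x X) c b) + S.η c * (S.x X a c * (S.K * S.x X) c b))

lemma bd_E_yc {a b : Fin n} (hab : a ≠ b) : S.Bd 535 3 (S.E fun X => S.yc X a b) := by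
  have e : (S.E fun X => S.yc X a b) =
      (∑ c, S.Dg c * (S.E fun X => S.x X a c * (S.x X * S.x X) c b))
      + S.η b * (∑ c, S.η c * S.E fun X => S.x X a c)
      - ∑ c, ∑ e, S.D c e * (S.η c * S.E fun X => S.x X a c * S.x X e b) := by
    simp only [← E_mul_left, ← E_add, ← E_sum, ← E_sub]
    refine E_congr fun X hX => ?_
    unfold yc
    rw [Finset.mul_sum, ← Finset.sum_add_distrib, ← Finset.sum_sub_distrib]
    refine Finset.sum_congr rfl fun c _ => ?_
    have : ∑ e, S.D c e * (S.η c * (S.x X a c * S.x X e b)) = S.η c * (S.x X a c * (S.D * S.x X) c b) := by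
      rw [Matrix.mul_apply, Finset.mul_sum, Finset.mul_sum]
      exact Finset.sum_congr rfl fun e _ => by ring
    rw [this, Kx_apply hX]
    ring
  rw [e]
  have k1 : S.Bd 529 (1 + 2) (∑ c, S.Dg c * (S.E fun X => S.x X a c * (S.x X * S.x X) c b)) := by
    refine (Bd.sum_except (a := 527) (b := 5) b (fun e he => ?_) ?_).mono (by norm_num) le_rfl
    · exact ((bd_Dg e).mul (S.bd_E_x_sq a he)).mono (by norm_num) (by norm_num)
    · have i1 : S.Bd 0 2 (S.E fun X => S.x X a b * (S.x X * S.x X) b b) := (P0.n1 fun X hX =>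
        ((bd_x hX a b).mul (bd_xx hX b b)).mono (by norm_num) (by norm_num)).bd
      exact ((bd_Dg b).mul i1).mono (by norm_num) (by norm_num)
  have k2 : S.Bd 258 (0 + 2) (∑ c, S.η c * S.E fun X => S.x X a c) :=
    Bd.sum fun c => ((bd_η c).mul (S.bd_E_x a c)).mono (by norm_num) (by norm_num)
  have k2' : S.Bd 259 3 (S.η b * ∑ c, S.η c * S.E fun X => S.x X a c) :=
    ((bd_η b).mul k2).mono (by norm_num) (by norm_num)
  have k3 : S.Bd 262 (0 + 2) (∑ c, ∑ e, S.D c e * (S.η c * S.E fun X => S.x X a c * S.x X e b)) := by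
    refine (Bd.D_sum2 (a := 260) (b := 260) b a (fun c e h => ?_) ?_).mono (by norm_num) le_rfl
    · have : S.Bd 259 (-1) (S.E fun X => S.x X a c * S.x X e b) := S.bd_E_xx (by unfold dist2; grind)
      exact ((bd_η c).mul this).mono (by norm_num) (by norm_num)
    · have i1 : S.Bd 0 0 (S.E fun X => S.x X a b * S.x X a b) :=
        (P0.n1 fun X hX => ((bd_x hX a b).mul (bd_x hX a b)).mono (by norm_num) (by norm_num)).bd
      exact ((bd_η b).mul i1).mono (by norm_num) (by norm_num)
  exact ((k1.add k2').sub (k3.mono_j (show (0:ℤ) + 2 ≤ 1 + 2 by norm_num))).mono (by norm_num) (by norm_num)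

lemma bd_E_κθ {a b : Fin n} (hab : a ≠ b) : S.Bd 290 5 (∑ c, ∑ e,
    (S.κ c e * (S.E fun X => S.x X a c * S.x X c e * S.x X e b)
      + (S.K c e * S.θ c e) * (S.E fun X => S.x X a c * S.x X e b))) := by
  have b2 : ∀ c e, S.Bd 7 2 (S.K c e * S.θ c e) := fun c e =>
    ((bd_K c e).mul (bd_θ c e)).mono (by norm_num) (by norm_num)
  have t1 : ∀ c e, S.Bd 0 0 (S.E fun X => S.x X a c * S.x X c e * S.x X e b) := fun c e =>
    (P0.n1 fun X hX => (((bd_x hX a c).mul (bd_x hX c e)).mul (bd_x hX e b)).mono (by norm_num) (by norm_num)).bd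
  have t2 : ∀ c e, S.Bd 0 0 (S.E fun X => S.x X a c * S.x X e b) := fun c e =>
    (P0.n1 fun X hX => ((bd_x hX a c).mul (bd_x hX e b)).mono (by norm_num) (by norm_num)).bd
  have triv : ∀ c e, S.Bd 10 2 (S.κ c e * (S.E fun X => S.x X a c * S.x X c e * S.x X e b)
      + (S.K c e * S.θ c e) * (S.E fun X => S.x X a c * S.x X e b)) := fun c e =>
    (((bd_κ c e).mul (t1 c e)).add ((b2 c e).mul (t2 c e))).mono (by norm_num) (by norm_num)
  refine (Bd.sum_except (a := 280) (b := 20) (j := 3) b (fun c hc => ?_)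
    (Bd.mono (Bd.sum (triv b)) (by norm_num) (by norm_num))).mono (by norm_num) (by norm_num)
  refine (Bd.sum_except (a := 275) (b := 20) (j := 1) a (fun e he => ?_)
    ((triv c a).mono (by norm_num) (by norm_num))).mono (by norm_num) (by norm_num)
  have h1 : S.Bd 263 (-1) (S.E fun X => S.x X a c * S.x X c e * S.x X e b) :=
    S.bd_E_xxx (by unfold dist2; grind) (by unfold dist2; grind) (by unfold dist2; grind)
  have h2 : S.Bd 259 (-1) (S.E fun X => S.x X a c * S.x X e b) := S.bd_E_xx (by unfold dist2; grind)
  exact (((bd_κ c e).mul h1).add ((b2 c e).mul h2)).mono (by norm_num) (by norm_num)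

lemma bd_E_xBx {a b : Fin n} (hab : a ≠ b) : S.Bd 540 5 (S.E fun X => (S.x X * S.B X * S.x X) a b) := by
  have e : (S.E fun X => (S.x X * S.B X * S.x X) a b) =
      -(S.v * n * ((S.E fun X => S.yc X a b) + (S.E fun X => S.yc X b a)))
      + (∑ c, ∑ e, (S.κ c e * (S.E fun X => S.x X a c * S.x X c e * S.x X e b)
      + (S.K c e * S.θ c e) * (S.E fun X => S.x X a c * S.x X e b)))
      + S.E fun X => ∑ c, ∑ e, S.x X a c * (S.x X c e * S.ρU X c e + S.K c e * (S.ρV X c e + (S.x X * S.x X * S.x X) c e))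
      * S.x X e b := by
    simp only [← E_mul_left, ← E_add, ← E_sum, ← E_neg]
    refine E_congr fun X hX => ?_
    have h1 : (S.x X * S.B X * S.x X) a b = ∑ c, ∑ e, S.x X a c * S.B X c e * S.x X e b := by
      rw [Matrix.mul_apply, Finset.sum_comm]
      simp only [Matrix.mul_apply, Finset.sum_mul]
    have h2 : S.yc X a b = ∑ c, ∑ e, S.x X a c * (S.Dg c * S.x X c e + S.η c * S.K c e) * S.x X e b := by
      unfold yc
      refine Finset.sum_congr rfl fun c _ => ?_
      simp only [Matrix.mul_apply, Finset.mul_sum]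
      rw [← Finset.sum_add_distrib]
      exact Finset.sum_congr rfl fun e _ => by ring
    have h3 : S.yc X b a = ∑ c, ∑ e, S.x X a c * (S.Dg e * S.x X c e + S.η e * S.K c e) * S.x X e b := by
      rw [Finset.sum_comm]
      unfold yc
      refine Finset.sum_congr rfl fun c _ => ?_
      simp only [Matrix.mul_apply, Finset.mul_sum]
      rw [← Finset.sum_add_distrib]
      exact Finset.sum_congr rfl fun e _ => by rw [x_symm hX b c, x_symm hX c e, x_symm hX e a, S.K_symm c e]; ring
    rw [h1, h2, h3, ← Finset.sum_add_distrib, Finset.mul_sum, ← Finset.sum_neg_distrib, ← Finset.sum_add_distrib,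
      ← Finset.sum_add_distrib]
    refine Finset.sum_congr rfl fun c _ => ?_
    rw [← Finset.sum_add_distrib, Finset.mul_sum, ← Finset.sum_neg_distrib, ← Finset.sum_add_distrib,
      ← Finset.sum_add_distrib]
    refine Finset.sum_congr rfl fun e _ => ?_
    rw [B_apply hX]
    unfold z r
    ring
  rw [e]
  have k1 := (S.bd_vn.mul ((S.bd_E_yc hab).add (S.bd_E_yc hab.symm))).neg
  have k2 := S.bd_E_κθ hab
  have k3 := (S.n1_xrx a b).bd
  exact (((k1.mono_j (show (2:ℤ) + 3 ≤ 5 by norm_num)).add k2).add k3).mono (by norm_num) (by norm_num)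

section mem
variable {S} {X : Matrix (Fin n) (Fin n) ℝ} (hX : X ∈ S.Ω)
include hX

lemma xxB_apply (a b : Fin n) : (S.x X * S.x X * S.B X) a b = (S.B X * (S.x X * S.x X)) b a := by
  have hB : (S.B X).transpose = S.B X := by ext i j; exact B_symm hX j i
  rw [← Matrix.transpose_apply (S.B X * _), Matrix.transpose_mul, Matrix.transpose_mul, x_transpose hX, hB]

lemma XY_apply (a e : Fin n) : (X * S.Y X) a e = S.v * n + (S.u * (S.η a - (S.x X * S.D) a e)
    - (S.x X * S.x X) a e + S.v * (-S.Dg a - S.Dg e + (S.D * S.D) a e) - S.l * (S.η e - (S.D * S.x X) a e)) := by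
  have h1 : X = S.x X + S.l • S.K := by unfold x; simp
  have h2 : S.Y X = S.u • S.K - S.x X := by
    unfold Y x u; ext i j; simp [sub_mul]
  have h3 : X * S.Y X = S.u • (S.x X * S.K) - S.x X * S.x X + (S.l * S.u) • (S.K * S.K) - S.l • (S.K * S.x X) := by
    calc X * S.Y X = (S.x X + S.l • S.K) * (S.u • S.K - S.x X) := by rw [← h1, ← h2]
      _ = _ := ?_
    rw [add_mul, mul_sub, mul_sub, Matrix.mul_smul, Matrix.mul_smul, Matrix.smul_mul, Matrix.smul_mul, smul_smul]
    rw [mul_comm S.u S.l]; abel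
  rw [h3]
  simp only [Matrix.add_apply, Matrix.sub_apply, Matrix.smul_apply, smul_eq_mul, K2_apply, xK_apply hX, Kx_apply hX]
  unfold v
  ring

lemma abs_swD_mul_swD_le {N : Matrix (Fin n) (Fin n) ℝ} {C : ℝ} (hN : ∀ i j, |N i j| ≤ C) (a b c d p q : Fin n) :
    |(swD a b c d * N * swD a b c d) p q| ≤ 16 * C * (hit a b c d p * hit a b c d q) := by
  have hC : 0 ≤ C := (abs_nonneg _).trans (hN p q)
  have h0 := hit_nonneg a b c d p
  rw [Matrix.mul_apply]
  refine (Finset.abs_sum_le_sum_abs _ _).trans ?_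
  calc ∑ j, |(swD a b c d * N) p j * swD a b c d j q| ≤ ∑ j, (4 * C * hit a b c d p) * |swD a b c d q j| := by
        refine Finset.sum_le_sum fun j _ => ?_
        rw [abs_mul]
        have e : swD a b c d j q = swD a b c d q j := by
          conv_lhs => rw [← (swD_symm a b c d).eq]
          rfl
        rw [e]
        exact mul_le_mul_of_nonneg_right (abs_swD_mul_le hX hN a b c d p j) (abs_nonneg _)
    _ ≤ (4 * C * hit a b c d p) * (4 * hit a b c d q) := by
        rw [← Finset.mul_sum]
        exact mul_le_mul_of_nonneg_left (sum_abs_swD_le a b c d q) (by positivity)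
    _ = _ := by ring

lemma W_ssx (a b : Fin n) : S.W X (fun e f g h => (swD e f g h * swD e f g h * S.x X) a b) =
    8 * ∑ e, S.M X a e * (S.x X a b - S.x X e b) := by
  rw [← sum_W_swD_sq_mul hX a (fun e => S.x X e b)]
  simp only [Matrix.mul_apply (M := swD _ _ _ _ * swD _ _ _ _), W_sum]
  refine Finset.sum_congr rfl fun e _ => ?_
  rw [← W_mul_right]

lemma W_xss (a b : Fin n) : S.W X (fun e f g h => (S.x X * (swD e f g h * swD e f g h)) a b) =
    8 * ∑ e, S.M X b e * (S.x X b a - S.x X e a) := by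
  rw [← W_ssx hX]
  congr 1
  ext e f g h
  rw [← Matrix.transpose_apply (swD e f g h * _ * _), Matrix.transpose_mul, Matrix.transpose_mul, x_transpose hX,
    (swD_symm e f g h).eq]

lemma xxx_add_sub (Z : Matrix (Fin n) (Fin n) ℝ) (a b : Fin n) :
    (S.x (X + Z) * S.x (X + Z) * S.x (X + Z)) a b - (S.x X * S.x X * S.x X) a b =
      (Z * (S.x X * S.x X)) a b + ∑ e, (S.x X * Z) a e * S.x X e b + (S.x X * S.x X * Z) a b
      + (Z * Z * S.x X) a b + (S.x X * (Z * Z)) a b + (Z * S.x X * Z) a b + (Z * Z * Z) a b := by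
  rw [x_add, ← Matrix.mul_apply]
  simp only [mul_add, add_mul, Matrix.add_apply, mul_assoc]
  ring

lemma W_xxx (a b : Fin n) : S.W X (fun e f g h =>
    (S.x (X + swD e f g h) * S.x (X + swD e f g h) * S.x (X + swD e f g h)) a b - (S.x X * S.x X * S.x X) a b) =
    -12 * (S.v * (n:ℝ)^2) * (S.x X * S.x X * S.x X) a b
      + (-4 * ((S.B X * (S.x X * S.x X)) a b + (S.x X * S.B X * S.x X) a b + (S.B X * (S.x X * S.x X)) b a)
      + 8 * (∑ e, S.M X a e * (S.x X a b - S.x X e b) + ∑ e, S.M X b e * (S.x X b a - S.x X e a))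
      + S.W X (fun e f g h => (swD e f g h * S.x X * swD e f g h) a b)
      + S.W X (fun e f g h => (swD e f g h * swD e f g h * swD e f g h) a b)) := by
  simp only [xxx_add_sub hX, W_add, W_swD_mul hX, W_mul_swD hX, W_ssx hX, W_xss hX, W_sum, W_mul_right, xxB_apply hX]
  have h1 : ∑ e, -4 * (S.v * (n:ℝ)^2 * (S.x X * S.x X) a e + (S.x X * S.B X) a e) * S.x X e b =
      -4 * (S.v * (n:ℝ)^2) * (S.x X * S.x X * S.x X) a b + -4 * (S.x X * S.B X * S.x X) a b := by
    rw [Matrix.mul_apply (M := S.x X * S.x X), Matrix.mul_apply (M := S.x X * S.B X), Finset.mul_sum, Finset.mul_sum,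
      ← Finset.sum_add_distrib]
    exact Finset.sum_congr rfl fun e _ => by ring
  rw [h1, ← mul_assoc (S.x X) (S.x X) (S.x X)]
  ring
end mem

lemma n2_XY {a e : Fin n} (h : a ≠ e) : S.N2 262 1 (fun X => (X * S.Y X) a e - S.v * n) := by
  have h1 : S.P0 5 1 (fun X => (S.u * (S.η a - (S.x X * S.D) a e)
    + S.v * (-S.Dg a - S.Dg e + (S.D * S.D) a e) - S.l * (S.η e - (S.D * S.x X) a e))) := fun X hX => by
    have i1 := bd_u.mul ((bd_η a).sub ((Bd.mul_D (bd_x hX) a e).mono_j (show (0:ℤ) + 1 ≤ 1 by norm_num)))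
    have i2 := bd_l.mul ((bd_η e).sub ((Bd.D_mul (bd_x hX) a e).mono_j (show (0:ℤ) + 1 ≤ 1 by norm_num)))
    have i3 := bd_v.mul (((bd_Dg a).neg.sub (bd_Dg e)).add ((Bd.mul_D (bd_D (S := S)) a e).mono_j (show (0:ℤ) + 1 ≤ 1 by norm_num)))
    exact ((i1.add i3).sub i2).mono (by norm_num) (by norm_num)
  refine ((h1.n2.sub (S.n2_xx h)).mono (b := 262) (j := 1) (by norm_num) le_rfl).of_le fun X hX => le_of_eq ?_
  rw [XY_apply hX]; congr 1; ring

lemma n1_M {a e : Fin n} (h : a ≠ e) : S.N1 526 3 (fun X => S.M X a e - (S.v * n) ^ 2) := by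
  have h1 := ((S.n2_XY h).n1.add (S.n2_XY h.symm).n1).const_mul S.bd_vn
  have h2 := (S.n2_XY h).mul (S.n2_XY h.symm)
  have h3 : S.N1 524 3 (fun X => ((X * S.Y X) a e - S.v * n) * ((X * S.Y X) e a - S.v * n)) :=
    h2.mono (by norm_num) (by norm_num)
  refine (((h1.mono le_rfl (show (2:ℤ) + 1 ≤ 3 by norm_num)).add h3).mono (b := 526) (j := 3) (by norm_num) le_rfl).of_le fun X hX => le_of_eq ?_
  unfold M
  rw [← XY_transpose hX]; congr 1; ring

lemma bd_E_Mx (a b : Fin n) : S.Bd 530 5 (S.E fun X => ∑ e, S.M X a e * (S.x X a b - S.x X e b)) := by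
  have e : (S.E fun X => ∑ e, S.M X a e * (S.x X a b - S.x X e b)) =
      (S.v * n) ^ 2 * (n * (S.E fun X => S.x X a b) - S.η b)
      + S.E fun X => ∑ e, (S.M X a e - (S.v * n) ^ 2) * (S.x X a b - S.x X e b) := by
    rw [← E_mul_left, ← S.E_const (S.η b), ← E_sub, ← E_mul_left, ← E_add]
    refine E_congr fun X hX => ?_
    have : ∑ e, (S.x X a b - S.x X e b) = n * S.x X a b - S.η b := by
      rw [Finset.sum_sub_distrib, x_col hX]; simp
    rw [← this, Finset.mul_sum, ← Finset.sum_add_distrib]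
    exact Finset.sum_congr rfl fun e _ => by ring
  have k1 : S.N1 528 (3 + 2) (fun X => ∑ e, (S.M X a e - (S.v * n) ^ 2) * (S.x X a b - S.x X e b)) := by
    refine N1.sum fun e => ?_
    by_cases h : a = e
    · subst h
      refine P0.n1 fun X hX => ?_
      rw [sub_self, mul_zero]; exact bd_zero _ _
    · exact ((S.n1_M h).mul_P0 (b := 1) (j := 0) fun X hX =>
        ((bd_x hX a b).sub (bd_x hX e b)).mono (by norm_num) (by norm_num)).mono (by norm_num) (by norm_num)
  have k2 : S.Bd 260 5 ((S.v * n) ^ 2 * (n * (S.E fun X => S.x X a b) - S.η b)) := by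
    rw [sq]
    have t := (S.bd_vn.mul S.bd_vn).mul (((bd_n (S := S)).mul (S.bd_E_x a b)).sub ((bd_η b).mono_j (show (1:ℤ) ≤ 2 + -1 by norm_num)))
    exact t.mono (by norm_num) (by norm_num)
  rw [e]
  exact (k2.add (k1.bd.mono_j (show (3:ℤ) + 2 ≤ 5 by norm_num))).mono (by norm_num) (by norm_num)

lemma bd_E_cube {a b : Fin n} (hab : a ≠ b) : S.Bd 550 1 (S.E fun X => (S.x X * S.x X * S.x X) a b) := by
  have k4 := S.bd_W_hit2 hab (c := 1) (j := 0) (f := fun X e f g h => (swD e f g h * S.x X * swD e f g h) a b)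
    (fun X hX e f g h => by
      refine (abs_swD_mul_swD_le hX (x_abs_le hX) e f g h a b).trans ?_
      have := S.hL
      refine mul_le_mul_of_nonneg_right ?_ (mul_nonneg (hit_nonneg _ _ _ _ _) (hit_nonneg _ _ _ _ _))
      simp; linarith)
  have k5 := S.bd_W_hit2 hab (c := 1) (j := 0) (f := fun X e f g h => (swD e f g h * swD e f g h * swD e f g h) a b)
    (fun X hX e f g h => by
      refine (abs_swD_mul_swD_le hX (abs_swD_le_16 hX e f g h) e f g h a b).trans ?_
      have := S.hL
      refine mul_le_mul_of_nonneg_right ?_ (mul_nonneg (hit_nonneg _ _ _ _ _) (hit_nonneg _ _ _ _ _))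
      simp; linarith)
  refine (Bd.gain (a := 549) (R := fun X =>
      (-4 * ((S.B X * (S.x X * S.x X)) a b + (S.x X * S.B X * S.x X) a b + (S.B X * (S.x X * S.x X)) b a)
      + 8 * (∑ e, S.M X a e * (S.x X a b - S.x X e b) + ∑ e, S.M X b e * (S.x X b a - S.x X e a))
      + S.W X (fun e f g h => (swD e f g h * S.x X * swD e f g h) a b)
      + S.W X (fun e f g h => (swD e f g h * swD e f g h * swD e f g h) a b))) 3 (by norm_num) ?_ ?_)
  · intro X hX
    rw [W_xxx hX]; ring
  · rw [E_add, E_add, E_add, E_mul_left, E_mul_left, E_add, E_add, E_add]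
    have t : S.Bd 1 0 (-4 : ℝ) := bd_thousand (by norm_num)
    have t' : S.Bd 1 0 (8 : ℝ) := bd_thousand (by norm_num)
    have i1 := t.mul (((S.bd_E_Bxx hab).add (S.bd_E_xBx hab)).add (S.bd_E_Bxx hab.symm))
    have i2 := t'.mul ((S.bd_E_Mx a b).add (S.bd_E_Mx b a))
    have i3 := k4.bd.mono_j (show (0:ℤ) + 4 ≤ 0 + 5 by norm_num)
    have i4 := k5.bd.mono_j (show (0:ℤ) + 4 ≤ 0 + 5 by norm_num)
    exact (((i1.add i2).add i3).add i4).mono (by norm_num) (by norm_num)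

end Setup

namespace Setup
variable {n : ℕ} (S : Setup n)

lemma bd_E_P0 {φ : Matrix (Fin n) (Fin n) ℝ → ℝ} {a : ℕ} {j : ℤ} (h : ∀ X ∈ S.Ω, S.Bd a j (φ X)) :
    S.Bd a j (S.E φ) := (P0.n1 h).bd

lemma bd_E_x_DxD {a b : Fin n} (hab : a ≠ b) (hD : S.D a b = 0) :
    S.Bd 263 1 (S.E fun X => S.x X a b * (S.D * S.x X * S.D) a b) := by
  have t0 : S.Bd 0 0 (S.E fun X => S.x X a b * S.x X a b) := S.bd_E_P0 fun X hX =>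
    ((bd_x hX a b).mul (bd_x hX a b)).mono (by norm_num) (by norm_num)
  let f : Fin n → Fin n → ℝ := fun c e => if (c = a ∧ e = b) ∨ (c = b ∧ e = a) then 0 else
    S.E fun X => S.x X a b * S.x X c e
  have hf : ∀ c e, S.Bd 259 (-1) (f c e) := by
    intro c e
    simp only [f]
    split_ifs with h
    · exact bd_zero _ _
    · exact S.bd_E_xx (by unfold dist2; grind)
  have e1 : (S.E fun X => S.x X a b * (S.D * S.x X * S.D) a b) =
      (S.E fun X => S.x X a b * S.x X a b) + ∑ c, S.D a c * ∑ e, S.D b e * f c e := by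
    have h1 : ∀ c e, S.D a c * (S.D b e * (S.E fun X => S.x X a b * S.x X c e)) =
        S.D a c * (S.D b e * f c e) +
          (if c = a then (if e = b then (S.E fun X => S.x X a b * S.x X a b) else 0) else 0) := by
      intro c e
      simp only [f]
      by_cases h : c = a ∧ e = b
      · rw [h.1, h.2]; simp [S.hD1]
      · by_cases h' : c = b ∧ e = a
        · rw [h'.1, h'.2, hD]; simp [hab.symm]
        · have : ¬ ((c = a ∧ e = b) ∨ (c = b ∧ e = a)) := by tauto
          rw [if_neg this]
          by_cases hc : c = a
          · have : e ≠ b := fun he => h ⟨hc, he⟩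
            simp [this]
          · simp [hc]
    have h2 : (S.E fun X => S.x X a b * (S.D * S.x X * S.D) a b) =
        ∑ c, ∑ e, S.D a c * (S.D b e * (S.E fun X => S.x X a b * S.x X c e)) := by
      simp only [← E_mul_left, ← E_sum]
      congr 1; ext X
      rw [Finset.sum_comm, Matrix.mul_apply, Finset.mul_sum]
      refine Finset.sum_congr rfl fun e _ => ?_
      rw [Matrix.mul_apply, Finset.sum_mul, Finset.mul_sum]
      refine Finset.sum_congr rfl fun c _ => ?_
      rw [S.hDs e b]; ring
    rw [h2]
    simp only [h1, Finset.sum_add_distrib, Finset.mul_sum]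
    rw [add_comm]
    congr 1
    simp
  rw [e1]
  have t1 : S.Bd 261 (-1 + 1 + 1) (∑ c, S.D a c * ∑ e, S.D b e * f c e) :=
    Bd.D_sum (fun c => Bd.D_sum (hf c) b) a
  exact ((t0.mono_j (show (0:ℤ) ≤ 1 by norm_num)).add (t1.mono_j (show (-1:ℤ) + 1 + 1 ≤ 1 by norm_num))).mono
    (by norm_num) (by norm_num)

lemma bd_E_x_xxD {a b : Fin n} (hD : S.D a b = 0) :
    S.Bd 527 1 (S.E fun X => S.x X a b * (S.x X * S.x X * S.D) a b) := by
  let f : Fin n → ℝ := fun e => if e = a then 0 else S.E fun X => S.x X b a * (S.x X * S.x X) a e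
  have hf : ∀ e, S.Bd 526 0 (f e) := by
    intro e
    simp only [f]
    split_ifs with h
    · exact bd_zero _ _
    · exact S.bd_E_x_sq b (Ne.symm h)
  have e1 : (S.E fun X => S.x X a b * (S.x X * S.x X * S.D) a b) = ∑ e, S.D b e * f e := by
    have h1 : ∀ e, S.D b e * f e = S.D b e * S.E fun X => S.x X b a * (S.x X * S.x X) a e := by
      intro e
      by_cases h : e = a
      · rw [h, S.hDs b a, hD, zero_mul, zero_mul]
      · simp [f, h]
    simp only [h1, ← E_mul_left, ← E_sum]
    refine E_congr fun X hX => ?_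
    rw [Matrix.mul_apply, Finset.mul_sum]
    refine Finset.sum_congr rfl fun e _ => ?_
    rw [S.hDs e b, x_symm hX a b]; ring
  rw [e1]
  exact (Bd.D_sum hf b).mono (by norm_num) (by norm_num)

lemma bd_E_x_Dxx {a b : Fin n} (hD : S.D a b = 0) :
    S.Bd 527 1 (S.E fun X => S.x X a b * (S.D * (S.x X * S.x X)) a b) := by
  have := S.bd_E_x_xxD (a := b) (b := a) (by rw [S.hDs, hD])
  rwa [E_congr (g := fun X => S.x X a b * (S.D * (S.x X * S.x X)) a b)] at this
  intro X hX
  rw [x_symm hX b a, Matrix.mul_apply, Matrix.mul_apply]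
  congr 1
  refine Finset.sum_congr rfl fun e _ => ?_
  rw [S.hDs e a, xx_symm hX b e]; ring

lemma bd_E_x_xDx {a b : Fin n} (hab : a ≠ b) :
    S.Bd 265 1 (S.E fun X => S.x X a b * (S.x X * S.D * S.x X) a b) := by
  let f : Fin n → Fin n → ℝ := fun c e => if c = b ∨ e = a then 0 else
    S.E fun X => S.x X a b * S.x X a c * S.x X e b
  have hf : ∀ c e, S.Bd 263 (-1) (f c e) := by
    intro c e
    simp only [f]
    split_ifs with h
    · exact bd_zero _ _
    · exact S.bd_E_xxx (by unfold dist2; grind) (by unfold dist2; grind) (by unfold dist2; grind)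
  have e1 : (S.E fun X => S.x X a b * (S.x X * S.D * S.x X) a b) = ∑ c, ∑ e, S.D c e * f c e := by
    have h1 : ∀ c e, S.D c e * f c e = S.E fun X => S.D c e * (S.x X a b * S.x X a c * S.x X e b) := by
      intro c e
      by_cases h : c = b ∨ e = a
      · simp only [f, if_pos h, mul_zero]
        rw [E_congr (g := fun _ => 0), E_const]
        intro X hX
        rcases h with h | h
        · have := x_mul_D hX e b
          rw [h, S.hDs b e]; linear_combination S.x X a b * S.x X a b * this
        · have := x_mul_D hX a c
          rw [h, S.hDs c a]; linear_combination S.x X a b * S.x X a b * this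
      · simp only [f, if_neg h, E_mul_left]
    simp only [h1, ← E_sum]
    refine E_congr fun X hX => ?_
    rw [Finset.sum_comm, Matrix.mul_apply, Finset.mul_sum]
    refine Finset.sum_congr rfl fun e _ => ?_
    rw [Matrix.mul_apply, Finset.sum_mul, Finset.mul_sum]
    exact Finset.sum_congr rfl fun c _ => by ring
  rw [e1]
  exact (Bd.D_sum2 (a := 263) (b := 263) (j := -1) b b (fun c e _ => hf c e)
    ((hf b b).mono_j (by norm_num))).mono (by norm_num) (by norm_num)

lemma bd_E_DxD (a b : Fin n) : S.Bd 259 1 (S.E fun X => (S.D * S.x X * S.D) a b) := by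
  have e1 : (S.E fun X => (S.D * S.x X * S.D) a b) =
      ∑ c, S.D a c * ∑ e, S.D b e * S.E fun X => S.x X c e := by
    simp only [← E_mul_left, ← E_sum]
    congr 1; ext X
    simp only [Finset.mul_sum]
    rw [Finset.sum_comm, Matrix.mul_apply]
    refine Finset.sum_congr rfl fun e _ => ?_
    rw [Matrix.mul_apply, Finset.sum_mul]
    refine Finset.sum_congr rfl fun c _ => ?_
    rw [S.hDs e b]; ring
  rw [e1]
  exact (Bd.D_sum (fun c => Bd.D_sum (S.bd_E_x c) b) a).mono (by norm_num) (by norm_num)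

lemma bd_E_xDD (a b : Fin n) : S.Bd 259 1 (S.E fun X => (S.x X * (S.D * S.D)) a b) := by
  have e1 : (S.E fun X => (S.x X * (S.D * S.D)) a b) =
      ∑ c, S.D b c * ∑ e, S.D c e * S.E fun X => S.x X a e := by
    simp only [← E_mul_left, ← E_sum]
    congr 1; ext X
    simp only [Finset.mul_sum]
    rw [← Matrix.mul_assoc, Matrix.mul_apply]
    refine Finset.sum_congr rfl fun e _ => ?_
    rw [Matrix.mul_apply, Finset.sum_mul]
    refine Finset.sum_congr rfl fun c _ => ?_
    rw [S.hDs e b, S.hDs c e]; ring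
  rw [e1]
  exact (Bd.D_sum (fun c => Bd.D_sum (S.bd_E_x a) c) b).mono (by norm_num) (by norm_num)

lemma bd_E_DDx (a b : Fin n) : S.Bd 259 1 (S.E fun X => ((S.D * S.D) * S.x X) a b) := by
  have := S.bd_E_xDD b a
  rwa [E_congr (g := fun X => ((S.D * S.D) * S.x X) a b)] at this
  intro X hX
  have e : (S.x X * (S.D * S.D)).transpose = (S.D * S.D) * S.x X := by
    rw [Matrix.transpose_mul, Matrix.transpose_mul, x_transpose hX, D_transpose]
  rw [← e, Matrix.transpose_apply]

lemma bd_E_q (a : Fin n) : S.Bd 258 1 (S.E fun X => S.q X a) := by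
  have e1 : (S.E fun X => S.q X a) = ∑ b, S.Dg b * S.E fun X => S.x X a b := by
    simp only [← E_mul_left, ← E_sum]
    congr 1; ext X
    exact Finset.sum_congr rfl fun e _ => by ring
  rw [e1]
  unfold Bd
  refine (Finset.abs_sum_le_sum_abs _ _).trans ?_
  calc _ ≤ ∑ b, S.Dg b * (S.L ^ 257 * S.s ^ (-1 : ℤ)) := Finset.sum_le_sum fun b _ => by
        rw [abs_mul, abs_of_nonneg (Dg_nonneg b)]
        exact mul_le_mul_of_nonneg_left (S.bd_E_x a b) (Dg_nonneg b)
    _ = S.tot * (S.L ^ 257 * S.s ^ (-1 : ℤ)) := by rw [← Finset.sum_mul]; rfl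
    _ ≤ S.L * S.s ^ 2 * (S.L ^ 257 * S.s ^ (-1 : ℤ)) := by
        have := S.htot
        rw [← S.s_sq] at this
        exact mul_le_mul_of_nonneg_right this (scale_pos S _ _).le
    _ = _ := by
        have := S.s_pos.ne'
        rw [zpow_neg_one, zpow_one]; field_simp

lemma bd_E_xDx {a b : Fin n} (hab : a ≠ b) : S.Bd 261 1 (S.E fun X => (S.x X * S.D * S.x X) a b) := by
  have e1 : (S.E fun X => (S.x X * S.D * S.x X) a b) =
      ∑ c, ∑ e, S.D c e * S.E fun X => S.x X a c * S.x X e b := by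
    simp only [← E_mul_left, ← E_sum]
    congr 1; ext X
    rw [Finset.sum_comm, Matrix.mul_apply]
    refine Finset.sum_congr rfl fun e _ => ?_
    rw [Matrix.mul_apply, Finset.sum_mul]
    exact Finset.sum_congr rfl fun c _ => by ring
  rw [e1]
  refine (Bd.D_sum2 (a := 259) (b := 0) (j := -1) b a (fun c e h => ?_) ?_).mono (by norm_num) (by norm_num)
  · exact S.bd_E_xx (by unfold dist2; grind)
  · exact (S.bd_E_P0 fun X hX => ((bd_x hX a b).mul (bd_x hX a b)).mono le_rfl (by norm_num))

/-- the random part of the remainder -/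
noncomputable def rr (X : Matrix (Fin n) (Fin n) ℝ) (a b : Fin n) : ℝ :=
  S.κ a b * S.x X a b + S.x X a b * S.ρU X a b + (S.ρV X a b + (S.x X * S.x X * S.x X) a b)

lemma bd_E_rr {a b : Fin n} (hab : a ≠ b) (hD : S.D a b = 0) : S.Bd 560 1 (S.E fun X => S.rr X a b) := by
  have pb : S.Bd 520 1 (S.E fun X => S.x X a b * S.p X b) := by
    have := S.bd_E_x_p hab.symm
    rwa [E_congr fun X hX => by rw [x_symm hX b a]] at this
  have e1 : (S.E fun X => S.rr X a b) =
      (S.κ a b * (S.E fun X => S.x X a b))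
      + ((S.u - S.l) * (S.E fun X => S.x X a b * (S.D * S.x X * S.D) a b)
        - (S.E fun X => S.x X a b * S.p X a) - (S.E fun X => S.x X a b * S.p X b)
        + (S.E fun X => S.x X a b * (S.x X * S.x X * S.D) a b)
        + (S.E fun X => S.x X a b * (S.D * (S.x X * S.x X)) a b)
        - (S.E fun X => S.x X a b * (S.x X * S.D * S.x X) a b))
      + (S.v * ((S.E fun X => (S.D * S.x X * S.D) a b) + (S.E fun X => S.q X a) + (S.E fun X => S.q X b)
          - (S.E fun X => (S.x X * (S.D * S.D)) a b) - (S.E fun X => ((S.D * S.D) * S.x X) a b))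
        - (S.l - S.u) * (S.E fun X => (S.x X * S.D * S.x X) a b))
      + (S.E fun X => (S.x X * S.x X * S.x X) a b) := by
    simp only [← E_mul_left, ← E_add, ← E_sub]
    congr 1; ext X
    unfold rr ρU ρV; ring
  rw [e1]
  have a1 := ((bd_κ a b).mul (S.bd_E_x a b)).mono_j (show (2:ℤ) + -1 ≤ 1 by norm_num)
  have a2 := (bd_u_sub_l (S := S).mul (S.bd_E_x_DxD hab hD)).mono_j (show (0:ℤ) + 1 ≤ 1 by norm_num)
  have a3 := ((((a2.sub (S.bd_E_x_p hab)).sub pb).add (S.bd_E_x_xxD hD)).add (S.bd_E_x_Dxx hD)).sub (S.bd_E_x_xDx hab)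
  have a4 := (bd_v (S := S).mul (((((S.bd_E_DxD a b).add ((S.bd_E_q a).mono (b := 259) (by norm_num) le_rfl)).add
    (S.bd_E_q b)).sub (S.bd_E_xDD a b)).sub (S.bd_E_DDx a b))).mono_j (show (0:ℤ) + 1 ≤ 1 by norm_num)
  have a5 := (bd_l_sub_u (S := S).mul (S.bd_E_xDx hab)).mono_j (show (0:ℤ) + 1 ≤ 1 by norm_num)
  exact (((a1.add a3).add (a4.sub a5)).add (S.bd_E_cube hab)).mono (by norm_num) (by norm_num)

lemma bd_inv_v : S.Bd 1 0 (1 / S.v) := bd_L (by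
  rw [abs_of_pos (one_div_pos.2 S.v_pos)]; exact S.inv_v_le)

lemma bd_inv_n : S.Bd 0 (-2) (1 / (n : ℝ)) := by
  unfold Bd
  rw [abs_of_nonneg (by positivity), ← S.s_sq]
  simp only [pow_zero, one_mul, one_div]
  exact le_of_eq rfl

/-- main term of the edge probability -/
noncomputable def mainT (a b : Fin n) : ℝ :=
  n * (S.η a + S.η b) + S.Dg a * S.η a + S.Dg b * S.η b - S.ηs + S.Dη a + S.Dη b
    + (S.u - S.l) / S.v * (S.η a * S.η b)

/-- expansion of the edge probability -/
theorem bd_E_main {a b : Fin n} (hab : a ≠ b) (hD : S.D a b = 0) :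
    S.Bd 570 1 ((n : ℝ) ^ 2 * (S.E fun X => S.x X a b) - S.mainT a b) := by
  have hK : S.K a b = 1 := by rw [K_apply, hD, sub_zero]
  have hst : S.E (fun X => S.v * (n:ℝ) ^ 2 * S.x X a b + S.B X a b) = 0 := by
    have h := S.E_stationary (fun X => X a b)
    rw [E_congr (g := fun X => -4 * (S.v * (n:ℝ) ^ 2 * S.x X a b + S.B X a b)) (fun X hX => by
      have := W_delta_mul_const hX a b 1
      simp only [mul_one, Matrix.add_apply, add_sub_cancel_left] at this ⊢
      exact this), E_mul_left] at h
    linarith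
  rw [E_congr (g := fun X => (S.v * (n:ℝ) ^ 2 - S.v * n * (S.Dg a + S.Dg b)) * S.x X a b
      - S.v * n * (S.η a + S.η b) + S.θ a b + S.rr X a b) (fun X hX => by
      rw [B_apply hX]; unfold z r rr; rw [hK]; ring)] at hst
  rw [E_add, E_add, E_sub, E_mul_left, E_const, E_const] at hst
  set e := S.E fun X => S.x X a b with he
  set P := S.E fun X => S.rr X a b with hP
  have hv := S.v_pos.ne'
  have hn : (n : ℝ) ≠ 0 := by have := S.n_ge_one; positivity
  have h1 : (n:ℝ) ^ 2 * e = n * (S.η a + S.η b) + n * (S.Dg a + S.Dg b) * e - 1 / S.v * S.θ a b - 1 / S.v * P := by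
    field_simp; linear_combination hst
  have h2 : n * e - (S.η a + S.η b) = (S.Dg a + S.Dg b) * e - 1 / (n:ℝ) * (1 / S.v * (S.θ a b + P)) := by
    have : (n:ℝ) * (n * e - (S.η a + S.η b)) = n * ((S.Dg a + S.Dg b) * e - 1 / (n:ℝ) * (1 / S.v * (S.θ a b + P))) := by
      have h3 : (n:ℝ) * (1 / (n:ℝ) * (1 / S.v * (S.θ a b + P))) = 1 / S.v * (S.θ a b + P) := by field_simp
      rw [mul_sub, mul_sub, h3]; linear_combination h1
    exact mul_left_cancel₀ hn this
  have bP : S.Bd 560 1 P := S.bd_E_rr hab hD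
  have b2 : S.Bd 564 0 (n * e - (S.η a + S.η b)) := by
    rw [h2]
    have c1 := (((bd_Dg a).add (bd_Dg b)).mul (S.bd_E_x a b)).mono_j (show (1:ℤ) + -1 ≤ 0 by norm_num)
    have c2 := (S.bd_inv_n.mul (S.bd_inv_v.mul ((bd_θ a b).add (bP.mono_j (show (1:ℤ) ≤ 2 by norm_num))))).mono_j
      (show (-2:ℤ) + (0 + 2) ≤ 0 by norm_num)
    exact (c1.sub c2).mono (by norm_num) le_rfl
  have e2 : (n:ℝ) ^ 2 * e - S.mainT a b = (S.Dg a + S.Dg b) * (n * e - (S.η a + S.η b)) - 1 / S.v * P := by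
    have e3 : 1 / S.v * S.θ a b = S.ηs - S.Dη a - S.Dη b + S.η a * S.Dg b + S.η b * S.Dg a
        - (S.u - S.l) / S.v * (S.η a * S.η b) := by
      unfold θ; field_simp; ring
    rw [h1, e3]; unfold mainT; ring
  rw [e2]
  have d1 := (((bd_Dg a).add (bd_Dg b)).mul b2).mono_j (show (1:ℤ) + 0 ≤ 1 by norm_num)
  have d2 := (S.bd_inv_v.mul bP).mono_j (show (0:ℤ) + 1 ≤ 1 by norm_num)
  exact (d1.sub d2).mono (by norm_num) le_rfl

end Setup

lemma abs_log_one_add_sub_le {t : ℝ} (ht : |t| ≤ 1 / 2) :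
    |Real.log (1 + t) - (t - t ^ 2 / 2)| ≤ 2 * |t| ^ 3 := by
  have h := Real.abs_log_sub_add_sum_range_le (x := -t) (by rw [abs_neg]; linarith) 2
  simp only [Finset.sum_range_succ, Finset.sum_range_zero, abs_neg, sub_neg_eq_add] at h
  norm_num at h
  have e : Real.log (1 + t) - (t - t ^ 2 / 2) = -t + t ^ 2 / 2 + Real.log (1 + t) := by ring
  rw [e]
  refine h.trans ?_
  rw [div_le_iff₀ (by linarith)]
  have := pow_nonneg (abs_nonneg t) 3
  nlinarith

namespace Setup
variable {n : ℕ} (S : Setup n)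

lemma bd_inv_l : S.Bd 1 0 (1 / S.l) := bd_L (by
  rw [abs_of_pos (one_div_pos.2 S.hl0)]
  refine le_trans (one_div_le_one_div_of_le S.v_pos ?_) S.inv_v_le
  unfold v; exact mul_le_of_le_one_right S.hl0.le S.u_le)

/-- second order expansion of the logarithm of the edge probability -/
noncomputable def logT (a b : Fin n) : ℝ :=
  (S.η a + S.η b) / (S.l * n) + (S.mainT a b - n * (S.η a + S.η b)) / (S.l * n ^ 2)
    - (S.η a + S.η b) ^ 2 / (2 * S.l ^ 2 * n ^ 2)

theorem log_E_X (hs : S.L ^ 300 ≤ S.s) {a b : Fin n} (hab : a ≠ b) (hD : S.D a b = 0) :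
    0 < (S.E fun X => X a b) ∧
    S.Bd 1000 (-3) (Real.log (S.E fun X => X a b) - Real.log S.l - S.logT a b) := by
  have hn : (n : ℝ) ≠ 0 := by have := S.n_ge_one; positivity
  have hl := S.hl0.ne'
  have hXx : (S.E fun X => X a b) = S.l + S.E fun X => S.x X a b := by
    rw [E_congr (g := fun X => S.l + S.x X a b) (fun X hX => by rw [x_apply, K_apply, hD]; ring),
      E_add, E_const]
  set e := S.E fun X => S.x X a b with he
  set t := 1 / S.l * e with ht
  have hX1 : (S.E fun X => X a b) = S.l * (1 + t) := by rw [hXx, ht]; field_simp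
  have bt : S.Bd 258 (-1) t := (S.bd_inv_l.mul (S.bd_E_x a b)).mono (by norm_num) (by norm_num)
  have ht2 : |t| ≤ 1 / 2 := by
    refine le_trans bt ?_
    have hp := S.s_pos
    have hL := S.hL
    rw [zpow_neg_one, ← div_eq_mul_inv, div_le_iff₀ hp]
    have : 2 * S.L ^ 258 ≤ S.L ^ 300 := by
      have h1 : S.L ^ 300 = S.L ^ 42 * S.L ^ 258 := by ring
      rw [h1]
      have h2 : 2 ≤ S.L ^ 42 := le_trans (by linarith) (le_self_pow₀ (by linarith) (by norm_num : (42:ℕ) ≠ 0))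
      exact mul_le_mul_of_nonneg_right h2 (by positivity)
    linarith
  have h1t : 0 < 1 + t := by linarith [(abs_le.1 ht2).1]
  refine ⟨by rw [hX1]; exact mul_pos S.hl0 h1t, ?_⟩
  rw [hX1, Real.log_mul hl h1t.ne']
  set τ := (1 / S.l) * ((1 / (n:ℝ)) * (S.η a + S.η b)) with hτ
  have bτ : S.Bd 3 (-1) τ :=
    (S.bd_inv_l.mul (S.bd_inv_n.mul ((bd_η a).add (bd_η b)))).mono (by norm_num) (by norm_num)
  have binn : S.Bd 0 (-4) (1 / (n:ℝ) * (1 / (n:ℝ))) := (S.bd_inv_n.mul S.bd_inv_n).mono (by norm_num) (by norm_num)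
  have b1 : S.Bd 571 (-3) (t - (1 / S.l) * ((1 / (n:ℝ) * (1 / (n:ℝ))) * S.mainT a b)) := by
    have := S.bd_inv_l.mul (binn.mul (S.bd_E_main hab hD))
    have e1 : t - (1 / S.l) * ((1 / (n:ℝ) * (1 / (n:ℝ))) * S.mainT a b) =
      (1 / S.l) * ((1 / (n:ℝ) * (1 / (n:ℝ))) * ((n:ℝ) ^ 2 * e - S.mainT a b)) := by
      rw [ht]; field_simp
    rw [e1]
    exact this.mono (by norm_num) (by norm_num)
  have bm : S.Bd 20 2 (S.mainT a b - n * (S.η a + S.η b)) := by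
    have c1 := ((bd_Dg (S := S) a).mul (bd_η a)).mono_j (show (1:ℤ) + 1 ≤ 2 by norm_num)
    have c2 := ((bd_Dg (S := S) b).mul (bd_η b)).mono_j (show (1:ℤ) + 1 ≤ 2 by norm_num)
    have c3 := ((bd_u_sub_l (S := S).mul S.bd_inv_v).mul ((bd_η a).mul (bd_η b))).mono_j (show (0:ℤ) + 0 + (1 + 1) ≤ 2 by norm_num)
    have c4 := ((((c1.add c2).sub (bd_ηs (S := S))).add (bd_Dη a)).add (bd_Dη b)).add c3
    have e1 : S.mainT a b - n * (S.η a + S.η b) = S.Dg a * S.η a + S.Dg b * S.η b - S.ηs + S.Dη a + S.Dη b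
      + (S.u - S.l) * (1 / S.v) * (S.η a * S.η b) := by unfold mainT; ring
    rw [e1]
    exact c4.mono (by norm_num) le_rfl
  have b2 : S.Bd 573 (-2) (t - τ) := by
    have e1 : t - τ = (t - (1 / S.l) * ((1 / (n:ℝ) * (1 / (n:ℝ))) * S.mainT a b)) +
        (1 / S.l) * ((1 / (n:ℝ) * (1 / (n:ℝ))) * (S.mainT a b - n * (S.η a + S.η b))) := by
      rw [hτ]; field_simp; ring
    have c := (S.bd_inv_l.mul (binn.mul bm)).mono_j (show (0:ℤ) + (-4 + 2) ≤ -2 by norm_num)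
    rw [e1]
    exact ((b1.mono_j (show (-3:ℤ) ≤ -2 by norm_num)).add c).mono (by norm_num) le_rfl
  have b3 : S.Bd 900 (-3) ((t - τ) * (t + τ) * (1 / 2)) := by
    have : S.Bd 1 0 ((1:ℝ) / 2) := bd_thousand (by norm_num [abs_le])
    exact ((b2.mul (bt.add bτ)).mul this).mono (by norm_num) (by norm_num)
  have b4 : S.Bd 900 (-3) (Real.log (1 + t) - (t - t ^ 2 / 2)) := by
    have c : S.Bd 900 (-3) (2 * (t * t * t)) := by
      have : S.Bd 1 0 ((2:ℝ)) := bd_thousand (by norm_num [abs_le])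
      exact (this.mul ((bt.mul bt).mul bt)).mono (by norm_num) (by norm_num)
    refine c.of_abs_le ((abs_log_one_add_sub_le ht2).trans (le_of_eq ?_))
    clear_value t
    rw [abs_mul, abs_mul, abs_mul, abs_of_pos (two_pos : (0:ℝ) < 2), pow_succ, pow_two]
  have e9 : Real.log S.l + Real.log (1 + t) - Real.log S.l - S.logT a b =
      (Real.log (1 + t) - (t - t ^ 2 / 2)) - (t - τ) * (t + τ) * (1 / 2)
        + (t - (1 / S.l) * ((1 / (n:ℝ) * (1 / (n:ℝ))) * S.mainT a b)) := by
    unfold logT; rw [hτ]; field_simp; ring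
  rw [e9]
  exact ((b4.sub b3).add b1).mono (by norm_num) le_rfl

end Setup

/-- symmetric zero-one matrix with zero diagonal -/
structure IsAdj {n : ℕ} (A : Matrix (Fin n) (Fin n) ℝ) : Prop where
  zo : ∀ a b, A a b = 0 ∨ A a b = 1
  symm : ∀ a b, A a b = A b a
  diag : ∀ a, A a a = 0

/-- matrix of a single edge -/
noncomputable def edge {n : ℕ} (p q : Fin n) : Matrix (Fin n) (Fin n) ℝ :=
  Matrix.of fun a b => ind p a * ind q b + ind q a * ind p b

/-- all zero-one matrices -/
noncomputable def zeroOne (n : ℕ) : Finset (Matrix (Fin n) (Fin n) ℝ) :=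
  Finset.univ.image fun B : Fin n → Fin n → Bool => Matrix.of fun a b => if B a b = true then 1 else 0

lemma mem_zeroOne {n : ℕ} (X : Matrix (Fin n) (Fin n) ℝ) :
    X ∈ zeroOne n ↔ ∀ a b, X a b = 0 ∨ X a b = 1 := by
  unfold zeroOne
  simp only [Finset.mem_image, Finset.mem_univ, true_and]
  constructor
  · rintro ⟨B, rfl⟩ a b
    simp only [Matrix.of_apply]
    by_cases h : B a b = true
    · right; rw [if_pos h]
    · left; rw [if_neg h]
  · intro h
    refine ⟨fun a b => decide (X a b = 1), ?_⟩
    ext a b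
    simp only [Matrix.of_apply, decide_eq_true_eq]
    rcases h a b with h | h <;> simp [h]

/-- residual configurations: what is left of a graph with degrees `d` containing `A` -/
noncomputable def cfg {n : ℕ} (A : Matrix (Fin n) (Fin n) ℝ) (d : Fin n → ℝ) :
    Finset (Matrix (Fin n) (Fin n) ℝ) :=
  (zeroOne n).filter fun X => (∀ a b, X a b = X b a) ∧ (∀ a b, ind a b + A a b = 1 → X a b = 0) ∧
    ∀ a, ∑ b, X a b = d a - ∑ b, A a b

section
variable {n : ℕ} {A : Matrix (Fin n) (Fin n) ℝ} {d : Fin n → ℝ}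

lemma mem_cfg (X : Matrix (Fin n) (Fin n) ℝ) : X ∈ cfg A d ↔ (∀ a b, X a b = 0 ∨ X a b = 1) ∧
    (∀ a b, X a b = X b a) ∧ (∀ a b, ind a b + A a b = 1 → X a b = 0) ∧
    ∀ a, ∑ b, X a b = d a - ∑ b, A a b := by
  unfold cfg; rw [Finset.mem_filter, mem_zeroOne]

lemma ind_self (a : Fin n) : ind a a = 1 := by simp [ind]
lemma ind_ne {a b : Fin n} (h : a ≠ b) : ind a b = 0 := by simp [ind, h]

lemma edge_apply (p q a b : Fin n) : edge p q a b = ind p a * ind q b + ind q a * ind p b := rfl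

lemma edge_eq (p q : Fin n) (hpq : p ≠ q) (a b : Fin n) :
    edge p q a b = if (a = p ∧ b = q) ∨ (a = q ∧ b = p) then 1 else 0 := by
  rw [edge_apply]; unfold ind
  split_ifs <;> simp_all <;> grind

lemma edge_row (p q a : Fin n) : ∑ b, edge p q a b = ind p a + ind q a := by
  simp only [edge_apply, Finset.sum_add_distrib, ← Finset.mul_sum, sum_ind]; ring

lemma card_cfg_add_edge (hA : IsAdj A) {p q : Fin n} (hpq : p ≠ q) (h0 : A p q = 0) :
    ((cfg (A + edge p q) d).card : ℝ) = ∑ X ∈ cfg A d, X p q := by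
  have h1 : ∑ X ∈ cfg A d, X p q = (((cfg A d).filter fun X => X p q = 1).card : ℝ) := by
    rw [Finset.card_filter]
    push_cast
    refine Finset.sum_congr rfl fun X hX => ?_
    rcases ((mem_cfg X).1 hX).1 p q with h | h <;> simp [h]
  rw [h1]
  congr 1
  have h0' : A q p = 0 := by rw [hA.symm, h0]
  refine Finset.card_nbij' (fun X => X + edge p q) (fun X => X - edge p q) ?_ ?_ ?_ ?_
  · intro X hX
    have hX := (mem_cfg X).1 (by exact_mod_cast hX)
    obtain ⟨x1, x2, x3, x4⟩ := hX
    have y1 : X p q = 0 := x3 p q (by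
      rw [Matrix.add_apply, h0, edge_eq p q hpq, ind_ne hpq]; simp)
    have y2 : X q p = 0 := by rw [x2, y1]
    simp only [Finset.coe_filter, Set.mem_setOf_eq]
    refine ⟨(mem_cfg _).2 ⟨fun a b => ?_, fun a b => ?_, fun a b hab => ?_, fun a => ?_⟩, ?_⟩
    · rw [Matrix.add_apply, edge_eq p q hpq]
      split_ifs with h
      · rcases h with h | h
        · rw [h.1, h.2, y1]; simp
        · rw [h.1, h.2, y2]; simp
      · rw [add_zero]; exact x1 a b
    · rw [Matrix.add_apply, Matrix.add_apply, x2 a b, edge_apply, edge_apply]; ring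
    · rw [Matrix.add_apply, edge_eq p q hpq]
      split_ifs with h
      · exfalso
        rcases h with h | h
        · rw [h.1, h.2, h0, ind_ne hpq] at hab; norm_num at hab
        · rw [h.1, h.2, h0', ind_ne hpq.symm] at hab; norm_num at hab
      · rw [add_zero]; refine x3 a b ?_
        rw [Matrix.add_apply, edge_eq p q hpq, if_neg h, add_zero, hab]
    · simp only [Matrix.add_apply, Finset.sum_add_distrib] at x4 ⊢
      rw [x4]; ring
    · rw [Matrix.add_apply, edge_eq p q hpq, y1]; simp
  · intro X hX
    simp only [Finset.coe_filter, Set.mem_setOf_eq] at hX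
    obtain ⟨hX, z1⟩ := hX
    obtain ⟨x1, x2, x3, x4⟩ := (mem_cfg X).1 hX
    have z2 : X q p = 1 := by rw [x2, z1]
    simp only [Finset.mem_coe]
    refine (mem_cfg _).2 ⟨fun a b => ?_, fun a b => ?_, fun a b hab => ?_, fun a => ?_⟩
    · rw [Matrix.sub_apply, edge_eq p q hpq]
      split_ifs with h
      · rcases h with h | h
        · rw [h.1, h.2, z1]; simp
        · rw [h.1, h.2, z2]; simp
      · rw [sub_zero]; exact x1 a b
    · rw [Matrix.sub_apply, Matrix.sub_apply, x2 a b, edge_apply, edge_apply]; ring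
    · rw [Matrix.add_apply, edge_eq p q hpq] at hab
      rw [Matrix.sub_apply, edge_eq p q hpq]
      split_ifs at hab ⊢ with h
      · rcases h with h | h
        · rw [h.1, h.2, z1]; simp
        · rw [h.1, h.2, z2]; simp
      · rw [sub_zero]; exact x3 a b (by linarith)
    · simp only [Matrix.add_apply, Matrix.sub_apply, Finset.sum_add_distrib, Finset.sum_sub_distrib]
      rw [x4]; ring
  · intro X _; simp
  · intro X _; simp

end

/-- parameters of the estimates -/
structure Ctx (n : ℕ) where
  L : ℝ
  k : ℕ
  l : ℝ
  hL : 1000 ≤ L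
  hk : 6 ≤ k
  hkL : 16 * (k : ℝ) ≤ L
  hn : 1 ≤ n
  hnL : (n : ℝ) ≤ L ^ k
  hl0 : 0 < l
  hl1 : l < 1
  hv : 1 / L ≤ l * (1 - l)
  hs : L ^ 300 ≤ Real.sqrt n

namespace Ctx
variable {n : ℕ} (C : Ctx n)

/-- one minus the density -/
noncomputable def u : ℝ := 1 - C.l

/-- deviation of the degrees -/
noncomputable def δ (d : Fin n → ℝ) (a : Fin n) : ℝ := d a - C.l * (n - 1)

/-- admissible degrees -/
def Adm (d : Fin n → ℝ) : Prop :=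
  (∀ a, |C.δ d a| ≤ C.L * Real.sqrt n / 2) ∧ ∑ a, C.δ d a = 0

/-- admissible edge sets -/
def AdmA (A : Matrix (Fin n) (Fin n) ℝ) : Prop :=
  (∀ a, ∑ b, A a b ≤ C.L * Real.sqrt n / 2) ∧ ∑ a, ∑ b, A a b ≤ C.L * n / 2

variable {C}

lemma one_le_sqrt (C : Ctx n) : 1 ≤ Real.sqrt n := by
  rw [Real.one_le_sqrt]; exact_mod_cast C.hn

/-- the uniform model attached to a residual configuration space -/
noncomputable def toSetup (C : Ctx n) {A : Matrix (Fin n) (Fin n) ℝ} {d : Fin n → ℝ} (hA : IsAdj A)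
    (hAA : C.AdmA A) (hd : C.Adm d) (hne : (cfg A d).Nonempty) : Setup n where
  L := C.L
  k := C.k
  l := C.l
  D := Matrix.of fun a b => ind a b + A a b
  d := fun a => d a - ∑ b, A a b
  Ω := cfg A d
  hL := C.hL
  hk := C.hk
  hkL := C.hkL
  hn := C.hn
  hnL := C.hnL
  hl0 := C.hl0
  hl1 := C.hl1
  hv := C.hv
  hD := fun a b => by
    simp only [Matrix.of_apply]
    by_cases h : a = b
    · subst h; right; rw [ind_self, hA.diag, add_zero]
    · rw [ind_ne h, zero_add]; exact hA.zo a b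
  hDs := fun a b => by
    simp only [Matrix.of_apply]
    rw [hA.symm a b]; congr 1; unfold ind; simp only [eq_comm]
  hD1 := fun a => by simp only [Matrix.of_apply]; rw [ind_self, hA.diag, add_zero]
  hDg := fun a => by
    simp only [Matrix.of_apply, Finset.sum_add_distrib, sum_ind]
    have := hAA.1 a
    have := C.one_le_sqrt
    nlinarith [C.hL]
  htot := by
    simp only [Matrix.of_apply, Finset.sum_add_distrib, sum_ind]
    have := hAA.2
    have h2 : (1:ℝ) ≤ n := by exact_mod_cast C.hn
    simp only [Finset.sum_const, Finset.card_univ, Fintype.card_fin, nsmul_eq_mul, mul_one]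
    nlinarith [C.hL]
  hη := fun a => by
    simp only [Matrix.of_apply, Finset.sum_add_distrib, sum_ind]
    have h1 := hAA.1 a
    have h2 := hd.1 a
    have h3 : 0 ≤ ∑ b, A a b := Finset.sum_nonneg fun b _ => by rcases hA.zo a b with h | h <;> simp [h]
    have e : d a - ∑ b, A a b - C.l * (n - (1 + ∑ b, A a b)) = C.δ d a - (1 - C.l) * ∑ b, A a b := by
      unfold δ; ring
    rw [e]
    have h4 : |(1 - C.l) * ∑ b, A a b| ≤ ∑ b, A a b := by
      rw [abs_of_nonneg (mul_nonneg (by linarith [C.hl1]) h3)]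
      exact mul_le_of_le_one_left h3 (by linarith [C.hl0])
    linarith [abs_sub (C.δ d a) ((1 - C.l) * ∑ b, A a b)]
  hηs := by
    simp only [Matrix.of_apply, Finset.sum_add_distrib, sum_ind]
    have h1 := hAA.2
    have h2 : (1:ℝ) ≤ n := by exact_mod_cast C.hn
    have h3 : 0 ≤ ∑ a, ∑ b, A a b := Finset.sum_nonneg fun a _ => Finset.sum_nonneg fun b _ => by
      rcases hA.zo a b with h | h <;> simp [h]
    have e : ∑ a, (d a - ∑ b, A a b - C.l * (n - (1 + ∑ b, A a b))) =
        ∑ a, C.δ d a - (1 - C.l) * ∑ a, ∑ b, A a b := by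
      rw [Finset.mul_sum, ← Finset.sum_sub_distrib]
      refine Finset.sum_congr rfl fun a _ => ?_
      unfold δ; ring
    rw [e, hd.2, zero_sub, abs_neg, abs_of_nonneg (mul_nonneg (by linarith [C.hl1]) h3)]
    have := mul_le_of_le_one_left h3 (show 1 - C.l ≤ 1 by linarith [C.hl0])
    nlinarith [C.hL]
  hΩ := fun X => by
    rw [mem_cfg]; rfl
  hne := hne

section Reduction
variable {A : Matrix (Fin n) (Fin n) ℝ} {d : Fin n → ℝ} (hA : IsAdj A)
    (hAA : C.AdmA A) (hd : C.Adm d) (hne : (cfg A d).Nonempty)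

lemma toSetup_Dg (a : Fin n) : (C.toSetup hA hAA hd hne).Dg a = 1 + ∑ b, A a b := by
  change ∑ b, (ind a b + A a b) = _
  rw [Finset.sum_add_distrib, sum_ind]

lemma toSetup_η (a : Fin n) : (C.toSetup hA hAA hd hne).η a = C.δ d a - C.u * ∑ b, A a b := by
  unfold Setup.η
  rw [toSetup_Dg]
  change d a - ∑ b, A a b - C.l * _ = _
  unfold δ u; ring

lemma toSetup_ηs : (C.toSetup hA hAA hd hne).ηs = - C.u * ∑ a, ∑ b, A a b := by
  unfold Setup.ηs
  simp only [toSetup_η]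
  rw [Finset.sum_sub_distrib, hd.2, ← Finset.mul_sum]; ring

lemma toSetup_Dη (a : Fin n) : (C.toSetup hA hAA hd hne).Dη a =
    C.δ d a - C.u * ∑ b, A a b + (∑ b, A a b * C.δ d b - C.u * ∑ b, A a b * ∑ c, A b c) := by
  unfold Setup.Dη
  simp only [toSetup_η]
  change ∑ b, (ind a b + A a b) * _ = _
  simp only [add_mul, Finset.sum_add_distrib, sum_ind_mul]
  congr 1
  rw [Finset.mul_sum, ← Finset.sum_sub_distrib]
  exact Finset.sum_congr rfl fun b _ => by ring

/-- effect of adding one edge on the number of residual configurations -/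
theorem log_card_add_edge {p q : Fin n} (hpq : p ≠ q) (h0 : A p q = 0) :
    (cfg (A + edge p q) d).Nonempty ∧
    |Real.log ((cfg (A + edge p q) d).card) - Real.log ((cfg A d).card) - Real.log C.l
      - (C.toSetup hA hAA hd hne).logT p q| ≤ C.L ^ 1000 * Real.sqrt n ^ (-3 : ℤ) := by
  set S := C.toSetup hA hAA hd hne with hS
  obtain ⟨h1, h2⟩ := S.log_E_X (a := p) (b := q) C.hs hpq (by
    change ind p q + A p q = 0
    rw [h0, ind_ne hpq, add_zero])
  have hc : (0:ℝ) < (cfg A d).card := by exact_mod_cast hne.card_pos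
  have h3 : ((cfg (A + edge p q) d).card : ℝ) = (cfg A d).card * S.E fun X => X p q := by
    rw [card_cfg_add_edge hA hpq h0]
    unfold Setup.E
    change _ = ((cfg A d).card : ℝ) * ((∑ X ∈ cfg A d, X p q) / ((cfg A d).card : ℝ))
    field_simp
  have h4 : (0:ℝ) < (cfg (A + edge p q) d).card := by rw [h3]; exact mul_pos hc h1
  refine ⟨Finset.card_pos.1 (by exact_mod_cast h4), ?_⟩
  rw [h3, Real.log_mul hc.ne' h1.ne']
  have : Real.log ((cfg A d).card) + Real.log (S.E fun X => X p q) - Real.log ((cfg A d).card) - Real.log C.l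
      - S.logT p q = Real.log (S.E fun X => X p q) - Real.log S.l - S.logT p q := by
    change _ = Real.log (S.E fun X => X p q) - Real.log C.l - S.logT p q
    ring
  rw [this]
  exact h2

end Reduction
end Ctx

/-- sum of `φ` over the edges of `A` -/
noncomputable def es {n : ℕ} (A : Matrix (Fin n) (Fin n) ℝ) (φ : Fin n → Fin n → ℝ) : ℝ :=
  (∑ a, ∑ b, A a b * φ a b) / 2

section
variable {n : ℕ} {A H : Matrix (Fin n) (Fin n) ℝ}

lemma es_zero (φ : Fin n → Fin n → ℝ) : es 0 φ = 0 := by simp [es]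

lemma sum_edge_mul (p q : Fin n) (φ : Fin n → Fin n → ℝ) :
    ∑ a, ∑ b, edge p q a b * φ a b = φ p q + φ q p := by
  simp only [edge_apply, add_mul, Finset.sum_add_distrib, mul_assoc, ← Finset.mul_sum, sum_ind_mul]

lemma es_add_edge (p q : Fin n) (φ : Fin n → Fin n → ℝ) (hφ : ∀ a b, φ a b = φ b a) :
    es (A + edge p q) φ = es A φ + φ p q := by
  unfold es
  simp only [Matrix.add_apply, add_mul, Finset.sum_add_distrib]
  rw [sum_edge_mul, hφ q p]; ring

lemma IsAdj.nonneg (hA : IsAdj A) (a b : Fin n) : 0 ≤ A a b := by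
  rcases hA.zo a b with h | h <;> simp [h]

lemma IsAdj.row_nonneg (hA : IsAdj A) (a : Fin n) : 0 ≤ ∑ b, A a b :=
  Finset.sum_nonneg fun b _ => hA.nonneg a b

lemma IsAdj.le_row (hA : IsAdj A) (a b : Fin n) : A a b ≤ ∑ b, A a b :=
  Finset.single_le_sum (f := fun b => A a b) (fun b _ => hA.nonneg a b) (Finset.mem_univ b)

lemma isAdj_sub_edge (hA : IsAdj A) {p q : Fin n} (h : A p q = 1) : IsAdj (A - edge p q) := by
  have hpq : p ≠ q := by
    rintro rfl
    rw [hA.diag] at h; norm_num at h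
  refine ⟨fun a b => ?_, fun a b => ?_, fun a => ?_⟩
  · rw [Matrix.sub_apply, edge_eq p q hpq]
    split_ifs with h'
    · left
      rcases h' with h' | h'
      · rw [h'.1, h'.2, h, sub_self]
      · rw [h'.1, h'.2, hA.symm, h, sub_self]
    · rw [sub_zero]; exact hA.zo a b
  · rw [Matrix.sub_apply, Matrix.sub_apply, hA.symm a b, edge_apply, edge_apply]; ring
  · rw [Matrix.sub_apply, hA.diag, edge_eq p q hpq, if_neg, sub_zero]
    rintro (h' | h')
    · exact hpq (h'.1.symm.trans h'.2)
    · exact hpq (h'.2.symm.trans h'.1)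

end

namespace Ctx
variable {n : ℕ} (C : Ctx n)

/-- coefficient of the quadratic form over edges -/
noncomputable def Aq : ℝ := ((C.u - C.l) / (C.l * (C.l * C.u)) - 1 / C.l ^ 2) / n ^ 2
/-- coefficient of the squares -/
noncomputable def Bq : ℝ := - 1 / (2 * C.l ^ 2 * n ^ 2)

/-- main part of the logarithm of the containment probability -/
noncomputable def Φ (A : Matrix (Fin n) (Fin n) ℝ) (y : Fin n → ℝ) : ℝ :=
  es A (fun _ _ => 1) * Real.log C.l + (∑ a, (∑ b, A a b) * y a) / (C.l * n)
    - C.u / (C.l * n) * ((∑ a, ((∑ b, A a b) ^ 2 - ∑ b, A a b)) / 2)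
    + C.u * (es A (fun _ _ => 1) * (es A (fun _ _ => 1) - 1)) / (C.l * n ^ 2)
    + C.Aq * es A (fun a b => y a * y b) + C.Bq * ∑ a, (∑ b, A a b) * y a ^ 2

/-- weight of an edge in the constant error -/
noncomputable def wE (H : Matrix (Fin n) (Fin n) ℝ) (a b : Fin n) : ℝ :=
  (∑ c, H a c) ^ 2 + (∑ c, H b c) ^ 2 + ∑ c, (H a c + H b c) * ∑ e, H c e

/-- weight of an edge in the linear error -/
noncomputable def wL (H : Matrix (Fin n) (Fin n) ℝ) (c a b : Fin n) : ℝ :=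
  (ind a c + ind b c) * (∑ e, H a e + ∑ e, H b e) + H a c + H b c

/-- linear correction caused by one edge -/
noncomputable def γ (A : Matrix (Fin n) (Fin n) ℝ) (p q c : Fin n) : ℝ :=
  (ind p c * (2 + ∑ b, A p b) + ind q c * (2 + ∑ b, A q b) + A p c + A q c
    - (C.u - C.l) / C.l * ((∑ b, A p b) * ind q c + (∑ b, A q b) * ind p c)) / (C.l * n ^ 2)
  + C.u * (∑ b, A p b + ∑ b, A q b) / (C.l ^ 2 * n ^ 2) * (ind p c + ind q c)

/-- constant correction caused by one edge -/
noncomputable def errE (A : Matrix (Fin n) (Fin n) ℝ) (p q : Fin n) : ℝ :=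
  (- C.u * (2 + ∑ b, A p b) * (∑ b, A p b) - C.u * (2 + ∑ b, A q b) * (∑ b, A q b)
    - C.u * ∑ b, (A p b + A q b) * ∑ c, A b c
    + (C.u - C.l) / (C.l * C.u) * C.u ^ 2 * (∑ b, A p b) * (∑ b, A q b)) / (C.l * n ^ 2)
  - C.u ^ 2 * (∑ b, A p b + ∑ b, A q b) ^ 2 / (2 * C.l ^ 2 * n ^ 2)

lemma u_pos : 0 < C.u := by unfold u; linarith [C.hl1]
lemma u_lt_one : C.u < 1 := by unfold u; linarith [C.hl0]
lemma n_pos {n : ℕ} (C : Ctx n) : (0:ℝ) < n := by exact_mod_cast C.hn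

variable {C}
variable {A H : Matrix (Fin n) (Fin n) ℝ} {d : Fin n → ℝ}

lemma logT_eq (hA : IsAdj A) (hAA : C.AdmA A) (hd : C.Adm d) (hne : (cfg A d).Nonempty) {p q : Fin n}
    (hpq : p ≠ q) :
    Real.log C.l + (C.toSetup hA hAA hd hne).logT p q =
    C.Φ (A + edge p q) (C.δ d) - C.Φ A (C.δ d) + ∑ c, C.γ A p q c * C.δ d c + C.errE A p q := by
  have hl := C.hl0.ne'
  have hu := C.u_pos.ne'
  have hn := C.n_pos.ne'
  have hΔ : C.Φ (A + edge p q) (C.δ d) - C.Φ A (C.δ d) = Real.log C.l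
      + (C.δ d p + C.δ d q) / (C.l * n) - C.u / (C.l * n) * (∑ b, A p b + ∑ b, A q b + ind p q)
      + C.u * (2 * es A (fun _ _ => 1)) / (C.l * n ^ 2) + C.Aq * (C.δ d p * C.δ d q)
      + C.Bq * (C.δ d p ^ 2 + C.δ d q ^ 2) := by
    unfold Φ
    rw [es_add_edge p q _ (fun _ _ => rfl), es_add_edge p q _ (fun _ _ => mul_comm _ _)]
    have r : ∀ a, ∑ b, (A + edge p q) a b = ∑ b, A a b + (ind p a + ind q a) := fun a => by
      simp only [Matrix.add_apply, Finset.sum_add_distrib, edge_row]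
    simp only [r]
    have r1 : ∀ φ : Fin n → ℝ, ∑ a, (∑ b, A a b + (ind p a + ind q a)) * φ a =
        ∑ a, (∑ b, A a b) * φ a + (φ p + φ q) := fun φ => by
      simp only [add_mul, Finset.sum_add_distrib, sum_ind_mul]
    have r2 : ∑ a, ((∑ b, A a b + (ind p a + ind q a)) ^ 2 - (∑ b, A a b + (ind p a + ind q a))) =
        ∑ a, ((∑ b, A a b) ^ 2 - ∑ b, A a b) + 2 * (∑ b, A p b + ∑ b, A q b + ind p q) := by
      have : ∀ a, (∑ b, A a b + (ind p a + ind q a)) ^ 2 - (∑ b, A a b + (ind p a + ind q a)) =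
        ((∑ b, A a b) ^ 2 - ∑ b, A a b) + (ind p a * (2 * ∑ b, A a b) + ind q a * (2 * ∑ b, A a b) + 
          ind p a * (2 * ind q a)) := fun a => by
        have i1 : ind p a ^ 2 = ind p a := by unfold ind; split_ifs <;> norm_num
        have i2 : ind q a ^ 2 = ind q a := by unfold ind; split_ifs <;> norm_num
        linear_combination i1 + i2
      simp only [this, Finset.sum_add_distrib, sum_ind_mul]
      have : (ind q p : ℝ) = ind p q := by unfold ind; simp only [eq_comm]
      rw [this]; ring
    rw [r1 (C.δ d), r1 (fun a => C.δ d a ^ 2), r2]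
    ring
  have hγ : ∑ c, C.γ A p q c * C.δ d c =
      (C.δ d p * (2 + ∑ b, A p b) + C.δ d q * (2 + ∑ b, A q b) + ∑ b, A p b * C.δ d b + ∑ b, A q b * C.δ d b
      - (C.u - C.l) / C.l * ((∑ b, A p b) * C.δ d q + (∑ b, A q b) * C.δ d p)) / (C.l * n ^ 2)
      + C.u * (∑ b, A p b + ∑ b, A q b) / (C.l ^ 2 * n ^ 2) * (C.δ d p + C.δ d q) := by
    rw [← sum_ind_mul p (C.δ d), ← sum_ind_mul q (C.δ d)]
    have : ∀ c, C.γ A p q c * C.δ d c = (1 / (C.l * n ^ 2)) * (A p c * C.δ d c) + (1 / (C.l * n ^ 2)) * (A q c * C.δ d c)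
       + ((2 + ∑ b, A p b - (C.u - C.l) / C.l * (∑ b, A q b)) / (C.l * n ^ 2) + 
          C.u * (∑ b, A p b + ∑ b, A q b) / (C.l ^ 2 * n ^ 2)) * (ind p c * C.δ d c)
       + ((2 + ∑ b, A q b - (C.u - C.l) / C.l * (∑ b, A p b)) / (C.l * n ^ 2) + 
          C.u * (∑ b, A p b + ∑ b, A q b) / (C.l ^ 2 * n ^ 2)) * (ind q c * C.δ d c) := fun c => by
      unfold γ; ring
    simp only [this, Finset.sum_add_distrib, ← Finset.mul_sum]
    ring
  rw [hΔ, hγ, ind_ne hpq]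
  have hη : ∀ a, (C.toSetup hA hAA hd hne).η a = C.δ d a - C.u * ∑ b, A a b := toSetup_η hA hAA hd hne
  have hes : ∑ a, ∑ b, A a b = 2 * es A (fun _ _ => 1) := by unfold es; simp only [mul_one]; ring
  have hv : (C.toSetup hA hAA hd hne).v = C.l * C.u := rfl
  have hu' : (C.toSetup hA hAA hd hne).u = C.u := rfl
  have hl' : (C.toSetup hA hAA hd hne).l = C.l := rfl
  unfold Setup.logT Setup.mainT errE Aq Bq
  rw [hη, hη, toSetup_ηs, toSetup_Dη, toSetup_Dη, toSetup_Dg, toSetup_Dg, hes, hv, hu', hl']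
  have e1 : ∑ b, (A p b + A q b) * ∑ c, A b c = ∑ b, A p b * ∑ c, A b c + ∑ b, A q b * ∑ c, A b c := by
    simp only [add_mul, Finset.sum_add_distrib]
  rw [e1]
  generalize ∑ b, A p b * ∑ c, A b c = z1
  generalize ∑ b, A q b * ∑ c, A b c = z2
  generalize ∑ b, A p b * C.δ d b = z3
  generalize ∑ b, A q b * C.δ d b = z4
  generalize ∑ b, A p b = P
  generalize ∑ b, A q b = Q
  generalize es A (fun _ _ => 1) = M
  field_simp
  ring

lemma ind_nonneg (a b : Fin n) : (0:ℝ) ≤ ind a b := by unfold ind; split_ifs <;> norm_num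

lemma abs_γ_le (hA : IsAdj A) (hH : IsAdj H) (hAH : ∀ a b, A a b ≤ H a b) {p q : Fin n}
    (hp : ∑ b, A p b + 1 ≤ ∑ b, H p b) (hq : ∑ b, A q b + 1 ≤ ∑ b, H q b) (c : Fin n) :
    |C.γ A p q c| ≤ 4 / (C.l ^ 2 * n ^ 2) * wL H c p q := by
  have hl := C.hl0
  have hl1 := C.hl1
  have hu := C.u_pos
  have hu1 := C.u_lt_one
  have hn := C.n_pos
  have P0 := hA.row_nonneg p
  have Q0 := hA.row_nonneg q
  have a1 := hA.nonneg p c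
  have a2 := hA.nonneg q c
  have a3 := hAH p c
  have a4 := hAH q c
  have i1 := ind_nonneg p c
  have i2 := ind_nonneg q c
  have e : C.γ A p q c = (C.l * (ind p c * (2 + ∑ b, A p b) + ind q c * (2 + ∑ b, A q b) + A p c + A q c)
    - (C.u - C.l) * ((∑ b, A p b) * ind q c + (∑ b, A q b) * ind p c)
    + C.u * (∑ b, A p b + ∑ b, A q b) * (ind p c + ind q c)) / (C.l ^ 2 * n ^ 2) := by
    unfold γ; field_simp
  rw [e, abs_div, abs_of_pos (show 0 < C.l ^ 2 * (n:ℝ) ^ 2 by positivity), div_mul_eq_mul_div]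
  refine div_le_div_of_nonneg_right ?_ (by positivity)
  unfold wL
  generalize (∑ b, A p b) = P at *
  generalize (∑ b, A q b) = Q at *
  generalize (∑ b, H p b) = P' at *
  generalize (∑ b, H q b) = Q' at *
  set T1 := ind p c * (2 + P) + ind q c * (2 + Q) + A p c + A q c
  set T2 := P * ind q c + Q * ind p c
  set T3 := (P + Q) * (ind p c + ind q c)
  have hT1 : 0 ≤ T1 := by positivity
  have hT2 : 0 ≤ T2 := by positivity
  have hT3 : 0 ≤ T3 := by positivity
  have b1 : |C.l * T1| ≤ T1 := by
    rw [abs_of_nonneg (by positivity)]; exact mul_le_of_le_one_left hT1 hl1.le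
  have b2 : |(C.u - C.l) * T2| ≤ T2 := by
    rw [abs_mul, abs_of_nonneg hT2]; exact mul_le_of_le_one_left hT2 (abs_le.2 ⟨by linarith, by linarith⟩)
  have b3 : |C.u * (P + Q) * (ind p c + ind q c)| ≤ T3 := by
    rw [mul_assoc, abs_mul, abs_of_pos hu, abs_of_nonneg hT3]; exact mul_le_of_le_one_left hT3 hu1.le
  have b4 : |C.l * T1 - (C.u - C.l) * T2 + C.u * (P + Q) * (ind p c + ind q c)| ≤ T1 + T2 + T3 :=
    (abs_add_le _ _).trans (add_le_add ((abs_sub _ _).trans (add_le_add b1 b2)) b3)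
  refine b4.trans ?_
  have c1 : ind p c * (2 + P) ≤ ind p c * (2 * P' + 2 * Q') := mul_le_mul_of_nonneg_left (by linarith) i1
  have c2 : ind q c * (2 + Q) ≤ ind q c * (2 * P' + 2 * Q') := mul_le_mul_of_nonneg_left (by linarith) i2
  have c3 : P * ind q c ≤ P' * ind q c := mul_le_mul_of_nonneg_right (by linarith) i2
  have c4 : Q * ind p c ≤ Q' * ind p c := mul_le_mul_of_nonneg_right (by linarith) i1
  have c5 : T3 ≤ (P' + Q') * (ind p c + ind q c) := mul_le_mul_of_nonneg_right (by linarith) (by linarith)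
  have c6 : 0 ≤ P' * ind p c := mul_nonneg (by linarith) i1
  have c7 : 0 ≤ Q' * ind q c := mul_nonneg (by linarith) i2
  have c8 : 0 ≤ P' * ind q c := mul_nonneg (by linarith) i2
  have c9 : 0 ≤ Q' * ind p c := mul_nonneg (by linarith) i1
  change ind p c * (2 + P) + ind q c * (2 + Q) + A p c + A q c + (P * ind q c + Q * ind p c) + T3 ≤ _
  linarith

lemma abs_errE_le (hA : IsAdj A) (hH : IsAdj H) (hAH : ∀ a b, A a b ≤ H a b) {p q : Fin n}
    (hp : ∑ b, A p b + 1 ≤ ∑ b, H p b) (hq : ∑ b, A q b + 1 ≤ ∑ b, H q b) :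
    |C.errE A p q| ≤ 4 / (C.l ^ 2 * n ^ 2) * wE H p q := by
  have hl := C.hl0
  have hl1 := C.hl1
  have hu := C.u_pos
  have hu1 := C.u_lt_one
  have hn := C.n_pos
  have P0 := hA.row_nonneg p
  have Q0 := hA.row_nonneg q
  have z0 : 0 ≤ ∑ b, (A p b + A q b) * ∑ c, A b c := Finset.sum_nonneg fun b _ =>
    mul_nonneg (add_nonneg (hA.nonneg _ _) (hA.nonneg _ _)) (hA.row_nonneg b)
  have z1 : ∑ b, (A p b + A q b) * ∑ c, A b c ≤ ∑ b, (H p b + H q b) * ∑ c, H b c :=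
    Finset.sum_le_sum fun b _ => mul_le_mul (add_le_add (hAH _ _) (hAH _ _))
      (Finset.sum_le_sum fun c _ => hAH b c) (hA.row_nonneg b) (add_nonneg (hH.nonneg _ _) (hH.nonneg _ _))
  have e : C.errE A p q = (- (C.l * C.u * ((2 + ∑ b, A p b) * (∑ b, A p b) + (2 + ∑ b, A q b) * (∑ b, A q b)
      + ∑ b, (A p b + A q b) * ∑ c, A b c))
    + (C.u - C.l) * C.u * ((∑ b, A p b) * (∑ b, A q b)) 
    - C.u ^ 2 * ((∑ b, A p b + ∑ b, A q b) ^ 2 / 2)) / (C.l ^ 2 * n ^ 2) := by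
    unfold errE; field_simp; ring
  rw [e, abs_div, abs_of_pos (show 0 < C.l ^ 2 * (n:ℝ) ^ 2 by positivity), div_mul_eq_mul_div]
  refine div_le_div_of_nonneg_right ?_ (by positivity)
  unfold wE
  generalize (∑ b, (A p b + A q b) * ∑ c, A b c) = Z at *
  generalize (∑ b, (H p b + H q b) * ∑ c, H b c) = Z' at *
  generalize (∑ b, A p b) = P at *
  generalize (∑ b, A q b) = Q at *
  generalize (∑ b, H p b) = P' at *
  generalize (∑ b, H q b) = Q' at *
  set T1 := (2 + P) * P + (2 + Q) * Q + Z
  set T2 := P * Q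
  set T3 := (P + Q) ^ 2 / 2
  have hT1 : 0 ≤ T1 := by positivity
  have hT2 : 0 ≤ T2 := by positivity
  have hT3 : 0 ≤ T3 := by positivity
  have b1 : |-(C.l * C.u * T1)| ≤ T1 := by
    rw [abs_neg, abs_of_nonneg (by positivity)]; exact mul_le_of_le_one_left hT1 (by nlinarith)
  have b2 : |(C.u - C.l) * C.u * T2| ≤ T2 := by
    rw [abs_mul, abs_of_nonneg hT2]; exact mul_le_of_le_one_left hT2 (abs_le.2 ⟨by nlinarith, by nlinarith⟩)
  have b3 : |C.u ^ 2 * T3| ≤ T3 := by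
    rw [abs_of_nonneg (by positivity)]; exact mul_le_of_le_one_left hT3 (by nlinarith)
  have b4 : |-(C.l * C.u * T1) + (C.u - C.l) * C.u * T2 - C.u ^ 2 * T3| ≤ T1 + T2 + T3 :=
    (abs_sub _ _).trans (add_le_add ((abs_add_le _ _).trans (add_le_add b1 b2)) b3)
  refine b4.trans ?_
  have c1 : (2 + P) * P ≤ P' ^ 2 := by nlinarith
  have c2 : (2 + Q) * Q ≤ Q' ^ 2 := by nlinarith
  have c3 : P * Q ≤ (P' ^ 2 + Q' ^ 2) / 2 := by nlinarith [sq_nonneg (P - Q)]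
  have c4 : T3 ≤ P' ^ 2 + Q' ^ 2 := by
    change (P + Q) ^ 2 / 2 ≤ _
    nlinarith [sq_nonneg (P - Q)]
  change (2 + P) * P + (2 + Q) * Q + Z + P * Q + T3 ≤ _
  nlinarith [sq_nonneg P', sq_nonneg Q']

lemma wE_symm (a b : Fin n) : wE H a b = wE H b a := by
  unfold wE
  simp only [add_comm (H a _)]; ring
lemma wL_symm (c a b : Fin n) : wL H c a b = wL H c b a := by
  unfold wL; ring

lemma es_const_mul (r : ℝ) (φ : Fin n → Fin n → ℝ) : es A (fun a b => r * φ a b) = r * es A φ := by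
  unfold es
  simp only [mul_left_comm _ r, ← Finset.mul_sum]; ring

lemma es_add (φ ψ : Fin n → Fin n → ℝ) : es A (fun a b => φ a b + ψ a b) = es A φ + es A ψ := by
  unfold es
  simp only [mul_add, Finset.sum_add_distrib]; ring

lemma AdmA.mono (hH : C.AdmA H) (h : ∀ a b, A a b ≤ H a b) : C.AdmA A :=
  ⟨fun a => (Finset.sum_le_sum fun b _ => h a b).trans (hH.1 a),
   (Finset.sum_le_sum fun a _ => Finset.sum_le_sum fun b _ => h a b).trans hH.2⟩

theorem log_card_cfg_aux (hH : IsAdj H) (hHA : C.AdmA H) (N : ℕ) :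
    ∀ A : Matrix (Fin n) (Fin n) ℝ, IsAdj A → (∀ a b, A a b ≤ H a b) → ∑ a, ∑ b, A a b ≤ N →
    ∃ g : Fin n → ℝ, (∀ c, |g c| ≤ 4 / (C.l ^ 2 * n ^ 2) * es A (wL H c)) ∧
      ∀ d, C.Adm d → (cfg 0 d).Nonempty → (cfg A d).Nonempty ∧
        |Real.log (cfg A d).card - Real.log (cfg 0 d).card - C.Φ A (C.δ d) - ∑ c, g c * C.δ d c| ≤
          es A (fun a b => C.L ^ 1000 * Real.sqrt n ^ (-3 : ℤ) + 4 / (C.l ^ 2 * n ^ 2) * wE H a b) := by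
  induction N with
  | zero =>
    intro A hA hAH hN
    have h0 : A = 0 := by
      ext a b
      have h1 := Finset.single_le_sum (f := fun a => ∑ b, A a b) (fun a _ => hA.row_nonneg a) (Finset.mem_univ a)
      have h2 := hA.le_row a b
      have h3 := hA.nonneg a b
      push_cast at hN
      simp only [Matrix.zero_apply] at *
      linarith
    subst h0
    refine ⟨0, fun c => by simp [es_zero], fun d hd hne => ⟨hne, ?_⟩⟩
    simp [es_zero, Φ]
  | succ N ih =>
    intro A hA hAH hN
    by_cases h : ∃ p q, A p q = 1
    · obtain ⟨p, q, hpq1⟩ := h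
      have hpq : p ≠ q := by
        rintro rfl
        rw [hA.diag] at hpq1; norm_num at hpq1
      set B := A - edge p q with hB
      have hBadj : IsAdj B := isAdj_sub_edge hA hpq1
      have hAB : A = B + edge p q := by rw [hB, sub_add_cancel]
      have hBA : ∀ a b, B a b ≤ A a b := fun a b => by
        rw [hB, Matrix.sub_apply, edge_eq p q hpq]; split_ifs <;> linarith
      have hBH : ∀ a b, B a b ≤ H a b := fun a b => (hBA a b).trans (hAH a b)
      have rowA : ∀ a, ∑ b, A a b = ∑ b, B a b + (ind p a + ind q a) := fun a => by
        rw [hAB]; simp only [Matrix.add_apply, Finset.sum_add_distrib, edge_row]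
      have hBN : ∑ a, ∑ b, B a b ≤ N := by
        have h1 : ∑ a, ∑ b, A a b = ∑ a, ∑ b, B a b + (1 + 1) := by
          simp only [rowA]
          rw [Finset.sum_add_distrib, Finset.sum_add_distrib, sum_ind, sum_ind]
        push_cast at hN
        linarith
      have hp : ∑ b, B p b + 1 ≤ ∑ b, H p b := by
        have h1 := rowA p
        rw [ind_self, ind_ne hpq.symm] at h1
        have h2 := Finset.sum_le_sum fun b (_ : b ∈ Finset.univ) => hAH p b
        linarith
      have hq : ∑ b, B q b + 1 ≤ ∑ b, H q b := by
        have h1 := rowA q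
        rw [ind_self, ind_ne hpq] at h1
        have h2 := Finset.sum_le_sum fun b (_ : b ∈ Finset.univ) => hAH q b
        linarith
      have hB0 : B p q = 0 := by
        rw [hB, Matrix.sub_apply, hpq1, edge_eq p q hpq]; simp
      obtain ⟨g, hg, hgd⟩ := ih B hBadj hBH hBN
      have hBadm : C.AdmA B := hHA.mono hBH
      refine ⟨fun c => g c + C.γ B p q c, fun c => ?_, fun d hd hne => ?_⟩
      · rw [hAB, es_add_edge p q _ (wL_symm c), mul_add]
        exact (abs_add_le _ _).trans (add_le_add (hg c) (abs_γ_le hBadj hH hBH hp hq c))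
      · obtain ⟨k1, k2⟩ := hgd d hd hne
        obtain ⟨k3, k4⟩ := log_card_add_edge hBadj hBadm hd k1 hpq hB0
        have k5 := logT_eq hBadj hBadm hd k1 hpq
        rw [← hAB] at k3 k4 k5
        refine ⟨k3, ?_⟩
        have k6 : es A (fun a b => C.L ^ 1000 * Real.sqrt n ^ (-3 : ℤ) + 4 / (C.l ^ 2 * n ^ 2) * wE H a b) =
            es B (fun a b => C.L ^ 1000 * Real.sqrt n ^ (-3 : ℤ) + 4 / (C.l ^ 2 * n ^ 2) * wE H a b)
            + (C.L ^ 1000 * Real.sqrt n ^ (-3 : ℤ) + 4 / (C.l ^ 2 * n ^ 2) * wE H p q) := by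
          rw [hAB]; exact es_add_edge p q _ (fun a b => by rw [wE_symm])
        rw [k6]
        have k7 := abs_errE_le (C := C) hBadj hH hBH hp hq
        have k8 : ∑ c, (g c + C.γ B p q c) * C.δ d c = ∑ c, g c * C.δ d c + ∑ c, C.γ B p q c * C.δ d c := by
          rw [← Finset.sum_add_distrib]; exact Finset.sum_congr rfl fun c _ => by ring
        rw [k8]
        rw [abs_le] at k2 k4 k7 ⊢
        constructor <;> linarith
    · push Not at h
      refine ih A hA hAH ?_
      have h0 : ∀ a b, A a b = 0 := fun a b => (hA.zo a b).resolve_right (h a b)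
      simp [h0]

end Ctx

namespace Ctx
variable {n : ℕ} {C : Ctx n} {H : Matrix (Fin n) (Fin n) ℝ}

lemma es_wL (hH : IsAdj H) (c : Fin n) :
    es H (wL H c) = (∑ e, H c e) ^ 2 + 2 * ∑ q, H c q * ∑ e, H q e := by
  have e1 : ∀ a b, H a b * wL H c a b = ind c a * (H a b * (∑ e, H a e + ∑ e, H b e))
      + ind c b * (H a b * (∑ e, H a e + ∑ e, H b e)) + H a b * H c a + H a b * H c b := fun a b => by
    unfold wL
    rw [hH.symm a c, hH.symm b c]
    have : ∀ a, ind a c = ind c a := fun a => by unfold ind; simp only [eq_comm]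
    rw [this a, this b]; ring
  unfold es
  simp only [e1, Finset.sum_add_distrib, ← Finset.mul_sum, sum_ind_mul]
  have t1 : ∑ x, (∑ b, H x b) * H c x = ∑ q, H c q * ∑ e, H q e :=
    Finset.sum_congr rfl fun q _ => mul_comm _ _
  have t2 : ∑ x, ∑ y, H x y * H c y = ∑ q, H c q * ∑ e, H q e := by
    rw [Finset.sum_comm]
    refine Finset.sum_congr rfl fun q _ => ?_
    rw [← Finset.sum_mul, mul_comm]
    congr 1
    exact Finset.sum_congr rfl fun e _ => hH.symm _ _
  have t3 : ∑ x, H c x * (∑ e, H c e + ∑ e, H x e) = (∑ e, H c e) ^ 2 + ∑ q, H c q * ∑ e, H q e := by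
    simp only [mul_add, Finset.sum_add_distrib, ← Finset.sum_mul]; ring
  have t4 : ∑ x, H x c * (∑ e, H x e + ∑ e, H c e) = (∑ e, H c e) ^ 2 + ∑ q, H c q * ∑ e, H q e := by
    rw [← t3]
    refine Finset.sum_congr rfl fun q _ => ?_
    rw [hH.symm q c]; ring
  have t5 : ∑ x, ∑ b, H x b * H c x = ∑ q, H c q * ∑ e, H q e := by
    rw [← t1]; simp only [← Finset.sum_mul]
  rw [t2, t3]
  simp only [t1, t4, t5]
  ring

lemma sum_edge_le (hH : IsAdj H) :
    ∑ a, (∑ e, H a e) * ∑ c, H a c * ∑ e, H c e ≤ ∑ a, (∑ e, H a e) ^ 3 := by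
  have e1 : ∑ a, (∑ e, H a e) * ∑ c, H a c * ∑ e, H c e ≤
      ∑ a, ∑ c, H a c * (((∑ e, H a e) ^ 2 + (∑ e, H c e) ^ 2) / 2) := by
    refine Finset.sum_le_sum fun a _ => ?_
    rw [Finset.mul_sum]
    refine Finset.sum_le_sum fun c _ => ?_
    rw [mul_left_comm]
    refine mul_le_mul_of_nonneg_left ?_ (hH.nonneg a c)
    nlinarith [sq_nonneg ((∑ e, H a e) - ∑ e, H c e)]
  refine e1.trans (le_of_eq ?_)
  have e2 : ∀ a c, H a c * (((∑ e, H a e) ^ 2 + (∑ e, H c e) ^ 2) / 2) =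
      H a c * ((∑ e, H a e) ^ 2 / 2) + H a c * ((∑ e, H c e) ^ 2 / 2) := fun a c => by ring
  simp only [e2, Finset.sum_add_distrib]
  rw [Finset.sum_comm (f := fun a c => H a c * ((∑ e, H c e) ^ 2 / 2))]
  simp only [← Finset.sum_mul]
  have : ∀ c, ∑ a, H a c = ∑ a, H c a := fun c => Finset.sum_congr rfl fun a _ => hH.symm _ _
  simp only [this]
  rw [← Finset.sum_add_distrib]
  exact Finset.sum_congr rfl fun a _ => by ring

lemma es_wE_le (hH : IsAdj H) : es H (wE H) ≤ 2 * ∑ a, (∑ e, H a e) ^ 3 := by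
  have h1 := sum_edge_le hH
  have hcol : ∀ c, ∑ a, H a c = ∑ a, H c a := fun c => Finset.sum_congr rfl fun a _ => hH.symm _ _
  have e1 : ∀ a b, H a b * wE H a b = H a b * ((∑ c, H a c) ^ 2 + ∑ c, H a c * ∑ e, H c e) +
      H a b * ((∑ c, H b c) ^ 2 + ∑ c, H b c * ∑ e, H c e) := fun a b => by
    unfold wE
    simp only [add_mul, Finset.sum_add_distrib]; ring
  have e2 : es H (wE H) = ∑ a, (∑ e, H a e) * ((∑ c, H a c) ^ 2 + ∑ c, H a c * ∑ e, H c e) := by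
    unfold es
    simp only [e1, Finset.sum_add_distrib]
    rw [Finset.sum_comm (f := fun a b => H a b * ((∑ c, H b c) ^ 2 + ∑ c, H b c * ∑ e, H c e))]
    simp only [← Finset.sum_mul, hcol]
    ring
  rw [e2]
  have e3 : ∑ a, (∑ e, H a e) * ((∑ c, H a c) ^ 2 + ∑ c, H a c * ∑ e, H c e) =
      ∑ a, (∑ e, H a e) ^ 3 + ∑ a, (∑ e, H a e) * ∑ c, H a c * ∑ e, H c e := by
    rw [← Finset.sum_add_distrib]
    exact Finset.sum_congr rfl fun a _ => by ring
  rw [e3]; linarith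

/-- the number of graphs containing a given one -/
theorem log_card_cfg (hH : IsAdj H) (hHA : C.AdmA H) :
    ∃ g : Fin n → ℝ,
      (∀ c, |g c| ≤ 4 / (C.l ^ 2 * n ^ 2) * ((∑ e, H c e) ^ 2 + 2 * ∑ q, H c q * ∑ e, H q e)) ∧
      ∀ d, C.Adm d → (cfg 0 d).Nonempty → (cfg H d).Nonempty ∧
        |Real.log (cfg H d).card - Real.log (cfg 0 d).card - C.Φ H (C.δ d) - ∑ c, g c * C.δ d c| ≤
          es H (fun _ _ => 1) * (C.L ^ 1000 * Real.sqrt n ^ (-3 : ℤ)) +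
            8 / (C.l ^ 2 * n ^ 2) * ∑ a, (∑ e, H a e) ^ 3 := by
  obtain ⟨N, hN⟩ := exists_nat_ge (∑ a, ∑ b, H a b)
  obtain ⟨g, hg, hd⟩ := log_card_cfg_aux hH hHA N H hH (fun _ _ => le_rfl) hN
  refine ⟨g, fun c => by rw [← es_wL hH]; exact hg c, fun d h1 h2 => ⟨(hd d h1 h2).1, (hd d h1 h2).2.trans ?_⟩⟩
  have e0 := es_add (A := H) (fun _ _ => C.L ^ 1000 * Real.sqrt n ^ (-3 : ℤ)) (fun a b => 4 / (C.l ^ 2 * n ^ 2) * wE H a b)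
  have e0' := es_const_mul (A := H) (4 / (C.l ^ 2 * n ^ 2)) (wE H)
  have e1 : es H (fun _ _ => C.L ^ 1000 * Real.sqrt n ^ (-3 : ℤ)) =
      es H (fun _ _ => 1) * (C.L ^ 1000 * Real.sqrt n ^ (-3 : ℤ)) := by
    rw [mul_comm (es H _)]
    have := es_const_mul (A := H) (C.L ^ 1000 * Real.sqrt n ^ (-3 : ℤ)) (fun _ _ => 1)
    simpa only [mul_one] using this
  rw [e0, e0', e1]
  have hn := C.n_pos
  have hl := C.hl0
  have h3 := es_wE_le hH
  have h4 : 4 / (C.l ^ 2 * n ^ 2) * es H (wE H) ≤ 4 / (C.l ^ 2 * n ^ 2) * (2 * ∑ a, (∑ e, H a e) ^ 3) :=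
    mul_le_mul_of_nonneg_left h3 (by positivity)
  calc _ ≤ es H (fun _ _ => 1) * (C.L ^ 1000 * Real.sqrt n ^ (-3 : ℤ)) + 4 / (C.l ^ 2 * n ^ 2) * (2 * ∑ a, (∑ e, H a e) ^ 3) := by
        linarith
    _ = _ := by ring

end Ctx

/-- adjacency matrix -/
noncomputable def adjM {n : ℕ} (G : SimpleGraph (Fin n)) : Matrix (Fin n) (Fin n) ℝ :=
  Matrix.of fun a b => if G.Adj a b then 1 else 0

section
variable {n : ℕ}

lemma adjM_apply (G : SimpleGraph (Fin n)) (a b : Fin n) : adjM G a b = if G.Adj a b then 1 else 0 := rfl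

lemma isAdj_adjM (G : SimpleGraph (Fin n)) : IsAdj (adjM G) :=
  ⟨fun a b => by rw [adjM_apply]; split_ifs <;> simp,
   fun a b => by rw [adjM_apply, adjM_apply]; simp only [G.adj_comm],
   fun a => by rw [adjM_apply]; simp⟩

lemma sum_adjM (G : SimpleGraph (Fin n)) (a : Fin n) : ∑ b, adjM G a b = deg G a := by
  unfold deg
  rw [Finset.card_filter]
  push_cast
  exact Finset.sum_congr rfl fun b _ => adjM_apply G a b

lemma card_filter_le_eq (d : Fin n → ℕ) (H : SimpleGraph (Fin n)) :
    ((degFinset n d).filter fun G => H ≤ G).card = (cfg (adjM H) fun j => (d j : ℝ)).card := by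
  refine Finset.card_bij' (fun G _ => adjM G - adjM H)
    (fun X _ => SimpleGraph.fromRel fun a b => X a b = 1 ∨ H.Adj a b) ?_ ?_ ?_ ?_
  · intro G hG
    rw [Finset.mem_filter] at hG
    obtain ⟨h1, h2⟩ := hG
    unfold degFinset at h1
    rw [Finset.mem_filter] at h1
    refine (mem_cfg _).2 ⟨fun a b => ?_, fun a b => ?_, fun a b hab => ?_, fun a => ?_⟩
    · simp only [Matrix.sub_apply, adjM_apply]
      by_cases hH : H.Adj a b
      · simp [hH, h2 hH]
      · by_cases hg : G.Adj a b <;> simp [hH, hg]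
    · simp only [Matrix.sub_apply, adjM_apply, G.adj_comm a b, H.adj_comm a b]
    · simp only [Matrix.sub_apply, adjM_apply] at hab ⊢
      by_cases hH : H.Adj a b
      · simp [hH, h2 hH]
      · rw [if_neg hH] at hab
        have : a = b := by
          by_contra hne; rw [ind_ne hne] at hab; norm_num at hab
        subst this
        simp
    · simp only [Matrix.sub_apply, Finset.sum_sub_distrib, sum_adjM]
      rw [h1.2 a]
  · intro X hX
    obtain ⟨x1, x2, x3, x4⟩ := (mem_cfg X).1 hX
    have key : adjM (SimpleGraph.fromRel fun a b => X a b = 1 ∨ H.Adj a b) = X + adjM H := by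
      ext a b
      rw [Matrix.add_apply, adjM_apply, adjM_apply]
      simp only [SimpleGraph.fromRel_adj, x2 b a, H.adj_comm b a, or_self]
      by_cases hab : a = b
      · subst hab
        have : X a a = 0 := x3 a a (by rw [ind_self, adjM_apply]; simp)
        simp [this]
      · by_cases hH : H.Adj a b
        · have : X a b = 0 := x3 a b (by rw [ind_ne hab, adjM_apply]; simp [hH])
          simp [hH, this, hab]
        · rcases x1 a b with h | h <;> simp [hH, h, hab]
    rw [Finset.mem_filter]
    unfold degFinset
    rw [Finset.mem_filter]
    refine ⟨⟨Finset.mem_univ _, fun a => ?_⟩, fun a b hab => ?_⟩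
    · have h1 := sum_adjM (SimpleGraph.fromRel fun a b => X a b = 1 ∨ H.Adj a b) a
      rw [key] at h1
      simp only [Matrix.add_apply, Finset.sum_add_distrib] at h1
      rw [x4 a] at h1
      rw [sub_add_cancel] at h1
      exact_mod_cast h1.symm
    · rw [SimpleGraph.fromRel_adj]
      exact ⟨hab.ne, Or.inl (Or.inr hab)⟩
  · intro G hG
    rw [Finset.mem_filter] at hG
    ext a b
    rw [SimpleGraph.fromRel_adj]
    simp only [Matrix.sub_apply, adjM_apply]
    have h1 : H.Adj a b → G.Adj a b := fun h => hG.2 h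
    have h2 : G.Adj b a ↔ G.Adj a b := G.adj_comm _ _
    have h3 : H.Adj b a ↔ H.Adj a b := H.adj_comm _ _
    have h4 : G.Adj a b → a ≠ b := fun h => h.ne
    rw [h2, h3]
    by_cases hH : H.Adj a b
    · simp [hH, h1 hH, h4 (h1 hH)]
    · by_cases hg : G.Adj a b
      · simp [hH, hg, h4 hg]
      · simp [hH, hg]
  · intro X hX
    obtain ⟨x1, x2, x3, x4⟩ := (mem_cfg X).1 hX
    ext a b
    rw [Matrix.sub_apply, adjM_apply, adjM_apply]
    simp only [SimpleGraph.fromRel_adj, x2 b a, H.adj_comm b a, or_self]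
    by_cases hab : a = b
    · subst hab
      have : X a a = 0 := x3 a a (by rw [ind_self, adjM_apply]; simp)
      simp [this]
    · by_cases hH : H.Adj a b
      · have : X a b = 0 := x3 a b (by rw [ind_ne hab, adjM_apply]; simp [hH])
        simp [hH, this, hab]
      · rcases x1 a b with h | h <;> simp [hH, h, hab]

lemma card_cfg_submatrix (A : Matrix (Fin n) (Fin n) ℝ) (d : Fin n → ℝ) (σ : Equiv.Perm (Fin n)) :
    (cfg (A.submatrix σ σ) (fun j => d (σ j))).card = (cfg A d).card := by
  have key : ∀ (A : Matrix (Fin n) (Fin n) ℝ) (d : Fin n → ℝ) (σ : Equiv.Perm (Fin n)) X, X ∈ cfg A d →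
      X.submatrix σ σ ∈ cfg (A.submatrix σ σ) (fun j => d (σ j)) := by
    intro A d σ X hX
    obtain ⟨x1, x2, x3, x4⟩ := (mem_cfg X).1 hX
    refine (mem_cfg _).2 ⟨fun a b => x1 _ _, fun a b => x2 _ _, fun a b hab => x3 _ _ ?_, fun a => ?_⟩
    · rw [← hab]
      simp only [Matrix.submatrix_apply]
      congr 1
      unfold ind; simp
    · simp only [Matrix.submatrix_apply]
      rw [Equiv.sum_comp σ (fun b => X (σ a) b), Equiv.sum_comp σ (fun b => A (σ a) b)]
      exact x4 _
  refine Finset.card_bij' (fun X _ => X.submatrix σ.symm σ.symm) (fun X _ => X.submatrix σ σ) ?_ ?_ ?_ ?_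
  · intro X hX
    have := key _ _ σ.symm X hX
    simpa using this
  · intro X hX
    exact key _ _ σ X hX
  · intro X _; simp
  · intro X _; simp

lemma autCard_pos (H : SimpleGraph (Fin n)) : 0 < autCard H :=
  Finset.card_pos.2 ⟨1, by simp⟩

lemma card_comap_fiber (H K : SimpleGraph (Fin n)) (h : Nonempty (K ≃g H)) :
    (Finset.univ.filter fun π : Equiv.Perm (Fin n) => H.comap π = K).card = autCard H := by
  obtain ⟨φ⟩ := h
  unfold autCard
  have hφ : ∀ i j, H.Adj (φ i) (φ j) ↔ K.Adj i j := fun i j => φ.map_adj_iff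
  refine Finset.card_bij' (fun π _ => φ.toEquiv.symm.trans π) (fun π _ => φ.toEquiv.trans π) ?_ ?_ ?_ ?_
  · intro π hπ
    rw [Finset.mem_filter] at hπ ⊢
    refine ⟨Finset.mem_univ _, fun i j => ?_⟩
    have h1 : ∀ i j, K.Adj i j ↔ H.Adj (π i) (π j) := fun i j => by rw [← hπ.2]; rfl
    simp only [Equiv.trans_apply]
    rw [← h1, ← hφ]
    change H.Adj (φ (φ.symm i)) (φ (φ.symm j)) ↔ _
    rw [φ.apply_symm_apply, φ.apply_symm_apply]
  · intro π hπ
    rw [Finset.mem_filter] at hπ ⊢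
    refine ⟨Finset.mem_univ _, ?_⟩
    ext i j
    simp only [SimpleGraph.comap_adj, Equiv.trans_apply]
    rw [hπ.2]
    exact hφ i j
  · intro π _
    ext i
    change (π (φ.symm (φ i)) : ℕ) = π i
    rw [φ.symm_apply_apply]
  · intro π _
    ext i
    change (π (φ (φ.symm i)) : ℕ) = π i
    rw [φ.apply_symm_apply]

lemma adjM_comap (H : SimpleGraph (Fin n)) (π : Equiv.Perm (Fin n)) :
    adjM (H.comap π) = (adjM H).submatrix π π := by
  ext a b
  simp only [Matrix.submatrix_apply, adjM_apply, SimpleGraph.comap_adj]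

lemma card_cfg_zero_comp (d : Fin n → ℕ) (π : Equiv.Perm (Fin n)) :
    (cfg 0 fun j => (d (π j) : ℝ)).card = (degFinset n d).card := by
  have h1 := card_cfg_submatrix (0 : Matrix (Fin n) (Fin n) ℝ) (fun j => (d j : ℝ)) π
  have h2 := card_filter_le_eq d ⊥
  have h3 : adjM (⊥ : SimpleGraph (Fin n)) = 0 := by
    ext a b; simp [adjM_apply]
  rw [h3] at h2
  simp only [bot_le, Finset.filter_true] at h2
  rw [h2, ← h1]
  congr 1

/-- copies are counted by permutations -/
theorem expCopies_eq (d : Fin n → ℕ) (H : SimpleGraph (Fin n)) :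
    expCopies n d H = (∑ π : Equiv.Perm (Fin n),
      ((cfg (adjM H) fun j => (d (π j) : ℝ)).card : ℝ) / ((cfg 0 fun j => (d (π j) : ℝ)).card : ℝ)) / autCard H := by
  have h0 := card_cfg_zero_comp d
  simp only [h0]
  unfold expCopies
  rw [← Finset.sum_div, div_right_comm]
  congr 1
  rw [eq_div_iff (by exact_mod_cast (autCard_pos H).ne')]
  norm_cast
  have e1 : ∑ G ∈ degFinset n d, copyCount H G = ∑ K ∈ Finset.univ.filter (fun K : SimpleGraph (Fin n) => Nonempty (K ≃g H)),
      ((degFinset n d).filter fun G => K ≤ G).card := by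
    unfold copyCount
    simp only [Finset.card_filter]
    rw [Finset.sum_comm, Finset.sum_filter]
    refine Finset.sum_congr rfl fun K _ => ?_
    split_ifs with h
    · simp only [h, and_true]
    · simp only [h, and_false, if_false, Finset.sum_const_zero]
  rw [e1, Finset.sum_mul]
  have e2 : ∀ π : Equiv.Perm (Fin n), (cfg (adjM H) fun j => (d (π j) : ℝ)).card =
      ((degFinset n d).filter fun G => H.comap π.symm ≤ G).card := fun π => by
    rw [card_filter_le_eq, adjM_comap, ← card_cfg_submatrix _ _ π.symm]
    simp
  simp only [e2]
  rw [← Equiv.sum_comp (Equiv.inv (Equiv.Perm (Fin n)))]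
  have e3 : ∀ π : Equiv.Perm (Fin n), H.comap ((Equiv.inv (Equiv.Perm (Fin n)) π).symm) = H.comap π := fun π => rfl
  simp only [e3]
  rw [← Finset.sum_fiberwise_of_maps_to (s := Finset.univ) (t := Finset.univ.filter (fun K : SimpleGraph (Fin n) => Nonempty (K ≃g H)))
    (g := fun π : Equiv.Perm (Fin n) => H.comap π)]
  · refine Finset.sum_congr rfl fun K hK => ?_
    rw [Finset.mem_filter] at hK
    rw [← card_comap_fiber H K hK.2, mul_comm, ← smul_eq_mul, ← Finset.sum_const]
    refine Finset.sum_congr rfl fun π hπ => ?_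
    rw [Finset.mem_filter] at hπ
    rw [hπ.2]
  · intro π _
    rw [Finset.mem_filter]
    exact ⟨Finset.mem_univ _, ⟨⟨π, Iff.rfl⟩⟩⟩

end

section
variable {n : ℕ}

/-- expectation with respect to the exponentially tilted uniform measure on permutations -/
noncomputable def tE (f : Equiv.Perm (Fin n) → ℝ) (t : ℝ) (φ : Equiv.Perm (Fin n) → ℝ) : ℝ :=
  (∑ π, φ π * Real.exp (t * f π)) / ∑ π, Real.exp (t * f π)

variable {f : Equiv.Perm (Fin n) → ℝ} {t : ℝ}

lemma tZ_pos (f : Equiv.Perm (Fin n) → ℝ) (t : ℝ) : 0 < ∑ π, Real.exp (t * f π) :=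
  Finset.sum_pos (fun _ _ => Real.exp_pos _) Finset.univ_nonempty

lemma tE_add (φ ψ : Equiv.Perm (Fin n) → ℝ) : tE f t (fun π => φ π + ψ π) = tE f t φ + tE f t ψ := by
  unfold tE; simp only [add_mul, Finset.sum_add_distrib, add_div]

lemma tE_mul (r : ℝ) (φ : Equiv.Perm (Fin n) → ℝ) : tE f t (fun π => r * φ π) = r * tE f t φ := by
  unfold tE; simp only [mul_assoc, ← Finset.mul_sum, mul_div_assoc]

lemma tE_sub (φ ψ : Equiv.Perm (Fin n) → ℝ) : tE f t (fun π => φ π - ψ π) = tE f t φ - tE f t ψ := by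
  unfold tE; simp only [sub_mul, Finset.sum_sub_distrib, sub_div]

lemma tE_const (r : ℝ) : tE f t (fun _ => r) = r := by
  unfold tE; rw [← Finset.mul_sum, mul_div_assoc, div_self (tZ_pos f t).ne', mul_one]

lemma tE_sum {ι : Type*} (s : Finset ι) (φ : ι → Equiv.Perm (Fin n) → ℝ) :
    tE f t (fun π => ∑ i ∈ s, φ i π) = ∑ i ∈ s, tE f t (φ i) := by
  unfold tE
  rw [← Finset.sum_div]
  congr 1
  simp only [Finset.sum_mul]
  rw [Finset.sum_comm]

lemma tE_mono {φ ψ : Equiv.Perm (Fin n) → ℝ} (h : ∀ π, φ π ≤ ψ π) : tE f t φ ≤ tE f t ψ :=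
  div_le_div_of_nonneg_right (Finset.sum_le_sum fun π _ =>
    mul_le_mul_of_nonneg_right (h π) (Real.exp_pos _).le) (tZ_pos f t).le

lemma abs_tE_le {φ : Equiv.Perm (Fin n) → ℝ} {M : ℝ} (h : ∀ π, |φ π| ≤ M) : |tE f t φ| ≤ M := by
  rw [abs_le]
  constructor
  · rw [← tE_const (f := f) (t := t) (-M)]; exact tE_mono fun π => (abs_le.1 (h π)).1
  · rw [← tE_const (f := f) (t := t) M]; exact tE_mono fun π => (abs_le.1 (h π)).2

lemma tE_swap (φ : Equiv.Perm (Fin n) → ℝ) (τ : Equiv.Perm (Fin n)) :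
    tE f t φ = tE f t fun π => φ (π * τ) * Real.exp (t * (f (π * τ) - f π)) := by
  unfold tE
  congr 1
  rw [← Equiv.sum_comp (Equiv.mulRight τ)]
  refine Finset.sum_congr rfl fun π _ => ?_
  rw [mul_assoc, ← Real.exp_add, Equiv.coe_mulRight]
  congr 2; ring

lemma tE_antisymm {φ : Equiv.Perm (Fin n) → ℝ} {τ : Equiv.Perm (Fin n)} (h : ∀ π, φ (π * τ) = - φ π) :
    tE f t φ = 1 / 2 * tE f t fun π => φ π * (1 - Real.exp (t * (f (π * τ) - f π))) := by
  have h1 := tE_swap (f := f) (t := t) φ τ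
  have h2 : tE f t (fun π => φ (π * τ) * Real.exp (t * (f (π * τ) - f π))) =
      tE f t (fun π => φ π * (1 - Real.exp (t * (f (π * τ) - f π)))) - tE f t φ := by
    rw [← tE_sub]; congr 1; funext π; rw [h]; ring
  linarith

lemma abs_tE_antisymm_le {φ : Equiv.Perm (Fin n) → ℝ} {τ : Equiv.Perm (Fin n)} (h : ∀ π, φ (π * τ) = - φ π)
    (ht0 : 0 ≤ t) (ht1 : t ≤ 1) {M r : ℝ} (hM : ∀ π, |φ π| ≤ M) (hr : ∀ π, |f (π * τ) - f π| ≤ r) (hr1 : r ≤ 1) :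
    |tE f t φ| ≤ M * r := by
  rw [tE_antisymm h, abs_mul, abs_of_pos (by norm_num : (0:ℝ) < 1 / 2)]
  have : |tE f t fun π => φ π * (1 - Real.exp (t * (f (π * τ) - f π)))| ≤ M * (2 * r) := abs_tE_le fun π => by
    rw [abs_mul]
    have hx : |t * (f (π * τ) - f π)| ≤ r := by
      rw [abs_mul, abs_of_nonneg ht0]
      exact (mul_le_of_le_one_left (abs_nonneg _) ht1).trans (hr π)
    have h2 := Real.abs_exp_sub_one_le (x := t * (f (π * τ) - f π)) (hx.trans hr1)
    rw [abs_sub_comm] at h2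
    exact mul_le_mul (hM π) (by linarith) (abs_nonneg _) ((abs_nonneg _).trans (hM π))
  linarith

lemma abs_tE_antisymm_second_le {φ : Equiv.Perm (Fin n) → ℝ} {τ : Equiv.Perm (Fin n)} (h : ∀ π, φ (π * τ) = - φ π)
    (ht0 : 0 ≤ t) (ht1 : t ≤ 1) {M r : ℝ} (hM : ∀ π, |φ π| ≤ M) (hr : ∀ π, |f (π * τ) - f π| ≤ r) (hr1 : r ≤ 1) :
    |tE f t φ + t / 2 * tE f t (fun π => φ π * (f (π * τ) - f π))| ≤ M * r ^ 2 / 2 := by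
  have e : tE f t φ + t / 2 * tE f t (fun π => φ π * (f (π * τ) - f π)) =
      1 / 2 * tE f t fun π => φ π * (1 - Real.exp (t * (f (π * τ) - f π)) + t * (f (π * τ) - f π)) := by
    rw [tE_antisymm h]
    have : (fun π => φ π * (1 - Real.exp (t * (f (π * τ) - f π)) + t * (f (π * τ) - f π))) =
      fun π => φ π * (1 - Real.exp (t * (f (π * τ) - f π))) + t * (φ π * (f (π * τ) - f π)) := by
      funext π; ring
    rw [this, tE_add, tE_mul]; ring
  rw [e, abs_mul, abs_of_pos (by norm_num : (0:ℝ) < 1 / 2)]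
  have : |tE f t fun π => φ π * (1 - Real.exp (t * (f (π * τ) - f π)) + t * (f (π * τ) - f π))| ≤ M * r ^ 2 :=
    abs_tE_le fun π => by
      rw [abs_mul]
      have hx : |t * (f (π * τ) - f π)| ≤ r := by
        rw [abs_mul, abs_of_nonneg ht0]
        exact (mul_le_of_le_one_left (abs_nonneg _) ht1).trans (hr π)
      have h2 := Real.abs_exp_sub_one_sub_id_le (x := t * (f (π * τ) - f π)) (hx.trans hr1)
      have h3 : (t * (f (π * τ) - f π)) ^ 2 ≤ r ^ 2 := by
        rw [← sq_abs]; exact pow_le_pow_left₀ (abs_nonneg _) hx 2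
      have h4 : |1 - Real.exp (t * (f (π * τ) - f π)) + t * (f (π * τ) - f π)| ≤ r ^ 2 := by
        rw [← abs_neg]
        refine le_trans (le_of_eq ?_) (h2.trans h3)
        congr 1; ring
      exact mul_le_mul (hM π) h4 (abs_nonneg _) ((abs_nonneg _).trans (hM π))
  linarith

/-- the logarithm of the moment generating function -/
noncomputable def lZ (f : Equiv.Perm (Fin n) → ℝ) (t : ℝ) : ℝ := Real.log (∑ π, Real.exp (t * f π))

lemma hasDerivAt_lZ (f : Equiv.Perm (Fin n) → ℝ) (t : ℝ) : HasDerivAt (lZ f) (tE f t f) t := by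
  have h1 : HasDerivAt (fun t => ∑ π, Real.exp (t * f π)) (∑ π, f π * Real.exp (t * f π)) t := by
    refine HasDerivAt.fun_sum fun π _ => ?_
    have := ((hasDerivAt_id t).mul_const (f π)).exp
    simpa [mul_comm] using this
  exact h1.log (tZ_pos f t).ne'

lemma abs_lZ_le (f : Equiv.Perm (Fin n) → ℝ) {Q1 Q2 ε : ℝ}
    (h : ∀ t, 0 ≤ t → t ≤ 1 → |tE f t f - (t * Q1 + Q2)| ≤ ε) :
    |lZ f 1 - lZ f 0 - (Q1 / 2 + Q2)| ≤ ε := by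
  have hd : ∀ t, HasDerivAt (fun t => lZ f t - (t ^ 2 / 2 * Q1 + t * Q2)) (tE f t f - (t * Q1 + Q2)) t := fun t => by
    refine (hasDerivAt_lZ f t).sub ?_
    have h1 := (((hasDerivAt_id t).fun_pow 2).div_const 2).mul_const Q1
    have h2 := (hasDerivAt_id t).mul_const Q2
    have := h1.add h2
    refine (this.congr_deriv ?_)
    simp
  have := Convex.norm_image_sub_le_of_norm_hasDerivWithin_le (s := Set.Icc (0:ℝ) 1) (C := ε)
    (fun x _ => (hd x).hasDerivWithinAt) (fun x hx => by rw [Real.norm_eq_abs]; exact h x hx.1 hx.2)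
    (convex_Icc 0 1) (Set.left_mem_Icc.2 zero_le_one) (Set.right_mem_Icc.2 zero_le_one)
  simp only [Real.norm_eq_abs, sub_zero, abs_one, mul_one] at this
  refine le_trans (le_of_eq ?_) this
  congr 1; ring

end

/-- a function of permutations with controlled response to transpositions -/
structure SwapData (n : ℕ) where
  y : Fin n → ℝ
  h : Fin n → ℝ
  c : Fin n → ℝ
  f : Equiv.Perm (Fin n) → ℝ
  D : ℝ
  χ : ℝ
  κ : ℝ
  θ : ℝ
  hn : 1 ≤ n
  hD0 : 0 ≤ D
  hχ0 : 0 ≤ χ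
  hκ0 : 0 ≤ κ
  hy0 : ∑ j, y j = 0
  hyD : ∀ j, |y j| ≤ D
  hh : ∀ j, 0 ≤ h j
  hc : ∀ j, |c j| ≤ χ * h j
  hf : ∀ π j k, j ≠ k → |f (π * Equiv.swap j k) - f π - (c j - c k) * (y (π k) - y (π j))| ≤ κ * (h j + h k)
  hθ : θ = 2 * D * χ + κ
  hθ1 : ∀ j k, θ * (h j + h k) ≤ 1

namespace SwapData
variable {n : ℕ} (S : SwapData n)

/-- mean square -/
noncomputable def R : ℝ := (∑ j, S.y j ^ 2) / n
/-- power sums -/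
noncomputable def P (i : ℕ) : ℝ := ∑ j, S.h j ^ i

lemma n_pos {n : ℕ} (S : SwapData n) : (0:ℝ) < n := by exact_mod_cast S.hn

lemma θ_nonneg : 0 ≤ S.θ := by
  rw [S.hθ]; have := S.hD0; have := S.hχ0; have := S.hκ0; positivity

lemma abs_diff_le (π : Equiv.Perm (Fin n)) (j k : Fin n) :
    |S.f (π * Equiv.swap j k) - S.f π| ≤ S.θ * (S.h j + S.h k) := by
  by_cases hjk : j = k
  · subst hjk
    rw [Equiv.swap_self]
    have : π * Equiv.refl (Fin n) = π := mul_one π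
    rw [this, sub_self, abs_zero]
    exact mul_nonneg S.θ_nonneg (add_nonneg (S.hh _) (S.hh _))
  · have h1 := S.hf π j k hjk
    have h2 : |(S.c j - S.c k) * (S.y (π k) - S.y (π j))| ≤ (S.χ * (S.h j + S.h k)) * (2 * S.D) := by
      rw [abs_mul]
      refine mul_le_mul ?_ ?_ (abs_nonneg _) (mul_nonneg S.hχ0 (add_nonneg (S.hh _) (S.hh _)))
      · linarith [abs_sub (S.c j) (S.c k), S.hc j, S.hc k]
      · linarith [abs_sub (S.y (π k)) (S.y (π j)), S.hyD (π k), S.hyD (π j)]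
    have h3 := abs_add_le (S.f (π * Equiv.swap j k) - S.f π - (S.c j - S.c k) * (S.y (π k) - S.y (π j)))
      ((S.c j - S.c k) * (S.y (π k) - S.y (π j)))
    rw [sub_add_cancel] at h3
    rw [S.hθ]; nlinarith

lemma swap_apply_left (π : Equiv.Perm (Fin n)) (j k : Fin n) : (π * Equiv.swap j k) j = π k := by
  simp [Equiv.Perm.mul_apply]
lemma swap_apply_right (π : Equiv.Perm (Fin n)) (j k : Fin n) : (π * Equiv.swap j k) k = π j := by
  simp [Equiv.Perm.mul_apply]
lemma swap_apply_ne (π : Equiv.Perm (Fin n)) {i j k : Fin n} (hj : i ≠ j) (hk : i ≠ k) :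
    (π * Equiv.swap j k) i = π i := by
  simp [Equiv.Perm.mul_apply, Equiv.swap_apply_of_ne_of_ne hj hk]

lemma sum_y_perm (π : Equiv.Perm (Fin n)) : ∑ l, S.y (π l) = 0 := by
  rw [Equiv.sum_comp π S.y, S.hy0]

lemma sum_sq_perm (π : Equiv.Perm (Fin n)) : ∑ l, S.y (π l) ^ 2 = n * S.R := by
  rw [Equiv.sum_comp π (fun l => S.y l ^ 2)]; unfold R
  have := S.n_pos.ne'
  field_simp

lemma sq_le (j : Fin n) : S.y j ^ 2 ≤ S.D ^ 2 := by
  rw [← sq_abs]; exact pow_le_pow_left₀ (abs_nonneg _) (S.hyD j) 2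

lemma abs_mul_le (j k : Fin n) : |S.y j * S.y k| ≤ S.D ^ 2 := by
  rw [abs_mul, sq]; exact mul_le_mul (S.hyD j) (S.hyD k) (abs_nonneg _) S.hD0

/-- averaging a bound over the second index -/
lemma sum_θ (j : Fin n) (M : ℝ) : ∑ l, M * (S.θ * (S.h j + S.h l)) = n * (M * (S.θ * (S.h j + S.P 1 / n))) := by
  have := S.n_pos.ne'
  simp only [← Finset.mul_sum, Finset.sum_add_distrib, Finset.sum_const, Finset.card_univ, Fintype.card_fin,
    nsmul_eq_mul]
  unfold P
  simp only [pow_one]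
  field_simp

variable {t : ℝ} (ht0 : 0 ≤ t) (ht1 : t ≤ 1)

lemma tE_sq (ht0 : 0 ≤ t) (ht1 : t ≤ 1) (j : Fin n) :
    |tE S.f t (fun π => S.y (π j) ^ 2) - S.R| ≤ S.D ^ 2 * (S.θ * (S.h j + S.P 1 / n)) := by
  have hn := S.n_pos
  have h1 : ∀ l, |tE S.f t (fun π => S.y (π j) ^ 2 - S.y (π l) ^ 2)| ≤ S.D ^ 2 * (S.θ * (S.h j + S.h l)) := fun l =>
    abs_tE_antisymm_le (τ := Equiv.swap j l) (fun π => by rw [swap_apply_left, swap_apply_right]; ring) ht0 ht1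
      (fun π => by
        have := S.sq_le (π j); have := S.sq_le (π l)
        rw [abs_le]; constructor <;> nlinarith [sq_nonneg (S.y (π j)), sq_nonneg (S.y (π l))])
      (fun π => S.abs_diff_le π j l) (S.hθ1 j l)
  have h2 : n * (tE S.f t (fun π => S.y (π j) ^ 2) - S.R) = ∑ l, tE S.f t (fun π => S.y (π j) ^ 2 - S.y (π l) ^ 2) := by
    rw [← tE_sum]
    have : (fun π : Equiv.Perm (Fin n) => ∑ l, (S.y (π j) ^ 2 - S.y (π l) ^ 2)) =
        fun π => n * S.y (π j) ^ 2 - n * S.R := by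
      funext π
      rw [Finset.sum_sub_distrib, sum_sq_perm]; simp
    rw [this, tE_sub, tE_mul, tE_const]; ring
  have h3 : n * |tE S.f t (fun π => S.y (π j) ^ 2) - S.R| ≤ n * (S.D ^ 2 * (S.θ * (S.h j + S.P 1 / n))) := by
    rw [← sum_θ]
    nth_rewrite 1 [← abs_of_pos hn]
    rw [← abs_mul, h2]
    exact (Finset.abs_sum_le_sum_abs _ _).trans (Finset.sum_le_sum fun l _ => h1 l)
  exact le_of_mul_le_mul_left h3 hn

lemma tE_mul_le (ht0 : 0 ≤ t) (ht1 : t ≤ 1) {j k : Fin n} (hjk : j ≠ k) :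
    |tE S.f t (fun π => S.y (π j) * S.y (π k))| ≤ 2 * S.D ^ 2 / n + 2 * S.D ^ 2 * (S.θ * (S.h k + S.P 1 / n)) := by
  have hn := S.n_pos
  have hD := sq_nonneg S.D
  have h1 : ∀ l, |tE S.f t (fun π => S.y (π j) * S.y (π k) - S.y (π j) * S.y (π l))| ≤
      ind j l * (2 * S.D ^ 2) + 2 * S.D ^ 2 * (S.θ * (S.h k + S.h l)) := fun l => by
    have hb : ∀ π : Equiv.Perm (Fin n), |S.y (π j) * S.y (π k) - S.y (π j) * S.y (π l)| ≤ 2 * S.D ^ 2 := fun π => by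
      linarith [abs_sub (S.y (π j) * S.y (π k)) (S.y (π j) * S.y (π l)), S.abs_mul_le (π j) (π k), S.abs_mul_le (π j) (π l)]
    have h0 : 0 ≤ 2 * S.D ^ 2 * (S.θ * (S.h k + S.h l)) :=
      mul_nonneg (by linarith) (mul_nonneg S.θ_nonneg (add_nonneg (S.hh _) (S.hh _)))
    by_cases hl : j = l
    · subst hl
      rw [ind_self, one_mul]
      linarith [abs_tE_le (f := S.f) (t := t) hb]
    · rw [ind_ne hl, zero_mul, zero_add]
      exact abs_tE_antisymm_le (τ := Equiv.swap k l)
        (fun π => by rw [swap_apply_left, swap_apply_right, swap_apply_ne π hjk hl]; ring) ht0 ht1 hb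
        (fun π => S.abs_diff_le π k l) (S.hθ1 k l)
  have h2 : n * tE S.f t (fun π => S.y (π j) * S.y (π k)) =
      ∑ l, tE S.f t (fun π => S.y (π j) * S.y (π k) - S.y (π j) * S.y (π l)) := by
    rw [← tE_sum]
    have : (fun π : Equiv.Perm (Fin n) => ∑ l, (S.y (π j) * S.y (π k) - S.y (π j) * S.y (π l))) =
        fun π => n * (S.y (π j) * S.y (π k)) := by
      funext π
      have e : ∑ l, S.y (π j) * S.y (π l) = 0 := by rw [← Finset.mul_sum, sum_y_perm, mul_zero]
      rw [Finset.sum_sub_distrib, e]; simp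
    rw [this, tE_mul]
  have h3 : n * |tE S.f t (fun π => S.y (π j) * S.y (π k))| ≤
      n * (2 * S.D ^ 2 / n + 2 * S.D ^ 2 * (S.θ * (S.h k + S.P 1 / n))) := by
    rw [mul_add, ← sum_θ, mul_div_cancel₀ _ hn.ne']
    nth_rewrite 1 [← abs_of_pos hn]
    rw [← abs_mul, h2]
    refine (Finset.abs_sum_le_sum_abs _ _).trans ((Finset.sum_le_sum fun l _ => h1 l).trans (le_of_eq ?_))
    rw [Finset.sum_add_distrib, ← Finset.sum_mul, sum_ind, one_mul]
  exact le_of_mul_le_mul_left h3 hn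

/-- mean of a difference of two coordinates -/
lemma tE_diff (ht0 : 0 ≤ t) (ht1 : t ≤ 1) (j k : Fin n) :
    |tE S.f t (fun π => S.y (π j) - S.y (π k)) - t * S.R * (S.c j - S.c k)| ≤
      S.D * S.κ * (S.h j + S.h k) + S.D * (S.θ * (S.h j + S.h k)) ^ 2 +
      |S.c j - S.c k| * (2 * S.D ^ 2 / n + 3 * S.D ^ 2 * (S.θ * (S.h j + S.h k + 2 * (S.P 1 / n)))) := by
  have hn := S.n_pos
  have hD := S.hD0
  have hθ := S.θ_nonneg
  have hj := S.hh j
  have hk := S.hh k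
  have hκ := S.hκ0
  have hP : 0 ≤ S.P 1 / n := div_nonneg (Finset.sum_nonneg fun j _ => pow_nonneg (S.hh j) 1) hn.le
  by_cases hjk : j = k
  · subst hjk
    simp only [sub_self, mul_zero, tE_const, abs_zero, zero_mul, add_zero]
    positivity
  have a1 : ∀ π : Equiv.Perm (Fin n), |S.y (π j) - S.y (π k)| ≤ 2 * S.D := fun π => by
    linarith [abs_sub (S.y (π j)) (S.y (π k)), S.hyD (π k), S.hyD (π j)]
  have h1 := abs_tE_antisymm_second_le (f := S.f) (t := t) (φ := fun π => S.y (π j) - S.y (π k)) (τ := Equiv.swap j k)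
    (fun π => by rw [swap_apply_left, swap_apply_right]; ring) ht0 ht1 a1 (fun π => S.abs_diff_le π j k) (S.hθ1 j k)
  have h2 : |tE S.f t (fun π => (S.y (π j) - S.y (π k)) * (S.f (π * Equiv.swap j k) - S.f π)) +
      (S.c j - S.c k) * tE S.f t (fun π => (S.y (π j) - S.y (π k)) ^ 2)| ≤ 2 * S.D * (S.κ * (S.h j + S.h k)) := by
    rw [← tE_mul, ← tE_add]
    refine abs_tE_le fun π => ?_
    have : (S.y (π j) - S.y (π k)) * (S.f (π * Equiv.swap j k) - S.f π) + (S.c j - S.c k) * (S.y (π j) - S.y (π k)) ^ 2 =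
      (S.y (π j) - S.y (π k)) * (S.f (π * Equiv.swap j k) - S.f π - (S.c j - S.c k) * (S.y (π k) - S.y (π j))) := by ring
    rw [this, abs_mul]
    exact mul_le_mul (a1 π) (S.hf π j k hjk) (abs_nonneg _) (by positivity)
  have h3 : tE S.f t (fun π => (S.y (π j) - S.y (π k)) ^ 2) = tE S.f t (fun π => S.y (π j) ^ 2) +
      tE S.f t (fun π => S.y (π k) ^ 2) - 2 * tE S.f t (fun π => S.y (π j) * S.y (π k)) := by
    rw [← tE_mul, ← tE_add, ← tE_sub]; congr 1; funext π; ring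
  have h4 : |tE S.f t (fun π => (S.y (π j) - S.y (π k)) ^ 2) - 2 * S.R| ≤
      4 * S.D ^ 2 / n + 6 * S.D ^ 2 * (S.θ * (S.h j + S.h k + 2 * (S.P 1 / n))) := by
    have b1 := S.tE_sq ht0 ht1 j
    have b2 := S.tE_sq ht0 ht1 k
    have b3 := S.tE_mul_le ht0 ht1 hjk
    have p1 : 0 ≤ S.D ^ 2 * (S.θ * (S.h j + S.P 1 / n)) := by positivity
    have p2 : 0 ≤ S.D ^ 2 * (S.θ * (S.h k + S.P 1 / n)) := by positivity
    have p3 : S.D ^ 2 * (S.θ * (S.h j + S.h k + 2 * (S.P 1 / n))) = S.D ^ 2 * (S.θ * (S.h j + S.P 1 / n)) +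
      S.D ^ 2 * (S.θ * (S.h k + S.P 1 / n)) := by ring
    rw [h3]
    have p4 : 4 * S.D ^ 2 / (n:ℝ) = 2 * (2 * S.D ^ 2 / n) := by ring
    rw [p4]
    rw [abs_le] at b1 b2 b3 ⊢
    constructor <;> linarith
  set e1 := tE S.f t (fun π => (S.y (π j) - S.y (π k)) * (S.f (π * Equiv.swap j k) - S.f π))
  set e2 := tE S.f t (fun π => (S.y (π j) - S.y (π k)) ^ 2)
  set e0 := tE S.f t (fun π => S.y (π j) - S.y (π k))
  have e : e0 - t * S.R * (S.c j - S.c k) = (e0 + t / 2 * e1) - t / 2 * (e1 + (S.c j - S.c k) * e2)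
      + t / 2 * ((S.c j - S.c k) * (e2 - 2 * S.R)) := by ring
  have ht2 : |t / 2| ≤ 1 / 2 := by rw [abs_of_nonneg (by linarith)]; linarith
  have c1 : |t / 2 * (e1 + (S.c j - S.c k) * e2)| ≤ 1 / 2 * (2 * S.D * (S.κ * (S.h j + S.h k))) := by
    rw [abs_mul]; exact mul_le_mul ht2 h2 (abs_nonneg _) (by norm_num)
  have c2 : |t / 2 * ((S.c j - S.c k) * (e2 - 2 * S.R))| ≤ 1 / 2 * (|S.c j - S.c k| *
      (4 * S.D ^ 2 / n + 6 * S.D ^ 2 * (S.θ * (S.h j + S.h k + 2 * (S.P 1 / n))))) := by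
    rw [abs_mul, abs_mul]
    exact mul_le_mul ht2 (mul_le_mul_of_nonneg_left h4 (abs_nonneg _)) (by positivity) (by norm_num)
  rw [e]
  refine (abs_add_le _ _).trans ((add_le_add ((abs_sub _ _).trans (add_le_add h1 c1)) c2).trans (le_of_eq ?_))
  ring

end SwapData

namespace SwapData
variable {n : ℕ} (S : SwapData n) {t : ℝ}

lemma P_one_sq_le : S.P 1 * (S.P 1 / n) ≤ S.P 2 := by
  have h := sq_sum_le_card_mul_sum_sq (s := Finset.univ) (f := S.h)
  have hn := S.n_pos
  rw [Finset.card_univ, Fintype.card_fin] at h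
  unfold P
  simp only [pow_one]
  rw [← mul_div_assoc, div_le_iff₀ hn, ← sq]; linarith

lemma P_nonneg (i : ℕ) : 0 ≤ S.P i := Finset.sum_nonneg fun j _ => pow_nonneg (S.hh j) i

lemma P_mul_le : S.P 2 * (S.P 1 / n) ≤ 2 * S.P 3 := by
  have hn := S.n_pos
  have h : S.P 2 * S.P 1 ≤ n * S.P 3 + n * S.P 3 := by
    unfold P
    rw [Finset.sum_mul_sum]
    have e : ∑ i : Fin n, ∑ j, (S.h i ^ 3 + S.h j ^ 3) = n * ∑ j, S.h j ^ 3 + n * ∑ j, S.h j ^ 3 := by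
      simp only [Finset.sum_add_distrib, Finset.sum_const, Finset.card_univ, Fintype.card_fin, nsmul_eq_mul,
        ← Finset.mul_sum]
    rw [← e]
    refine Finset.sum_le_sum fun i _ => Finset.sum_le_sum fun j _ => ?_
    have hi := S.hh i
    have hj := S.hh j
    rcases le_total (S.h i) (S.h j) with h | h
    · have := pow_le_pow_left₀ hi h 2
      nlinarith [pow_nonneg hi 3]
    · nlinarith [pow_nonneg hj 3, pow_nonneg hi 2]
  rw [← mul_div_assoc, div_le_iff₀ hn]; linarith

lemma sum_pair_sq : ∑ j, ∑ k, (S.h j + S.h k) ^ 2 ≤ 4 * n * S.P 2 := by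
  have e : ∑ i : Fin n, ∑ j, (2 * S.h i ^ 2 + 2 * S.h j ^ 2) = 4 * n * S.P 2 := by
    unfold P
    simp only [Finset.sum_add_distrib, Finset.sum_const, Finset.card_univ, Fintype.card_fin, nsmul_eq_mul,
        ← Finset.mul_sum]
    ring
  rw [← e]
  refine Finset.sum_le_sum fun i _ => Finset.sum_le_sum fun j _ => ?_
  nlinarith [sq_nonneg (S.h i - S.h j)]

lemma sum_pair_cube : ∑ j, ∑ k, (S.h j + S.h k) ^ 3 ≤ 8 * n * S.P 3 := by
  have e : ∑ i : Fin n, ∑ j, (4 * S.h i ^ 3 + 4 * S.h j ^ 3) = 8 * n * S.P 3 := by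
    unfold P
    simp only [Finset.sum_add_distrib, Finset.sum_const, Finset.card_univ, Fintype.card_fin, nsmul_eq_mul,
        ← Finset.mul_sum]
    ring
  rw [← e]
  refine Finset.sum_le_sum fun i _ => Finset.sum_le_sum fun j _ => ?_
  have := S.hh i
  have := S.hh j
  nlinarith [mul_nonneg (add_nonneg (S.hh i) (S.hh j)) (sq_nonneg (S.h i - S.h j))]

lemma sum_pair_mul (x y : Fin n → ℝ) : ∑ j, ∑ k, (x j - x k) * (y j - y k) =
    2 * (n * ∑ j, x j * y j - (∑ j, x j) * ∑ j, y j) := by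
  have e : ∀ j k, (x j - x k) * (y j - y k) = x j * y j + x k * y k - x j * y k - x k * y j := fun j k => by ring
  simp only [e, Finset.sum_sub_distrib, Finset.sum_add_distrib, Finset.sum_const, Finset.card_univ, Fintype.card_fin,
    nsmul_eq_mul, ← Finset.mul_sum, ← Finset.sum_mul]
  ring

lemma tE_linear (ht0 : 0 ≤ t) (ht1 : t ≤ 1) :
    |∑ j, S.c j * tE S.f t (fun π => S.y (π j)) - t * S.R * (∑ j, S.c j ^ 2 - (∑ j, S.c j) ^ 2 / n)| ≤
      (2 * S.θ * S.κ + 4 * S.θ ^ 2 / n) * S.P 2 + 40 * S.θ ^ 3 * S.P 3 := by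
  have hn := S.n_pos
  set e := fun j => tE S.f t (fun π => S.y (π j)) with he
  set p := S.P 1 / n with hp
  have hp0 : 0 ≤ p := div_nonneg (S.P_nonneg 1) hn.le
  have hD := S.hD0
  have hχ := S.hχ0
  have hκ := S.hκ0
  have hθ := S.θ_nonneg
  have e0 : ∑ j, e j = 0 := by
    rw [he, ← tE_sum]
    simp only [sum_y_perm, tE_const]
  have h1 := sum_pair_mul S.c e
  rw [e0, mul_zero, sub_zero] at h1
  have h2 := sum_pair_mul S.c S.c
  have hterm : ∀ j k, |(S.c j - S.c k) * (e j - e k) - t * S.R * ((S.c j - S.c k) * (S.c j - S.c k))| ≤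
      (S.θ * S.κ + 2 * S.θ ^ 2 / n + 6 * S.θ ^ 3 * p) * (S.h j + S.h k) ^ 2 + 4 * S.θ ^ 3 * (S.h j + S.h k) ^ 3 := fun j k => by
    have h3 := S.tE_diff ht0 ht1 j k
    rw [tE_sub] at h3
    have h4 : (S.c j - S.c k) * (e j - e k) - t * S.R * ((S.c j - S.c k) * (S.c j - S.c k)) =
      (S.c j - S.c k) * (e j - e k - t * S.R * (S.c j - S.c k)) := by ring
    rw [h4, abs_mul]
    have hw : 0 ≤ S.h j + S.h k := add_nonneg (S.hh _) (S.hh _)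
    have h5 : |S.c j - S.c k| ≤ S.χ * (S.h j + S.h k) := by
      linarith [abs_sub (S.c j) (S.c k), S.hc j, S.hc k]
    refine (mul_le_mul h5 h3 (abs_nonneg _) (by positivity)).trans ?_
    have hDχ : S.D * S.χ ≤ S.θ := by rw [S.hθ]; nlinarith [mul_nonneg hD hχ]
    have hDχ0 : 0 ≤ S.D * S.χ := mul_nonneg hD hχ
    have h6 := mul_le_mul_of_nonneg_right h5 (show 0 ≤ 2 * S.D ^ 2 / n + 3 * S.D ^ 2 * (S.θ * (S.h j + S.h k + 2 * p)) by positivity)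
    refine (mul_le_mul_of_nonneg_left (add_le_add_right h6 _) (by positivity)).trans ?_
    set w := S.h j + S.h k
    have q1 : (S.D * S.χ) ^ 2 ≤ S.θ ^ 2 := pow_le_pow_left₀ hDχ0 hDχ 2
    have r1 : (S.D * S.χ) * (S.κ * w ^ 2) ≤ S.θ * (S.κ * w ^ 2) := mul_le_mul_of_nonneg_right hDχ (by positivity)
    have r2 : (S.D * S.χ) * (S.θ ^ 2 * w ^ 3) ≤ S.θ * (S.θ ^ 2 * w ^ 3) := mul_le_mul_of_nonneg_right hDχ (by positivity)
    have r3 : (S.D * S.χ) ^ 2 * (w ^ 2 * (2 / n + 3 * (S.θ * (w + 2 * p)))) ≤ S.θ ^ 2 * (w ^ 2 * (2 / n + 3 * (S.θ * (w + 2 * p)))) :=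
      mul_le_mul_of_nonneg_right q1 (by positivity)
    have l1 : S.χ * w * (S.D * S.κ * w + S.D * (S.θ * w) ^ 2 + S.χ * w * (2 * S.D ^ 2 / n + 3 * S.D ^ 2 * (S.θ * (w + 2 * p)))) =
      (S.D * S.χ) * (S.κ * w ^ 2) + (S.D * S.χ) * (S.θ ^ 2 * w ^ 3) + (S.D * S.χ) ^ 2 * (w ^ 2 * (2 / n + 3 * (S.θ * (w + 2 * p)))) := by ring
    rw [l1]
    refine (add_le_add (add_le_add r1 r2) r3).trans (le_of_eq ?_)
    ring
  have h7 : 2 * n * |∑ j, S.c j * e j - t * S.R * (∑ j, S.c j ^ 2 - (∑ j, S.c j) ^ 2 / n)| ≤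
      (S.θ * S.κ + 2 * S.θ ^ 2 / n + 6 * S.θ ^ 3 * p) * (4 * n * S.P 2) + 4 * S.θ ^ 3 * (8 * n * S.P 3) := by
    have h8 : 2 * n * (∑ j, S.c j * e j - t * S.R * (∑ j, S.c j ^ 2 - (∑ j, S.c j) ^ 2 / n)) =
      ∑ j, ∑ k, ((S.c j - S.c k) * (e j - e k) - t * S.R * ((S.c j - S.c k) * (S.c j - S.c k))) := by
      simp only [Finset.sum_sub_distrib, ← Finset.mul_sum]
      rw [h1, h2]
      simp only [← sq]
      field_simp
    have h9 : (2 * n : ℝ) = |(2 * n : ℝ)| := (abs_of_pos (by positivity)).symm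
    rw [h9, ← abs_mul, h8]
    refine (Finset.abs_sum_le_sum_abs _ _).trans ?_
    refine (Finset.sum_le_sum fun j _ => (Finset.abs_sum_le_sum_abs _ _).trans (Finset.sum_le_sum fun k _ => hterm j k)).trans ?_
    simp only [Finset.sum_add_distrib, ← Finset.mul_sum]
    exact add_le_add (mul_le_mul_of_nonneg_left S.sum_pair_sq (by positivity))
      (mul_le_mul_of_nonneg_left S.sum_pair_cube (by positivity))
  have h10 : S.θ ^ 3 * (S.P 2 * p) ≤ S.θ ^ 3 * (2 * S.P 3) := mul_le_mul_of_nonneg_left S.P_mul_le (by positivity)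
  have h11 := S.P_nonneg 3
  refine le_of_mul_le_mul_left (h7.trans ?_) (show (0:ℝ) < 2 * n by positivity)
  have : 2 * n * ((2 * S.θ * S.κ + 4 * S.θ ^ 2 / n) * S.P 2 + 40 * S.θ ^ 3 * S.P 3) -
    ((S.θ * S.κ + 2 * S.θ ^ 2 / n + 6 * S.θ ^ 3 * p) * (4 * n * S.P 2) + 4 * S.θ ^ 3 * (8 * n * S.P 3)) =
    24 * n * (S.θ ^ 3 * (2 * S.P 3) - S.θ ^ 3 * (S.P 2 * p)) := by
    ring
  nlinarith [mul_nonneg hn.le (sub_nonneg.2 h10)]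

end SwapData

section model
variable {n : ℕ} {H : Matrix (Fin n) (Fin n) ℝ} (hH : IsAdj H)

/-- quadratic function of a permuted vector -/
noncomputable def qF (H : Matrix (Fin n) (Fin n) ℝ) (y c : Fin n → ℝ) (A B : ℝ) (π : Equiv.Perm (Fin n)) : ℝ :=
  ∑ j, c j * y (π j) + A * es H (fun a b => y (π a) * y (π b)) + B * ∑ j, (∑ e, H j e) * y (π j) ^ 2

lemma es_sub (H : Matrix (Fin n) (Fin n) ℝ) (φ ψ : Fin n → Fin n → ℝ) : es H (fun a b => φ a b - ψ a b) = es H φ - es H ψ := by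
  unfold es
  simp only [mul_sub, Finset.sum_sub_distrib]; ring

lemma abs_es_le (hH : IsAdj H) {φ ψ : Fin n → Fin n → ℝ} (h : ∀ a b, H a b ≠ 0 → |φ a b| ≤ ψ a b) : |es H φ| ≤ es H ψ := by
  unfold es
  rw [abs_div, abs_of_pos (by norm_num : (0:ℝ) < 2)]
  refine div_le_div_of_nonneg_right ?_ (by norm_num)
  refine (Finset.abs_sum_le_sum_abs _ _).trans (Finset.sum_le_sum fun a _ => (Finset.abs_sum_le_sum_abs _ _).trans
    (Finset.sum_le_sum fun b _ => ?_))
  rw [abs_mul, abs_of_nonneg (hH.nonneg a b)]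
  by_cases h0 : H a b = 0
  · rw [h0, zero_mul, zero_mul]
  · exact mul_le_mul_of_nonneg_left (h a b h0) (hH.nonneg a b)

lemma IsAdj.col (hH : IsAdj H) (c : Fin n) : ∑ a, H a c = ∑ a, H c a := Finset.sum_congr rfl fun a _ => hH.symm _ _

lemma es_vertex (hH : IsAdj H) (φ : Fin n → ℝ) : es H (fun a b => φ a + φ b) = ∑ a, (∑ e, H a e) * φ a := by
  unfold es
  simp only [mul_add, Finset.sum_add_distrib]
  rw [Finset.sum_comm (f := fun a b => H a b * φ b)]
  simp only [← Finset.sum_mul, hH.col]; ring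

lemma qF_swap (hH : IsAdj H) {y c : Fin n → ℝ} {A B D : ℝ} (hD0 : 0 ≤ D) (hyD : ∀ j, |y j| ≤ D)
    (π : Equiv.Perm (Fin n)) {j k : Fin n} (hjk : j ≠ k) :
    |qF H y c A B (π * Equiv.swap j k) - qF H y c A B π - (c j - c k) * (y (π k) - y (π j))| ≤
      (2 * |A| + |B|) * D ^ 2 * (∑ e, H j e + ∑ e, H k e) := by
  set z := fun i => y (π i) with hz
  set z' := fun i => y ((π * Equiv.swap j k) i) with hz'
  have hzD : ∀ i, |z i| ≤ D := fun i => hyD _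
  have hzD' : ∀ i, |z' i| ≤ D := fun i => hyD _
  have hne : ∀ i, i ≠ j → i ≠ k → z' i = z i := fun i h1 h2 => by
    change y _ = y _; rw [SwapData.swap_apply_ne π h1 h2]
  have hj : z' j = z k := by change y _ = y _; rw [SwapData.swap_apply_left]
  have hk : z' k = z j := by change y _ = y _; rw [SwapData.swap_apply_right]
  have e1 : ∑ i, c i * z' i = ∑ i, c i * z i + (c j - c k) * (z k - z j) := by
    have : ∀ i, c i * z' i = c i * z i + (ind j i * (c i * (z k - z j)) - ind k i * (c i * (z k - z j))) := fun i => by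
      by_cases h1 : i = j
      · subst h1; rw [ind_self, ind_ne hjk.symm, hj]; ring
      · by_cases h2 : i = k
        · subst h2; rw [ind_self, ind_ne hjk, hk]; ring
        · rw [ind_ne (Ne.symm h1), ind_ne (Ne.symm h2), hne i h1 h2]; ring
    simp only [this, Finset.sum_add_distrib, Finset.sum_sub_distrib, sum_ind_mul]; ring
  have m1 : ∀ a b, |z a * z b| ≤ D ^ 2 := fun a b => by
    rw [abs_mul, sq]; exact mul_le_mul (hzD a) (hzD b) (abs_nonneg _) hD0
  have m2 : ∀ a b, |z' a * z' b| ≤ D ^ 2 := fun a b => by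
    rw [abs_mul, sq]; exact mul_le_mul (hzD' a) (hzD' b) (abs_nonneg _) hD0
  have hD2 := sq_nonneg D
  have big : ∀ i, (i = j ∨ i = k) → ind j i + ind k i = 1 := by
    rintro i (h | h)
    · subst h; rw [ind_self, ind_ne hjk.symm]; ring
    · subst h; rw [ind_self, ind_ne hjk]; ring
  have pos : ∀ i, 0 ≤ ind j i + ind k i := fun i => by
    have := Ctx.ind_nonneg j i; have := Ctx.ind_nonneg k i; linarith
  have e2 : |es H (fun a b => z' a * z' b) - es H (fun a b => z a * z b)| ≤ 2 * D ^ 2 * (∑ e, H j e + ∑ e, H k e) := by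
    rw [← es_sub]
    refine (abs_es_le hH (ψ := fun a b => 2 * D ^ 2 * (ind j a + ind k a) + 2 * D ^ 2 * (ind j b + ind k b)) fun a b _ => ?_).trans (le_of_eq ?_)
    · by_cases ha : a = j ∨ a = k
      · rw [big a ha]
        have := pos b
        nlinarith [abs_sub (z' a * z' b) (z a * z b), m1 a b, m2 a b]
      · by_cases hb : b = j ∨ b = k
        · rw [big b hb]
          have := pos a
          nlinarith [abs_sub (z' a * z' b) (z a * z b), m1 a b, m2 a b]
        · push Not at ha hb
          rw [hne a ha.1 ha.2, hne b hb.1 hb.2, sub_self, abs_zero]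
          have := pos a
          have := pos b
          positivity
    · rw [es_vertex hH fun a => 2 * D ^ 2 * (ind j a + ind k a)]
      have : ∀ a, (∑ e, H a e) * (2 * D ^ 2 * (ind j a + ind k a)) = ind j a * (2 * D ^ 2 * (∑ e, H a e)) + ind k a * (2 * D ^ 2 * (∑ e, H a e)) :=
        fun a => by ring
      simp only [this, Finset.sum_add_distrib, sum_ind_mul]; ring
  have e3 : |∑ i, (∑ e, H i e) * z' i ^ 2 - ∑ i, (∑ e, H i e) * z i ^ 2| ≤ D ^ 2 * (∑ e, H j e + ∑ e, H k e) := by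
    rw [← Finset.sum_sub_distrib]
    refine (Finset.abs_sum_le_sum_abs _ _).trans ?_
    have : ∀ i, |(∑ e, H i e) * z' i ^ 2 - (∑ e, H i e) * z i ^ 2| ≤ ind j i * (D ^ 2 * (∑ e, H i e)) + ind k i * (D ^ 2 * (∑ e, H i e)) := fun i => by
      rw [← mul_sub, ← add_mul, abs_mul, abs_of_nonneg (hH.row_nonneg i)]
      by_cases hi : i = j ∨ i = k
      · rw [big i hi, one_mul, mul_comm]
        refine mul_le_mul_of_nonneg_right ?_ (hH.row_nonneg i)
        have h1 := m1 i i
        have h2 := m2 i i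
        rw [abs_le] at h1 h2 ⊢
        constructor <;> nlinarith [sq_nonneg (z i), sq_nonneg (z' i)]
      · push Not at hi
        rw [hne i hi.1 hi.2, sub_self, abs_zero, mul_zero]
        exact mul_nonneg (pos i) (mul_nonneg hD2 (hH.row_nonneg i))
    refine (Finset.sum_le_sum fun i _ => this i).trans (le_of_eq ?_)
    simp only [Finset.sum_add_distrib, sum_ind_mul]; ring
  have e4 : qF H y c A B (π * Equiv.swap j k) - qF H y c A B π - (c j - c k) * (y (π k) - y (π j)) =
      A * (es H (fun a b => z' a * z' b) - es H (fun a b => z a * z b)) +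
      B * (∑ i, (∑ e, H i e) * z' i ^ 2 - ∑ i, (∑ e, H i e) * z i ^ 2) := by
    change (∑ i, c i * z' i + A * es H (fun a b => z' a * z' b) + B * ∑ i, (∑ e, H i e) * z' i ^ 2) -
      (∑ i, c i * z i + A * es H (fun a b => z a * z b) + B * ∑ i, (∑ e, H i e) * z i ^ 2) - (c j - c k) * (z k - z j) = _
    rw [e1]; ring
  rw [e4]
  refine (abs_add_le _ _).trans ?_
  rw [abs_mul, abs_mul]
  have f1 := mul_le_mul_of_nonneg_left e2 (abs_nonneg A)
  have f2 := mul_le_mul_of_nonneg_left e3 (abs_nonneg B)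
  refine (add_le_add f1 f2).trans (le_of_eq ?_)
  ring

set_option maxHeartbeats 1000000 in
/-- moment generating function of a quadratic function of a random permutation -/
theorem abs_lZ_qF_le (hn : 1 ≤ n) (hH : IsAdj H) {y c : Fin n → ℝ} {A B D χ κ θ : ℝ} (hD0 : 0 ≤ D) (hχ0 : 0 ≤ χ)
    (hy0 : ∑ j, y j = 0) (hyD : ∀ j, |y j| ≤ D) (hc : ∀ j, |c j| ≤ χ * ∑ e, H j e)
    (hκ : κ = (2 * |A| + |B|) * D ^ 2) (hθ : θ = 2 * D * χ + κ)
    (hθ1 : ∀ j k, θ * (∑ e, H j e + ∑ e, H k e) ≤ 1) :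
    |lZ (qF H y c A B) 1 - lZ (qF H y c A B) 0 -
      ((∑ j, y j ^ 2) / n * (∑ j, c j ^ 2 - (∑ j, c j) ^ 2 / n) / 2 + B * ((∑ j, y j ^ 2) / n) * ∑ j, ∑ e, H j e)| ≤
      40 * θ ^ 3 * ∑ j, (∑ e, H j e) ^ 3 + 4 * θ ^ 2 / n * ∑ j, (∑ e, H j e) ^ 2 +
      4 * θ * κ * ∑ j, (∑ e, H j e) ^ 2 + κ / n * ∑ j, ∑ e, H j e := by
  have hκ0 : 0 ≤ κ := by rw [hκ]; positivity
  let S : SwapData n :=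
    { y := y, h := fun j => ∑ e, H j e, c := c, f := qF H y c A B, D := D, χ := χ, κ := κ, θ := θ, hn := hn, hD0 := hD0,
      hχ0 := hχ0, hκ0 := hκ0, hy0 := hy0, hyD := hyD, hh := hH.row_nonneg, hc := hc, hθ := hθ, hθ1 := hθ1,
      hf := fun π j k hjk => by rw [hκ]; exact qF_swap hH hD0 hyD π hjk }
  have hn' := S.n_pos
  have hθ0 : 0 ≤ θ := S.θ_nonneg
  refine abs_lZ_le _ fun t ht0 ht1 => ?_
  set E := fun φ => tE (qF H y c A B) t φ with hE
  have hR : S.R = (∑ j, y j ^ 2) / n := rfl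
  have hP1 : S.P 1 = ∑ j, ∑ e, H j e := by unfold SwapData.P; simp only [pow_one]; rfl
  have hP2 : S.P 2 = ∑ j, (∑ e, H j e) ^ 2 := rfl
  have hP3 : S.P 3 = ∑ j, (∑ e, H j e) ^ 3 := rfl
  rw [← hP1, ← hP2, ← hP3, ← hR]
  have b1 := S.tE_linear ht0 ht1
  have hP1' := S.P_nonneg 1
  have hP2' := S.P_nonneg 2
  have hp := S.P_one_sq_le
  have hD2 := sq_nonneg D
  have b2 : |es H fun a b => E fun π => y (π a) * y (π b)| ≤ D ^ 2 * (S.P 1 / n) + 2 * D ^ 2 * θ * S.P 2 := by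
    refine (abs_es_le hH (ψ := fun a b => (D ^ 2 / n + D ^ 2 * (θ * (∑ e, H a e + S.P 1 / n)))
      + (D ^ 2 / n + D ^ 2 * (θ * (∑ e, H b e + S.P 1 / n)))) fun a b hab => ?_).trans ?_
    · have hne : a ≠ b := by
        rintro rfl; exact hab (hH.diag a)
      have h1 := S.tE_mul_le ht0 ht1 hne
      have h2 := S.tE_mul_le ht0 ht1 hne.symm
      have h3 : tE S.f t (fun π => S.y (π b) * S.y (π a)) = tE S.f t (fun π => S.y (π a) * S.y (π b)) := by
        congr 1; funext π; ring
      rw [h3] at h2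
      change |tE S.f t (fun π => S.y (π a) * S.y (π b))| ≤ _
      have h4 : S.D = D := rfl
      have h5 : S.θ = θ := rfl
      have h6 : ∀ a, S.h a = ∑ e, H a e := fun _ => rfl
      rw [h4, h5, h6] at h1 h2
      have h7 : 2 * D ^ 2 / (n:ℝ) = 2 * (D ^ 2 / n) := by ring
      rw [h7] at h1 h2
      linarith
    · rw [es_vertex hH fun a => D ^ 2 / n + D ^ 2 * (θ * (∑ e, H a e + S.P 1 / n))]
      have h1 : ∀ a, (∑ e, H a e) * (D ^ 2 / n + D ^ 2 * (θ * (∑ e, H a e + S.P 1 / n))) =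
        (∑ e, H a e) * (D ^ 2 / n + D ^ 2 * θ * (S.P 1 / n)) + D ^ 2 * θ * (∑ e, H a e) ^ 2 := fun a => by ring
      simp only [h1]
      rw [Finset.sum_add_distrib, ← Finset.sum_mul, ← Finset.mul_sum, ← hP1, ← hP2]
      have h8 := mul_le_mul_of_nonneg_left hp (mul_nonneg hD2 hθ0)
      have h9 : S.P 1 * (D ^ 2 / n + D ^ 2 * θ * (S.P 1 / n)) + D ^ 2 * θ * S.P 2 =
        D ^ 2 * (S.P 1 / n) + D ^ 2 * θ * (S.P 1 * (S.P 1 / n)) + D ^ 2 * θ * S.P 2 := by ring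
      rw [h9]
      linarith
  have b3 : |∑ j, (∑ e, H j e) * (E fun π => y (π j) ^ 2) - S.R * S.P 1| ≤ 2 * D ^ 2 * θ * S.P 2 := by
    have h1 : ∑ j, (∑ e, H j e) * (E fun π => y (π j) ^ 2) - S.R * S.P 1 =
        ∑ j, (∑ e, H j e) * ((E fun π => y (π j) ^ 2) - S.R) := by
      simp only [mul_sub, Finset.sum_sub_distrib]
      rw [← Finset.sum_mul, ← hP1]; ring
    rw [h1]
    refine (Finset.abs_sum_le_sum_abs _ _).trans ?_
    have h2 : ∀ j, |(∑ e, H j e) * ((E fun π => y (π j) ^ 2) - S.R)| ≤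
        (∑ e, H j e) * (D ^ 2 * θ * (S.P 1 / n)) + D ^ 2 * θ * (∑ e, H j e) ^ 2 := fun j => by
      rw [abs_mul, abs_of_nonneg (hH.row_nonneg j)]
      refine (mul_le_mul_of_nonneg_left (S.tE_sq ht0 ht1 j) (hH.row_nonneg j)).trans (le_of_eq ?_)
      change (∑ e, H j e) * (D ^ 2 * (θ * (∑ e, H j e + S.P 1 / n))) = _
      ring
    refine (Finset.sum_le_sum fun j _ => h2 j).trans ?_
    rw [Finset.sum_add_distrib, ← Finset.sum_mul, ← Finset.mul_sum, ← hP1, ← hP2]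
    have h8 := mul_le_mul_of_nonneg_left hp (mul_nonneg hD2 hθ0)
    have h9 : S.P 1 * (D ^ 2 * θ * (S.P 1 / n)) + D ^ 2 * θ * S.P 2 =
      D ^ 2 * θ * (S.P 1 * (S.P 1 / n)) + D ^ 2 * θ * S.P 2 := by ring
    rw [h9]
    linarith
  have e1 : E (qF H y c A B) = ∑ j, c j * (E fun π => y (π j)) + A * es H (fun a b => E fun π => y (π a) * y (π b))
      + B * ∑ j, (∑ e, H j e) * (E fun π => y (π j) ^ 2) := by
    have h0 : (qF H y c A B) = fun π => (∑ j, c j * y (π j) + A * es H (fun a b => y (π a) * y (π b))) +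
      B * ∑ j, (∑ e, H j e) * y (π j) ^ 2 := rfl
    simp only [hE]
    conv_lhs => arg 3; rw [h0]
    rw [tE_add, tE_add, tE_mul, tE_mul, tE_sum, tE_sum]
    simp only [tE_mul]
    congr 3
    unfold es
    have : (fun π : Equiv.Perm (Fin n) => (∑ a, ∑ b, H a b * (y (π a) * y (π b))) / 2) =
      fun π => (1 / 2) * ∑ a, ∑ b, H a b * (y (π a) * y (π b)) := by funext π; ring
    rw [this, tE_mul, tE_sum]
    simp only [tE_sum, tE_mul]
    ring
  change |E (qF H y c A B) - _| ≤ _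
  rw [e1]
  have b1' : |∑ j, c j * (E fun π => y (π j)) - t * S.R * (∑ j, c j ^ 2 - (∑ j, c j) ^ 2 / n)| ≤
      (2 * θ * κ + 4 * θ ^ 2 / n) * S.P 2 + 40 * θ ^ 3 * S.P 3 := b1
  set X1 := ∑ j, c j * (E fun π => y (π j))
  set X2 := es H (fun a b => E fun π => y (π a) * y (π b))
  set X3 := ∑ j, (∑ e, H j e) * (E fun π => y (π j) ^ 2)
  set V := ∑ j, c j ^ 2 - (∑ j, c j) ^ 2 / n
  have e2 : X1 + A * X2 + B * X3 - (t * (S.R * V) + B * S.R * S.P 1) =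
    (X1 - t * S.R * V) + A * X2 + B * (X3 - S.R * S.P 1) := by ring
  have b2' := mul_le_mul_of_nonneg_left b2 (abs_nonneg A)
  have b3' := mul_le_mul_of_nonneg_left b3 (abs_nonneg B)
  rw [← abs_mul] at b2' b3'
  have b4 : |X1 + A * X2 + B * X3 - (t * (S.R * V) + B * S.R * S.P 1)| ≤
    ((2 * θ * κ + 4 * θ ^ 2 / n) * S.P 2 + 40 * θ ^ 3 * S.P 3) + |A| * (D ^ 2 * (S.P 1 / n) + 2 * D ^ 2 * θ * S.P 2)
     + |B| * (2 * D ^ 2 * θ * S.P 2) := by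
    rw [e2]
    exact (abs_add_le _ _).trans (add_le_add ((abs_add_le _ _).trans (add_le_add b1' b2')) b3')
  have e3 : S.R * V / 2 * 2 = S.R * V := by ring
  have hA0 := abs_nonneg A
  have hB0 := abs_nonneg B
  have hpn : 0 ≤ S.P 1 / n := by positivity
  have k1 : |A| * D ^ 2 * (S.P 1 / n) ≤ κ * (S.P 1 / n) := mul_le_mul_of_nonneg_right (by rw [hκ]; nlinarith [mul_nonneg hA0 hD2, mul_nonneg hB0 hD2]) hpn
  have k2 : (|A| + |B|) * D ^ 2 * (2 * θ * S.P 2) ≤ κ * (2 * θ * S.P 2) :=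
    mul_le_mul_of_nonneg_right (by rw [hκ]; nlinarith [mul_nonneg hA0 hD2, mul_nonneg hB0 hD2]) (by positivity)
  refine b4.trans ?_
  have k3 : κ / n * S.P 1 = κ * (S.P 1 / n) := by ring
  rw [k3]
  nlinarith

end model

lemma abs_log_sum_exp_sub_le {ι : Type*} [Fintype ι] [Nonempty ι] (f g : ι → ℝ) {r : ℝ} (h : ∀ i, |g i - f i| ≤ r) :
    |Real.log (∑ i, Real.exp (g i)) - Real.log (∑ i, Real.exp (f i))| ≤ r := by
  have key : ∀ f g : ι → ℝ, (∀ i, |g i - f i| ≤ r) →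
      Real.log (∑ i, Real.exp (g i)) ≤ r + Real.log (∑ i, Real.exp (f i)) := fun f g h => by
    have pos : ∀ f : ι → ℝ, 0 < ∑ i, Real.exp (f i) := fun f =>
      Finset.sum_pos (fun i _ => Real.exp_pos _) Finset.univ_nonempty
    rw [← Real.log_exp r, ← Real.log_mul (Real.exp_pos r).ne' (pos f).ne']
    refine Real.log_le_log (pos g) ?_
    rw [Finset.mul_sum]
    refine Finset.sum_le_sum fun i _ => ?_
    rw [← Real.exp_add, Real.exp_le_exp]
    linarith [(abs_le.1 (h i)).2]
  rw [abs_le]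
  have h1 := key f g h
  have h2 := key g f fun i => by rw [abs_sub_comm]; exact h i
  constructor <;> linarith

namespace Ctx
variable {n : ℕ} {C : Ctx n}

/-- the part of the exponent that does not depend on the permutation -/
noncomputable def K₀ (C : Ctx n) (H : Matrix (Fin n) (Fin n) ℝ) : ℝ :=
  es H (fun _ _ => 1) * Real.log C.l - C.u / (C.l * n) * ((∑ a, ((∑ b, H a b) ^ 2 - ∑ b, H a b)) / 2)
    + C.u * (es H (fun _ _ => 1) * (es H (fun _ _ => 1) - 1)) / (C.l * n ^ 2)

theorem log_expCopies (d : Fin n → ℕ) (hd : C.Adm fun j => (d j : ℝ)) (hne : (degFinset n d).Nonempty)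
    (G : SimpleGraph (Fin n)) (hG : C.AdmA (adjM G)) :
    ∃ g : Fin n → ℝ,
      (∀ c, |g c| ≤ 4 / (C.l ^ 2 * n ^ 2) * ((∑ e, adjM G c e) ^ 2 + 2 * ∑ q, adjM G c q * ∑ e, adjM G q e)) ∧
      0 < expCopies n d G * autCard G ∧
      |Real.log (expCopies n d G * autCard G) - (C.K₀ (adjM G) +
        lZ (qF (adjM G) (C.δ fun j => (d j : ℝ)) (fun j => (∑ e, adjM G j e) / (C.l * n) + g j) C.Aq C.Bq) 1)| ≤
          es (adjM G) (fun _ _ => 1) * (C.L ^ 1000 * Real.sqrt n ^ (-3 : ℤ)) +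
            8 / (C.l ^ 2 * n ^ 2) * ∑ a, (∑ e, adjM G a e) ^ 3 := by
  obtain ⟨g, hg, hlog⟩ := log_card_cfg (isAdj_adjM G) hG
  refine ⟨g, hg, ?_⟩
  have hap : (autCard G : ℝ) ≠ 0 := by exact_mod_cast (autCard_pos G).ne'
  rw [expCopies_eq, div_mul_cancel₀ _ hap]
  set err := es (adjM G) (fun _ _ => 1) * (C.L ^ 1000 * Real.sqrt n ^ (-3 : ℤ)) +
            8 / (C.l ^ 2 * n ^ 2) * ∑ a, (∑ e, adjM G a e) ^ 3
  set H := adjM G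
  set y := C.δ fun j => (d j : ℝ) with hy
  have hadm : ∀ π : Equiv.Perm (Fin n), C.Adm fun j => (d (π j) : ℝ) := fun π =>
    ⟨fun a => hd.1 (π a), by rw [← hd.2]; exact Equiv.sum_comp π (C.δ fun j => (d j : ℝ))⟩
  have hne0 : ∀ π : Equiv.Perm (Fin n), (cfg 0 fun j => (d (π j) : ℝ)).Nonempty := fun π => by
    rw [← Finset.card_pos, card_cfg_zero_comp, Finset.card_pos]; exact hne
  set c : Fin n → ℝ := fun j => (∑ e, H j e) / (C.l * n) + g j with hc
  have hΦ : ∀ π : Equiv.Perm (Fin n), C.Φ H (C.δ fun j => (d (π j) : ℝ)) + ∑ j, g j * C.δ (fun j => (d (π j) : ℝ)) j =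
      C.K₀ H + qF H y c C.Aq C.Bq π := fun π => by
    have h0 : ∀ j, C.δ (fun j => (d (π j) : ℝ)) j = y (π j) := fun j => rfl
    unfold Φ K₀ qF
    simp only [h0, hc]
    have h1 : ∑ j, ((∑ e, H j e) / (C.l * n) + g j) * y (π j) = (∑ j, (∑ e, H j e) * y (π j)) / (C.l * n) +
        ∑ j, g j * y (π j) := by
      rw [Finset.sum_div, ← Finset.sum_add_distrib]
      exact Finset.sum_congr rfl fun j _ => by ring
    rw [h1]; ring
  set ρ : Equiv.Perm (Fin n) → ℝ := fun π => Real.log (cfg H fun j => (d (π j) : ℝ)).card -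
    Real.log (cfg 0 fun j => (d (π j) : ℝ)).card with hρ
  have hratio : ∀ π : Equiv.Perm (Fin n), ((cfg H fun j => (d (π j) : ℝ)).card : ℝ) / ((cfg 0 fun j => (d (π j) : ℝ)).card : ℝ)
      = Real.exp (ρ π) := fun π => by
    have h1 : (0:ℝ) < (cfg 0 fun j => (d (π j) : ℝ)).card := by exact_mod_cast Finset.card_pos.2 (hne0 π)
    have h2 : (0:ℝ) < (cfg H fun j => (d (π j) : ℝ)).card := by
      exact_mod_cast Finset.card_pos.2 (hlog _ (hadm π) (hne0 π)).1
    rw [hρ, Real.exp_sub, Real.exp_log h1, Real.exp_log h2]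
  simp only [hratio]
  refine ⟨Finset.sum_pos (fun i _ => Real.exp_pos _) Finset.univ_nonempty, ?_⟩
  have h1 : C.K₀ H + lZ (qF H y c C.Aq C.Bq) 1 = Real.log (∑ π, Real.exp (C.K₀ H + qF H y c C.Aq C.Bq π)) := by
    unfold lZ
    simp only [Real.exp_add, one_mul, ← Finset.mul_sum]
    rw [Real.log_mul (Real.exp_pos _).ne' (Finset.sum_pos (fun i _ => Real.exp_pos _) Finset.univ_nonempty).ne',
      Real.log_exp]
  rw [h1]
  refine abs_log_sum_exp_sub_le _ _ fun π => ?_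
  rw [← hΦ]
  refine le_trans (le_of_eq ?_) (hlog _ (hadm π) (hne0 π)).2
  simp only [hρ]
  congr 1; ring

end Ctx

lemma sum_sq_mul_sum_le {n : ℕ} {h : Fin n → ℝ} (hh : ∀ j, 0 ≤ h j) :
    (∑ j, h j ^ 2) * ∑ j, h j ≤ n * ∑ j, h j ^ 3 := by
  have e1 : ∑ j, ∑ k, (h j ^ 3 * (2 / 3) + h k ^ 3 / 3) = n * ∑ j, h j ^ 3 := by
    simp only [Finset.sum_add_distrib, Finset.sum_const, Finset.card_univ, Fintype.card_fin, nsmul_eq_mul,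
      ← Finset.mul_sum, ← Finset.sum_mul, ← Finset.sum_div]
    ring
  rw [Finset.sum_mul_sum, ← e1]
  refine Finset.sum_le_sum fun j _ => Finset.sum_le_sum fun k _ => ?_
  nlinarith [mul_nonneg (sq_nonneg (h j - h k)) (hh j), mul_nonneg (sq_nonneg (h j - h k)) (hh k)]

section cov
variable {n : ℕ} {H : Matrix (Fin n) (Fin n) ℝ}

lemma sum_mul_edge_sum_sq (hH : IsAdj H) :
    ∑ c, ((∑ e, H c e) ^ 2 + 2 * ∑ q, H c q * ∑ e, H q e) = 3 * ∑ c, (∑ e, H c e) ^ 2 := by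
  rw [Finset.sum_add_distrib, ← Finset.mul_sum, Finset.sum_comm]
  have : ∀ q, ∑ c, H c q * ∑ e, H q e = (∑ e, H q e) ^ 2 := fun q => by
    rw [← Finset.sum_mul, hH.col]; ring
  simp only [this]; ring

lemma abs_variance_sub_le (hn : 1 ≤ n) (hH : IsAdj H) {r : ℝ} (hr : 0 ≤ r) {g : Fin n → ℝ}
    (hg : ∀ c, |g c| ≤ 4 * r ^ 2 * ((∑ e, H c e) ^ 2 + 2 * ∑ q, H c q * ∑ e, H q e))
    (hgr : ∀ c, |g c| ≤ r * ∑ e, H c e) :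
    |(∑ j, (r * (∑ e, H j e) + g j) ^ 2 - (∑ j, (r * (∑ e, H j e) + g j)) ^ 2 / n) -
      r ^ 2 * (∑ j, (∑ e, H j e) ^ 2 - (∑ j, ∑ e, H j e) ^ 2 / n)| ≤ 96 * r ^ 3 * ∑ j, (∑ e, H j e) ^ 3 := by
  have hn' : (0:ℝ) < n := by exact_mod_cast hn
  set h : Fin n → ℝ := fun j => ∑ e, H j e with hh
  have hh0 : ∀ j, 0 ≤ h j := hH.row_nonneg
  have hhd : ∀ j, ∑ e, H j e = h j := fun _ => rfl
  have c1 := sum_sq_mul_sum_le hh0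
  have w1 := sum_mul_edge_sum_sq hH
  have w2 := Ctx.sum_edge_le hH
  simp only [hhd] at hg hgr w1 w2 ⊢
  set w : Fin n → ℝ := fun c => h c ^ 2 + 2 * ∑ q, H c q * h q with hw
  have w3 : ∑ c, h c * w c ≤ 3 * ∑ c, h c ^ 3 := by
    have : ∀ c, h c * w c = h c ^ 3 + 2 * (h c * ∑ q, H c q * h q) := fun c => by simp only [hw]; ring
    rw [Finset.sum_congr rfl fun c _ => this c, Finset.sum_add_distrib, ← Finset.mul_sum]
    linarith
  have g1 : ∑ j, |g j| ≤ 12 * r ^ 2 * ∑ j, h j ^ 2 := by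
    refine (Finset.sum_le_sum fun j _ => hg j).trans (le_of_eq ?_)
    rw [← Finset.mul_sum, w1]; ring
  have g2 : ∑ j, h j * |g j| ≤ 12 * r ^ 2 * ∑ j, h j ^ 3 := by
    refine (Finset.sum_le_sum fun j _ => mul_le_mul_of_nonneg_left (hg j) (hh0 j)).trans ?_
    have : ∀ j, h j * (4 * r ^ 2 * w j) = 4 * r ^ 2 * (h j * w j) := fun j => by ring
    rw [Finset.sum_congr rfl fun j _ => this j, ← Finset.mul_sum]
    nlinarith [mul_le_mul_of_nonneg_left w3 (sq_nonneg r)]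
  have g3 : ∑ j, g j ^ 2 ≤ r * ∑ j, h j * |g j| := by
    rw [Finset.mul_sum]
    refine Finset.sum_le_sum fun j _ => ?_
    rw [← sq_abs]
    nlinarith [mul_le_mul_of_nonneg_right (hgr j) (abs_nonneg (g j))]
  have g4 : (∑ j, g j) ^ 2 / n ≤ ∑ j, g j ^ 2 := by
    rw [div_le_iff₀ hn']
    have := sq_sum_le_card_mul_sum_sq (s := Finset.univ) (f := g)
    rw [Finset.card_univ, Fintype.card_fin] at this
    linarith
  have g5 : |∑ j, h j * g j| ≤ ∑ j, h j * |g j| := by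
    refine (Finset.abs_sum_le_sum_abs _ _).trans (le_of_eq (Finset.sum_congr rfl fun j _ => ?_))
    rw [abs_mul, abs_of_nonneg (hh0 j)]
  have g6 : |(∑ j, h j) * (∑ j, g j) / n| ≤ 12 * r ^ 2 * ∑ j, h j ^ 3 := by
    have hs : 0 ≤ ∑ j, h j := Finset.sum_nonneg fun j _ => hh0 j
    rw [abs_div, abs_mul, abs_of_nonneg hs, abs_of_pos hn', div_le_iff₀ hn']
    have h1 : |∑ j, g j| ≤ 12 * r ^ 2 * ∑ j, h j ^ 2 := (Finset.abs_sum_le_sum_abs _ _).trans g1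
    have h2 := mul_le_mul_of_nonneg_left h1 hs
    nlinarith [mul_le_mul_of_nonneg_left c1 (sq_nonneg r)]
  have e1 : ∑ j, (r * h j + g j) ^ 2 = r ^ 2 * ∑ j, h j ^ 2 + 2 * r * ∑ j, h j * g j + ∑ j, g j ^ 2 := by
    simp only [Finset.mul_sum, ← Finset.sum_add_distrib]
    exact Finset.sum_congr rfl fun j _ => by ring
  have e2 : ∑ j, (r * h j + g j) = r * ∑ j, h j + ∑ j, g j := by
    rw [Finset.sum_add_distrib, Finset.mul_sum]
  rw [e1, e2]
  have p3 : 0 ≤ ∑ j, h j ^ 3 := Finset.sum_nonneg fun j _ => pow_nonneg (hh0 j) 3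
  have q1 : 0 ≤ ∑ j, g j ^ 2 := Finset.sum_nonneg fun j _ => sq_nonneg _
  have q2 : 0 ≤ (∑ j, g j) ^ 2 / n := by positivity
  have e3 : r ^ 2 * ∑ j, h j ^ 2 + 2 * r * ∑ j, h j * g j + ∑ j, g j ^ 2 - (r * ∑ j, h j + ∑ j, g j) ^ 2 / n -
      r ^ 2 * (∑ j, h j ^ 2 - (∑ j, h j) ^ 2 / n) = 2 * (r * ∑ j, h j * g j) + (∑ j, g j ^ 2 - (∑ j, g j) ^ 2 / n)
       - 2 * (r * ((∑ j, h j) * (∑ j, g j) / n)) := by ring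
  rw [e3]
  have f1 := mul_le_mul_of_nonneg_left (abs_le.1 (g5.trans g2)).2 hr
  have f2 := mul_le_mul_of_nonneg_left (abs_le.1 (g5.trans g2)).1 hr
  have f3 := mul_le_mul_of_nonneg_left (abs_le.1 g6).2 hr
  have f4 := mul_le_mul_of_nonneg_left (abs_le.1 g6).1 hr
  have f5 := mul_le_mul_of_nonneg_left g2 hr
  have f6 : r * (12 * r ^ 2 * ∑ j, h j ^ 3) = 12 * (r ^ 3 * ∑ j, h j ^ 3) := by ring
  have f7 : r * -(12 * r ^ 2 * ∑ j, h j ^ 3) = -(12 * (r ^ 3 * ∑ j, h j ^ 3)) := by ring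
  have f8 : 0 ≤ r ^ 3 * ∑ j, h j ^ 3 := by positivity
  rw [f6] at f1 f3 f5
  rw [f7] at f2 f4
  rw [mul_assoc, abs_le]
  constructor <;> linarith

end cov

namespace Ctx
variable {n : ℕ} (C : Ctx n)

lemma Aq_eq : C.Aq = - (1 / (C.l * n)) ^ 2 * (C.l / C.u) := by
  have hl := C.hl0
  have hu := C.u_pos
  have hn := C.n_pos
  unfold Aq
  field_simp
  ring

lemma abs_Aq_le : |C.Aq| ≤ C.L * (1 / (C.l * n)) ^ 2 := by
  have hl := C.hl0
  have hu := C.u_pos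
  have hn := C.n_pos
  have hL : 0 < C.L := by linarith [C.hL]
  rw [Aq_eq, abs_mul, abs_neg, abs_of_nonneg (sq_nonneg _), abs_of_nonneg (by positivity), mul_comm]
  refine mul_le_mul_of_nonneg_right ?_ (sq_nonneg _)
  have h1 := C.hv
  rw [div_le_iff₀ hu]
  change 1 / C.L ≤ C.l * C.u at h1
  rw [div_le_iff₀ hL] at h1
  have h2 : C.l < 1 := C.hl1
  nlinarith [mul_pos hL hu]

lemma abs_Bq : |C.Bq| = (1 / (C.l * n)) ^ 2 / 2 := by
  have hl := C.hl0
  have hn := C.n_pos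
  have : C.Bq = - ((1 / (C.l * n)) ^ 2 / 2) := by
    unfold Bq; field_simp
  rw [this, abs_neg, abs_of_nonneg (by positivity)]

lemma one_div_l_le : 1 / C.l ≤ C.L := by
  have hl := C.hl0
  have hu := C.u_pos
  have hL : 0 < C.L := by linarith [C.hL]
  have h1 := C.hv
  change 1 / C.L ≤ C.l * C.u at h1
  rw [div_le_iff₀ hL] at h1
  rw [div_le_iff₀ hl]
  nlinarith [mul_pos hL hl, C.u_lt_one]

end Ctx

lemma sum_sq_le_mul_add {n : ℕ} {h : Fin n → ℝ} (hh : ∀ j, 0 ≤ h j) {T : ℝ} (hT : 0 < T) :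
    ∑ j, h j ^ 2 ≤ T * ∑ j, h j + (∑ j, h j ^ 3) / T := by
  rw [Finset.mul_sum, Finset.sum_div, ← Finset.sum_add_distrib]
  refine Finset.sum_le_sum fun j _ => ?_
  have : h j ^ 2 * T ≤ (T * h j) * T + h j ^ 3 := by
    nlinarith [mul_nonneg (hh j) (sq_nonneg (T - h j)), mul_nonneg (hh j) (sq_nonneg T), hh j,
      mul_nonneg (mul_nonneg (hh j) (hh j)) (hh j)]
  rw [← sub_le_iff_le_add', le_div_iff₀ hT]
  linarith

lemma mgf_error_le {L s n r D Y P1 P2 P3 κ θ : ℝ} (hL : 1 ≤ L) (hs : 1 ≤ s) (hn : n = s ^ 2) (hr : 0 ≤ r) (hrL : r ≤ L / n)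
    (hD0 : 0 ≤ D) (hD : D ≤ L * s / 2) (hY : Y = r * D) (hP1 : 0 ≤ P1) (hP2 : 0 ≤ P2) (hP3 : 0 ≤ P3) (hP1n : P1 / n ≤ L / 2)
    (hP21 : P2 ≤ L * P1 + P3 / L) (hP22 : P2 ≤ L ^ 2 * P1 + P3 / L ^ 2)
    (hκ0 : 0 ≤ κ) (hκ : κ ≤ 3 * L * Y ^ 2) (hθ0 : 0 ≤ θ) (hθ : θ ≤ 5 * Y) :
    40 * θ ^ 3 * P3 + 4 * θ ^ 2 / n * P2 + 4 * θ * κ * P2 + κ / n * P1 ≤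
      100 * (r ^ 2 * P3) + 5060 * (Y ^ 3 * P3) + 163 * (L ^ 9 / s) := by
  have hs0 : 0 < s := by linarith
  have hn0 : 0 < n := by rw [hn]; positivity
  have hL0 : 0 < L := by linarith
  have hY0 : 0 ≤ Y := by rw [hY]; positivity
  have hYs : Y ≤ L ^ 2 / (2 * s) := by
    rw [hY]
    refine (mul_le_mul hrL hD hD0 (by positivity)).trans (le_of_eq ?_)
    rw [hn]; field_simp
  set K := L ^ 9 / s with hK
  have hK0 : 0 ≤ K := by positivity
  have a1 : L ^ 2 * (Y ^ 2 * (P1 / n)) ≤ K := by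
    have h1 : Y ^ 2 ≤ (L ^ 2 / (2 * s)) ^ 2 := pow_le_pow_left₀ hY0 hYs 2
    have h2 : Y ^ 2 * (P1 / n) ≤ (L ^ 2 / (2 * s)) ^ 2 * (L / 2) := mul_le_mul h1 hP1n (by positivity) (by positivity)
    refine (mul_le_mul_of_nonneg_left h2 (by positivity)).trans ?_
    have h3 : L ^ 2 * ((L ^ 2 / (2 * s)) ^ 2 * (L / 2)) = L ^ 7 / s * (1 / (8 * s)) := by field_simp; norm_num
    have h4 : 1 / (8 * s) ≤ 1 := by rw [div_le_one (by positivity)]; linarith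
    have h5 : L ^ 7 / s ≤ K := div_le_div_of_nonneg_right (pow_le_pow_right₀ hL (by norm_num)) hs0.le
    rw [h3]
    calc _ ≤ L ^ 7 / s * 1 := mul_le_mul_of_nonneg_left h4 (by positivity)
      _ ≤ K := by linarith
  have a2 : L ^ 2 * (Y ^ 3 * P1) ≤ K := by
    have h1 : Y ^ 3 ≤ (L ^ 2 / (2 * s)) ^ 3 := pow_le_pow_left₀ hY0 hYs 3
    have hP1' : P1 ≤ L / 2 * n := by rwa [div_le_iff₀ hn0] at hP1n
    have h2 : Y ^ 3 * P1 ≤ (L ^ 2 / (2 * s)) ^ 3 * (L / 2 * n) := mul_le_mul h1 hP1' hP1 (by positivity)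
    refine (mul_le_mul_of_nonneg_left h2 (by positivity)).trans ?_
    have h3 : L ^ 2 * ((L ^ 2 / (2 * s)) ^ 3 * (L / 2 * n)) = K * (1 / 16) := by rw [hn, hK]; field_simp; norm_num
    rw [h3]; linarith
  have a3 : Y ^ 2 * (P3 / L ^ 2 / n) ≤ r ^ 2 * P3 := by
    have h1 : D ^ 2 ≤ (L * s / 2) ^ 2 := pow_le_pow_left₀ hD0 hD 2
    have h2 : D ^ 2 / (L ^ 2 * n) ≤ 1 := by
      rw [div_le_one (by positivity), hn]
      nlinarith [sq_nonneg (L * s)]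
    have h3 : Y ^ 2 * (P3 / L ^ 2 / n) = (r ^ 2 * P3) * (D ^ 2 / (L ^ 2 * n)) := by rw [hY]; field_simp
    rw [h3]
    calc _ ≤ (r ^ 2 * P3) * 1 := mul_le_mul_of_nonneg_left h2 (by positivity)
      _ = _ := mul_one _
  have b1 : 40 * θ ^ 3 * P3 ≤ 5000 * (Y ^ 3 * P3) := by
    have := mul_le_mul_of_nonneg_right (pow_le_pow_left₀ hθ0 hθ 3) hP3
    nlinarith
  have b2 : 4 * θ ^ 2 / n * P2 ≤ 100 * (r ^ 2 * P3) + 100 * K := by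
    have h1 : θ ^ 2 ≤ (5 * Y) ^ 2 := pow_le_pow_left₀ hθ0 hθ 2
    have h2 : P2 / n ≤ L ^ 2 * (P1 / n) + P3 / L ^ 2 / n := by
      rw [← mul_div_assoc, ← add_div]; exact div_le_div_of_nonneg_right hP22 hn0.le
    have h3 : θ ^ 2 * (P2 / n) ≤ (5 * Y) ^ 2 * (L ^ 2 * (P1 / n) + P3 / L ^ 2 / n) :=
      mul_le_mul h1 h2 (by positivity) (by positivity)
    have h4 : 4 * θ ^ 2 / n * P2 = 4 * (θ ^ 2 * (P2 / n)) := by ring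
    have h5 : (5 * Y) ^ 2 * (L ^ 2 * (P1 / n) + P3 / L ^ 2 / n) = 25 * (L ^ 2 * (Y ^ 2 * (P1 / n))) +
      25 * (Y ^ 2 * (P3 / L ^ 2 / n)) := by ring
    rw [h4]
    linarith
  have b3 : 4 * θ * κ * P2 ≤ 60 * (Y ^ 3 * P3) + 60 * K := by
    have h1 : θ * κ ≤ (5 * Y) * (3 * L * Y ^ 2) := mul_le_mul hθ hκ hκ0 (by positivity)
    have h3 := mul_le_mul h1 hP21 hP2 (by positivity)
    have h4 : 4 * θ * κ * P2 = 4 * (θ * κ * P2) := by ring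
    have h5 : (5 * Y) * (3 * L * Y ^ 2) * (L * P1 + P3 / L) = 15 * (L ^ 2 * (Y ^ 3 * P1)) + 15 * (Y ^ 3 * P3) := by
      field_simp; ring
    rw [h4]
    linarith
  have b4 : κ / n * P1 ≤ 3 * K := by
    have h1 : κ * (P1 / n) ≤ (3 * L * Y ^ 2) * (P1 / n) := mul_le_mul_of_nonneg_right hκ (by positivity)
    have h2 : κ / n * P1 = κ * (P1 / n) := by ring
    have h3 : L * (Y ^ 2 * (P1 / n)) ≤ L ^ 2 * (Y ^ 2 * (P1 / n)) :=
      mul_le_mul_of_nonneg_right (by nlinarith) (by positivity)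
    rw [h2]
    linarith
  linarith

namespace Ctx
variable {n : ℕ} {C : Ctx n} {H : Matrix (Fin n) (Fin n) ℝ}

lemma sqrt_ge (C : Ctx n) (k : ℕ) (hk : k ≤ 300) : C.L ^ k ≤ Real.sqrt n :=
  (pow_le_pow_right₀ (by linarith [C.hL]) hk).trans C.hs

lemma abs_lin_le (hH : IsAdj H) (hHA : C.AdmA H) {g : Fin n → ℝ}
    (hg : ∀ c, |g c| ≤ 4 / (C.l ^ 2 * n ^ 2) * ((∑ e, H c e) ^ 2 + 2 * ∑ q, H c q * ∑ e, H q e)) (c : Fin n) :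
    |g c| ≤ 1 / (C.l * n) * ∑ e, H c e := by
  have hl := C.hl0
  have hn := C.n_pos
  have hL : 0 < C.L := by linarith [C.hL]
  set s := Real.sqrt n with hs
  have hs2 : s ^ 2 = n := Real.sq_sqrt hn.le
  have hs0 : 0 < s := Real.sqrt_pos.2 hn
  set M := C.L * s / 2 with hM
  have hh := hH.row_nonneg
  have hhM : ∀ j, ∑ e, H j e ≤ M := hHA.1
  refine (hg c).trans ?_
  have h1 : ∑ q, H c q * ∑ e, H q e ≤ (∑ e, H c e) * M := by
    rw [Finset.sum_mul]
    exact Finset.sum_le_sum fun q _ => mul_le_mul_of_nonneg_left (hhM q) (hH.nonneg c q)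
  have h2 : (∑ e, H c e) ^ 2 ≤ (∑ e, H c e) * M := by
    rw [sq]; exact mul_le_mul_of_nonneg_left (hhM c) (hh c)
  have h3 : 4 / (C.l ^ 2 * n ^ 2) * ((∑ e, H c e) ^ 2 + 2 * ∑ q, H c q * ∑ e, H q e) ≤
    4 / (C.l ^ 2 * n ^ 2) * (3 * ((∑ e, H c e) * M)) := mul_le_mul_of_nonneg_left (by linarith) (by positivity)
  refine h3.trans ?_
  have h4 : 4 / (C.l ^ 2 * n ^ 2) * (3 * ((∑ e, H c e) * M)) = 12 * M / n * (1 / C.l) * (1 / (C.l * n) * ∑ e, H c e) := by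
    field_simp; ring
  have h5 : 12 * M / n * (1 / C.l) ≤ 1 := by
    have h6 := C.sqrt_ge 3 (by norm_num)
    have h7 := C.hL
    calc 12 * M / n * (1 / C.l) ≤ 12 * M / n * C.L := mul_le_mul_of_nonneg_left C.one_div_l_le (by positivity)
      _ = 6 * C.L ^ 2 / s := by rw [← hs2, hM]; field_simp; norm_num
      _ ≤ 1 := by
        rw [div_le_one hs0]
        refine le_trans ?_ h6
        nlinarith [sq_nonneg C.L]
  rw [h4]
  have h8 : 0 ≤ 1 / (C.l * n) * ∑ e, H c e := mul_nonneg (by positivity) (hh c)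
  nlinarith [mul_le_mul_of_nonneg_right h5 h8]

end Ctx

/-- the algebraic recombination of the error terms -/
lemma exponent_combine {l n r B D Y P1 P2 P3 R V Z0 Z1 L s q : ℝ} (hl : 0 < l) (hn : 0 < n)
    (hu0 : 0 ≤ 1 - l) (hu1 : 1 - l ≤ 1) (hr : r = 1 / (l * n)) (hB : B = - r ^ 2 / 2) (hr0 : 0 ≤ r) (hr1 : r ≤ 1)
    (hD0 : 0 ≤ D) (hY : Y = r * D) (hP1 : 0 ≤ P1) (hP3 : 0 ≤ P3) (hR0 : 0 ≤ R) (hRD : R ≤ D ^ 2) (hL1 : 1 ≤ L)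
    (hs0 : 0 < s) (hs1 : 1 ≤ s) (hs2 : n = s ^ 2) (hrL : r ≤ L / n) (hP1n : P1 / n ≤ L / 2)
    (hvar : |V - r ^ 2 * (P2 - P1 ^ 2 / n)| ≤ 96 * r ^ 3 * P3)
    (hmgf : |Z1 - Z0 - (R * V / 2 + B * R * P1)| ≤ 100 * (r ^ 2 * P3) + 5060 * (Y ^ 3 * P3) + 163 * (L ^ 9 / s)) :
    |q - (1 - l) / (l * n) * ((P2 - P1) / 2) + (1 - l) * (P1 / 2 * (P1 / 2 - 1)) / (l * n ^ 2) + Z1 -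
      (Z0 + q + ((1 - l) / (4 * l) * ((P1 / n) ^ 2 + 2 * (P1 / n) - 2 * (P2 / n)) -
        R / (2 * l ^ 2 * n) * ((P1 / n) ^ 2 + P1 / n - P2 / n)))| ≤
      148 * (r ^ 2 * P3) + 5108 * (Y ^ 3 * P3) + 164 * (L ^ 9 / s) := by
  have hL0 : 0 < L := by linarith
  have e1 : q - (1 - l) / (l * n) * ((P2 - P1) / 2) + (1 - l) * (P1 / 2 * (P1 / 2 - 1)) / (l * n ^ 2) + Z1 -
      (Z0 + q + ((1 - l) / (4 * l) * ((P1 / n) ^ 2 + 2 * (P1 / n) - 2 * (P2 / n)) -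
        R / (2 * l ^ 2 * n) * ((P1 / n) ^ 2 + P1 / n - P2 / n))) =
      (Z1 - Z0 - (R * V / 2 + B * R * P1)) + R / 2 * (V - r ^ 2 * (P2 - P1 ^ 2 / n)) - (1 - l) * r * P1 / n / 2 := by
    rw [hB, hr]
    field_simp
    ring
  rw [e1]
  have f1 : |R / 2 * (V - r ^ 2 * (P2 - P1 ^ 2 / n))| ≤ 48 * (r ^ 2 * P3) + 48 * (Y ^ 3 * P3) := by
    rw [abs_mul, abs_of_nonneg (by positivity)]
    refine (mul_le_mul (div_le_div_of_nonneg_right hRD (by norm_num : (0:ℝ) ≤ 2)) hvar (abs_nonneg _) (by positivity)).trans ?_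
    have h1 : D ^ 2 ≤ 1 + D ^ 3 := by
      rcases le_total D 1 with h | h
      · nlinarith [pow_nonneg hD0 3]
      · nlinarith [sq_nonneg D]
    have h2 : r ^ 3 ≤ r ^ 2 := pow_le_pow_of_le_one hr0 hr1 (by norm_num)
    have h3 : D ^ 2 / 2 * (96 * r ^ 3 * P3) = 48 * (D ^ 2 * (r ^ 3 * P3)) := by ring
    have h4 : D ^ 2 * (r ^ 3 * P3) ≤ (1 + D ^ 3) * (r ^ 3 * P3) := mul_le_mul_of_nonneg_right h1 (by positivity)
    have h5 : r ^ 3 * P3 ≤ r ^ 2 * P3 := mul_le_mul_of_nonneg_right h2 hP3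
    have h6 : Y ^ 3 * P3 = D ^ 3 * (r ^ 3 * P3) := by rw [hY]; ring
    rw [h3, h6]
    linarith
  have f2 : |(1 - l) * r * P1 / n / 2| ≤ L ^ 9 / s := by
    rw [abs_of_nonneg (by positivity)]
    have h1 : (1 - l) * r * P1 / n / 2 = (1 - l) * (r * (P1 / n)) / 2 := by ring
    have h2 : r * (P1 / n) ≤ L / n * (L / 2) := mul_le_mul hrL hP1n (by positivity) (by positivity)
    have h3 : (1 - l) * (r * (P1 / n)) ≤ 1 * (r * (P1 / n)) := mul_le_mul_of_nonneg_right hu1 (by positivity)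
    have h4 : L / n * (L / 2) = L ^ 2 / (n * 2) := by ring
    have h5 : L ^ 2 / (n * 2) ≤ L ^ 9 / s := by
      refine div_le_div₀ (by positivity) (pow_le_pow_right₀ hL1 (by norm_num)) hs0 ?_
      rw [hs2]; nlinarith
    have h6 : 0 ≤ r * (P1 / n) := by positivity
    rw [h1]
    linarith
  have g1 := abs_sub (Z1 - Z0 - (R * V / 2 + B * R * P1) + R / 2 * (V - r ^ 2 * (P2 - P1 ^ 2 / n))) ((1 - l) * r * P1 / n / 2)
  have g2 := abs_add_le (Z1 - Z0 - (R * V / 2 + B * R * P1)) (R / 2 * (V - r ^ 2 * (P2 - P1 ^ 2 / n)))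
  linarith

namespace Ctx
variable {n : ℕ} {C : Ctx n} {H : Matrix (Fin n) (Fin n) ℝ}

/-- the asymptotic exponent in terms of power sums of degrees -/
noncomputable def expo (C : Ctx n) (R P1 P2 : ℝ) : ℝ :=
  (1 - C.l) / (4 * C.l) * ((P1 / n) ^ 2 + 2 * (P1 / n) - 2 * (P2 / n)) -
    R / (2 * C.l ^ 2 * n) * ((P1 / n) ^ 2 + P1 / n - P2 / n)

set_option maxHeartbeats 1000000 in
theorem abs_exponent_le (hH : IsAdj H) (hHA : C.AdmA H) {g y : Fin n → ℝ} {D : ℝ}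
    (hg : ∀ c, |g c| ≤ 4 / (C.l ^ 2 * n ^ 2) * ((∑ e, H c e) ^ 2 + 2 * ∑ q, H c q * ∑ e, H q e))
    (hy0 : ∑ j, y j = 0) (hD0 : 0 ≤ D) (hyD : ∀ j, |y j| ≤ D) (hDs : D ≤ C.L * Real.sqrt n / 2)
    (hY : (1 / (C.l * n) * D) ^ 3 * ∑ j, (∑ e, H j e) ^ 3 ≤ 1 / 1000) :
    |C.K₀ H + lZ (qF H y (fun j => (∑ e, H j e) / (C.l * n) + g j) C.Aq C.Bq) 1 -
      (lZ (qF H y (fun j => (∑ e, H j e) / (C.l * n) + g j) C.Aq C.Bq) 0 + es H (fun _ _ => 1) * Real.log C.l +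
        C.expo ((∑ j, y j ^ 2) / n) (∑ j, ∑ e, H j e) (∑ j, (∑ e, H j e) ^ 2))| ≤
      148 * ((1 / (C.l * n)) ^ 2 * ∑ j, (∑ e, H j e) ^ 3) + 5108 * ((1 / (C.l * n) * D) ^ 3 * ∑ j, (∑ e, H j e) ^ 3) +
        164 * (C.L ^ 9 / Real.sqrt n) := by
  have hl := C.hl0
  have hn := C.n_pos
  have hL := C.hL
  have hL0 : 0 < C.L := by linarith
  have hu := C.u_pos
  have hu1 := C.u_lt_one
  set s := Real.sqrt n with hs
  have hs2 : (n:ℝ) = s ^ 2 := (Real.sq_sqrt hn.le).symm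
  have hs0 : 0 < s := Real.sqrt_pos.2 hn
  have hs1 : 1 ≤ s := by have := C.sqrt_ge 0 (by norm_num); rwa [pow_zero] at this
  have hs6 := C.sqrt_ge 6 (by norm_num)
  set r := 1 / (C.l * n) with hr
  have hr0 : 0 < r := by positivity
  have hrL : r ≤ C.L / n := by
    have : r = 1 / C.l / n := by rw [hr]; field_simp
    rw [this]; exact div_le_div_of_nonneg_right C.one_div_l_le hn.le
  have hLn : C.L / n ≤ 1 := by
    rw [div_le_one hn, hs2]
    have := C.sqrt_ge 1 (by norm_num)
    nlinarith
  have hr1 : r ≤ 1 := hrL.trans hLn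
  have hh := hH.row_nonneg
  have hgr := abs_lin_le hH hHA hg
  have hc : ∀ j, (∑ e, H j e) / (C.l * n) + g j = r * (∑ e, H j e) + g j := fun j => by rw [hr]; ring
  simp only [hc]
  have hg' : ∀ c, |g c| ≤ 4 * r ^ 2 * ((∑ e, H c e) ^ 2 + 2 * ∑ q, H c q * ∑ e, H q e) := fun c => by
    have e : 4 * r ^ 2 = 4 / (C.l ^ 2 * n ^ 2) := by rw [hr]; field_simp
    rw [e]; exact hg c
  set c : Fin n → ℝ := fun j => r * (∑ e, H j e) + g j with hcd
  have hcχ : ∀ j, |c j| ≤ 2 * r * ∑ e, H j e := fun j => by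
    have h1 := hgr j
    have h2 : |r * ∑ e, H j e| = r * ∑ e, H j e := abs_of_nonneg (mul_nonneg hr0.le (hh j))
    have h3 := abs_add_le (r * ∑ e, H j e) (g j)
    simp only [hcd]
    linarith
  have hvar := abs_variance_sub_le C.hn hH hr0.le hg' hgr
  set Y := r * D with hYd
  have hY0 : 0 ≤ Y := by positivity
  set κ := (2 * |C.Aq| + |C.Bq|) * D ^ 2 with hκ
  have hκ0 : 0 ≤ κ := by positivity
  have hκL : κ ≤ 3 * C.L * Y ^ 2 := by
    have h1 := C.abs_Aq_le
    have h2 := C.abs_Bq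
    rw [← hr] at h1 h2
    have h3 : 2 * |C.Aq| + |C.Bq| ≤ 3 * C.L * r ^ 2 := by rw [h2]; nlinarith [sq_nonneg r]
    rw [hκ, hYd, mul_pow, ← mul_assoc]
    exact mul_le_mul_of_nonneg_right h3 (sq_nonneg D)
  have hYs : C.L * Y ≤ 1 / 3 := by
    have h1 : Y ≤ C.L / n * (C.L * s / 2) := mul_le_mul hrL hDs hD0 (by positivity)
    have h2 : C.L * (C.L / n * (C.L * s / 2)) = C.L ^ 3 / (2 * s) := by rw [hs2]; field_simp
    have h3 : C.L ^ 3 / (2 * s) ≤ 1 / 3 := by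
      rw [div_le_div_iff₀ (by positivity) (by norm_num)]
      have h4 : C.L ^ 3 ≥ 1000 ^ 3 := pow_le_pow_left₀ (by norm_num) hL 3
      have h5 : C.L ^ 6 = C.L ^ 3 * C.L ^ 3 := by ring
      nlinarith
    have := mul_le_mul_of_nonneg_left h1 hL0.le
    linarith
  set θ := 2 * D * (2 * r) + κ with hθ
  have hθ0 : 0 ≤ θ := by positivity
  have hθY : θ ≤ 5 * Y := by
    have : θ = 4 * Y + κ := by rw [hθ, hYd]; ring
    rw [this]; nlinarith
  have hYh : ∀ j, Y * ∑ e, H j e ≤ 1 / 10 := fun j => by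
    have h1 : (∑ e, H j e) ^ 3 ≤ ∑ j, (∑ e, H j e) ^ 3 :=
      Finset.single_le_sum (f := fun j => (∑ e, H j e) ^ 3) (fun i _ => pow_nonneg (hh i) 3) (Finset.mem_univ j)
    have h2 : (Y * ∑ e, H j e) ^ 3 ≤ (1 / 10) ^ 3 := by
      rw [mul_pow]
      refine (mul_le_mul_of_nonneg_left h1 (by positivity)).trans (hY.trans (by norm_num))
    exact le_of_pow_le_pow_left₀ (by norm_num) (by norm_num) h2
  have hθ1 : ∀ j k, θ * (∑ e, H j e + ∑ e, H k e) ≤ 1 := fun j k => by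
    have h1 : θ * (∑ e, H j e + ∑ e, H k e) ≤ 5 * Y * (∑ e, H j e + ∑ e, H k e) :=
      mul_le_mul_of_nonneg_right hθY (add_nonneg (hh j) (hh k))
    have := hYh j
    have := hYh k
    linarith
  have hmgf := abs_lZ_qF_le C.hn hH hD0 (by positivity) hy0 hyD hcχ hκ hθ hθ1
  have hP2T := fun T hT => sum_sq_le_mul_add (h := fun j => ∑ e, H j e) hh (T := T) hT
  have hm : es H (fun _ _ => 1) = (∑ j, ∑ e, H j e) / 2 := by unfold es; simp only [mul_one]
  have hPA := hHA.2
  have hP1 : 0 ≤ ∑ j, ∑ e, H j e := Finset.sum_nonneg fun j _ => hh j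
  have hP2 : 0 ≤ ∑ j, (∑ e, H j e) ^ 2 := Finset.sum_nonneg fun j _ => sq_nonneg _
  have hP3 : 0 ≤ ∑ j, (∑ e, H j e) ^ 3 := Finset.sum_nonneg fun j _ => pow_nonneg (hh j) 3
  have hR0 : 0 ≤ (∑ j, y j ^ 2) / n := by positivity
  have hRD : (∑ j, y j ^ 2) / n ≤ D ^ 2 := by
    rw [div_le_iff₀ hn]
    refine (Finset.sum_le_card_nsmul Finset.univ _ (D ^ 2) fun j _ => ?_).trans (le_of_eq ?_)
    · rw [← sq_abs]; exact pow_le_pow_left₀ (abs_nonneg _) (hyD j) 2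
    · rw [Finset.card_univ, Fintype.card_fin, nsmul_eq_mul, mul_comm]
  unfold K₀
  rw [Finset.sum_sub_distrib, hm]
  set P1 := ∑ j, ∑ e, H j e
  set P2 := ∑ j, (∑ e, H j e) ^ 2
  set P3 := ∑ j, (∑ e, H j e) ^ 3
  set R := (∑ j, y j ^ 2) / n
  set V := ∑ j, c j ^ 2 - (∑ j, c j) ^ 2 / n
  set Z1 := lZ (qF H y c C.Aq C.Bq) 1
  set Z0 := lZ (qF H y c C.Aq C.Bq) 0
  have hP1n : P1 / n ≤ C.L / 2 := by rw [div_le_iff₀ hn]; linarith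
  have herr := mgf_error_le (by linarith) hs1 hs2 hr0.le hrL hD0 hDs hYd hP1 hP2 hP3 hP1n (hP2T _ hL0)
    (hP2T _ (by positivity)) hκ0 hκL hθ0 hθY
  have hBq : C.Bq = - r ^ 2 / 2 := by unfold Bq; rw [hr]; field_simp
  have := exponent_combine (q := P1 / 2 * Real.log C.l) hl hn hu.le hu1.le hr hBq hr0.le hr1 hD0 hYd hP1 hP3 hR0 hRD (by linarith)
    hs0 hs1 hs2 hrL hP1n hvar (hmgf.trans herr)
  exact this

end Ctx

lemma total_error_le {L s n m X : ℝ} {k : ℕ} (hL : 1000 ≤ L) (hs : 0 < s) (hn : n = s ^ 2) (hk : 8 ≤ k) (hm : m ≤ L * n / 4) :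
    m * (L ^ k * s ^ (-3 : ℤ)) + 8 * X + 164 * (L ^ 9 / s) ≤ 8 * X + L ^ (k + 2) / s := by
  have hL0 : 0 < L := by linarith
  have h1 : m * (L ^ k * s ^ (-3 : ℤ)) ≤ L * n / 4 * (L ^ k * s ^ (-3 : ℤ)) := mul_le_mul_of_nonneg_right hm (by positivity)
  have h2 : L * n / 4 * (L ^ k * s ^ (-3 : ℤ)) = L ^ (k + 1) / s / 4 := by
    rw [hn, zpow_neg]
    have : s ^ (3 : ℤ) = s ^ 3 := by norm_cast
    rw [this]
    field_simp
    ring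
  have h3 : L ^ 9 / s ≤ L ^ (k + 1) / s :=
    div_le_div_of_nonneg_right (pow_le_pow_right₀ (by linarith) (by omega)) hs.le
  have h4 : L ^ (k + 2) / s = L * (L ^ (k + 1) / s) := by ring
  have h5 : 0 ≤ L ^ (k + 1) / s := by positivity
  rw [h4]
  nlinarith

namespace Ctx
variable {n : ℕ} {C : Ctx n}

theorem expCopies_estimate (d : Fin n → ℕ) (hd : C.Adm fun j => (d j : ℝ)) (hne : (degFinset n d).Nonempty)
    (G : SimpleGraph (Fin n)) (hG : C.AdmA (adjM G)) {m : ℕ} (hm : ∑ j, deg G j = 2 * m) {D : ℝ} (hD0 : 0 ≤ D)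
    (hyD : ∀ j, |C.δ (fun j => (d j : ℝ)) j| ≤ D) (hDs : D ≤ C.L * Real.sqrt n / 2)
    (hY : (1 / (C.l * n) * D) ^ 3 * ∑ j, (deg G j : ℝ) ^ 3 ≤ 1 / 1000) :
    ∃ E : ℝ, |E| ≤ 156 * ((1 / (C.l * n)) ^ 2 * ∑ j, (deg G j : ℝ) ^ 3) +
        5108 * ((1 / (C.l * n) * D) ^ 3 * ∑ j, (deg G j : ℝ) ^ 3) + C.L ^ 1002 / Real.sqrt n ∧
      expCopies n d G = ((Nat.factorial n : ℝ) / (autCard G : ℝ)) * C.l ^ m *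
        Real.exp (C.expo ((∑ j, C.δ (fun j => (d j : ℝ)) j ^ 2) / n) (∑ j, (deg G j : ℝ)) (∑ j, (deg G j : ℝ) ^ 2) + E) := by
  obtain ⟨g, hg, hpos, hlog⟩ := log_expCopies d hd hne G hG
  have hexp := abs_exponent_le (isAdj_adjM G) hG hg hd.2 hD0 hyD hDs (by simpa only [sum_adjM] using hY)
  simp only [sum_adjM] at hlog hexp
  have hes : es (adjM G) (fun _ _ => 1) = m := by
    have h1 : ((∑ j, deg G j : ℕ) : ℝ) = 2 * m := by rw [hm]; push_cast; ring
    push_cast at h1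
    unfold es
    simp only [mul_one, sum_adjM]
    rw [h1]; ring
  rw [hes] at hlog hexp
  set T := C.expo ((∑ j, C.δ (fun j => (d j : ℝ)) j ^ 2) / n) (∑ j, (deg G j : ℝ)) (∑ j, (deg G j : ℝ) ^ 2)
  have hZ0 : ∀ f : Equiv.Perm (Fin n) → ℝ, lZ f 0 = Real.log (Nat.factorial n) := fun f => by
    unfold lZ
    simp [Fintype.card_perm]
  rw [hZ0] at hexp
  have hmL : (m : ℝ) ≤ C.L * n / 4 := by
    have h1 := hG.2
    rw [← hes]; unfold es
    simp only [mul_one]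
    linarith
  have hn := C.n_pos
  have hl := C.hl0
  have htot := total_error_le (k := 1000) (X := (1 / (C.l * n)) ^ 2 * ∑ j, (deg G j : ℝ) ^ 3) C.hL (Real.sqrt_pos.2 hn)
    (Real.sq_sqrt hn.le).symm (by norm_num) hmL
  have e8 : 8 / (C.l ^ 2 * n ^ 2) * ∑ j, (deg G j : ℝ) ^ 3 = 8 * ((1 / (C.l * n)) ^ 2 * ∑ j, (deg G j : ℝ) ^ 3) := by
    field_simp
  rw [e8] at hlog
  refine ⟨Real.log (expCopies n d G * autCard G) - (Real.log (Nat.factorial n) + m * Real.log C.l + T), ?_, ?_⟩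
  · have := abs_sub_le (Real.log (expCopies n d G * autCard G)) _ (Real.log (Nat.factorial n) + m * Real.log C.l + T) |>.trans
      (add_le_add hlog hexp)
    refine this.trans ?_
    linarith
  · have hap : (0:ℝ) < autCard G := by exact_mod_cast autCard_pos G
    have hf : (0:ℝ) < Nat.factorial n := by exact_mod_cast Nat.factorial_pos n
    have e1 : T + (Real.log (expCopies n d G * autCard G) - (Real.log (Nat.factorial n) + m * Real.log C.l + T)) =
      Real.log (expCopies n d G * autCard G) - (Real.log (Nat.factorial n) + Real.log (C.l ^ m)) := by
      rw [Real.log_pow]; ring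
    rw [e1, Real.exp_sub, Real.exp_add, Real.exp_log hpos, Real.exp_log hf, Real.exp_log (by positivity)]
    field_simp

end Ctx

open Filter Topology in
/-- the size conditions on `n` used below, with `L = n ^ e` -/
lemma eventually_large {a b C₀ e : ℝ} (ha : 0 < a) (hb : 0 < b) (he : 0 < e) (k : ℕ) :
    ∀ᶠ n : ℕ in atTop, 3 ≤ n ∧ 1000 ≤ (n:ℝ) ^ e ∧ 16 * (k:ℝ) ≤ (n:ℝ) ^ e ∧ (3 * a * Real.log n) ^ 2 ≤ (n:ℝ) ^ e ∧
      4 * C₀ ≤ (n:ℝ) ^ (e / 2) ∧ C₀ * (n:ℝ) ^ (-b) ≤ 1 / 1000 := by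
  have t : ∀ c : ℝ, 0 < c → Tendsto (fun n : ℕ => (n:ℝ) ^ c) atTop atTop := fun c hc =>
    (tendsto_rpow_atTop hc).comp tendsto_natCast_atTop_atTop
  have t2 : Tendsto (fun n : ℕ => C₀ * (n:ℝ) ^ (-b)) atTop (𝓝 (C₀ * 0)) :=
    ((tendsto_rpow_neg_atTop hb).comp tendsto_natCast_atTop_atTop).const_mul C₀
  rw [mul_zero] at t2
  have t3 := (tendsto_natCast_atTop_atTop (R := ℝ)).eventually
    ((isLittleO_log_rpow_atTop (half_pos he)).bound (show (0:ℝ) < 1 / (3 * a) by positivity))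
  filter_upwards [eventually_ge_atTop 3, (t e he).eventually_ge_atTop 1000, (t e he).eventually_ge_atTop (16 * k), t3,
    (t (e / 2) (by positivity)).eventually_ge_atTop (4 * C₀), t2.eventually_le_const (show (0:ℝ) < 1 / 1000 by norm_num)]
    with n h1 h2 h3 h4 h5 h6
  refine ⟨h1, h2, h3, ?_, h5, h6⟩
  have hn : (0:ℝ) < n := by exact_mod_cast (show 0 < n by omega)
  have h7 : |3 * a * Real.log n| ≤ (n:ℝ) ^ (e / 2) := by
    rw [Real.norm_eq_abs, Real.norm_eq_abs, abs_of_nonneg (a := (n:ℝ) ^ (e / 2)) (by positivity)] at h4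
    rw [abs_mul, abs_of_pos (by positivity : 0 < 3 * a)]
    have := mul_le_mul_of_nonneg_left h4 (by positivity : 0 ≤ 3 * a)
    rwa [← mul_assoc, mul_one_div_cancel (by positivity), one_mul] at this
  rw [← sq_abs]
  refine (pow_le_pow_left₀ (abs_nonneg _) h7 2).trans (le_of_eq ?_)
  rw [← Real.rpow_natCast, ← Real.rpow_mul hn.le]
  congr 1; push_cast; ring

/-- the density of a degree sequence in the admissible range -/
lemma lam_bounds {n : ℕ} (hn : 3 ≤ n) {d : Fin n → ℕ} {z : ℝ} (hz : 0 < z)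
    (h : min (dbar n d) ((n : ℝ) - dbar n d - 1) ≥ n * z) : z ≤ lam n d ∧ z ≤ 1 - lam n d ∧ lam n d * (n - 1) = dbar n d := by
  have hn' : (3:ℝ) ≤ n := by exact_mod_cast hn
  have h1 : (n:ℝ) * z ≤ dbar n d := h.trans (min_le_left _ _)
  have h2 : (n:ℝ) * z ≤ n - dbar n d - 1 := h.trans (min_le_right _ _)
  have h3 : lam n d * (n - 1) = dbar n d := by
    unfold lam; rw [div_mul_cancel₀]; linarith
  refine ⟨?_, ?_, h3⟩
  · unfold lam
    rw [le_div_iff₀ (by linarith)]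
    linarith
  · have : 1 - lam n d = (n - dbar n d - 1) / (n - 1) := by
      unfold lam
      have : (n:ℝ) - 1 ≠ 0 := by linarith
      field_simp; ring
    rw [this, le_div_iff₀ (by linarith)]
    linarith

lemma abs_sub_le_deltaPar {n : ℕ} (d : Fin n → ℕ) (j : Fin n) : |(d j : ℝ) - dbar n d| ≤ deltaPar n d :=
  le_ciSup (f := fun j : Fin n => |(d j : ℝ) - dbar n d|) (Set.finite_range _).bddAbove j

theorem statement10 (a b C₀ : ℝ) (ha : 0 < a) (hb : 0 < b) (hab : a + b < 1 / 2)
    (hC₀ : 0 < C₀) :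
    ∃ ε : ℝ, 0 < ε ∧ ∃ C : ℝ, 0 < C ∧ ∃ N : ℕ, ∀ n : ℕ, N ≤ n →
      ∀ d : Fin n → ℕ, (degFinset n d).Nonempty →
        deltaPar n d ≤ C₀ * (n : ℝ) ^ ((1 : ℝ) / 2 + ε) →
        min (dbar n d) ((n : ℝ) - dbar n d - 1) ≥ (n : ℝ) / (3 * a * Real.log n) →
        ∀ H : SimpleGraph (Fin n), ∀ m : ℕ,
          (∑ j, deg H j) = 2 * m →
          (m : ℝ) ≤ C₀ * (n : ℝ) ^ ((1 : ℝ) + 2 * ε) →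
          (∀ j, (deg H j : ℝ) ≤ C₀ * (n : ℝ) ^ ((1 : ℝ) / 2 + ε)) →
          (deltaPar n d) ^ 3 * mu n H 3 / ((lam n d) ^ 3 * (n : ℝ) ^ 2) ≤
            C₀ * (n : ℝ) ^ (-b) →
          mu n H 3 ≤ C₀ * (lam n d) ^ 2 * (n : ℝ) ^ ((1 : ℝ) - b) →
          ∃ E : ℝ, |E| ≤ C * (n : ℝ) ^ (-b) ∧
            expCopies n d H =
              ((Nat.factorial n : ℝ) / (autCard H : ℝ)) * (lam n d) ^ m *
                Real.exp (
                  (1 - lam n d) / (4 * lam n d) *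
                      ((mu n H 1) ^ 2 + 2 * mu n H 1 - 2 * mu n H 2)
                  - Rpar n d / (2 * (lam n d) ^ 2 * n) *
                      ((mu n H 1) ^ 2 + mu n H 1 - mu n H 2)
                  + E) := by
  obtain ⟨e, he⟩ : ∃ e : ℝ, e = (1 / 2 - b) / 2000 := ⟨_, rfl⟩
  have hb2 : b < 1 / 2 := by linarith
  have he0 : 0 < e := by rw [he]; linarith
  have he1 : 1002 * e ≤ 1 / 2 - b := by rw [he]; linarith
  obtain ⟨k₀, hk₀⟩ := exists_nat_ge (1 / e)
  obtain ⟨k, hk⟩ : ∃ k : ℕ, k = k₀ + 6 := ⟨_, rfl⟩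
  have hke : 1 ≤ e * k := by
    rw [div_le_iff₀ he0] at hk₀
    rw [hk]; push_cast
    linarith
  obtain ⟨N, hN⟩ := Filter.eventually_atTop.1 (eventually_large (C₀ := C₀) ha hb he0 k)
  refine ⟨e / 4, by linarith, 5264 * C₀ + 1, by linarith, N, ?_⟩
  intro n hnN d hne hδ hd H m hm hmn hH h3 hμ
  obtain ⟨n3, nL, nk, nlog, nC, nb⟩ := hN n hnN
  have n3' : (3:ℝ) ≤ n := by exact_mod_cast n3
  have hn : (0:ℝ) < n := by linarith
  have hn1 : (1:ℝ) ≤ n := by linarith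
  have hlog : 0 < Real.log n := Real.log_pos (by linarith)
  set z := 1 / (3 * a * Real.log n) with hz
  have hz0 : 0 < z := by positivity
  obtain ⟨hl1, hl2, hl3⟩ := lam_bounds n3 hz0 (by rw [hz, mul_one_div]; exact hd)
  have hl0 : 0 < lam n d := by linarith
  have hpow : ∀ j : ℕ, ((n:ℝ) ^ e) ^ j = (n:ℝ) ^ (e * j) := fun j => by
    rw [← Real.rpow_natCast, ← Real.rpow_mul hn.le]
  have hL0 : 0 < (n:ℝ) ^ e := Real.rpow_pos_of_pos hn e
  have hmono : ∀ {x y : ℝ}, x ≤ y → (n:ℝ) ^ x ≤ (n:ℝ) ^ y := fun h => Real.rpow_le_rpow_of_exponent_le hn1 h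
  obtain ⟨C, hCL, hCl⟩ : ∃ C : Ctx n, C.L = (n:ℝ) ^ e ∧ C.l = lam n d := by
    refine ⟨⟨(n:ℝ) ^ e, k, lam n d, nL, (by omega), nk, (by omega), ?_, hl0, (by linarith), ?_, ?_⟩, rfl, rfl⟩
    · rw [hpow]
      calc (n:ℝ) = (n:ℝ) ^ (1:ℝ) := (Real.rpow_one _).symm
        _ ≤ _ := hmono hke
    · have h1 : z * z ≤ lam n d * (1 - lam n d) := mul_le_mul hl1 hl2 hz0.le hl0.le
      refine le_trans ?_ h1
      have h2 : z * z = 1 / (3 * a * Real.log n) ^ 2 := by rw [hz]; field_simp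
      rw [h2]
      exact one_div_le_one_div_of_le (by positivity) nlog
    · rw [hpow, Real.sqrt_eq_rpow]
      refine hmono ?_
      push_cast; linarith
  have hroot : C₀ * (n:ℝ) ^ ((1:ℝ) / 2 + e / 4) ≤ C.L * Real.sqrt n / 2 := by
    have h1 : (n:ℝ) ^ e * (n:ℝ) ^ ((1:ℝ) / 2) = (n:ℝ) ^ (3 * e / 4) * (n:ℝ) ^ ((1:ℝ) / 2 + e / 4) := by
      rw [← Real.rpow_add hn, ← Real.rpow_add hn]; congr 1; ring
    have h2 : (n:ℝ) ^ (e / 2) ≤ (n:ℝ) ^ (3 * e / 4) := hmono (by linarith)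
    have h3 := mul_le_mul_of_nonneg_right (nC.trans h2) (Real.rpow_nonneg hn.le ((1:ℝ) / 2 + e / 4))
    have h4 : 0 ≤ C₀ * (n:ℝ) ^ ((1:ℝ) / 2 + e / 4) := by positivity
    rw [hCL, Real.sqrt_eq_rpow, h1]
    linarith
  have hdiff : ∀ j, C.δ (fun j => (d j : ℝ)) j = d j - dbar n d := fun j => by
    unfold Ctx.δ; rw [hCl, hl3]
  have hyD : ∀ j, |C.δ (fun j => (d j : ℝ)) j| ≤ deltaPar n d := fun j => by
    rw [hdiff]; exact abs_sub_le_deltaPar d j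
  have hD0 : 0 ≤ deltaPar n d := (abs_nonneg _).trans (hyD ⟨0, by omega⟩)
  have hDs := hδ.trans hroot
  have hAdm : C.Adm fun j => (d j : ℝ) := by
    refine ⟨fun j => (hyD j).trans hDs, ?_⟩
    simp only [hdiff, Finset.sum_sub_distrib, Finset.sum_const, Finset.card_univ, Fintype.card_fin, nsmul_eq_mul]
    unfold dbar
    rw [mul_div_cancel₀ _ hn.ne', sub_self]
  have hAdmA : C.AdmA (adjM H) := by
    refine ⟨fun j => by rw [sum_adjM]; exact (hH j).trans hroot, ?_⟩
    simp only [sum_adjM]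
    have h1 : ∑ j, (deg H j : ℝ) = 2 * m := by exact_mod_cast hm
    have h2 : (n:ℝ) ^ e * n = (n:ℝ) ^ (e / 2) * (n:ℝ) ^ ((1:ℝ) + 2 * (e / 4)) := by
      nth_rewrite 2 [← Real.rpow_one (n:ℝ)]
      rw [← Real.rpow_add hn, ← Real.rpow_add hn]; congr 1; ring
    have h3 := mul_le_mul_of_nonneg_right nC (Real.rpow_nonneg hn.le ((1:ℝ) + 2 * (e / 4)))
    rw [h1, hCL, h2]
    linarith
  have hP3 : ∑ j, (deg H j : ℝ) ^ 3 = n * mu n H 3 := by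
    unfold mu; rw [mul_div_cancel₀ _ hn.ne']
  have hX : (1 / (C.l * n)) ^ 2 * ∑ j, (deg H j : ℝ) ^ 3 ≤ C₀ * (n:ℝ) ^ (-b) := by
    have h1 : (1 / (lam n d * n)) ^ 2 * (n * mu n H 3) = mu n H 3 / (lam n d ^ 2 * n) := by field_simp
    have h2 : (n:ℝ) ^ (1 - b) = n * (n:ℝ) ^ (-b) := by
      rw [sub_eq_add_neg, Real.rpow_add hn, Real.rpow_one]
    rw [hP3, hCl, h1, div_le_iff₀ (by positivity)]
    rw [h2] at hμ
    linarith
  have hW : (1 / (C.l * n) * deltaPar n d) ^ 3 * ∑ j, (deg H j : ℝ) ^ 3 ≤ C₀ * (n:ℝ) ^ (-b) := by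
    have h1 : (1 / (lam n d * n) * deltaPar n d) ^ 3 * (n * mu n H 3) =
      deltaPar n d ^ 3 * mu n H 3 / (lam n d ^ 3 * n ^ 2) := by field_simp
    rw [hP3, hCl, h1]
    exact h3
  have hK : C.L ^ 1002 / Real.sqrt n ≤ (n:ℝ) ^ (-b) := by
    rw [hCL, hpow, Real.sqrt_eq_rpow, ← Real.rpow_sub hn]
    refine hmono ?_
    push_cast; linarith
  obtain ⟨E, hE, hexp⟩ := Ctx.expCopies_estimate d hAdm hne H hAdmA hm hD0 hyD hDs (hW.trans nb)
  refine ⟨E, hE.trans (by linarith), ?_⟩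
  rw [hexp]
  unfold Ctx.expo
  simp only [hCl, hdiff]
  unfold Rpar mu
  simp only [pow_one]

end Stmt10
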